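/- Let γ₁ ≠ γ₂ be Jordan curves in ℝ² of Lebesgue measure zero such that 𝒜 = γ₁ ∩ γ₂ is an arc (the image of a continuous injective map from [0,1] into ℝ²) and γ₁ \ 𝒜 ⊆ ℐ(γ₂). Let Γ¹, Γ² be solutions to the curvature flow problem with initial curves γ₁, γ₂ and stopping time T ∈ (0,∞); write cf(γ_i,t) = Γ^i(S¹,t). Then for every t ∈ (0,T), cf(γ₁,t) and cf(γ₂,t) are disjoint and cf(γ₁,t) ⊆ ℐ(cf(γ₂,t)). -/

import Mathlib

open Set Filter Metric Real MeasureTheory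

noncomputable section

/-- The Euclidean plane. -/
abbrev E2 := EuclideanSpace ℝ (Fin 2)

/-- `φ` is a parametrization of the curve `γ`: a continuous injective map from the unit
circle onto `γ` (such a map is automatically a homeomorphism onto its image). -/
def IsParam (γ : Set E2) (φ : Circle → E2) : Prop :=
  Continuous φ ∧ Function.Injective φ ∧ Set.range φ = γ

/-- A Jordan curve in the plane: the image of a continuous injective map from the
unit circle. -/
def IsJordanCurve (γ : Set E2) : Prop :=
  ∃ φ : Circle → E2, IsParam γ φ

/-- The Fréchet distance between two Jordan curves. -/
noncomputable def frechetDist (γ₁ γ₂ : Set E2) : ℝ :=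
  sInf { d : ℝ | ∃ φ₁ φ₂ : Circle → E2, IsParam γ₁ φ₁ ∧ IsParam γ₂ φ₂ ∧
    d = ⨆ x : Circle, ‖φ₁ x - φ₂ x‖ }

/-- The curvature vector of a curve `c` parametrized by angle, at parameter `x`:
`kn = (1/‖c'‖) ∂ₓ(c'/‖c'‖)`. -/
noncomputable def curvatureVector (c : ℝ → E2) (x : ℝ) : E2 :=
  ‖deriv c x‖⁻¹ • deriv (fun y => ‖deriv c y‖⁻¹ • deriv c y) x

/-- A solution to the curvature flow problem with initial curve `γ₀` and stopping time `T`: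
a smooth map `Γ : S¹ × (0,T) → ℝ²` (with `S¹` parametrized by angle, i.e. `Γ` is `2π`-periodic
in the space variable), injective on `S¹` with nonvanishing space derivative for each fixed
time, satisfying `∂ₜΓ = kn` and converging to `γ₀` in Fréchet distance as `t → 0⁺`. -/
structure CurvatureFlowSolution (γ₀ : Set E2) (T : ℝ) where
  Γ : ℝ → ℝ → E2
  periodic : ∀ t, Function.Periodic (fun x => Γ x t) (2 * π)
  smooth : ContDiffOn ℝ (⊤ : ℕ∞) (fun p : ℝ × ℝ => Γ p.1 p.2) (univ ×ˢ Ioo 0 T)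
  inj : ∀ t ∈ Ioo 0 T, ∀ x ∈ Ico 0 (2 * π), ∀ y ∈ Ico 0 (2 * π), Γ x t = Γ y t → x = y
  deriv_ne : ∀ t ∈ Ioo 0 T, ∀ x : ℝ, deriv (fun y => Γ y t) x ≠ 0
  flow : ∀ t ∈ Ioo 0 T, ∀ x : ℝ,
    deriv (fun s => Γ x s) t = curvatureVector (fun y => Γ y t) x
  init : Tendsto (fun t => frechetDist (Set.range (fun x => Γ x t)) γ₀)
    (nhdsWithin 0 (Ioi 0)) (nhds 0)

/-- The evolved curve at time `t` (by convention, the initial curve at `t = 0`). -/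
noncomputable def CurvatureFlowSolution.cf {γ₀ : Set E2} {T : ℝ}
    (sol : CurvatureFlowSolution γ₀ T) (t : ℝ) : Set E2 :=
  if t = 0 then γ₀ else Set.range (fun x => sol.Γ x t)

/-- A set consisting of exactly two points. -/
def HasTwoPoints (s : Set E2) : Prop := ∃ a b : E2, a ≠ b ∧ s = {a, b}


/-- The interior region `ℐ(γ)` of a Jordan curve: the set of points off `γ` whose
connected component in the complement of `γ` is bounded. -/
def interiorRegion (γ : Set E2) : Set E2 :=
  {p : E2 | p ∉ γ ∧ Bornology.IsBounded (connectedComponentIn γᶜ p)}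

section

open Topology
open scoped ContDiff

/-- A continuous integer-valued real function on a preconnected set is constant. -/
lemma eq_of_int_valued {α : Type*} [TopologicalSpace α] {S : Set α} (hS : IsPreconnected S)
    {f : α → ℝ} (hf : ContinuousOn f S) (hi : ∀ x ∈ S, ∃ n : ℤ, f x = n) {x y : α}
    (hx : x ∈ S) (hy : y ∈ S) : f x = f y := by
  refine hS.constant_of_mapsTo (T := Set.range ((↑) : ℤ → ℝ)) ?_ hf ?_ hx hy
  · exact ⟨Int.isClosedEmbedding_coe_real.isEmbedding.toHomeomorph.symm.isEmbedding.discreteTopology⟩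
  · intro z hz
    obtain ⟨n, hn⟩ := hi z hz
    exact ⟨n, hn.symm⟩

/-- Two continuous logarithms of the same function on a preconnected set differ by a constant. -/
lemma log_branch_sub_eq {α : Type*} [TopologicalSpace α] {S : Set α} (hS : IsPreconnected S)
    {a b : α → ℂ} (ha : ContinuousOn a S) (hb : ContinuousOn b S)
    (h : ∀ x ∈ S, Complex.exp (a x) = Complex.exp (b x)) {x y : α} (hx : x ∈ S) (hy : y ∈ S) :
    a x - b x = a y - b y := by
  have key : ∀ z ∈ S, ∃ n : ℤ, a z - b z = n * (2 * π * Complex.I) := by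
    intro z hz
    obtain ⟨n, hn⟩ := Complex.exp_eq_exp_iff_exists_int.1 (h z hz)
    exact ⟨n, by rw [hn]; ring⟩
  have := eq_of_int_valued hS (f := fun z => ((a z - b z) / (2 * π * Complex.I)).re)
    (Complex.continuous_re.comp_continuousOn ((ha.sub hb).div_const _)) ?_ hx hy
  · obtain ⟨n, hn⟩ := key x hx
    obtain ⟨m, hm⟩ := key y hy
    have h2 : (2 * π * Complex.I : ℂ) ≠ 0 := by simp [Real.pi_ne_zero]
    simp only [hn, hm, mul_div_cancel_right₀ _ h2] at this
    rw [hn, hm]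
    congr 1
    exact_mod_cast this
  · intro z hz
    obtain ⟨n, hn⟩ := key z hz
    have h2 : (2 * π * Complex.I : ℂ) ≠ 0 := by simp [Real.pi_ne_zero]
    exact ⟨n, by simp [hn, mul_div_cancel_right₀ _ h2]⟩

/-- `f` has a continuous logarithm on `X`. -/
def HasLogOn {α : Type*} [TopologicalSpace α] (X : Set α) (f : α → ℂ) : Prop :=
  ∃ l : α → ℂ, ContinuousOn l X ∧ ∀ z ∈ X, Complex.exp (l z) = f z

section HasLogOn
variable {α β : Type*} [TopologicalSpace α] [TopologicalSpace β] {X Y : Set α} {f g : α → ℂ}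

lemma HasLogOn.mono (h : HasLogOn Y f) (hXY : X ⊆ Y) : HasLogOn X f := by
  obtain ⟨l, hl, hf⟩ := h
  exact ⟨l, hl.mono hXY, fun z hz => hf z (hXY hz)⟩

lemma HasLogOn.congr (h : HasLogOn X f) (hfg : ∀ z ∈ X, f z = g z) : HasLogOn X g := by
  obtain ⟨l, hl, hf⟩ := h
  exact ⟨l, hl, fun z hz => (hf z hz).trans (hfg z hz)⟩

lemma HasLogOn.mul (hf : HasLogOn X f) (hg : HasLogOn X g) :
    HasLogOn X (fun z => f z * g z) := by
  obtain ⟨l, hl, hf⟩ := hf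
  obtain ⟨m, hm, hg⟩ := hg
  exact ⟨fun z => l z + m z, hl.add hm, fun z hz => by simp [Complex.exp_add, hf z hz, hg z hz]⟩

lemma HasLogOn.inv (hf : HasLogOn X f) : HasLogOn X (fun z => (f z)⁻¹) := by
  obtain ⟨l, hl, hf⟩ := hf
  exact ⟨fun z => - l z, hl.neg, fun z hz => by simp [Complex.exp_neg, hf z hz]⟩

lemma HasLogOn.div (hf : HasLogOn X f) (hg : HasLogOn X g) :
    HasLogOn X (fun z => f z / g z) := by
  simpa only [div_eq_mul_inv] using hf.mul hg.inv

lemma hasLogOn_const {c : ℂ} (hc : c ≠ 0) : HasLogOn X (fun _ => c) :=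
  ⟨fun _ => Complex.log c, continuousOn_const, fun _ _ => Complex.exp_log hc⟩

lemma hasLogOn_of_slitPlane (hf : ContinuousOn f X) (h : ∀ z ∈ X, f z ∈ Complex.slitPlane) :
    HasLogOn X f :=
  ⟨fun z => Complex.log (f z), hf.clog h,
    fun z hz => Complex.exp_log (Complex.slitPlane_ne_zero (h z hz))⟩

lemma HasLogOn.comp {φ : β → α} {Z : Set β} (h : HasLogOn X f) (hφ : ContinuousOn φ Z)
    (hm : MapsTo φ Z X) : HasLogOn Z (fun z => f (φ z)) := by
  obtain ⟨l, hl, hf⟩ := h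
  exact ⟨fun z => l (φ z), hl.comp hφ hm, fun z hz => hf _ (hm hz)⟩

/-- A function uniformly closer to `g` than `‖g‖` has a logarithm when `g` does. -/
lemma HasLogOn.of_close (hg : HasLogOn X g) (hf : ContinuousOn f X) (hgc : ContinuousOn g X)
    (h : ∀ z ∈ X, ‖f z - g z‖ < ‖g z‖) : HasLogOn X f := by
  have h0 : ∀ z ∈ X, g z ≠ 0 := fun z hz h0 => by
    have := h z hz
    rw [h0, norm_zero] at this
    exact absurd this (not_lt.2 (norm_nonneg _))
  have h1 : HasLogOn X (fun z => f z / g z) := by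
    refine hasLogOn_of_slitPlane (hf.div hgc h0) fun z hz => ?_
    have : ‖f z / g z - 1‖ < 1 := by
      rw [div_sub_one (h0 z hz), norm_div, div_lt_one (norm_pos_iff.2 (h0 z hz))]
      exact h z hz
    simpa using Complex.mem_slitPlane_of_norm_lt_one this
  exact (h1.mul hg).congr fun z hz => div_mul_cancel₀ _ (h0 z hz)

/-- Descent of a logarithm along a continuous map from a compact space. -/
lemma HasLogOn.of_comp [T2Space α] [CompactSpace β] {φ : β → α} (hφ : Continuous φ)
    {l : β → ℂ} (hl : Continuous l) (hc : ∀ x y, φ x = φ y → l x = l y)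
    (h : ∀ x, Complex.exp (l x) = f (φ x)) : HasLogOn (range φ) f := by
  classical
  let q : β → range φ := rangeFactorization φ
  have hq : Topology.IsQuotientMap q := by
    have hqc : Continuous q := hφ.subtype_mk _
    exact hqc.isClosedMap.isQuotientMap hqc rangeFactorization_surjective
  let m : α → ℂ := fun z => if hz : z ∈ range φ then l hz.choose else 0
  have hm : ∀ x, m (φ x) = l x := by
    intro x
    have hz : φ x ∈ range φ := mem_range_self x
    simp only [m, hz, dif_pos]
    exact hc _ _ hz.choose_spec
  refine ⟨m, ?_, ?_⟩
  · rw [continuousOn_iff_continuous_domRestrict, hq.continuous_iff]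
    convert hl using 1
    ext x
    exact hm x
  · rintro _ ⟨x, rfl⟩
    rw [hm, h]

/-- Logarithms on two closed sets glue if the intersection is preconnected. -/
lemma HasLogOn.union (hX : IsClosed X) (hY : IsClosed Y) (hf : HasLogOn X f) (hg : HasLogOn Y f)
    (hc : IsPreconnected (X ∩ Y)) : HasLogOn (X ∪ Y) f := by
  classical
  obtain ⟨l, hl, hf⟩ := hf
  obtain ⟨m, hm, hg⟩ := hg
  have : ∃ c : ℂ, Complex.exp c = 1 ∧ ∀ z ∈ X ∩ Y, l z = m z + c := by
    rcases (X ∩ Y).eq_empty_or_nonempty with h | ⟨z₀, hz₀⟩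
    · exact ⟨0, by simp, by simp [h]⟩
    · have e : ∀ z ∈ X ∩ Y, Complex.exp (l z) = Complex.exp (m z) := fun z hz => by
        rw [hf z hz.1, hg z hz.2]
      refine ⟨l z₀ - m z₀, ?_, fun z hz => ?_⟩
      · rw [Complex.exp_sub, e z₀ hz₀, div_self (Complex.exp_ne_zero _)]
      · have := log_branch_sub_eq hc (hl.mono inter_subset_left) (hm.mono inter_subset_right)
          e hz hz₀
        rw [← this]; ring
  obtain ⟨c, hc1, hc2⟩ := this
  refine ⟨X.piecewise l (fun z => m z + c), ?_, ?_⟩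
  · refine ContinuousOn.union_of_isClosed ?_ ?_ hX hY
    · exact hl.congr fun z hz => piecewise_eq_of_mem _ _ _ hz
    · refine (hm.add (continuousOn_const (c := c))).congr fun z hz => ?_
      by_cases h : z ∈ X
      · rw [piecewise_eq_of_mem _ _ _ h, hc2 z ⟨h, hz⟩]; rfl
      · rw [piecewise_eq_of_notMem _ _ _ h]; rfl
  · rintro z hz
    by_cases h : z ∈ X
    · rw [piecewise_eq_of_mem _ _ _ h, hf z h]
    · rw [piecewise_eq_of_notMem _ _ _ h, Complex.exp_add, hc1, mul_one]
      exact hg z (hz.resolve_left h)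

end HasLogOn

/-- A continuous nonvanishing function on a simply connected space has a logarithm. -/
lemma exists_log_of_simplyConnected {E : Type*} [TopologicalSpace E] [SimplyConnectedSpace E]
    [LocallyPathConnectedSpace E] {f : E → ℂ} (hf : Continuous f) (h0 : ∀ z, f z ≠ 0) :
    ∃ l : E → ℂ, Continuous l ∧ ∀ z, Complex.exp (l z) = f z := by
  have x₀ : E := Classical.arbitrary E
  obtain ⟨l, ⟨-, hl⟩, -⟩ := Complex.isCoveringMapOn_exp.existsUnique_continuousMap_lifts
    ⟨f, hf⟩ (Complex.exp_log (h0 x₀)) (fun x => h0 x)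
  exact ⟨l, l.continuous, fun z => congrFun hl z⟩

/-- Winding comparison in a punctured plane: a nonvanishing continuous function cannot agree with
`(z - p) / (z - r)` both near its pole `r` and near infinity. -/
lemma not_agree_near_pole_and_infty {p r : ℂ} (hpr : p ≠ r) {F : ℂ → ℂ}
    (hF : ContinuousOn F {r}ᶜ) (h0 : ∀ z ≠ r, F z ≠ 0)
    (hnear : ∀ᶠ z in nhdsWithin r {r}ᶜ, F z = (z - p) / (z - r))
    (hfar : ∀ᶠ z in Bornology.cobounded ℂ, F z = (z - p) / (z - r)) : False := by
  have hrp : r - p ≠ 0 := sub_ne_zero.2 hpr.symm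
  have hne : ∀ ζ : ℂ, r + Complex.exp ζ ≠ r := fun ζ => by simp [Complex.exp_ne_zero]
  obtain ⟨φ, hφ, hφe⟩ := exists_log_of_simplyConnected (f := fun ζ : ℂ => F (r + Complex.exp ζ))
    (by
      refine hF.comp_continuous (by fun_prop) fun ζ => ?_
      exact hne ζ) (fun ζ => h0 _ (hne ζ))
  have hI : Complex.exp (2 * π * Complex.I) = 1 := Complex.exp_two_pi_mul_I
  have hconst : ∀ ζ ξ : ℂ, φ (ζ + 2 * π * Complex.I) - φ ζ = φ (ξ + 2 * π * Complex.I) - φ ξ := by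
    intro ζ ξ
    refine log_branch_sub_eq (S := univ) (a := fun ζ => φ (ζ + 2 * π * Complex.I)) isPreconnected_univ
      (by fun_prop) hφ.continuousOn (fun x _ => ?_) (mem_univ _) (mem_univ _)
    simp only [hφe, Complex.exp_add, hI, mul_one]
  -- near the pole
  obtain ⟨R₁, hR₁⟩ : ∃ R₁ : ℝ, ∀ ζ : ℂ, ζ.re < R₁ →
      F (r + Complex.exp ζ) = (r + Complex.exp ζ - p) / Complex.exp ζ ∧
      (r + Complex.exp ζ - p) / (r - p) ∈ Complex.slitPlane := by
    rw [eventually_nhdsWithin_iff, Metric.eventually_nhds_iff] at hnear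
    obtain ⟨ε, hε, hn⟩ := hnear
    refine ⟨Real.log (min ε ‖r - p‖), fun ζ hζ => ?_⟩
    have hm : 0 < min ε ‖r - p‖ := lt_min hε (norm_pos_iff.2 hrp)
    have hn' : ‖Complex.exp ζ‖ < min ε ‖r - p‖ := by
      rw [Complex.norm_exp]
      exact (Real.lt_log_iff_exp_lt hm).1 hζ
    constructor
    · rw [hn (by simpa [dist_eq_norm] using hn'.trans_le (min_le_left _ _)) (hne ζ)]
      simp
    · have : ‖Complex.exp ζ / (r - p)‖ < 1 := by
        rw [norm_div, div_lt_one (norm_pos_iff.2 hrp)]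
        exact hn'.trans_le (min_le_right _ _)
      have h2 := Complex.mem_slitPlane_of_norm_lt_one this
      rwa [show (r + Complex.exp ζ - p) / (r - p) = 1 + Complex.exp ζ / (r - p) by
        field_simp; ring]
  have hA : ∀ ζ : ℂ, ζ.re < R₁ → φ (ζ + 2 * π * Complex.I) - φ ζ = - (2 * π * Complex.I) := by
    intro ζ hζ
    have hζ' : (ζ + 2 * π * Complex.I).re < R₁ := by simpa using hζ
    have := log_branch_sub_eq (S := {ζ : ℂ | ζ.re < R₁}) (a := φ)
      (b := fun ζ => Complex.log ((r + Complex.exp ζ - p) / (r - p)) + Complex.log (r - p) - ζ)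
      (convex_halfSpace_re_lt R₁).isPreconnected hφ.continuousOn
      (ContinuousOn.sub (ContinuousOn.add (ContinuousOn.clog (by fun_prop) fun ζ h => (hR₁ ζ h).2)
        continuousOn_const) continuousOn_id) (fun ξ hξ => ?_) hζ' hζ
    · simp only [Complex.exp_add, hI, mul_one] at this
      linear_combination this
    · rw [hφe, (hR₁ ξ hξ).1, Complex.exp_sub, Complex.exp_add, Complex.exp_log hrp,
        Complex.exp_log (Complex.slitPlane_ne_zero (hR₁ ξ hξ).2), div_mul_cancel₀ _ hrp]
  -- near infinity
  obtain ⟨R₂, hR₂⟩ : ∃ R₂ : ℝ, ∀ ζ : ℂ, R₂ < ζ.re →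
      F (r + Complex.exp ζ) = 1 + (r - p) / Complex.exp ζ ∧
      1 + (r - p) / Complex.exp ζ ∈ Complex.slitPlane := by
    rw [(Metric.hasBasis_cobounded_compl_closedBall r).eventually_iff] at hfar
    obtain ⟨ε, -, hn⟩ := hfar
    refine ⟨Real.log (max (max ε ‖r - p‖) 1), fun ζ hζ => ?_⟩
    have hm : 0 < max (max ε ‖r - p‖) 1 := lt_max_of_lt_right one_pos
    have hn' : max (max ε ‖r - p‖) 1 < ‖Complex.exp ζ‖ := by
      rw [Complex.norm_exp]
      exact (Real.log_lt_iff_lt_exp hm).1 hζ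
    constructor
    · rw [hn]
      · simp only [add_sub_cancel_left]
        field_simp [Complex.exp_ne_zero ζ]
        ring
      · simp only [mem_compl_iff, mem_closedBall, dist_eq_norm, add_sub_cancel_left, not_le]
        exact ((le_max_left _ _).trans (le_max_left _ _)).trans_lt hn'
    · apply Complex.mem_slitPlane_of_norm_lt_one
      rw [norm_div, div_lt_one (norm_pos_iff.2 (Complex.exp_ne_zero _))]
      exact ((le_max_right _ _).trans (le_max_left _ _)).trans_lt hn'
  have hB : ∀ ζ : ℂ, R₂ < ζ.re → φ (ζ + 2 * π * Complex.I) - φ ζ = 0 := by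
    intro ζ hζ
    have hζ' : R₂ < (ζ + 2 * π * Complex.I).re := by simpa using hζ
    have := log_branch_sub_eq (S := {ζ : ℂ | R₂ < ζ.re}) (a := φ)
      (b := fun ζ => Complex.log (1 + (r - p) / Complex.exp ζ))
      (convex_halfSpace_re_gt R₂).isPreconnected hφ.continuousOn
      (ContinuousOn.clog (continuousOn_const.add (continuousOn_const.div (by fun_prop)
        fun ζ _ => Complex.exp_ne_zero ζ)) fun ζ h => (hR₂ ζ h).2) (fun ξ hξ => ?_) hζ' hζ
    · simp only [Complex.exp_add, hI, mul_one] at this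
      linear_combination this
    · rw [hφe, (hR₂ ξ hξ).1, Complex.exp_log (Complex.slitPlane_ne_zero (hR₂ ξ hξ).2)]
  have h1 := hA ((R₁ - 1 : ℝ) : ℂ) (by simp)
  have h2 := hB ((R₂ + 1 : ℝ) : ℂ) (by simp)
  rw [hconst _ ((R₂ + 1 : ℝ) : ℂ), h2] at h1
  have : (2 * π * Complex.I : ℂ) = 0 := by linear_combination h1
  simp [Real.pi_ne_zero] at this

lemma mem_component_of_bounded {X : Set ℂ} (hX : IsCompact X) {p r : ℂ} (hp : p ∉ X) (hr : r ∉ X)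
    (h : HasLogOn X fun z => (z - p) / (z - r))
    (hb : Bornology.IsBounded (connectedComponentIn Xᶜ p)) : r ∈ connectedComponentIn Xᶜ p := by
  classical
  by_contra hrC
  set C := connectedComponentIn Xᶜ p with hC
  have hCo : IsOpen C := hX.isClosed.isOpen_compl.connectedComponentIn
  have hpC : p ∈ C := mem_connectedComponentIn hp
  have hcl : closure C ⊆ C ∪ X := by
    intro z hz
    by_contra hz'
    rw [mem_union, not_or] at hz'
    have hzo : IsOpen (connectedComponentIn Xᶜ z) := hX.isClosed.isOpen_compl.connectedComponentIn
    obtain ⟨y, hy1, hy2⟩ := mem_closure_iff.1 hz _ hzo (mem_connectedComponentIn hz'.2)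
    have e1 := connectedComponentIn_eq hy1
    have e2 := connectedComponentIn_eq hy2
    apply hz'.1
    rw [hC, e2, ← e1]
    exact mem_connectedComponentIn hz'.2
  have hrcl : r ∉ closure C := fun h => (hcl h).elim hrC hr
  obtain ⟨l, hl, hle⟩ := h
  obtain ⟨L, hL⟩ := ContinuousMap.exists_extension' (Y := ℂ) (hX.isClosed.isClosedEmbedding_subtypeVal)
    ⟨X.domRestrict l, continuousOn_iff_continuous_domRestrict.1 hl⟩
  have hLX : ∀ z ∈ X, Complex.exp (L z) = (z - p) / (z - r) := by
    intro z hz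
    have := congr_fun hL ⟨z, hz⟩
    simp only [Function.comp_apply, ContinuousMap.coe_mk, domRestrict_apply] at this
    rw [this, hle z hz]
  have hpr : p ≠ r := fun h => hrC (h ▸ hpC)
  refine not_agree_near_pole_and_infty hpr
    (F := C.piecewise (fun z => Complex.exp (L z)) fun z => (z - p) / (z - r)) ?_ ?_ ?_ ?_
  · refine ContinuousOn.piecewise ?_ (by fun_prop) ?_
    · rintro z ⟨-, hz⟩
      rw [hCo.frontier_eq] at hz
      exact hLX z ((hcl hz.1).resolve_left hz.2)
    · exact ContinuousOn.div (by fun_prop) (by fun_prop) fun z hz => sub_ne_zero.2 hz.1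
  · intro z hz
    by_cases h : z ∈ C
    · rw [piecewise_eq_of_mem _ _ _ h]; exact Complex.exp_ne_zero _
    · rw [piecewise_eq_of_notMem _ _ _ h]
      exact div_ne_zero (sub_ne_zero.2 fun e => h (e ▸ hpC)) (sub_ne_zero.2 hz)
  · refine (eventually_nhdsWithin_of_eventually_nhds ?_)
    filter_upwards [isClosed_closure.isOpen_compl.mem_nhds hrcl] with z hz
    exact piecewise_eq_of_notMem _ _ _ fun h => hz (subset_closure h)
  · filter_upwards [Bornology.isBounded_def.1 hb] with z hz
    exact piecewise_eq_of_notMem _ _ _ hz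

lemma isPreconnected_norm_gt {R : ℝ} (hR : 0 < R) : IsPreconnected {z : ℂ | R < ‖z‖} := by
  have : {z : ℂ | R < ‖z‖} = Complex.exp '' {ζ : ℂ | Real.log R < ζ.re} := by
    ext z
    constructor
    · intro hz
      have h0 : z ≠ 0 := norm_pos_iff.1 (hR.trans hz)
      refine ⟨Complex.log z, ?_, Complex.exp_log h0⟩
      rw [mem_ofPred_eq, Complex.log_re]
      exact Real.log_lt_log hR hz
    · rintro ⟨ζ, hζ, rfl⟩
      rw [mem_ofPred_eq, Complex.norm_exp]
      exact (Real.log_lt_iff_lt_exp hR).1 hζ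
  rw [this]
  exact (convex_halfSpace_re_gt _).isPreconnected.image _ Complex.continuous_exp.continuousOn

lemma IsCompact.exists_norm_bound {X : Set ℂ} (hX : IsCompact X) :
    ∃ R : ℝ, 0 < R ∧ ∀ z ∈ X, ‖z‖ < R := by
  obtain ⟨R, hR⟩ := hX.isBounded.exists_norm_le
  exact ⟨|R| + 1, by positivity, fun z hz => by
    have := hR z hz
    have := le_abs_self R
    linarith⟩

lemma exists_norm_gt_of_unbounded {C : Set ℂ} (h : ¬ Bornology.IsBounded C) (R : ℝ) :
    ∃ z ∈ C, R < ‖z‖ := by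
  by_contra! H
  exact h (isBounded_iff_forall_norm_le.2 ⟨R, H⟩)

/-- `X` does not separate `p` from `r`, if `(z - p) / (z - r)` has a logarithm on `X`. -/
lemma mem_component_of_hasLogOn {X : Set ℂ} (hX : IsCompact X) {p r : ℂ} (hp : p ∉ X) (hr : r ∉ X)
    (h : HasLogOn X fun z => (z - p) / (z - r)) : r ∈ connectedComponentIn Xᶜ p := by
  by_cases hb : Bornology.IsBounded (connectedComponentIn Xᶜ p)
  · exact mem_component_of_bounded hX hp hr h hb
  by_cases hb' : Bornology.IsBounded (connectedComponentIn Xᶜ r)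
  · have := mem_component_of_bounded hX hr hp (h.inv.congr fun z _ => by simp) hb'
    rw [← connectedComponentIn_eq this]
    exact mem_connectedComponentIn hr
  obtain ⟨R, hR, hXR⟩ := hX.exists_norm_bound
  obtain ⟨a, ha, haR⟩ := exists_norm_gt_of_unbounded hb R
  obtain ⟨b, hb, hbR⟩ := exists_norm_gt_of_unbounded hb' R
  have hsub : {z : ℂ | R < ‖z‖} ⊆ Xᶜ := fun z hz hzX => lt_asymm hz (hXR z hzX)
  have hab := (isPreconnected_norm_gt hR).subset_connectedComponentIn haR hsub hbR
  rw [connectedComponentIn_eq ha, connectedComponentIn_eq hab, ← connectedComponentIn_eq hb]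
  exact mem_connectedComponentIn hr

lemma hasLogOn_sub_of_far {X : Set ℂ} {R : ℝ} (hX : ∀ z ∈ X, ‖z‖ < R) {r : ℂ} (hr : R ≤ ‖r‖) :
    HasLogOn X fun z => z - r := by
  rcases X.eq_empty_or_nonempty with rfl | ⟨z₀, hz₀⟩
  · exact ⟨0, by simp, by simp⟩
  have hR : 0 < R := (norm_nonneg _).trans_lt (hX _ hz₀)
  have hr0 : r ≠ 0 := norm_pos_iff.1 (hR.trans_le hr)
  refine (hasLogOn_const (neg_ne_zero.2 hr0)).of_close (by fun_prop) (by fun_prop) fun z hz => ?_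
  simpa using (hX z hz).trans_le hr

/-- If `z - p` has a logarithm on `X`, then the component of `p` off `X` is unbounded. -/
lemma not_isBounded_component_of_hasLogOn {X : Set ℂ} (hX : IsCompact X) {p : ℂ} (hp : p ∉ X)
    (h : HasLogOn X fun z => z - p) : ¬ Bornology.IsBounded (connectedComponentIn Xᶜ p) := by
  intro hb
  obtain ⟨R, hR, hXR⟩ := hX.exists_norm_bound
  obtain ⟨R', hR'⟩ := isBounded_iff_forall_norm_le.1 hb
  set r : ℂ := ((max R R' + 1 : ℝ) : ℂ)
  have hrn : ‖r‖ = max R R' + 1 := by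
    rw [Complex.norm_real, Real.norm_of_nonneg]
    have := le_max_left R R'
    linarith
  have hr : R ≤ ‖r‖ := by rw [hrn]; linarith [le_max_left R R']
  have := mem_component_of_hasLogOn hX hp (fun h => absurd (hXR r h) (not_lt.2 hr))
    (h.div (hasLogOn_sub_of_far hXR hr))
  have := hR' r this
  rw [hrn] at this
  linarith [le_max_right R R']

/-- `(z - p) / (z - r)` has a logarithm on a closed set not separating `p` from `r`. -/
lemma hasLogOn_div_of_mem_component {X : Set ℂ} (hX : IsClosed X) {p r : ℂ}
    (h : r ∈ connectedComponentIn Xᶜ p) : HasLogOn X fun z => (z - p) / (z - r) := by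
  have hp : p ∈ Xᶜ := by
    by_contra hp
    rw [connectedComponentIn_eq_empty hp] at h
    exact h
  set C := connectedComponentIn Xᶜ p
  have hCX : C ⊆ Xᶜ := connectedComponentIn_subset _ _
  refine (isPreconnected_connectedComponentIn (F := Xᶜ) (x := p)).induction₂
    (fun p r => HasLogOn X fun z => (z - p) / (z - r)) ?_ ?_ ?_ (mem_connectedComponentIn hp) h
  · intro x hx
    obtain ⟨ε, hε, hb⟩ := Metric.isOpen_iff.1 hX.isOpen_compl x (hCX hx)
    refine eventually_nhdsWithin_of_eventually_nhds ?_
    filter_upwards [ball_mem_nhds x hε] with y hy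
    have h0 : ∀ z ∈ X, z - x ≠ 0 := fun z hz e => hCX hx (sub_eq_zero.1 e ▸ hz)
    have : HasLogOn X fun z => (z - y) / (z - x) := by
      refine (hasLogOn_const one_ne_zero).of_close
        (ContinuousOn.div (by fun_prop) (by fun_prop) h0) (by fun_prop) fun z hz => ?_
      rw [div_sub_one (h0 z hz), norm_div, norm_one, div_lt_one (norm_pos_iff.2 (h0 z hz))]
      have h1 : ε ≤ dist z x := not_lt.1 fun hlt => hb hlt hz
      rw [← dist_eq_norm z x]
      refine lt_of_lt_of_le ?_ h1
      rw [show z - y - (z - x) = x - y by ring, ← dist_eq_norm, dist_comm]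
      exact hy
    exact this.inv.congr fun z _ => by simp
  · intro x y z _ hy _ h1 h2
    refine (h1.mul h2).congr fun w hw => ?_
    have : w - y ≠ 0 := fun e => hCX hy (sub_eq_zero.1 e ▸ hw)
    field_simp
  · intro x y _ _ h
    exact h.inv.congr fun z _ => by simp

/-- If the component of `p` off a compact set `X` is unbounded, then `z - p` has a logarithm. -/
lemma hasLogOn_of_not_isBounded {X : Set ℂ} (hX : IsCompact X) {p : ℂ}
    (h : ¬ Bornology.IsBounded (connectedComponentIn Xᶜ p)) : HasLogOn X fun z => z - p := by
  obtain ⟨R, hR, hXR⟩ := hX.exists_norm_bound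
  obtain ⟨r, hr, hrR⟩ := exists_norm_gt_of_unbounded h R
  refine ((hasLogOn_div_of_mem_component hX.isClosed hr).mul
    (hasLogOn_sub_of_far hXR hrR.le)).congr fun z hz => ?_
  have : z - r ≠ 0 := fun e => connectedComponentIn_subset _ _ hr (sub_eq_zero.1 e ▸ hz)
  exact div_mul_cancel₀ _ this

/-- Derivative in the space variable. -/
def dx (f : ℝ × ℝ → ℂ) (p : ℝ × ℝ) : ℂ := fderiv ℝ f p (1, 0)
/-- Derivative in the time variable. -/
def dt (f : ℝ × ℝ → ℂ) (p : ℝ × ℝ) : ℂ := fderiv ℝ f p (0, 1)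

section partials
variable {f : ℝ × ℝ → ℂ}

lemma contDiff_dx (hf : ContDiff ℝ ∞ f) : ContDiff ℝ ∞ (dx f) :=
  (hf.fderiv_right (m := ∞) (by simp)).clm_apply contDiff_const

lemma contDiff_dt (hf : ContDiff ℝ ∞ f) : ContDiff ℝ ∞ (dt f) :=
  (hf.fderiv_right (m := ∞) (by simp)).clm_apply contDiff_const

lemma hasDerivAt_dx (hf : ContDiff ℝ ∞ f) (x t : ℝ) :
    HasDerivAt (fun y => f (y, t)) (dx f (x, t)) x := by
  have h := (hf.differentiable (by simp) (x, t)).hasFDerivAt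
  exact h.comp_hasDerivAt x ((hasDerivAt_id x).prodMk (hasDerivAt_const x t))

lemma hasDerivAt_dt (hf : ContDiff ℝ ∞ f) (x t : ℝ) :
    HasDerivAt (fun s => f (x, s)) (dt f (x, t)) t := by
  have h := (hf.differentiable (by simp) (x, t)).hasFDerivAt
  exact h.comp_hasDerivAt t ((hasDerivAt_const t x).prodMk (hasDerivAt_id t))

lemma fderiv_eq_dx_dt (p v : ℝ × ℝ) :
    fderiv ℝ f p v = v.1 • dx f p + v.2 • dt f p := by
  have : v = v.1 • ((1 : ℝ), (0 : ℝ)) + v.2 • ((0 : ℝ), (1 : ℝ)) := by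
    ext <;> simp
  conv_lhs => rw [this]
  simp only [map_add, map_smul, dx, dt]

lemma dt_dx_comm (hf : ContDiff ℝ ∞ f) (p : ℝ × ℝ) : dt (dx f) p = dx (dt f) p := by
  have hs : IsSymmSndFDerivAt ℝ f p := hf.contDiffAt.isSymmSndFDerivAt (by
    simp only [minSmoothness_of_isRCLikeNormedField]; exact WithTop.coe_le_coe.2 (le_top : (2 : ℕ∞) ≤ ⊤))
  have hd : DifferentiableAt ℝ (fderiv ℝ f) p :=
    (hf.fderiv_right (m := ∞) (by simp)).differentiable (by simp) p
  have e1 : dt (dx f) p = fderiv ℝ (fderiv ℝ f) p (0, 1) (1, 0) := by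
    unfold dt
    have : dx f = fun q => fderiv ℝ f q (1, 0) := rfl
    rw [this, fderiv_clm_apply hd (by fun_prop)]
    simp
  have e2 : dx (dt f) p = fderiv ℝ (fderiv ℝ f) p (1, 0) (0, 1) := by
    unfold dx
    have : dt f = fun q => fderiv ℝ f q (0, 1) := rfl
    rw [this, fderiv_clm_apply hd (by fun_prop)]
    simp
  rw [e1, e2]
  exact hs _ _

end partials

/-- A smooth family of smoothly embedded closed curves. -/
structure Fam where
  F : ℝ × ℝ → ℂ
  smooth : ContDiff ℝ ∞ F
  per : ∀ x t, F (x + 2 * π, t) = F (x, t)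
  inj : ∀ x y t, F (x, t) = F (y, t) → ∃ k : ℤ, y = x + 2 * π * k
  imm : ∀ p, dx F p ≠ 0

namespace Fam

instance : CoeFun Fam (fun _ => ℝ × ℝ → ℂ) := ⟨Fam.F⟩

variable (Γ : Fam)

/-- The curve at time `t`. -/
def curve (t : ℝ) : Set ℂ := range fun x => Γ (x, t)

/-- The space derivative. -/
def vel (p : ℝ × ℝ) : ℂ := dx Γ.F p

lemma vel_ne (p : ℝ × ℝ) : Γ.vel p ≠ 0 := Γ.imm p

@[fun_prop] lemma continuous : Continuous Γ.F := Γ.smooth.continuous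

lemma contDiff_vel : ContDiff ℝ ∞ Γ.vel := contDiff_dx Γ.smooth

@[fun_prop] lemma continuous_vel : Continuous Γ.vel := Γ.contDiff_vel.continuous

lemma hasDerivAt_x (x t : ℝ) : HasDerivAt (fun y => Γ (y, t)) (Γ.vel (x, t)) x :=
  hasDerivAt_dx Γ.smooth x t

lemma per_int (x t : ℝ) (k : ℤ) : Γ (x + 2 * π * k, t) = Γ (x, t) := by
  have h : Function.Periodic (fun y => Γ (y, t)) (2 * π) := fun y => Γ.per y t
  have := h.int_mul k x
  simpa [mul_comm] using this

lemma vel_per (x t : ℝ) : Γ.vel (x + 2 * π, t) = Γ.vel (x, t) := by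
  have h := (Γ.hasDerivAt_x (x + 2 * π) t).comp_add_const x (2 * π)
  have e : (fun y => Γ (y + 2 * π, t)) = fun y => Γ (y, t) := by
    ext y; exact Γ.per y t
  rw [e] at h
  exact h.unique (Γ.hasDerivAt_x x t)

lemma vel_per_int (x t : ℝ) (k : ℤ) : Γ.vel (x + 2 * π * k, t) = Γ.vel (x, t) := by
  have h : Function.Periodic (fun y => Γ.vel (y, t)) (2 * π) := fun y => Γ.vel_per y t
  have := h.int_mul k x
  simpa [mul_comm] using this

lemma mem_curve (x t : ℝ) : Γ (x, t) ∈ Γ.curve t := ⟨x, rfl⟩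

lemma exists_param {t : ℝ} {z : ℂ} (hz : z ∈ Γ.curve t) (a : ℝ) :
    ∃ x ∈ Ico a (a + 2 * π), Γ (x, t) = z := by
  obtain ⟨y, rfl⟩ := hz
  have h : Function.Periodic (fun y => Γ (y, t)) (2 * π) := fun y => Γ.per y t
  obtain ⟨x, hx, e⟩ := h.exists_mem_Ico two_pi_pos y a
  exact ⟨x, hx, e.symm⟩

lemma curve_eq_image (t : ℝ) : Γ.curve t = (fun x => Γ (x, t)) '' Icc 0 (2 * π) := by
  ext z
  constructor
  · intro hz
    obtain ⟨x, hx, rfl⟩ := Γ.exists_param hz 0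
    exact ⟨x, ⟨hx.1, by linarith [hx.2]⟩, rfl⟩
  · rintro ⟨x, -, rfl⟩
    exact Γ.mem_curve x t

lemma isCompact_curve (t : ℝ) : IsCompact (Γ.curve t) := by
  rw [curve_eq_image]
  exact isCompact_Icc.image (by fun_prop)

lemma isClosed_curve (t : ℝ) : IsClosed (Γ.curve t) := (Γ.isCompact_curve t).isClosed

/-- The space-time track of the family is closed. -/
lemma isClosed_track : IsClosed {q : ℂ × ℝ | q.1 ∈ Γ.curve q.2} := by
  have e : {q : ℂ × ℝ | q.1 ∈ Γ.curve q.2} =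
      Prod.snd '' {r : Icc (0 : ℝ) (2 * π) × (ℂ × ℝ) | Γ (r.1, r.2.2) = r.2.1} := by
    ext q
    constructor
    · intro hq
      obtain ⟨x, hx, e⟩ := Γ.exists_param hq 0
      exact ⟨(⟨x, hx.1, by linarith [hx.2]⟩, q), e, rfl⟩
    · rintro ⟨r, hr, rfl⟩
      exact ⟨_, hr⟩
  rw [e]
  apply isClosedMap_snd_of_compactSpace
  exact isClosed_eq (by fun_prop) (by fun_prop)

/-- Points of the curve that are close come from parameters that are close modulo `2π`. -/
lemma close (x₀ t₀ : ℝ) {ε : ℝ} (hε : 0 < ε) :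
    ∀ᶠ q : ℂ × ℝ in 𝓝 (Γ (x₀, t₀), t₀), ∀ x, Γ (x, q.2) = q.1 →
      ∃ k : ℤ, |x + 2 * π * k - x₀| < ε := by
  set ε' := min ε π
  have hε' : 0 < ε' := lt_min hε pi_pos
  let K : Set (Icc (x₀ - π) (x₀ + π) × (ℂ × ℝ)) :=
    {r | Γ (r.1, r.2.2) = r.2.1 ∧ ε' ≤ |(r.1 : ℝ) - x₀|}
  have hK : IsClosed (Prod.snd '' K) := by
    have h1 : IsClosed {r : Icc (x₀ - π) (x₀ + π) × (ℂ × ℝ) | Γ (r.1, r.2.2) = r.2.1} :=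
      isClosed_eq (by fun_prop) (by fun_prop)
    have h2 : IsClosed {r : Icc (x₀ - π) (x₀ + π) × (ℂ × ℝ) | ε' ≤ |(r.1 : ℝ) - x₀|} :=
      isClosed_le (by fun_prop) (by fun_prop)
    exact isClosedMap_snd_of_compactSpace _ (h1.inter h2)
  have h0 : (Γ (x₀, t₀), t₀) ∉ Prod.snd '' K := by
    rintro ⟨⟨⟨y, hy⟩, q⟩, ⟨h1, h2⟩, rfl⟩
    simp only at h1 h2
    obtain ⟨k, hk⟩ := Γ.inj _ _ _ h1
    have hk0 : k = 0 := by
      have h3 : |(k : ℝ)| < 1 := by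
        have hpi := pi_pos
        rw [abs_lt]
        constructor <;> nlinarith [hy.1, hy.2]
      have : |k| < 1 := by exact_mod_cast h3
      exact Int.abs_lt_one_iff.mp this
    rw [hk0] at hk
    have : |y - x₀| = 0 := by rw [hk]; simp
    linarith
  filter_upwards [hK.isOpen_compl.mem_nhds h0] with q hq x hx
  obtain ⟨y, hy, e⟩ := Γ.exists_param ⟨x, hx⟩ (x₀ - π)
  obtain ⟨k, hk⟩ := Γ.inj x y q.2 (hx.trans e.symm)
  refine ⟨k, ?_⟩
  rw [← hk]
  by_contra hcon
  exact hq ⟨⟨⟨y, hy.1, by linarith [hy.2]⟩, q⟩, ⟨e, (min_le_left _ _).trans (not_lt.mp hcon)⟩, rfl⟩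

/-- Exponentiating the integral of a logarithmic derivative. -/
lemma _root_.exp_integral_logDeriv {f f' : ℝ → ℂ} (hf : ∀ x, HasDerivAt f (f' x) x)
    (hf' : Continuous f') (h0 : ∀ x, f x ≠ 0) {a : ℝ} {l : ℂ} (hl : Complex.exp l = f a) (x : ℝ) :
    Complex.exp (l + ∫ y in a..x, f' y / f y) = f x := by
  have hfc : Continuous f := continuous_iff_continuousAt.2 fun x => (hf x).continuousAt
  have hc : Continuous fun y => f' y / f y := hf'.div hfc h0
  have hd : ∀ x, HasDerivAt (fun x => Complex.exp (-(l + ∫ y in a..x, f' y / f y)) * f x) 0 x := by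
    intro x
    have h1 : HasDerivAt (fun x => ∫ y in a..x, f' y / f y) (f' x / f x) x :=
      intervalIntegral.integral_hasDerivAt_right (hc.intervalIntegrable _ _)
        hc.stronglyMeasurable.stronglyMeasurableAtFilter hc.continuousAt
    have h2 := ((h1.const_add l).neg.cexp).mul (hf x)
    refine h2.congr_deriv ?_
    have := h0 x
    field_simp
    ring
  have hk := is_const_of_deriv_eq_zero (fun x => (hd x).differentiableAt) (fun x => (hd x).deriv) x a
  simp only [intervalIntegral.integral_same, add_zero] at hk
  rw [← hl, ← Complex.exp_add, neg_add_cancel, Complex.exp_zero, Complex.exp_neg] at hk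
  have := Complex.exp_ne_zero (l + ∫ y in a..x, f' y / f y)
  field_simp at hk
  exact hk.symm

/-- The winding number integral. -/
def wn (p : ℂ) (t : ℝ) : ℝ := (2 * π)⁻¹ * ∫ x in (0 : ℝ)..2 * π, (Γ.vel (x, t) / (Γ (x, t) - p)).im

variable {Γ} in
lemma sub_ne {p : ℂ} {t : ℝ} (hp : p ∉ Γ.curve t) (x : ℝ) : Γ (x, t) - p ≠ 0 := by
  intro h
  exact hp ⟨x, sub_eq_zero.mp h⟩

variable {Γ} in
lemma continuous_logDeriv {p : ℂ} {t : ℝ} (hp : p ∉ Γ.curve t) :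
    Continuous fun x => Γ.vel (x, t) / (Γ (x, t) - p) :=
  Continuous.div (by fun_prop) (by fun_prop) (sub_ne hp)

variable {Γ} in
/-- The lift of the logarithm along the curve. -/
lemma exp_lift {p : ℂ} {t : ℝ} (hp : p ∉ Γ.curve t) {a : ℝ} {l : ℂ}
    (hl : Complex.exp l = Γ (a, t) - p) (x : ℝ) :
    Complex.exp (l + ∫ y in a..x, Γ.vel (y, t) / (Γ (y, t) - p)) = Γ (x, t) - p :=
  exp_integral_logDeriv (f := fun x => Γ (x, t) - p) (fun x => (Γ.hasDerivAt_x x t).sub_const p)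
    (by fun_prop) (sub_ne hp) hl x

variable {Γ} in
lemma integral_eq_wn {p : ℂ} {t : ℝ} (hp : p ∉ Γ.curve t) (a : ℝ) :
    ∫ x in a..(a + 2 * π), Γ.vel (x, t) / (Γ (x, t) - p) = (Γ.wn p t : ℂ) * (2 * π * Complex.I) ∧
      ∃ n : ℤ, Γ.wn p t = n := by
  have hper : Function.Periodic (fun x => Γ.vel (x, t) / (Γ (x, t) - p)) (2 * π) := by
    intro x; simp only [Γ.per, Γ.vel_per]
  have h1 := exp_lift hp (a := 0) (Complex.exp_log (sub_ne hp 0)) (2 * π)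
  rw [Complex.exp_add, Complex.exp_log (sub_ne hp 0)] at h1
  have h2 : Γ (2 * π, t) = Γ (0, t) := by simpa using Γ.per 0 t
  rw [h2, mul_eq_left₀ (sub_ne hp 0), Complex.exp_eq_one_iff] at h1
  obtain ⟨n, hn⟩ := h1
  have h3 : Γ.wn p t = n := by
    have : ∫ x in (0 : ℝ)..2 * π, (Γ.vel (x, t) / (Γ (x, t) - p)).im
        = (∫ x in (0 : ℝ)..2 * π, Γ.vel (x, t) / (Γ (x, t) - p)).im :=
      (Complex.imCLM.intervalIntegral_comp_comm ((continuous_logDeriv hp).intervalIntegrable _ _))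
    rw [wn, this, hn]
    have hpi := pi_pos.ne'
    simp
    field_simp
  refine ⟨?_, n, h3⟩
  rw [hper.intervalIntegral_add_eq a 0, zero_add, hn, h3]
  simp

lemma isOpen_off : IsOpen {q : ℂ × ℝ | q.1 ∉ Γ.curve q.2} := Γ.isClosed_track.isOpen_compl

lemma continuousOn_wn : ContinuousOn (fun q : ℂ × ℝ => Γ.wn q.1 q.2) {q | q.1 ∉ Γ.curve q.2} := by
  rw [continuousOn_iff_continuous_domRestrict]
  unfold wn
  apply Continuous.mul continuous_const
  apply intervalIntegral.continuous_parametric_intervalIntegral_of_continuous' (f := fun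
    (q : {q : ℂ × ℝ | q.1 ∉ Γ.curve q.2}) x => (Γ.vel (x, q.1.2) / (Γ (x, q.1.2) - q.1.1)).im)
  refine Complex.continuous_im.comp (Continuous.div (by fun_prop) (by fun_prop) ?_)
  rintro ⟨⟨q, hq⟩, x⟩
  exact sub_ne hq x

/-- The winding number is constant on preconnected sets off the track. -/
lemma wn_eq_of_isPreconnected {S : Set (ℂ × ℝ)} (hS : IsPreconnected S)
    (h : ∀ q ∈ S, q.1 ∉ Γ.curve q.2) {q r : ℂ × ℝ} (hq : q ∈ S) (hr : r ∈ S) :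
    Γ.wn q.1 q.2 = Γ.wn r.1 r.2 :=
  eq_of_int_valued hS (Γ.continuousOn_wn.mono h) (fun q hq => (integral_eq_wn (h q hq) 0).2) hq hr

lemma wn_eventually {p : ℂ} {t : ℝ} (h : p ∉ Γ.curve t) :
    ∀ᶠ q : ℂ × ℝ in 𝓝 (p, t), q.1 ∉ Γ.curve q.2 ∧ Γ.wn q.1 q.2 = Γ.wn p t := by
  obtain ⟨ε, hε, hb⟩ := Metric.isOpen_iff.mp Γ.isOpen_off (p, t) h
  filter_upwards [Metric.ball_mem_nhds _ hε] with q hq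
  exact ⟨hb hq, Γ.wn_eq_of_isPreconnected (convex_ball (p, t) ε).isPreconnected (fun q hq => hb hq)
    hq (Metric.mem_ball_self hε)⟩

lemma _root_.HasLogOn.of_lift {Γ : Fam} {t : ℝ} {f : ℂ → ℂ} {l : ℝ → ℂ} (hl : Continuous l)
    (hper : ∀ x, l (x + 2 * π) = l x) (h : ∀ x, Complex.exp (l x) = f (Γ (x, t))) :
    HasLogOn (Γ.curve t) f := by
  have hc : Γ.curve t = range fun x : Icc (0 : ℝ) (2 * π) => Γ (x, t) := by
    rw [curve_eq_image, image_eq_range]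
  rw [hc]
  refine HasLogOn.of_comp (l := fun x : Icc (0 : ℝ) (2 * π) => l x) (by fun_prop) (by fun_prop) ?_
    (fun x => h x)
  intro x y hxy
  obtain ⟨k, hk⟩ := Γ.inj _ _ _ hxy
  have := (show Function.Periodic l (2 * π) from hper).int_mul k x
  change l x = l y
  rw [hk, ← this, mul_comm (k : ℝ)]

variable {Γ} in
lemma hasLogOn_iff_of_lift {t : ℝ} {f : ℂ → ℂ} {L : ℝ → ℂ} {c : ℂ} (hL : Continuous L)
    (hc : ∀ x, L (x + 2 * π) = L x + c) (he : ∀ x, Complex.exp (L x) = f (Γ (x, t))) :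
    HasLogOn (Γ.curve t) f ↔ c = 0 := by
  constructor
  · rintro ⟨l, hl, h⟩
    have hl' : ContinuousOn (fun x => l (Γ (x, t))) univ :=
      hl.comp (by fun_prop) fun x _ => Γ.mem_curve x t
    have := log_branch_sub_eq isPreconnected_univ hl' hL.continuousOn
      (fun x _ => by rw [he, h _ (Γ.mem_curve x t)]) (mem_univ 0) (mem_univ (0 + 2 * π))
    rw [Γ.per, hc] at this
    linear_combination this
  · rintro rfl
    exact HasLogOn.of_lift hL (by simpa using hc) he

variable {Γ} in
lemma exists_lift {t : ℝ} {p : ℂ} (hp : p ∉ Γ.curve t) : ∃ L : ℝ → ℂ, Continuous L ∧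
    (∀ x, L (x + 2 * π) = L x + Γ.wn p t * (2 * π * Complex.I)) ∧
    ∀ x, Complex.exp (L x) = Γ (x, t) - p := by
  have hc := continuous_logDeriv hp
  refine ⟨_, ?_, fun x => ?_, exp_lift hp (a := 0) (Complex.exp_log (sub_ne hp 0))⟩
  · exact continuous_const.add (intervalIntegral.continuous_primitive (fun a b =>
      hc.intervalIntegrable a b) 0)
  · rw [← (integral_eq_wn hp x).1, add_assoc, intervalIntegral.integral_add_adjacent_intervals
      (hc.intervalIntegrable _ _) (hc.intervalIntegrable _ _)]

variable {Γ} in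
lemma hasLogOn_div_iff {t : ℝ} {p r : ℂ} (hp : p ∉ Γ.curve t) (hr : r ∉ Γ.curve t) :
    HasLogOn (Γ.curve t) (fun z => (z - p) / (z - r)) ↔ Γ.wn p t = Γ.wn r t := by
  obtain ⟨L, hL, hc, he⟩ := exists_lift hp
  obtain ⟨M, hM, hc', he'⟩ := exists_lift hr
  rw [hasLogOn_iff_of_lift (hL.sub hM)
    (c := (Γ.wn p t - Γ.wn r t : ℂ) * (2 * π * Complex.I)) (fun x => ?_) (fun x => ?_)]
  · have : (2 * π * Complex.I : ℂ) ≠ 0 := Complex.two_pi_I_ne_zero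
    rw [mul_eq_zero, or_iff_left this, sub_eq_zero]
    exact_mod_cast Iff.rfl
  · simp only [hc, hc', Pi.sub_apply]; ring
  · simp only [Pi.sub_apply, Complex.exp_sub, he, he']

variable {Γ} in
lemma hasLogOn_iff {t : ℝ} {p : ℂ} (hp : p ∉ Γ.curve t) :
    HasLogOn (Γ.curve t) (fun z => z - p) ↔ Γ.wn p t = 0 := by
  obtain ⟨L, hL, hc, he⟩ := exists_lift hp
  rw [hasLogOn_iff_of_lift hL hc he, mul_eq_zero, or_iff_left Complex.two_pi_I_ne_zero]
  exact_mod_cast Iff.rfl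

lemma wn_eq_zero_of_far {t R : ℝ} (hR : ∀ z ∈ Γ.curve t, ‖z‖ < R) {p : ℂ} (hp : R ≤ ‖p‖) :
    Γ.wn p t = 0 := by
  rw [← hasLogOn_iff fun h => absurd (hR p h) (not_lt.2 hp)]
  exact hasLogOn_sub_of_far hR hp

end Fam

/-- The cross product of two complex numbers. -/
def cr (u v : ℂ) : ℝ := u.re * v.im - u.im * v.re

lemma cr_self (u : ℂ) : cr u u = 0 := by simp [cr, mul_comm]
lemma cr_add_left (u v w : ℂ) : cr (u + v) w = cr u w + cr v w := by simp [cr]; ring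
lemma cr_add_right (u v w : ℂ) : cr u (v + w) = cr u v + cr u w := by simp [cr]; ring
lemma cr_smul_left (r : ℝ) (u v : ℂ) : cr (r • u) v = r * cr u v := by simp [cr]; ring
lemma cr_smul_right (r : ℝ) (u v : ℂ) : cr u (r • v) = r * cr u v := by simp [cr]; ring
lemma cr_comm (u v : ℂ) : cr u v = - cr v u := by simp [cr]; ring
lemma cr_neg_right (u v : ℂ) : cr u (-v) = - cr u v := by simp [cr]; ring

@[fun_prop] lemma Continuous.cr {α : Type*} [TopologicalSpace α] {f g : α → ℂ} (hf : Continuous f)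
    (hg : Continuous g) : Continuous fun a => cr (f a) (g a) := by
  unfold _root_.cr
  fun_prop

lemma HasDerivAt.cr_const {f : ℝ → ℂ} {f' : ℂ} {x : ℝ} (h : HasDerivAt f f' x) (n : ℂ) :
    HasDerivAt (fun y => cr (f y) n) (cr f' n) x := by
  have h1 : HasDerivAt (fun y => (f y).re) f'.re x :=
    Complex.reCLM.hasFDerivAt.comp_hasDerivAt x h
  have h2 : HasDerivAt (fun y => (f y).im) f'.im x :=
    Complex.imCLM.hasFDerivAt.comp_hasDerivAt x h
  exact (h1.mul_const _).sub (h2.mul_const _)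

lemma cr_eq_im_div (u v : ℂ) (hu : u ≠ 0) : cr u v = Complex.normSq u * (v / u).im := by
  have : Complex.normSq u ≠ 0 := by simpa using hu
  rw [Complex.div_im, cr]
  field_simp

lemma cr_pos_iff {u v : ℂ} (hu : u ≠ 0) : 0 < cr u v ↔ 0 < (v / u).im := by
  rw [cr_eq_im_div u v hu, mul_pos_iff_of_pos_left (Complex.normSq_pos.2 hu)]

lemma cr_mul_I {u : ℂ} (hu : u ≠ 0) : 0 < cr u (Complex.I * u) := by
  rw [cr_pos_iff hu, mul_div_assoc, div_self hu]
  simp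

lemma eq_of_no_critical {h h' : ℝ → ℝ} {c ε : ℝ} (hd : ∀ x, HasDerivAt h (h' x) x)
    (hn : ∀ x, |x - c| < ε → h' x ≠ 0) {a b : ℝ} (ha : |a - c| < ε) (hb : |b - c| < ε)
    (hab : h a = h b) : a = b := by
  wlog hlt : a < b generalizing a b
  · rcases lt_trichotomy a b with h1 | h1 | h1
    · exact absurd h1 hlt
    · exact h1
    · exact (this hb ha hab.symm h1).symm
  obtain ⟨x, hx, e⟩ := exists_hasDerivAt_eq_zero hlt
    (fun x _ => (hd x).continuousAt.continuousWithinAt) hab fun x _ => hd x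
  refine absurd e (hn x ?_)
  rw [abs_lt] at *
  constructor <;> linarith [hx.1, hx.2]

namespace Fam
variable (Γ : Fam)

/-- Near a point of the curve, transversal displacements leave the curve. -/
lemma side {x₀ t₀ : ℝ} {n₀ : ℂ} (hn : cr (Γ.vel (x₀, t₀)) n₀ ≠ 0) :
    ∀ᶠ q : (ℝ × ℝ) × ℂ × ℝ in 𝓝 ((x₀, t₀), n₀, 0), q.2.2 ≠ 0 →
      Γ q.1 + q.2.2 • q.2.1 ∉ Γ.curve q.1.2 := by
  have h1 : ∀ᶠ q : (ℝ × ℝ) × ℂ in 𝓝 ((x₀, t₀), n₀), cr (Γ.vel q.1) q.2 ≠ 0 :=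
    (show Continuous fun q : (ℝ × ℝ) × ℂ => cr (Γ.vel q.1) q.2 by fun_prop).continuousAt.eventually_ne hn
  obtain ⟨ε, hε, h1⟩ := Metric.eventually_nhds_iff_ball.mp h1
  have hc := Γ.close x₀ t₀ hε
  have h2 : Tendsto (fun q : (ℝ × ℝ) × ℂ × ℝ => (Γ q.1 + q.2.2 • q.2.1, q.1.2))
      (𝓝 ((x₀, t₀), n₀, 0)) (𝓝 (Γ (x₀, t₀), t₀)) := by
    have : Continuous (fun q : (ℝ × ℝ) × ℂ × ℝ => (Γ q.1 + q.2.2 • q.2.1, q.1.2)) := by fun_prop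
    convert this.tendsto ((x₀, t₀), n₀, 0) using 2
    simp
  filter_upwards [h2.eventually hc, Metric.ball_mem_nhds _ hε] with ⟨⟨x, t⟩, n, s⟩ hq hb hs
  rintro ⟨y, hy⟩
  simp only at hy hq
  rw [Metric.mem_ball, Prod.dist_eq, Prod.dist_eq, Prod.dist_eq, max_lt_iff, max_lt_iff,
    max_lt_iff] at hb
  simp only [Real.dist_eq] at hb
  obtain ⟨k, hk⟩ := hq y hy
  have hne : ∀ z, |z - x₀| < ε → cr (Γ.vel (z, t)) n ≠ 0 := fun z hz => by
    refine h1 ((z, t), n) ?_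
    rw [Metric.mem_ball, Prod.dist_eq, Prod.dist_eq, max_lt_iff, max_lt_iff]
    exact ⟨⟨hz, hb.1.2⟩, hb.2.1⟩
  have hyx : y + 2 * π * k = x := by
    refine eq_of_no_critical (h := fun y => cr (Γ (y, t)) n)
      (fun y => (Γ.hasDerivAt_x y t).cr_const n) hne hk hb.1.1 ?_
    rw [Γ.per_int, hy, cr_add_left, cr_smul_left, cr_self]
    ring
  have h3 := Γ.per_int y t k
  rw [hyx, hy] at h3
  have h4 : s • n = 0 := by simpa using h3.symm
  rcases smul_eq_zero.mp h4 with h5 | h5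
  · exact hs h5
  · exact hne x hb.1.1 (by simp [h5, cr])

/-- One-sided constancy of the winding number near a point of the curve. -/
lemma side_const {x₀ t₀ : ℝ} {n₀ : ℂ} (hn : cr (Γ.vel (x₀, t₀)) n₀ ≠ 0) :
    ∃ k : ℤ, ∀ᶠ q : (ℝ × ℝ) × ℂ × ℝ in 𝓝 ((x₀, t₀), n₀, 0), 0 < q.2.2 →
      Γ q.1 + q.2.2 • q.2.1 ∉ Γ.curve q.1.2 ∧ Γ.wn (Γ q.1 + q.2.2 • q.2.1) q.1.2 = k := by
  obtain ⟨ε, hε, h⟩ := Metric.eventually_nhds_iff_ball.mp (Γ.side hn)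
  set S : Set ((ℝ × ℝ) × ℂ × ℝ) := ball ((x₀, t₀), n₀, 0) ε ∩ {q | 0 < q.2.2}
  have hS : Convex ℝ S := by
    refine (convex_ball _ _).inter ?_
    exact (convex_Ioi (0 : ℝ)).linear_preimage
      ((LinearMap.snd ℝ ℂ ℝ).comp (LinearMap.snd ℝ (ℝ × ℝ) (ℂ × ℝ)))
  have hoff : ∀ q ∈ S, Γ q.1 + q.2.2 • q.2.1 ∉ Γ.curve q.1.2 := fun q hq => h q hq.1 (ne_of_gt hq.2)
  have hq₀ : (((x₀, t₀), n₀, ε / 2) : (ℝ × ℝ) × ℂ × ℝ) ∈ S := by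
    refine ⟨?_, half_pos hε⟩
    simp [Prod.dist_eq, hε, abs_of_pos hε]
  obtain ⟨k, hk⟩ := (integral_eq_wn (hoff _ hq₀) 0).2
  refine ⟨k, ?_⟩
  filter_upwards [Metric.ball_mem_nhds _ hε] with q hq hs
  refine ⟨hoff q ⟨hq, hs⟩, ?_⟩
  rw [← hk]
  have hI : IsPreconnected ((fun q : (ℝ × ℝ) × ℂ × ℝ => (Γ q.1 + q.2.2 • q.2.1, q.1.2)) '' S) :=
    hS.isPreconnected.image _ (by fun_prop)
  refine Γ.wn_eq_of_isPreconnected hI ?_ (mem_image_of_mem _ ⟨hq, hs⟩) (mem_image_of_mem _ hq₀)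
  rintro _ ⟨q, hq, rfl⟩
  exact hoff q hq

/-- The winding number jumps by one across the curve. -/
lemma wn_jump {x t s : ℝ} {n : ℂ} (hn : 0 < cr (Γ.vel (x, t)) n) (hs : 0 < s)
    (hoff : ∀ s', |s'| ≤ s → s' ≠ 0 → Γ (x, t) + s' • n ∉ Γ.curve t) :
    Γ.wn (Γ (x, t) + s • n) t = Γ.wn (Γ (x, t) - s • n) t + 1 := by
  set P := Γ (x, t) with hP
  have hL : P + s • n ∉ Γ.curve t := hoff s (abs_of_pos hs).le hs.ne'
  have hR : P - s • n ∉ Γ.curve t := by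
    have := hoff (-s) (by rw [abs_neg, abs_of_pos hs]) (by linarith)
    simpa [sub_eq_add_neg] using this
  have hn0 : n ≠ 0 := by rintro rfl; simp [cr] at hn
  have hsn : s • n ≠ 0 := smul_ne_zero hs.ne' hn0
  obtain ⟨L, hLc, hLp, hLe⟩ := exists_lift hL
  obtain ⟨M, hMc, hMp, hMe⟩ := exists_lift hR
  set R : ℝ → ℂ := fun q => (Γ (q, t) - (P + s • n)) / (Γ (q, t) - (P - s • n)) with hRdef
  have hRc : Continuous R := Continuous.div (by fun_prop) (by fun_prop) (sub_ne hR)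
  have hRper : ∀ q, R (q + 2 * π) = R q := fun q => by simp only [hRdef, Γ.per]
  have hRx : R x = -1 := by
    simp only [hRdef, ← hP]
    have : P - (P - s • n) ≠ 0 := by simpa using hsn
    rw [div_eq_iff this]; ring
  have hRd : HasDerivAt R (2 * Γ.vel (x, t) / (s • n)) x := by
    have h1 := ((Γ.hasDerivAt_x x t).sub_const (P + s • n)).div
      ((Γ.hasDerivAt_x x t).sub_const (P - s • n)) (sub_ne hR x)
    refine h1.congr_deriv ?_
    rw [← hP]
    have e1 : P - (P - s • n) = s • n := by ring
    have e2 : P - (P + s • n) = - (s • n) := by ring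
    rw [e1, e2]
    field_simp
    ring
  have hRd' : HasDerivAt R (2 * Γ.vel (x, t) / (s • n)) (x + 2 * π) := by
    have h1 : HasDerivAt R (2 * Γ.vel (x, t) / (s • n)) (x + 2 * π - 2 * π) := by simpa using hRd
    have h2 := h1.comp_sub_const (x + 2 * π) (2 * π)
    refine h2.congr_of_eventuallyEq (Eventually.of_forall fun q => ?_)
    have h3 := hRper (q - 2 * π)
    rw [sub_add_cancel] at h3
    exact h3
  have hneg : (2 * Γ.vel (x, t) / (s • n)).im < 0 := by
    have h1 := cr_eq_im_div n (Γ.vel (x, t)) hn0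
    rw [cr_comm] at h1
    have h2 : (2 * Γ.vel (x, t) / (s • n)) = (2 / s : ℝ) • (Γ.vel (x, t) / n) := by
      have : (s : ℂ) ≠ 0 := by exact_mod_cast hs.ne'
      simp only [Complex.real_smul]
      push_cast
      field_simp
    rw [h2, Complex.smul_im, smul_eq_mul]
    have h3 : 0 < Complex.normSq n := Complex.normSq_pos.2 hn0
    have h4 : (Γ.vel (x, t) / n).im < 0 := by
      by_contra h; push Not at h
      nlinarith
    exact mul_neg_of_pos_of_neg (by positivity) h4
  have hslit : ∀ q ∈ Ioo x (x + 2 * π), R q ∈ Complex.slitPlane := by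
    intro q hq
    by_contra hcon
    rw [Complex.mem_slitPlane_iff, not_or, not_lt, not_not] at hcon
    obtain ⟨h1, h2⟩ := hcon
    have h3 : R q = ((R q).re : ℂ) := by apply Complex.ext <;> simp [h2]
    set r := (R q).re
    have h4 : Γ (q, t) - (P + s • n) = r * (Γ (q, t) - (P - s • n)) := by
      rw [← h3]; exact (div_mul_cancel₀ _ (sub_ne hR q)).symm
    have hr : (1 : ℝ) - r ≠ 0 := by linarith
    have hr' : (1 : ℂ) - r ≠ 0 := by exact_mod_cast hr
    have h5 : Γ (q, t) = P + (s * (1 + r) / (1 - r)) • n := by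
      simp only [Complex.real_smul] at h4 ⊢
      push_cast
      field_simp
      linear_combination h4
    by_cases h0 : s * (1 + r) / (1 - r) = 0
    · rw [h0, zero_smul, add_zero, hP] at h5
      obtain ⟨k, hk⟩ := Γ.inj _ _ _ h5.symm
      rw [hk] at hq
      have hpi := pi_pos
      have k1 : (0 : ℝ) < k := by
        by_contra hh; push Not at hh; nlinarith [hq.1]
      have k2 : (k : ℝ) < 1 := by
        by_contra hh; push Not at hh; nlinarith [hq.2]
      have k3 : 0 < k := by exact_mod_cast k1
      have k4 : k < 1 := by exact_mod_cast k2
      omega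
    · refine hoff _ ?_ h0 (h5 ▸ Γ.mem_curve q t)
      rw [abs_div, abs_mul, abs_of_pos hs, abs_of_pos (by linarith : 0 < 1 - r),
        div_le_iff₀ (by linarith)]
      gcongr
      rw [abs_le]; constructor <;> linarith
  have hlogc : ContinuousOn (fun q => Complex.log (R q)) (Ioo x (x + 2 * π)) :=
    hRc.continuousOn.clog hslit
  have hbr : ∀ q ∈ Ioo x (x + 2 * π), ∀ q' ∈ Ioo x (x + 2 * π),
      L q - M q - Complex.log (R q) = L q' - M q' - Complex.log (R q') := fun q hq q' hq' =>
    log_branch_sub_eq (a := fun q => L q - M q) isPreconnected_Ioo (hLc.sub hMc).continuousOn hlogc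
      (fun q hq => by
        rw [Complex.exp_sub, hLe, hMe, Complex.exp_log (Complex.slitPlane_ne_zero (hslit q hq))])
      hq hq'
  have hpi := pi_pos
  have hmid : x + π ∈ Ioo x (x + 2 * π) := by constructor <;> linarith
  set c := L (x + π) - M (x + π) - Complex.log (R (x + π))
  have hre : ((-1 : ℂ)).re < 0 := by simp
  have him : ((-1 : ℂ)).im = 0 := by simp
  have t1 : Tendsto (fun q => Complex.log (R q)) (𝓝[>] x) (𝓝 (-(π * Complex.I))) := by
    have h1 := Complex.tendsto_log_nhdsWithin_im_neg_of_re_neg_of_im_zero hre him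
    simp only [norm_neg, norm_one, Real.log_one, Complex.ofReal_zero, zero_sub] at h1
    refine h1.comp (tendsto_nhdsWithin_iff.2 ⟨?_, ?_⟩)
    · rw [← hRx]; exact hRc.continuousAt.tendsto.mono_left nhdsWithin_le_nhds
    · have hd : HasDerivAt (fun q => (R q).im) (2 * Γ.vel (x, t) / (s • n)).im x :=
        Complex.imCLM.hasFDerivAt.comp_hasDerivAt x hRd
      have := eventually_nhdsWithin_sign_eq_of_deriv_neg (by rw [hd.deriv]; exact hneg)
        (by simp [hRx])
      filter_upwards [this.filter_mono nhdsWithin_le_nhds, self_mem_nhdsWithin] with q hq hq'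
      rw [mem_Ioi] at hq'
      rw [sign_neg (by linarith : x - q < 0), sign_eq_neg_one_iff] at hq
      exact hq
  have t2 : Tendsto (fun q => Complex.log (R q)) (𝓝[<] (x + 2 * π)) (𝓝 (π * Complex.I)) := by
    have h1 := Complex.tendsto_log_nhdsWithin_im_nonneg_of_re_neg_of_im_zero hre him
    simp only [norm_neg, norm_one, Real.log_one, Complex.ofReal_zero, zero_add] at h1
    refine h1.comp (tendsto_nhdsWithin_iff.2 ⟨?_, ?_⟩)
    · rw [← hRx, ← hRper]; exact hRc.continuousAt.tendsto.mono_left nhdsWithin_le_nhds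
    · have hd : HasDerivAt (fun q => (R q).im) (2 * Γ.vel (x, t) / (s • n)).im (x + 2 * π) :=
        Complex.imCLM.hasFDerivAt.comp_hasDerivAt _ hRd'
      have := eventually_nhdsWithin_sign_eq_of_deriv_neg (by rw [hd.deriv]; exact hneg)
        (by simp [hRx, hRper])
      filter_upwards [this.filter_mono nhdsWithin_le_nhds, self_mem_nhdsWithin] with q hq hq'
      rw [mem_Iio] at hq'
      rw [sign_pos (by linarith : 0 < x + 2 * π - q), sign_eq_one_iff] at hq
      exact hq.le
  have u1 : L x - M x - -(π * Complex.I) = c := by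
    refine tendsto_nhds_unique (((hLc.sub hMc).continuousAt.tendsto.mono_left
      nhdsWithin_le_nhds).sub t1) (tendsto_const_nhds.congr' ?_)
    filter_upwards [Ioo_mem_nhdsGT (by linarith : x < x + 2 * π)] with q hq
    exact hbr _ hmid _ hq
  have u2 : L (x + 2 * π) - M (x + 2 * π) - π * Complex.I = c := by
    refine tendsto_nhds_unique (((hLc.sub hMc).continuousAt.tendsto.mono_left
      nhdsWithin_le_nhds).sub t2) (tendsto_const_nhds.congr' ?_)
    filter_upwards [Ioo_mem_nhdsLT (by linarith : x < x + 2 * π)] with q hq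
    exact hbr _ hmid _ hq
  rw [hLp, hMp] at u2
  have u3 : ((Γ.wn (P + s • n) t : ℂ) - Γ.wn (P - s • n) t - 1) * (2 * π * Complex.I) = 0 := by
    linear_combination u2 - u1
  rw [mul_eq_zero, or_iff_left Complex.two_pi_I_ne_zero] at u3
  have u4 : Γ.wn (P + s • n) t - Γ.wn (P - s • n) t - 1 = 0 := by exact_mod_cast u3
  linarith

/-- Winding number `k` on the left and `k - 1` on the right, near a point of the curve. -/
def SideAt (q₀ : (ℝ × ℝ) × ℂ) (k : ℤ) : Prop :=
  ∀ᶠ q : (ℝ × ℝ) × ℂ × ℝ in 𝓝 (q₀.1, q₀.2, 0),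
    (0 < q.2.2 → Γ q.1 + q.2.2 • q.2.1 ∉ Γ.curve q.1.2 ∧
      Γ.wn (Γ q.1 + q.2.2 • q.2.1) q.1.2 = k) ∧
    (q.2.2 < 0 → Γ q.1 + q.2.2 • q.2.1 ∉ Γ.curve q.1.2 ∧
      Γ.wn (Γ q.1 + q.2.2 • q.2.1) q.1.2 = k - 1)

variable {Γ} in
lemma SideAt.eventually {q₀ : (ℝ × ℝ) × ℂ} {k : ℤ} (h : Γ.SideAt q₀ k) :
    ∀ᶠ q in 𝓝 q₀, Γ.SideAt q k := by
  have h1 := Filter.Eventually.eventually_nhds h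
  have h2 : Tendsto (fun q : (ℝ × ℝ) × ℂ => (q.1, q.2, (0 : ℝ))) (𝓝 q₀) (𝓝 (q₀.1, q₀.2, 0)) :=
    (show Continuous fun q : (ℝ × ℝ) × ℂ => (q.1, q.2, (0 : ℝ)) by fun_prop).tendsto q₀
  exact h2.eventually h1

lemma eventually_small (q₀ : (ℝ × ℝ) × ℂ) {P : (ℝ × ℝ) × ℂ × ℝ → Prop}
    (h : ∀ᶠ q in 𝓝 (q₀.1, q₀.2, 0), P q) : ∀ᶠ s : ℝ in 𝓝 0, P (q₀.1, q₀.2, s) :=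
  (show Continuous fun s : ℝ => (q₀.1, q₀.2, s) by fun_prop).tendsto 0 |>.eventually h

variable {Γ} in
lemma SideAt.unique {q₀ : (ℝ × ℝ) × ℂ} {k l : ℤ} (h : Γ.SideAt q₀ k) (h' : Γ.SideAt q₀ l) :
    k = l := by
  have h1 := (eventually_small q₀ h).and (eventually_small q₀ h')
  obtain ⟨s, hs, hs0⟩ := ((h1.filter_mono nhdsWithin_le_nhds).and
    (self_mem_nhdsWithin (s := Ioi (0 : ℝ)))).exists
  have e := (hs.1.1 hs0).2.symm.trans (hs.2.1 hs0).2
  exact_mod_cast e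

lemma exists_sideAt (q₀ : (ℝ × ℝ) × ℂ) (hn : 0 < cr (Γ.vel q₀.1) q₀.2) :
    ∃ k : ℤ, Γ.SideAt q₀ k := by
  obtain ⟨⟨x, t⟩, n⟩ := q₀
  simp only at hn
  obtain ⟨k, hk⟩ := Γ.side_const hn.ne'
  obtain ⟨l, hl⟩ := Γ.side_const (x₀ := x) (t₀ := t) (n₀ := -n)
    (by rw [cr_neg_right]; exact neg_ne_zero.2 hn.ne')
  have hl' : ∀ᶠ q : (ℝ × ℝ) × ℂ × ℝ in 𝓝 ((x, t), n, 0), q.2.2 < 0 →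
      Γ q.1 + q.2.2 • q.2.1 ∉ Γ.curve q.1.2 ∧ Γ.wn (Γ q.1 + q.2.2 • q.2.1) q.1.2 = l := by
    have ht : Tendsto (fun q : (ℝ × ℝ) × ℂ × ℝ => (q.1, -q.2.1, -q.2.2)) (𝓝 ((x, t), n, 0))
        (𝓝 ((x, t), -n, 0)) := by
      have := (show Continuous (fun q : (ℝ × ℝ) × ℂ × ℝ => (q.1, -q.2.1, -q.2.2)) by
        fun_prop).tendsto ((x, t), n, 0)
      simpa using this
    filter_upwards [ht.eventually hl] with q hq hs
    simpa using hq (by simpa using hs)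
  have hkl : l = k - 1 := by
    have a1 := eventually_small ((x, t), n) hk
    have a2 := eventually_small ((x, t), n) hl'
    obtain ⟨ε, hε, h⟩ := Metric.eventually_nhds_iff_ball.mp (a1.and a2)
    have hj := Γ.wn_jump hn (half_pos hε) (fun s' hs hs' => by
      have hb : s' ∈ ball (0 : ℝ) ε := by
        rw [mem_ball_zero_iff, Real.norm_eq_abs]; linarith
      rcases lt_or_gt_of_ne hs' with h0 | h0
      · exact ((h s' hb).2 h0).1
      · exact ((h s' hb).1 h0).1)
    have b1 := ((h (ε / 2) (by simp [abs_of_pos hε, hε])).1 (half_pos hε)).2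
    have b2 := ((h (-(ε / 2)) (by simp [abs_of_pos hε, hε])).2 (by simpa using hε)).2
    simp only [neg_smul, ← sub_eq_add_neg] at b1 b2
    rw [b1, b2] at hj
    have : (k : ℝ) = (l + 1 : ℤ) := by rw [hj]; push_cast; rfl
    have := Int.cast_injective this
    omega
  refine ⟨k, ?_⟩
  filter_upwards [hk, hl'] with q h1 h2
  refine ⟨h1, fun h => ⟨(h2 h).1, ?_⟩⟩
  rw [(h2 h).2, hkl]; push_cast; rfl

/-- The left winding number does not depend on the point nor on time. -/
lemma exists_sideAt_forall : ∃ k : ℤ, ∀ q : (ℝ × ℝ) × ℂ, 0 < cr (Γ.vel q.1) q.2 → Γ.SideAt q k := by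
  let N : (ℝ × ℝ) × ℝ × ℝ → (ℝ × ℝ) × ℂ := fun r =>
    (r.1, Γ.vel r.1 * (r.2.1 + Complex.I * Real.exp r.2.2))
  have hNc : Continuous N := by fun_prop
  have hN : ∀ r, 0 < cr (Γ.vel (N r).1) (N r).2 := fun r => by
    rw [cr_pos_iff (Γ.vel_ne _)]
    simp only [N]
    rw [mul_div_cancel_left₀ _ (Γ.vel_ne _)]
    simp only [Complex.add_im, Complex.ofReal_im, Complex.I_mul_im, Complex.ofReal_re, zero_add]
    exact Real.exp_pos _
  choose κ hκ using fun r => Γ.exists_sideAt (N r) (hN r)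
  have hloc : IsLocallyConstant κ := by
    rw [IsLocallyConstant.iff_eventually_eq]
    intro r
    filter_upwards [(hNc.tendsto r).eventually (hκ r).eventually] with r' hr'
    exact (hκ r').unique hr'
  refine ⟨κ 0, fun q hq => ?_⟩
  rw [cr_pos_iff (Γ.vel_ne _)] at hq
  let r : (ℝ × ℝ) × ℝ × ℝ := (q.1, (q.2 / Γ.vel q.1).re, Real.log (q.2 / Γ.vel q.1).im)
  have hr : N r = q := by
    refine Prod.ext rfl ?_
    simp only [N, r, Real.exp_log hq]
    rw [mul_comm Complex.I, Complex.re_add_im, mul_div_cancel₀ _ (Γ.vel_ne _)]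
  have := hκ r
  rwa [hr, hloc.apply_eq_of_preconnectedSpace r 0] at this

lemma wn_eq_or_of_sideAt {k : ℤ}
    (hk : ∀ q : (ℝ × ℝ) × ℂ, 0 < cr (Γ.vel q.1) q.2 → Γ.SideAt q k) {p : ℂ} {t : ℝ}
    (hp : p ∉ Γ.curve t) : Γ.wn p t = k ∨ Γ.wn p t = k - 1 := by
  obtain ⟨z, ⟨x, rfl⟩, hx⟩ := (Γ.isCompact_curve t).exists_isMinOn ⟨_, Γ.mem_curve 0 t⟩
    (f := fun z => ‖z - p‖) (by fun_prop)
  set n := p - Γ (x, t) with hn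
  have hn0 : n ≠ 0 := fun h => sub_ne hp x (by rw [← neg_sub, ← hn, h, neg_zero])
  have hoff : ∀ s ∈ Ioc (0 : ℝ) 1, Γ (x, t) + s • n ∉ Γ.curve t := by
    intro s hs hmem
    have h1 := hx hmem
    simp only [mem_ofPred_eq] at h1
    have e1 : Γ (x, t) - p = -n := by rw [hn]; ring
    have e2 : Γ (x, t) + s • n - p = -((1 - s) • n) := by
      rw [hn]; simp only [Complex.real_smul]; push_cast; ring
    rw [e1, e2, norm_neg, norm_neg, norm_smul, Real.norm_eq_abs, abs_of_nonneg (by linarith [hs.2])]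
      at h1
    nlinarith [hs.1, norm_pos_iff.2 hn0]
  have hcr : cr (Γ.vel (x, t)) n ≠ 0 := by
    intro h0
    have hd : HasDerivAt (fun y => ‖Γ (y, t) - p‖ ^ 2)
        (2 * inner ℝ (Γ (x, t) - p) (Γ.vel (x, t))) x :=
      ((Γ.hasDerivAt_x x t).sub_const p).norm_sq
    have hmin : IsLocalMin (fun y => ‖Γ (y, t) - p‖ ^ 2) x := by
      refine Eventually.of_forall fun y => ?_
      have := hx (Γ.mem_curve y t)
      exact pow_le_pow_left₀ (norm_nonneg _) this 2
    have h1 := hmin.hasDerivAt_eq_zero hd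
    have h2 : (Γ (x, t) - p) = -n := by rw [hn]; ring
    have hv := Γ.vel_ne (x, t)
    rw [h2, Complex.inner] at h1
    simp [cr] at h0 h1
    have h3 : Complex.normSq n * Complex.normSq (Γ.vel (x, t)) = 0 := by
      rw [Complex.normSq_apply, Complex.normSq_apply]
      have e1 : n.re * (Γ.vel (x, t)).re + n.im * (Γ.vel (x, t)).im = 0 := by linarith
      linear_combination (n.re * (Γ.vel (x, t)).re + n.im * (Γ.vel (x, t)).im) * e1 +
        ((Γ.vel (x, t)).re * n.im - (Γ.vel (x, t)).im * n.re) * h0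
    rcases mul_eq_zero.mp h3 with h | h
    · exact hn0 (Complex.normSq_eq_zero.mp h)
    · exact hv (Complex.normSq_eq_zero.mp h)
  have hconst : ∀ s ∈ Ioc (0 : ℝ) 1, Γ.wn (Γ (x, t) + s • n) t = Γ.wn p t := by
    intro s hs
    have hI : IsPreconnected ((fun s : ℝ => (Γ (x, t) + s • n, t)) '' Ioc 0 1) :=
      isPreconnected_Ioc.image _ (by fun_prop)
    have := Γ.wn_eq_of_isPreconnected hI (by rintro _ ⟨s, hs, rfl⟩; exact hoff s hs)
      (mem_image_of_mem _ hs) (mem_image_of_mem _ (right_mem_Ioc.2 one_pos))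
    simpa [hn] using this
  rcases lt_or_gt_of_ne hcr with h | h
  · have := eventually_small ((x, t), -n) (hk ((x, t), -n) (by simp [cr_neg_right, h]))
    obtain ⟨s, hs, hs1⟩ := ((this.filter_mono nhdsWithin_le_nhds).and
      (Ioo_mem_nhdsLT (show (-1 : ℝ) < 0 by norm_num))).exists
    right
    rw [← hconst (-s) ⟨by linarith [hs1.2], by linarith [hs1.1]⟩]
    simpa using (hs.2 hs1.2).2
  · have := eventually_small ((x, t), n) (hk ((x, t), n) h)
    obtain ⟨s, hs, hs1⟩ := ((this.filter_mono nhdsWithin_le_nhds).and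
      (Ioo_mem_nhdsGT (show (0 : ℝ) < 1 by norm_num))).exists
    left
    rw [← hconst s ⟨hs1.1, hs1.2.le⟩]
    exact (hs.1 hs1.1).2

/-- A family is positively oriented if the interior is on the left. -/
def Positive : Prop := ∀ q : (ℝ × ℝ) × ℂ, 0 < cr (Γ.vel q.1) q.2 → Γ.SideAt q 1

/-- The reversed family. -/
def rev : Fam where
  F p := Γ (-p.1, p.2)
  smooth := Γ.smooth.comp (by fun_prop)
  per x t := by
    have h : Function.Periodic (fun y => Γ (y, t)) (2 * π) := fun y => Γ.per y t
    simpa [neg_add_rev, add_comm, sub_eq_add_neg] using h.sub_eq (-x)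
  inj x y t h := by
    obtain ⟨k, hk⟩ := Γ.inj _ _ _ h
    exact ⟨-k, by push_cast; linarith⟩
  imm p := by
    have hs : ContDiff ℝ ∞ fun p : ℝ × ℝ => Γ (-p.1, p.2) := Γ.smooth.comp (by fun_prop)
    have h1 := hasDerivAt_dx hs p.1 p.2
    have h2 := (Γ.hasDerivAt_x (-p.1) p.2).scomp p.1 (hasDerivAt_neg p.1)
    rw [h1.unique h2]
    simpa using Γ.vel_ne _

@[simp] lemma rev_apply (p : ℝ × ℝ) : Γ.rev p = Γ (-p.1, p.2) := rfl

lemma rev_vel (x t : ℝ) : Γ.rev.vel (x, t) = -Γ.vel (-x, t) := by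
  have h2 := (Γ.hasDerivAt_x (-x) t).scomp x (hasDerivAt_neg x)
  rw [(Γ.rev.hasDerivAt_x x t).unique h2]
  simp

lemma rev_curve (t : ℝ) : Γ.rev.curve t = Γ.curve t := by
  ext z
  constructor
  · rintro ⟨x, rfl⟩; exact ⟨-x, rfl⟩
  · rintro ⟨x, rfl⟩; exact ⟨-x, by simp⟩

lemma rev_wn {p : ℂ} {t : ℝ} (hp : p ∉ Γ.curve t) : Γ.rev.wn p t = -Γ.wn p t := by
  have h1 := (integral_eq_wn hp (-(2 * π))).1
  have h2 := (integral_eq_wn (Γ := Γ.rev) (by rwa [rev_curve]) 0).1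
  rw [zero_add] at h2
  rw [neg_add_cancel] at h1
  have h3 : ∫ x in (0 : ℝ)..2 * π, Γ.rev.vel (x, t) / (Γ.rev (x, t) - p) =
      -∫ x in (-(2 * π))..0, Γ.vel (x, t) / (Γ (x, t) - p) := by
    have := intervalIntegral.integral_comp_neg (a := 0) (b := 2 * π)
      (fun x => Γ.vel (x, t) / (Γ (x, t) - p))
    rw [neg_zero] at this
    rw [← this, ← intervalIntegral.integral_neg]
    congr 1; ext x
    rw [rev_vel, rev_apply, neg_div]
  rw [h1, h2, ← neg_mul] at h3
  have h4 := mul_right_cancel₀ Complex.two_pi_I_ne_zero h3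
  exact_mod_cast h4

lemma exists_off_wn_zero (t : ℝ) : ∃ p, p ∉ Γ.curve t ∧ Γ.wn p t = 0 := by
  obtain ⟨R, hR0, hR⟩ := (Γ.isCompact_curve t).exists_norm_bound
  refine ⟨R, fun h => ?_, Γ.wn_eq_zero_of_far hR (by simp [abs_of_pos hR0])⟩
  have := hR _ h
  simp [abs_of_pos hR0] at this

lemma positive_or_rev : Γ.Positive ∨ Γ.rev.Positive := by
  obtain ⟨k, hk⟩ := Γ.exists_sideAt_forall
  obtain ⟨l, hl⟩ := Γ.rev.exists_sideAt_forall
  have hkl : l = 1 - k := by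
    have h1 := eventually_small _ (hk ((0, 0), Complex.I * Γ.vel (0, 0)) (cr_mul_I (Γ.vel_ne _)))
    have h2 := eventually_small _ (hl ((0, 0), Complex.I * Γ.rev.vel (0, 0))
      (cr_mul_I (Γ.rev.vel_ne _)))
    have h3 : Tendsto (fun s : ℝ => -s) (𝓝 0) (𝓝 0) := by simpa using (continuous_neg.tendsto (0 : ℝ))
    obtain ⟨s, hs, hs0⟩ := (((h1.and (h3.eventually h2)).filter_mono nhdsWithin_le_nhds).and
      (self_mem_nhdsWithin (s := Ioi (0 : ℝ)))).exists
    have a1 := hs.1.1 hs0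
    have a2 := (hs.2.2 (by simpa using hs0)).2
    simp only [rev_vel, rev_apply, neg_zero, mul_neg, smul_neg, neg_smul, neg_neg] at a2
    rw [rev_wn _ a1.1, a1.2] at a2
    have : ((l : ℤ) : ℝ) = (1 - k : ℤ) := by push_cast; linarith
    exact_mod_cast this
  obtain ⟨p, hp, h0⟩ := Γ.exists_off_wn_zero 0
  rcases Γ.wn_eq_or_of_sideAt hk hp with h | h
  · right
    have : k = 0 := by rw [h0] at h; exact_mod_cast h.symm
    subst this
    rw [Positive]
    simpa [hkl] using hl
  · left
    have : k = 1 := by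
      rw [h0] at h
      have : (k : ℝ) = (1 : ℤ) := by push_cast; linarith
      exact_mod_cast this
    subst this
    exact hk

/-- The interior region at time `t`. -/
def inside (t : ℝ) : Set ℂ := {p | p ∉ Γ.curve t ∧ Γ.wn p t = 1}

variable {Γ} in
lemma Positive.wn_eq (h : Γ.Positive) {p : ℂ} {t : ℝ} (hp : p ∉ Γ.curve t) :
    Γ.wn p t = 1 ∨ Γ.wn p t = 0 := by
  simpa using Γ.wn_eq_or_of_sideAt h hp

end Fam

namespace Fam
variable {Γ : Fam}

lemma re_lt_of_mem_inside {t q₀ : ℝ} (hq : ∀ x, (Γ (x, t)).re ≤ (Γ (q₀, t)).re) {b : ℂ}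
    (hb : b ∈ Γ.inside t) : b.re < (Γ (q₀, t)).re := by
  by_contra! hlt
  have hoff : ∀ s ∈ Ici (0 : ℝ), b + s ∉ Γ.curve t := by
    rintro s hs ⟨x, hx⟩
    simp only at hx
    have h1 := hq x
    rw [hx] at h1
    simp only [Complex.add_re, Complex.ofReal_re] at h1
    have hs0 : s = 0 := by linarith [mem_Ici.mp hs]
    subst hs0
    exact hb.1 ⟨x, by simpa using hx⟩
  obtain ⟨R, hR0, hR⟩ := (Γ.isCompact_curve t).exists_norm_bound
  have hfar : Γ.wn (b + ((R + ‖b‖ : ℝ) : ℂ)) t = 0 := by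
    refine Γ.wn_eq_zero_of_far hR ?_
    have := norm_sub_le (b + ((R + ‖b‖ : ℝ) : ℂ)) b
    rw [add_sub_cancel_left, Complex.norm_real, Real.norm_eq_abs,
      abs_of_nonneg (by positivity)] at this
    linarith
  have h := Γ.wn_eq_of_isPreconnected
    (S := (fun s : ℝ => (b + (s : ℂ), t)) '' Ici 0)
    (isPreconnected_Ici.image _ (by fun_prop))
    (by rintro _ ⟨s, hs, rfl⟩; exact hoff s hs)
    (mem_image_of_mem _ (self_mem_Ici (a := (0 : ℝ))))
    (mem_image_of_mem _ (show R + ‖b‖ ∈ Ici (0 : ℝ) by simp only [mem_Ici]; positivity))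
  simp only [Complex.ofReal_zero, add_zero] at h
  rw [hfar, hb.2] at h
  exact one_ne_zero h

/-- A continuous branch of `log ((Γ x - b) / Γ x)`, for `b` in the interior region. -/
theorem exists_branch {t : ℝ} (h0 : 0 ∈ Γ.inside t) : ∃ B : ℂ → ℝ → ℂ,
    ContinuousOn (fun q : ℂ × ℝ => B q.1 q.2) (Γ.inside t ×ˢ univ) ∧ (∀ x, B 0 x = 0) ∧
    (∀ b ∈ Γ.inside t, ∀ x, B b (x + 2 * π) = B b x) ∧
    ∀ b ∈ Γ.inside t, ∀ x, Complex.exp (B b x) = (Γ (x, t) - b) / Γ (x, t) := by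
  obtain ⟨q₀, hq₀⟩ : ∃ q₀, ∀ x, (Γ (x, t)).re ≤ (Γ (q₀, t)).re := by
    obtain ⟨z, ⟨q₀, rfl⟩, hz⟩ := (Γ.isCompact_curve t).exists_isMaxOn ⟨_, Γ.mem_curve 0 t⟩
      Complex.continuous_re.continuousOn
    exact ⟨q₀, fun x => hz (Γ.mem_curve x t)⟩
  let L : ℂ → ℝ → ℂ := fun b q => Complex.log (Γ (q₀, t) - b) +
    ∫ y in q₀..q, Γ.vel (y, t) / (Γ (y, t) - b)
  have hexp : ∀ b ∈ Γ.inside t, ∀ x, Complex.exp (L b x) = Γ (x, t) - b := fun b hb x =>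
    exp_lift hb.1 (Complex.exp_log (sub_ne hb.1 q₀)) x
  have hcont : ContinuousOn (fun q : ℂ × ℝ => L q.1 q.2) (Γ.inside t ×ˢ univ) := by
    refine ContinuousOn.add ?_ ?_
    · refine ContinuousOn.clog (by fun_prop) ?_
      rintro ⟨b, q⟩ ⟨hb, -⟩
      left
      have := re_lt_of_mem_inside hq₀ hb
      simpa using this
    · rw [continuousOn_iff_continuous_domRestrict]
      refine intervalIntegral.continuous_parametric_intervalIntegral_of_continuous
        (f := fun (p : (Γ.inside t ×ˢ (univ : Set ℝ) : Set (ℂ × ℝ))) y =>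
          Γ.vel (y, t) / (Γ (y, t) - p.1.1)) ?_ (s := fun p => p.1.2) (by fun_prop)
      refine Continuous.div (by fun_prop) (by fun_prop) ?_
      rintro ⟨⟨⟨b, q⟩, hb, -⟩, y⟩
      exact sub_ne hb.1 y
  have hper : ∀ b ∈ Γ.inside t, ∀ x, L b (x + 2 * π) = L b x + 2 * π * Complex.I := by
    intro b hb x
    have hi := continuous_logDeriv hb.1
    have h1 := intervalIntegral.integral_add_adjacent_intervals
      (hi.intervalIntegrable (μ := volume) q₀ x) (hi.intervalIntegrable x (x + 2 * π))
    rw [(integral_eq_wn hb.1 x).1, hb.2] at h1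
    simp only [L, ← h1]
    push_cast; ring
  refine ⟨fun b q => L b q - L 0 q, ?_, fun x => sub_self _, fun b hb x => ?_, fun b hb x => ?_⟩
  · refine hcont.sub ?_
    exact hcont.comp (f := fun q : ℂ × ℝ => ((0 : ℂ), q.2)) (by fun_prop) fun q _ => ⟨h0, mem_univ _⟩
  · simp only [hper b hb, hper 0 h0]; ring
  · simp only [Complex.exp_sub, hexp b hb, hexp 0 h0, sub_zero]

/-- The boundary value of the branch: a lift of `log (- Γ' / Γ)`, which is periodic. -/
theorem exists_boundary_branch (hΓ : Γ.Positive) {t : ℝ} (h0 : 0 ∈ Γ.inside t) {B : ℂ → ℝ → ℂ}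
    (hB : ContinuousOn (fun q : ℂ × ℝ => B q.1 q.2) (Γ.inside t ×ˢ univ))
    (hper : ∀ b ∈ Γ.inside t, ∀ x, B b (x + 2 * π) = B b x)
    (hexp : ∀ b ∈ Γ.inside t, ∀ x, Complex.exp (B b x) = (Γ (x, t) - b) / Γ (x, t)) :
    ∃ G : ℝ → ℂ, (∀ x, G (x + 2 * π) = G x) ∧
      (∀ x, HasDerivAt G (dx Γ.vel (x, t) / Γ.vel (x, t) - Γ.vel (x, t) / Γ (x, t)) x) ∧
      ∀ x e, 0 < cr (Γ.vel (x, t)) e → ∀ᶠ s : ℝ in 𝓝[>] 0,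
        Γ (x, t) + s • e ∈ Γ.inside t ∧
        B (Γ (x, t) + s • e) x = G x + Complex.log (s • e / Γ.vel (x, t)) := by
  have hΓ0 : ∀ x, Γ (x, t) ≠ 0 := fun x => by simpa using sub_ne h0.1 x
  have hd : ∀ x, HasDerivAt (fun y => Γ.vel (y, t)) (dx Γ.vel (x, t)) x :=
    fun x => hasDerivAt_dx Γ.contDiff_vel x t
  have hdc : Continuous fun x => dx Γ.vel (x, t) :=
    (contDiff_dx Γ.contDiff_vel).continuous.comp (by fun_prop)
  let dl : ℝ → ℂ := fun x => dx Γ.vel (x, t) / Γ.vel (x, t) - Γ.vel (x, t) / Γ (x, t)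
  have hdl : Continuous dl :=
    (hdc.div (by fun_prop) fun x => Γ.vel_ne _).sub (Continuous.div (by fun_prop) (by fun_prop) hΓ0)
  let Λ : ℝ → ℂ := fun x => Complex.log (-Γ.vel (0, t) / Γ (0, t)) + ∫ y in (0 : ℝ)..x, dl y
  have hΛd : ∀ x, HasDerivAt Λ (dl x) x := fun x =>
    (intervalIntegral.integral_hasDerivAt_right (hdl.intervalIntegrable _ _)
      (hdl.stronglyMeasurableAtFilter _ _) hdl.continuousAt).const_add _
  have hΛ : ∀ x, Complex.exp (Λ x) = -Γ.vel (x, t) / Γ (x, t) := by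
    have hf : ∀ x, HasDerivAt (fun y => -Γ.vel (y, t) / Γ (y, t))
        ((-dx Γ.vel (x, t) * Γ (x, t) - -Γ.vel (x, t) * Γ.vel (x, t)) / Γ (x, t) ^ 2) x := fun x =>
      (hd x).fun_neg.fun_div (Γ.hasDerivAt_x x t) (hΓ0 x)
    have hne : ∀ x, -Γ.vel (x, t) / Γ (x, t) ≠ 0 := fun x =>
      div_ne_zero (neg_ne_zero.2 (Γ.vel_ne _)) (hΓ0 x)
    intro x
    have := exp_integral_logDeriv hf (Continuous.div (by fun_prop) (by fun_prop) fun x =>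
      pow_ne_zero 2 (hΓ0 x)) hne (a := 0) (Complex.exp_log (hne 0)) x
    rw [← this]
    simp only [Λ]
    congr 2
    refine intervalIntegral.integral_congr fun y _ => ?_
    simp only [dl]
    have h1 := hΓ0 y
    have h2 := Γ.vel_ne (y, t)
    field_simp
    ring
  let H : ℝ × ℂ × ℝ → ℂ := fun q => B (Γ (q.1, t) + q.2.2 • q.2.1) q.1 -
    Complex.log (q.2.2 • q.2.1 / Γ.vel (q.1, t))
  let GAt : ℝ × ℂ → ℂ → Prop := fun r m => ∀ᶠ q : ℝ × ℂ × ℝ in 𝓝 (r.1, r.2, 0), 0 < q.2.2 →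
    Γ (q.1, t) + q.2.2 • q.2.1 ∈ Γ.inside t ∧ H q = Λ q.1 + m
  have hGev : ∀ {r m}, GAt r m → ∀ᶠ r' in 𝓝 r, GAt r' m := by
    intro r m h
    have h2 : Tendsto (fun q : ℝ × ℂ => (q.1, q.2, (0 : ℝ))) (𝓝 r) (𝓝 (r.1, r.2, 0)) :=
      (show Continuous fun q : ℝ × ℂ => (q.1, q.2, (0 : ℝ)) by fun_prop).tendsto r
    exact h2.eventually (Filter.Eventually.eventually_nhds h)
  have hGsmall : ∀ {r m}, GAt r m → ∀ᶠ s : ℝ in 𝓝[>] 0,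
      Γ (r.1, t) + s • r.2 ∈ Γ.inside t ∧ H (r.1, r.2, s) = Λ r.1 + m := by
    intro r m h
    have h1 : ∀ᶠ s : ℝ in 𝓝 0, 0 < s →
        Γ (r.1, t) + s • r.2 ∈ Γ.inside t ∧ H (r.1, r.2, s) = Λ r.1 + m :=
      (show Continuous fun s : ℝ => (r.1, r.2, s) by fun_prop).tendsto 0 |>.eventually h
    filter_upwards [h1.filter_mono nhdsWithin_le_nhds, self_mem_nhdsWithin] with s hs hs0
    exact hs hs0
  have hGex : ∀ r : ℝ × ℂ, 0 < cr (Γ.vel (r.1, t)) r.2 → ∃ m, GAt r m := by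
    rintro ⟨x, e⟩ he
    have hmap : Tendsto (fun q : ℝ × ℂ × ℝ => ((q.1, t), q.2.1, q.2.2)) (𝓝 (x, e, 0))
        (𝓝 ((x, t), e, 0)) :=
      (show Continuous fun q : ℝ × ℂ × ℝ => ((q.1, t), q.2.1, q.2.2) by fun_prop).tendsto (x, e, 0)
    have h1 := hmap.eventually (hΓ ((x, t), e) he)
    have h2 : ∀ᶠ q : ℝ × ℂ × ℝ in 𝓝 (x, e, 0), 0 < cr (Γ.vel (q.1, t)) q.2.1 :=
      (show Continuous fun q : ℝ × ℂ × ℝ => cr (Γ.vel (q.1, t)) q.2.1 by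
        fun_prop).tendsto (x, e, 0) |>.eventually (lt_mem_nhds he)
    obtain ⟨δ, hδ, hball⟩ := Metric.eventually_nhds_iff_ball.mp (h1.and h2)
    let S : Set (ℝ × ℂ × ℝ) := ball (x, e, 0) δ ∩ {q | 0 < q.2.2}
    have hSc : IsPreconnected S := by
      refine ((convex_ball _ _).inter ?_).isPreconnected
      exact convex_halfSpace_gt (f := fun q : ℝ × ℂ × ℝ => q.2.2)
        (((LinearMap.snd ℝ ℂ ℝ).comp (LinearMap.snd ℝ ℝ (ℂ × ℝ))).isLinear) 0
    have hin : ∀ q ∈ S, Γ (q.1, t) + q.2.2 • q.2.1 ∈ Γ.inside t := by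
      intro q hq
      have := (hball q hq.1).1.1 hq.2
      exact ⟨this.1, by simpa using this.2⟩
    have him : ∀ q ∈ S, 0 < (q.2.2 • q.2.1 / Γ.vel (q.1, t)).im := by
      intro q hq
      rw [← cr_pos_iff (Γ.vel_ne _), cr_smul_right]
      exact mul_pos hq.2 (hball q hq.1).2
    have hHc : ContinuousOn H S := by
      refine ContinuousOn.sub ?_ ?_
      · exact hB.comp (f := fun q : ℝ × ℂ × ℝ => (Γ (q.1, t) + q.2.2 • q.2.1, q.1))
          (by fun_prop) fun q hq => ⟨hin q hq, mem_univ _⟩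
      · refine ContinuousOn.clog (ContinuousOn.div (by fun_prop) (by fun_prop) fun q _ => Γ.vel_ne _)
          fun q hq => ?_
        exact Or.inr (him q hq).ne'
    have hHe : ∀ q ∈ S, Complex.exp (H q) = Complex.exp (Λ q.1) := by
      intro q hq
      have hne : q.2.2 • q.2.1 / Γ.vel (q.1, t) ≠ 0 := fun h => by
        have := him q hq
        rw [h] at this; simp at this
      rw [Complex.exp_sub, hexp _ (hin q hq), Complex.exp_log hne, hΛ]
      have h3 := hΓ0 q.1
      have h4 := Γ.vel_ne (q.1, t)
      have h5 : q.2.2 • q.2.1 ≠ 0 := fun h => hne (by rw [h, zero_div])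
      field_simp
      ring
    have hq₀ : (x, e, δ / 2) ∈ S := by
      refine ⟨?_, half_pos hδ⟩
      simp [Prod.dist_eq, abs_of_pos hδ, hδ]
    have hΛc : Continuous Λ := continuous_iff_continuousAt.2 fun x => (hΛd x).continuousAt
    refine ⟨H (x, e, δ / 2) - Λ x, ?_⟩
    filter_upwards [ball_mem_nhds _ hδ] with q hq hs
    refine ⟨hin q ⟨hq, hs⟩, ?_⟩
    have := log_branch_sub_eq hSc hHc (hΛc.comp continuous_fst).continuousOn hHe
      (x := q) ⟨hq, hs⟩ hq₀
    simp only [Function.comp] at this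
    linear_combination this
  have hGuniq : ∀ {r m m'}, GAt r m → GAt r m' → m = m' := by
    intro r m m' h h'
    obtain ⟨s, hs, hs'⟩ := ((hGsmall h).and (hGsmall h')).exists
    exact add_left_cancel (hs.2.symm.trans hs'.2)
  obtain ⟨m, hm⟩ : ∃ m, ∀ r : ℝ × ℂ, 0 < cr (Γ.vel (r.1, t)) r.2 → GAt r m := by
    let N : ℝ × ℝ × ℝ → ℝ × ℂ := fun r =>
      (r.1, Γ.vel (r.1, t) * (r.2.1 + Complex.I * Real.exp r.2.2))
    have hNc : Continuous N := by fun_prop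
    have hN : ∀ r, 0 < cr (Γ.vel ((N r).1, t)) (N r).2 := fun r => by
      rw [cr_pos_iff (Γ.vel_ne _)]
      simp only [N]
      rw [mul_div_cancel_left₀ _ (Γ.vel_ne _)]
      simp only [Complex.add_im, Complex.ofReal_im, Complex.I_mul_im, Complex.ofReal_re, zero_add]
      exact Real.exp_pos _
    choose κ hκ using fun r => hGex (N r) (hN r)
    have hloc : IsLocallyConstant κ := by
      rw [IsLocallyConstant.iff_eventually_eq]
      intro r
      filter_upwards [(hNc.tendsto r).eventually (hGev (hκ r))] with r' hr'
      exact hGuniq (hκ r') hr'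
    refine ⟨κ 0, fun q hq => ?_⟩
    rw [cr_pos_iff (Γ.vel_ne _)] at hq
    let r : ℝ × ℝ × ℝ := (q.1, (q.2 / Γ.vel (q.1, t)).re, Real.log (q.2 / Γ.vel (q.1, t)).im)
    have hr : N r = q := by
      refine Prod.ext rfl ?_
      simp only [N, r, Real.exp_log hq]
      rw [mul_comm Complex.I, Complex.re_add_im, mul_div_cancel₀ _ (Γ.vel_ne _)]
    have := hκ r
    rwa [hr, hloc.apply_eq_of_preconnectedSpace r 0] at this
  refine ⟨fun x => Λ x + m, fun x => ?_, fun x => (hΛd x).add_const m, fun x e he => ?_⟩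
  · have he := cr_mul_I (Γ.vel_ne (x, t))
    have he' : 0 < cr (Γ.vel (x + 2 * π, t)) (Complex.I * Γ.vel (x, t)) := by rwa [Γ.vel_per]
    obtain ⟨s, hs, hs'⟩ := ((hGsmall (hm (x, _) he)).and (hGsmall (hm (x + 2 * π, _) he'))).exists
    refine hs'.2.symm.trans (Eq.trans ?_ hs.2)
    simp only [H]
    simp only [Γ.vel_per, show Γ (x + 2 * π, t) = Γ (x, t) from Γ.per x t]
    rw [hper _ hs.1]
  · filter_upwards [hGsmall (hm (x, e) he)] with s hs
    refine ⟨hs.1, ?_⟩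
    rw [← hs.2]
    simp [H]

end Fam

lemma locallyIntegrable_inv : LocallyIntegrable (fun u : ℂ => u⁻¹) volume := by
  refine locallyIntegrable_of_norm_le_rpow (C := 1) (α := 1) ?_ ?_ ?_ ?_
  · rw [Complex.finrank_real_complex]; norm_num
  · rw [Complex.finrank_real_complex]; norm_num
  · refine Eventually.of_forall fun x => ?_
    rw [Real.rpow_neg (norm_nonneg _), Real.rpow_one, norm_inv, one_mul]
  · exact measurable_inv.aestronglyMeasurable

/-- The Cauchy transform of `ψ`. -/
def cauchyTransform (ψ : ℂ → ℂ) (q : ℂ) : ℂ := ∫ u : ℂ, u⁻¹ * ψ (q - u)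

section cauchyTransform
variable {ψ : ℂ → ℂ}

open scoped Convolution in
lemma cauchyTransform_eq : cauchyTransform ψ =
    ((fun u : ℂ => u⁻¹) ⋆[ContinuousLinearMap.mul ℝ ℂ, volume] ψ) := rfl

lemma contDiff_cauchyTransform (hψ : ContDiff ℝ ∞ ψ) (hs : HasCompactSupport ψ) :
    ContDiff ℝ ∞ (cauchyTransform ψ) := by
  rw [cauchyTransform_eq]
  exact hs.contDiff_convolution_right _ locallyIntegrable_inv hψ

lemma fderiv_cauchyTransform (hψ : ContDiff ℝ ∞ ψ) (hs : HasCompactSupport ψ) (q v : ℂ) :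
    fderiv ℝ (cauchyTransform ψ) q v = ∫ u : ℂ, u⁻¹ * fderiv ℝ ψ (q - u) v := by
  have h1 : ContDiff ℝ 1 ψ := hψ.of_le (by exact_mod_cast le_top)
  rw [cauchyTransform_eq, (hs.hasFDerivAt_convolution_right _ locallyIntegrable_inv h1 q).fderiv,
    convolution_precompR_apply _ locallyIntegrable_inv (hs.fderiv ℝ)
      (h1.continuous_fderiv one_ne_zero)]
  rfl

lemma integrable_inv_mul {f : ℂ → ℂ} (hf : Continuous f) (hs : HasCompactSupport f) (q : ℂ) :
    Integrable fun u : ℂ => u⁻¹ * f (q - u) := by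
  have := (hs.convolutionExists_right (ContinuousLinearMap.mul ℝ ℂ) locallyIntegrable_inv hf) q
  exact this

lemma dbar_cauchyTransform (hψ : ContDiff ℝ ∞ ψ) (hs : HasCompactSupport ψ) (q : ℂ) :
    fderiv ℝ (cauchyTransform ψ) q 1 + Complex.I * fderiv ℝ (cauchyTransform ψ) q Complex.I =
      2 * π * ψ q := by
  have h1 : ContDiff ℝ 1 ψ := hψ.of_le (by exact_mod_cast le_top)
  have hDc : Continuous (fderiv ℝ ψ) := h1.continuous_fderiv one_ne_zero
  have hDc' : ∀ v, Continuous fun z => fderiv ℝ ψ z v := fun v => hDc.clm_apply continuous_const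
  have hDs : ∀ v, HasCompactSupport fun z => fderiv ℝ ψ z v := fun v => hs.fderiv_apply ℝ v
  have hd : ∀ z, HasFDerivAt ψ (fderiv ℝ ψ z) z := fun z =>
    (h1.differentiable one_ne_zero z).hasFDerivAt
  rw [fderiv_cauchyTransform hψ hs, fderiv_cauchyTransform hψ hs, ← integral_const_mul,
    ← integral_add (integrable_inv_mul (hDc' 1) (hDs 1) q)
      ((integrable_inv_mul (hDc' _) (hDs _) q).const_mul _),
    ← Complex.integral_comp_polarCoord_symm]
  let e : ℝ → ℂ := fun θ => Real.cos θ + Real.sin θ * Complex.I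
  have he : ∀ θ, HasDerivAt e (Complex.I * e θ) θ := fun θ => by
    have := ((Real.hasDerivAt_cos θ).ofReal_comp).add
      (((Real.hasDerivAt_sin θ).ofReal_comp).mul_const Complex.I)
    refine this.congr_deriv ?_
    simp only [e]; push_cast
    linear_combination (-(Complex.sin θ)) * Complex.I_sq
  have hec : Continuous e := continuous_iff_continuousAt.2 fun θ => (he θ).continuousAt
  have hen : ∀ θ, ‖e θ‖ = 1 := fun θ => by
    have := Complex.norm_exp_ofReal_mul_I θ
    rwa [Complex.exp_mul_I, ← Complex.ofReal_cos, ← Complex.ofReal_sin] at this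
  let F1 : ℝ × ℝ → ℂ := fun p => fderiv ℝ ψ (q - p.1 * e p.2) (e p.2)
  let F2 : ℝ × ℝ → ℂ := fun p => fderiv ℝ ψ (q - p.1 * e p.2) (Complex.I * e p.2)
  have hF1c : Continuous F1 := (hDc.comp (by fun_prop)).clm_apply (by fun_prop)
  have hF2c : Continuous F2 := (hDc.comp (by fun_prop)).clm_apply (by fun_prop)
  obtain ⟨R, hR0, hR⟩ : ∃ R, 0 < R ∧ ∀ r θ : ℝ, R < r → ∀ v,
      ψ (q - r * e θ) = 0 ∧ fderiv ℝ ψ (q - r * e θ) v = 0 := by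
    obtain ⟨R, hR0, hR⟩ := IsCompact.exists_norm_bound hs
    refine ⟨R + ‖q‖, by positivity, fun r θ hr v => ?_⟩
    have hnot : q - r * e θ ∉ tsupport ψ := fun h => by
      have h2 := hR _ h
      have h3 := norm_sub_norm_le (r * e θ) q
      rw [norm_mul, hen, Complex.norm_real, Real.norm_eq_abs, mul_one, norm_sub_rev] at h3
      linarith [le_abs_self r]
    refine ⟨image_eq_zero_of_notMem_tsupport hnot, ?_⟩
    have : fderiv ℝ ψ (q - r * e θ) = 0 :=
      image_eq_zero_of_notMem_tsupport fun h => hnot (tsupport_fderiv_subset ℝ h)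
    rw [this]; rfl
  have hintg : ∀ F : ℝ × ℝ → ℂ, Continuous F → (∀ r θ : ℝ, R < r → F (r, θ) = 0) →
      IntegrableOn F (Ioi 0 ×ˢ Ioo (-π) π) (volume.prod volume) := by
    intro F hF hF0
    have h2 : IntegrableOn F (Icc 0 R ×ˢ Icc (-π) π) (volume.prod volume) :=
      hF.continuousOn.integrableOn_compact (isCompact_Icc.prod isCompact_Icc)
    refine (h2.of_forall_sdiff_eq_zero (measurableSet_Ioi.prod measurableSet_Ioo) ?_)
    rintro ⟨r, θ⟩ ⟨⟨hr, hθ⟩, hn⟩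
    refine hF0 r θ ?_
    by_contra! hle
    exact hn ⟨⟨le_of_lt hr, hle⟩, Ioo_subset_Icc_self hθ⟩
  have hI1 := hintg F1 hF1c fun r θ hr => (hR r θ hr _).2
  have hI2 := hintg F2 hF2c fun r θ hr => (hR r θ hr _).2
  have hpi : (-π) ≤ π := by linarith [Real.pi_pos]
  have e1 : ∫ p in Ioi (0 : ℝ) ×ˢ Ioo (-π) π, F1 p = 2 * π * ψ q := by
    rw [Measure.volume_eq_prod, ← Measure.prod_restrict, integral_prod_symm _
      (by rw [Measure.prod_restrict]; exact hI1)]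
    have : ∀ θ, ∫ r in Ioi (0 : ℝ), F1 (r, θ) = ψ q := by
      intro θ
      have hdr : ∀ r ∈ Ici (0 : ℝ), HasDerivAt (fun r : ℝ => -ψ (q - r * e θ)) (F1 (r, θ)) r := by
        intro r _
        have h3 : HasDerivAt (fun r : ℝ => q - r * e θ) (-(e θ)) r := by
          have := ((hasDerivAt_id r).ofReal_comp.mul_const (e θ)).const_sub q
          simpa using this
        have := ((hd (q - r * e θ)).comp_hasDerivAt r h3).fun_neg
        refine this.congr_deriv ?_
        rw [map_neg, neg_neg]
      have h4 := integral_Ioi_of_hasDerivAt_of_tendsto' hdr (m := 0) ?_ ?_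
      · rw [h4]; simp
      · have : IntegrableOn (fun r => F1 (r, θ)) (Icc 0 R) :=
          (hF1c.comp (by fun_prop : Continuous fun r : ℝ => (r, θ))).continuousOn.integrableOn_compact
            isCompact_Icc
        refine this.of_forall_sdiff_eq_zero measurableSet_Ioi ?_
        rintro r ⟨hr, hn⟩
        refine (hR r θ ?_ _).2
        by_contra! hle
        exact hn ⟨le_of_lt hr, hle⟩
      · refine tendsto_const_nhds.congr' ?_
        filter_upwards [Ioi_mem_atTop R] with r hr
        rw [(hR r θ hr 0).1, neg_zero]
    simp only [this]
    rw [setIntegral_const, Measure.real, Real.volume_Ioo, ENNReal.toReal_ofReal (by linarith)]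
    simp only [Complex.real_smul]; push_cast; ring
  have e2 : ∫ p in Ioi (0 : ℝ) ×ˢ Ioo (-π) π, F2 p = 0 := by
    rw [Measure.volume_eq_prod, ← Measure.prod_restrict, integral_prod _
      (by rw [Measure.prod_restrict]; exact hI2)]
    refine setIntegral_eq_zero_of_forall_eq_zero fun r hr => ?_
    have hdθ : ∀ θ ∈ uIcc (-π) π, HasDerivAt (fun θ : ℝ => -(r : ℂ)⁻¹ * ψ (q - r * e θ)) (F2 (r, θ)) θ := by
      intro θ _
      have h3 : HasDerivAt (fun θ : ℝ => q - r * e θ) (-(r * (Complex.I * e θ))) θ :=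
        ((he θ).const_mul (r : ℂ)).const_sub q
      have := ((hd (q - r * e θ)).comp_hasDerivAt θ h3).const_mul (-(r : ℂ)⁻¹)
      refine this.congr_deriv ?_
      rw [map_neg, ← Complex.real_smul (x := r) (z := Complex.I * e θ), map_smul,
        Complex.real_smul]
      have : (r : ℂ) ≠ 0 := by exact_mod_cast hr.ne'
      field_simp
      exact congrArg _ (mul_comm _ _)
    rw [← integral_Ioc_eq_integral_Ioo, ← intervalIntegral.integral_of_le hpi,
      intervalIntegral.integral_eq_sub_of_hasDerivAt hdθ
        ((hF2c.comp (by fun_prop : Continuous fun θ : ℝ => (r, θ))).intervalIntegrable _ _)]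
    simp [e]
  have e3 : ∫ p in polarCoord.target, p.1 • ((Complex.polarCoord.symm p)⁻¹ *
      fderiv ℝ ψ (q - Complex.polarCoord.symm p) 1 + Complex.I * ((Complex.polarCoord.symm p)⁻¹ *
      fderiv ℝ ψ (q - Complex.polarCoord.symm p) Complex.I)) =
      ∫ p in Ioi (0 : ℝ) ×ˢ Ioo (-π) π, (F1 p + Complex.I * F2 p) := by
    refine setIntegral_congr_fun (measurableSet_Ioi.prod measurableSet_Ioo) ?_
    rintro ⟨r, θ⟩ ⟨hr, -⟩
    have hr' : (r : ℂ) ≠ 0 := by exact_mod_cast (show (0 : ℝ) < r from hr).ne'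
    have he0 : e θ ≠ 0 := fun h => by have := hen θ; rw [h] at this; simp at this
    have hpc : Complex.polarCoord.symm (r, θ) = r * e θ := by
      rw [Complex.polarCoord_symm_apply]
    simp only [hpc, F1, F2]
    set D := fderiv ℝ ψ (q - r * e θ)
    have a1 : D (e θ) = Real.cos θ * D 1 + Real.sin θ * D Complex.I := by
      have : e θ = Real.cos θ • (1 : ℂ) + Real.sin θ • Complex.I := by
        simp only [e, Complex.real_smul, mul_one]
      rw [this, map_add, map_smul, map_smul, Complex.real_smul, Complex.real_smul]
    have a2 : D (Complex.I * e θ) = -Real.sin θ * D 1 + Real.cos θ * D Complex.I := by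
      have : Complex.I * e θ = (-Real.sin θ) • (1 : ℂ) + Real.cos θ • Complex.I := by
        simp only [e, Complex.real_smul, mul_one]
        push_cast
        linear_combination (Complex.sin θ) * Complex.I_sq
      rw [this, map_add, map_smul, map_smul, Complex.real_smul, Complex.real_smul]
      push_cast; ring
    have a3 : e θ * (Real.cos θ - Real.sin θ * Complex.I) = 1 := by
      simp only [e]
      have := Complex.cos_sq_add_sin_sq (θ : ℂ)
      push_cast
      linear_combination this - (Complex.sin θ) ^ 2 * Complex.I_sq
    rw [a1, a2, Complex.real_smul]
    field_simp
    linear_combination (-(D 1 + Complex.I * D Complex.I)) * a3 +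
      (-(e θ)) * Real.sin θ * D Complex.I * Complex.I_sq
  rw [← Measure.volume_eq_prod] at hI1 hI2
  rw [e3, integral_add hI1 (hI2.const_mul Complex.I), integral_const_mul, e1, e2]
  ring

end cauchyTransform

lemma hasDerivAt_integral_of_continuous {E : Type*} [NormedAddCommGroup E] [NormedSpace ℝ E]
    {F F' : ℝ → ℝ → E} (hF : Continuous (Function.uncurry F))
    (hF' : Continuous (Function.uncurry F')) (hd : ∀ t x, HasDerivAt (fun s => F s x) (F' t x) t)
    (a b t₀ : ℝ) :
    HasDerivAt (fun t => ∫ x in a..b, F t x) (∫ x in a..b, F' t₀ x) t₀ := by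
  obtain ⟨C, hC⟩ := ((isCompact_closedBall t₀ 1).prod (isCompact_uIcc (a := a) (b := b))).exists_bound_of_continuousOn
    hF'.continuousOn
  refine (intervalIntegral.hasDerivAt_integral_of_dominated_loc_of_deriv_le (bound := fun _ => C)
    (closedBall_mem_nhds t₀ one_pos) ?_ ?_ ?_ ?_ ?_ ?_).2
  · exact Eventually.of_forall fun t =>
      (hF.comp (by fun_prop : Continuous fun x : ℝ => (t, x))).aestronglyMeasurable
  · exact (hF.comp (by fun_prop : Continuous fun x : ℝ => (t₀, x))).intervalIntegrable _ _
  · exact (hF'.comp (by fun_prop : Continuous fun x : ℝ => (t₀, x))).aestronglyMeasurable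
  · exact Eventually.of_forall fun x hx t ht => hC (t, x) ⟨ht, uIoc_subset_uIcc hx⟩
  · exact intervalIntegrable_const
  · exact Eventually.of_forall fun x _ t _ => hd t x

namespace Fam
variable (Γ : Fam)

lemma dt_per (x t : ℝ) : dt Γ.F (x + 2 * π, t) = dt Γ.F (x, t) := by
  have h1 := hasDerivAt_dt Γ.smooth (x + 2 * π) t
  have h2 := hasDerivAt_dt Γ.smooth x t
  have : (fun s => Γ (x + 2 * π, s)) = fun s => Γ (x, s) := funext fun s => Γ.per x s
  rw [this] at h1
  exact h1.unique h2

@[fun_prop] lemma continuous_dt : Continuous (dt Γ.F) := (contDiff_dt Γ.smooth).continuous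

lemma integral_mul_wn {ψ : ℂ → ℝ} (hψ : Continuous ψ) (hs : HasCompactSupport ψ) (t : ℝ) :
    ∫ z, ψ z * Γ.wn z t =
      (2 * π)⁻¹ * ∫ x in (0 : ℝ)..2 * π,
        (Γ.vel (x, t) * cauchyTransform (fun z => (ψ z : ℂ)) (Γ (x, t))).im := by
  have hψc : Continuous fun z => (ψ z : ℂ) := by fun_prop
  have hsc : HasCompactSupport fun z => (ψ z : ℂ) := hs.comp_left (g := ((↑) : ℝ → ℂ)) rfl
  let f : ℝ → ℂ → ℂ := fun x z => Γ.vel (x, t) * ((ψ z : ℂ) / (Γ (x, t) - z))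
  have hbase : ∀ q, Integrable fun z => (ψ z : ℂ) / (q - z) := by
    intro q
    have := (integrable_inv_mul hψc hsc q).comp_sub_left q
    simp only [sub_sub_cancel] at this
    exact this.congr (Eventually.of_forall fun z => by simp only [div_eq_inv_mul])
  have hC : ∀ q, ∫ z, (ψ z : ℂ) / (q - z) = cauchyTransform (fun z => (ψ z : ℂ)) q := by
    intro q
    rw [cauchyTransform, ← integral_sub_left_eq_self _ volume q]
    simp only [sub_sub_cancel]
    exact integral_congr_ae (Eventually.of_forall fun z => by simp only [div_eq_inv_mul])
  have hf : Integrable (Function.uncurry f)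
      ((volume.restrict (Ioc 0 (2 * π))).prod volume) := by
    rw [integrable_prod_iff]
    · refine ⟨Eventually.of_forall fun x => ?_, ?_⟩
      · exact (hbase (Γ (x, t))).const_mul (Γ.vel (x, t))
      have hn : Continuous fun q => ∫ z, ‖(ψ z : ℂ) / (q - z)‖ := by
        have h1 := (hs.norm).continuous_convolution_right (ContinuousLinearMap.mul ℝ ℝ)
          (fun x => (locallyIntegrable_inv x).norm) hψ.norm
        refine h1.congr fun q => ?_
        rw [← integral_sub_left_eq_self _ volume q]
        simp only [sub_sub_cancel]
        refine integral_congr_ae (Eventually.of_forall fun z => ?_)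
        simp [div_eq_inv_mul]
      have : (fun x => ∫ z, ‖Function.uncurry f (x, z)‖) =
          fun x => ‖Γ.vel (x, t)‖ * ∫ z, ‖(ψ z : ℂ) / (Γ (x, t) - z)‖ := by
        ext x
        rw [← integral_const_mul]
        simp only [Function.uncurry, f, norm_mul]
      rw [this]
      have hc : Continuous fun x => ‖Γ.vel (x, t)‖ * ∫ z, ‖(ψ z : ℂ) / (Γ (x, t) - z)‖ :=
        Continuous.mul (by fun_prop) (hn.comp (by fun_prop))
      exact (hc.continuousOn.integrableOn_compact isCompact_Icc).mono_set Ioc_subset_Icc_self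
    · refine Measurable.aestronglyMeasurable ?_
      have h1 : Measurable fun p : ℝ × ℂ => Γ.vel (p.1, t) :=
        (by fun_prop : Continuous fun p : ℝ × ℂ => Γ.vel (p.1, t)).measurable
      have h2 : Measurable fun p : ℝ × ℂ => Γ (p.1, t) - p.2 :=
        (by fun_prop : Continuous fun p : ℝ × ℂ => Γ (p.1, t) - p.2).measurable
      have h3 : Measurable fun p : ℝ × ℂ => (ψ p.2 : ℂ) :=
        (by fun_prop : Continuous fun p : ℝ × ℂ => (ψ p.2 : ℂ)).measurable
      exact h1.mul (h3.div h2)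
  have hpi : (0 : ℝ) ≤ 2 * π := by positivity
  have e1 : ∀ z, ψ z * Γ.wn z t = (2 * π)⁻¹ * ∫ x in Ioc 0 (2 * π), (f x z).im := by
    intro z
    rw [wn, intervalIntegral.integral_of_le hpi, mul_left_comm, ← integral_const_mul (ψ z)]
    congr 2
    ext x
    simp only [f]
    rw [mul_div_left_comm, Complex.im_ofReal_mul]
  simp only [e1]
  rw [integral_const_mul, ← integral_integral_swap (f := fun x z => (f x z).im) hf.im,
    intervalIntegral.integral_of_le hpi]
  congr 2
  ext x
  have h2 : Integrable fun z => f x z := (hbase _).const_mul _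
  have h3 : ∫ z, (f x z).im = (∫ z, f x z).im := integral_im h2
  rw [h3, integral_const_mul, hC]

/-- Evolution of the winding-number-weighted area. -/
theorem hasDerivAt_integral_mul_wn {ψ : ℂ → ℝ} (hψ : ContDiff ℝ ∞ ψ) (hs : HasCompactSupport ψ)
    (t : ℝ) : HasDerivAt (fun s => ∫ z, ψ z * Γ.wn z s)
      (-∫ x in (0 : ℝ)..2 * π, ψ (Γ (x, t)) * cr (Γ.vel (x, t)) (dt Γ.F (x, t))) t := by
  have hψc : ContDiff ℝ ∞ fun z => (ψ z : ℂ) := Complex.ofRealCLM.contDiff.comp hψ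
  have hsc : HasCompactSupport fun z => (ψ z : ℂ) := hs.comp_left (g := ((↑) : ℝ → ℂ)) rfl
  set C := cauchyTransform fun z => (ψ z : ℂ) with hCdef
  have hC : ContDiff ℝ ∞ C := contDiff_cauchyTransform hψc hsc
  have hCc : Continuous C := hC.continuous
  have hDc : Continuous (fderiv ℝ C) := hC.continuous_fderiv (by simp)
  have hCd : ∀ z, HasFDerivAt C (fderiv ℝ C z) z := fun z =>
    (hC.differentiable (by simp) z).hasFDerivAt
  have hvt := fun x t => hasDerivAt_dt Γ.contDiff_vel x t
  have hdd : ∀ p, dt Γ.vel p = dx (dt Γ.F) p := dt_dx_comm Γ.smooth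
  have hddc : Continuous (dt Γ.vel) := (contDiff_dt Γ.contDiff_vel).continuous
  let F : ℝ → ℝ → ℂ := fun t x => Γ.vel (x, t) * C (Γ (x, t))
  let F' : ℝ → ℝ → ℂ := fun t x => dt Γ.vel (x, t) * C (Γ (x, t)) +
    Γ.vel (x, t) * fderiv ℝ C (Γ (x, t)) (dt Γ.F (x, t))
  have hFc : Continuous (Function.uncurry F) :=
    show Continuous fun p : ℝ × ℝ => Γ.vel (p.2, p.1) * C (Γ (p.2, p.1)) by fun_prop
  have hF'c : Continuous (Function.uncurry F') :=
    show Continuous fun p : ℝ × ℝ => dt Γ.vel (p.2, p.1) * C (Γ (p.2, p.1)) +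
      Γ.vel (p.2, p.1) * fderiv ℝ C (Γ (p.2, p.1)) (dt Γ.F (p.2, p.1)) by fun_prop
  have hFd : ∀ t x, HasDerivAt (fun s => F s x) (F' t x) t := fun t x =>
    (hvt x t).mul ((hCd _).comp_hasDerivAt t (hasDerivAt_dt Γ.smooth x t))
  have h1 := (hasDerivAt_integral_of_continuous hFc hF'c hFd 0 (2 * π) t)
  have h2 : HasDerivAt (fun s => ∫ z, ψ z * Γ.wn z s)
      ((2 * π)⁻¹ * (∫ x in (0 : ℝ)..2 * π, F' t x).im) t := by
    have := (Complex.imCLM.hasFDerivAt.comp_hasDerivAt t h1).const_mul (2 * π)⁻¹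
    refine this.congr_of_eventuallyEq (Eventually.of_forall fun s => ?_)
    show ∫ z, ψ z * Γ.wn z s = (2 * π)⁻¹ * (∫ x in (0 : ℝ)..2 * π, F s x).im
    rw [Γ.integral_mul_wn hψ.continuous hs]
    congr 1
    simp only [intervalIntegral.integral_of_le two_pi_pos.le]
    exact integral_im (((hFc.comp (by fun_prop : Continuous fun x : ℝ => (s, x))).continuousOn.integrableOn_compact
      isCompact_Icc).mono_set Ioc_subset_Icc_self)
  refine h2.congr_deriv ?_
  let P : ℝ → ℂ := fun x => dt Γ.vel (x, t) * C (Γ (x, t)) +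
    dt Γ.F (x, t) * fderiv ℝ C (Γ (x, t)) (Γ.vel (x, t))
  have hPc : Continuous P := by
    show Continuous fun x : ℝ => dt Γ.vel (x, t) * C (Γ (x, t)) +
      dt Γ.F (x, t) * fderiv ℝ C (Γ (x, t)) (Γ.vel (x, t))
    fun_prop
  have hP : ∫ x in (0 : ℝ)..2 * π, P x = 0 := by
    have hd : ∀ x ∈ uIcc 0 (2 * π), HasDerivAt (fun x => dt Γ.F (x, t) * C (Γ (x, t))) (P x) x := by
      intro x _
      have := (hasDerivAt_dx (contDiff_dt Γ.smooth) x t).mul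
        ((hCd _).comp_hasDerivAt x (Γ.hasDerivAt_x x t))
      rw [← hdd] at this
      exact this
    rw [intervalIntegral.integral_eq_sub_of_hasDerivAt hd (hPc.intervalIntegrable _ _)]
    have e1 := Γ.dt_per 0 t
    have e2 := Γ.per 0 t
    rw [zero_add] at e1 e2
    simp only [e1, e2, sub_self]
  have hF'i : IntervalIntegrable (F' t) volume 0 (2 * π) :=
    (hF'c.comp (by fun_prop : Continuous fun x : ℝ => (t, x))).intervalIntegrable _ _
  have h3 : ∫ x in (0 : ℝ)..2 * π, F' t x = ∫ x in (0 : ℝ)..2 * π, (-(2 * π * Complex.I)) *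
      ((ψ (Γ (x, t)) * cr (Γ.vel (x, t)) (dt Γ.F (x, t)) : ℝ) : ℂ) := by
    rw [← sub_zero (∫ x in (0 : ℝ)..2 * π, F' t x), ← hP,
      ← intervalIntegral.integral_sub hF'i (hPc.intervalIntegrable _ _)]
    refine intervalIntegral.integral_congr fun x _ => ?_
    have hb := dbar_cauchyTransform hψc hsc (Γ (x, t))
    rw [← hCdef] at hb
    have hlin : ∀ v : ℂ, fderiv ℝ C (Γ (x, t)) v =
        v.re * fderiv ℝ C (Γ (x, t)) 1 + v.im * fderiv ℝ C (Γ (x, t)) Complex.I := by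
      intro v
      conv_lhs => rw [← Complex.re_add_im v]
      rw [map_add, ← Complex.real_smul, ← Complex.real_smul, ← Complex.real_smul, ← map_smul,
        ← map_smul]
      simp
    simp only [F', P]
    rw [hlin (dt Γ.F (x, t)), hlin (Γ.vel (x, t))]
    set D1 := fderiv ℝ C (Γ (x, t)) 1
    set DI := fderiv ℝ C (Γ (x, t)) Complex.I
    have hv := Complex.re_add_im (Γ.vel (x, t))
    have hw := Complex.re_add_im (dt Γ.F (x, t))
    set a := Γ.vel (x, t)
    set c := dt Γ.F (x, t)
    simp only [cr]
    push_cast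
    linear_combination (-(c.re * D1 + c.im * DI)) * hv + (a.re * D1 + a.im * DI) * hw +
      (-(Complex.I * (a.re * c.im - a.im * c.re))) * hb +
      (a.re * c.im - a.im * c.re) * DI * Complex.I_sq
  rw [h3, intervalIntegral.integral_const_mul, intervalIntegral.integral_ofReal]
  have : (2 * π * Complex.I : ℂ) = ((2 * π : ℝ) : ℂ) * Complex.I := by push_cast; ring
  rw [this, neg_mul, Complex.neg_im, mul_assoc, Complex.im_ofReal_mul, Complex.I_mul_im,
    Complex.ofReal_re]
  have := Real.pi_pos
  field_simp

end Fam

namespace Fam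
variable (Γ : Fam)

/-- Reparametrize time by `τ` and translate by `v`. -/
def move {τ : ℝ → ℝ} (hτ : ContDiff ℝ ∞ τ) {v : ℝ → ℂ} (hv : ContDiff ℝ ∞ v) : Fam where
  F p := Γ (p.1, τ p.2) + v p.2
  smooth := (Γ.smooth.comp (contDiff_fst.prodMk (hτ.comp contDiff_snd))).add
    (hv.comp contDiff_snd)
  per x t := by simp only [Γ.per]
  inj x y t h := Γ.inj x y (τ t) (add_right_cancel h)
  imm p := by
    have h1 := hasDerivAt_dx ((Γ.smooth.comp (contDiff_fst.prodMk (hτ.comp contDiff_snd))).add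
      (hv.comp contDiff_snd)) p.1 p.2
    exact (h1.unique ((Γ.hasDerivAt_x p.1 (τ p.2)).add_const (v p.2))).trans_ne (Γ.vel_ne _)

section move
variable {τ : ℝ → ℝ} (hτ : ContDiff ℝ ∞ τ) {v : ℝ → ℂ} (hv : ContDiff ℝ ∞ v)

lemma move_apply (x s : ℝ) : Γ.move hτ hv (x, s) = Γ (x, τ s) + v s := rfl

lemma move_vel (x s : ℝ) : (Γ.move hτ hv).vel (x, s) = Γ.vel (x, τ s) :=
  ((Γ.move hτ hv).hasDerivAt_x x s).unique ((Γ.hasDerivAt_x x (τ s)).add_const (v s))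

lemma move_dt (x s : ℝ) :
    dt (Γ.move hτ hv).F (x, s) = deriv τ s • dt Γ.F (x, τ s) + deriv v s :=
  (hasDerivAt_dt (Γ.move hτ hv).smooth x s).unique
    (((hasDerivAt_dt Γ.smooth x (τ s)).scomp s
      (hτ.differentiable (by simp) s).hasDerivAt).add
      (hv.differentiable (by simp) s).hasDerivAt)

lemma mem_move_curve {z : ℂ} {s : ℝ} :
    z ∈ (Γ.move hτ hv).curve s ↔ z - v s ∈ Γ.curve (τ s) := by
  constructor
  · rintro ⟨x, rfl⟩; exact ⟨x, by simp [move_apply]⟩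
  · rintro ⟨x, hx⟩; exact ⟨x, by simp only [move_apply] at hx ⊢; rw [hx]; ring⟩

lemma move_wn (z : ℂ) (s : ℝ) : (Γ.move hτ hv).wn z s = Γ.wn (z - v s) (τ s) := by
  simp only [wn, move_vel, move_apply]
  congr 2
  ext x
  rw [show Γ (x, τ s) + v s - z = Γ (x, τ s) - (z - v s) by ring]

lemma mem_move_inside {z : ℂ} {s : ℝ} :
    z ∈ (Γ.move hτ hv).inside s ↔ z - v s ∈ Γ.inside (τ s) := by
  simp only [inside, mem_ofPred_eq, mem_move_curve, move_wn]

variable {Γ} in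
lemma Positive.move (h : Γ.Positive) : (Γ.move hτ hv).Positive := by
  obtain ⟨k, hk⟩ := (Γ.move hτ hv).exists_sideAt_forall
  suffices k = 1 by rwa [this] at hk
  have hc : 0 < cr (Γ.vel (0, τ 0)) (Complex.I * Γ.vel (0, τ 0)) := cr_mul_I (Γ.vel_ne _)
  have h1 := eventually_small ((0, τ 0), Complex.I * Γ.vel (0, τ 0)) (h ((0, τ 0), _) hc)
  have h2 := eventually_small ((0, 0), Complex.I * Γ.vel (0, τ 0))
    (hk ((0, 0), Complex.I * Γ.vel (0, τ 0)) (by rw [move_vel]; exact hc))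
  obtain ⟨s, ⟨hs1, hs2⟩, hs⟩ := (((h1.and h2).filter_mono nhdsWithin_le_nhds).and
    (self_mem_nhdsWithin (s := Ioi (0 : ℝ)))).exists
  have e1 := (hs1.1 hs).2
  have e2 := (hs2.1 hs).2
  simp only [move_wn, move_apply] at e1 e2
  rw [add_right_comm, add_sub_cancel_right, e1] at e2
  exact_mod_cast e2.symm

end move

/-- The angular speed of the tangent. -/
def curv (p : ℝ × ℝ) : ℝ := (dx Γ.vel p / Γ.vel p).im

@[fun_prop] lemma continuous_dx_vel : Continuous (dx Γ.vel) := (contDiff_dx Γ.contDiff_vel).continuous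

@[fun_prop] lemma continuous_curv : Continuous Γ.curv :=
  Complex.continuous_im.comp (Γ.continuous_dx_vel.div Γ.continuous_vel Γ.vel_ne)

/-- Curve shortening with time rescaled by the speed `a`. -/
def IsFlow (a : ℝ → ℝ) : Prop :=
  ∀ p, dt Γ.F p = (a p.2 * Γ.curv p / ‖Γ.vel p‖ ^ 2) • (Complex.I * Γ.vel p)

lemma cr_I_mul (u : ℂ) : cr u (Complex.I * u) = ‖u‖ ^ 2 := by
  rw [← Complex.normSq_eq_norm_sq, Complex.normSq_apply]
  simp [cr]

variable {Γ} in
lemma IsFlow.cr_eq {a : ℝ → ℝ} (h : Γ.IsFlow a) (p : ℝ × ℝ) :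
    cr (Γ.vel p) (dt Γ.F p) = a p.2 * Γ.curv p := by
  rw [h p, cr_smul_right, cr_I_mul]
  have := norm_ne_zero_iff.2 (Γ.vel_ne p)
  field_simp

variable {Γ} in
lemma Positive.nonempty_inside (h : Γ.Positive) (t : ℝ) : (Γ.inside t).Nonempty := by
  obtain ⟨s, h1, hs⟩ := (((eventually_small _ (h ((0, t), Complex.I * Γ.vel (0, t))
    (cr_mul_I (Γ.vel_ne _)))).filter_mono nhdsWithin_le_nhds).and
    (self_mem_nhdsWithin (s := Ioi (0 : ℝ)))).exists
  have := h1.1 hs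
  exact ⟨_, this.1, by simpa using this.2⟩

lemma turning_of_mem (h : Γ.Positive) {t : ℝ} (h0 : 0 ∈ Γ.inside t) :
    ∫ x in (0 : ℝ)..2 * π, Γ.curv (x, t) = 2 * π := by
  obtain ⟨B, hB, -, hper, hexp⟩ := Γ.exists_branch h0
  obtain ⟨G, hG, hG', -⟩ := Γ.exists_boundary_branch h h0 hB hper hexp
  have hc1 : Continuous fun x : ℝ => dx Γ.vel (x, t) / Γ.vel (x, t) :=
    Continuous.div (by fun_prop) (by fun_prop) fun x => Γ.vel_ne _
  have hc2 : Continuous fun x : ℝ => Γ.vel (x, t) / Γ (x, t) := by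
    simpa using continuous_logDeriv h0.1
  have h1 := intervalIntegral.integral_eq_sub_of_hasDerivAt (a := 0) (b := 2 * π)
    (fun x _ => hG' x) ((hc1.sub hc2).intervalIntegrable _ _)
  have h2 : G (2 * π) = G 0 := by simpa using hG 0
  have h3 := (integral_eq_wn h0.1 0).1
  simp only [sub_zero, zero_add] at h3
  rw [h2, sub_self, intervalIntegral.integral_sub (hc1.intervalIntegrable _ _)
    (hc2.intervalIntegrable _ _), h3, h0.2, sub_eq_zero] at h1
  have h4 : ∫ x in (0 : ℝ)..2 * π, Γ.curv (x, t) =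
      (∫ x in (0 : ℝ)..2 * π, dx Γ.vel (x, t) / Γ.vel (x, t)).im :=
    Complex.imCLM.intervalIntegral_comp_comm (hc1.intervalIntegrable _ _)
  rw [h4, h1]
  simp

lemma move_curv {τ : ℝ → ℝ} (hτ : ContDiff ℝ ∞ τ) {v : ℝ → ℂ} (hv : ContDiff ℝ ∞ v) (x s : ℝ) :
    (Γ.move hτ hv).curv (x, s) = Γ.curv (x, τ s) := by
  have h : dx (Γ.move hτ hv).vel (x, s) = dx Γ.vel (x, τ s) := by
    refine (hasDerivAt_dx (Γ.move hτ hv).contDiff_vel x s).unique ?_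
    simp only [move_vel]
    exact hasDerivAt_dx Γ.contDiff_vel x (τ s)
  simp only [curv, move_vel, h]

variable {Γ} in
lemma Positive.turning (h : Γ.Positive) (t : ℝ) :
    ∫ x in (0 : ℝ)..2 * π, Γ.curv (x, t) = 2 * π := by
  obtain ⟨p, hp⟩ := h.nonempty_inside t
  have := (Γ.move (τ := id) contDiff_id (v := fun _ => -p) contDiff_const).turning_of_mem
    (h.move _ _) (t := t) (by rw [mem_move_inside]; simpa using hp)
  simp only [move_curv] at this
  exact this

variable {Γ} in
lemma IsFlow.move_const {a : ℝ → ℝ} (h : Γ.IsFlow a) (w : ℂ) :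
    (Γ.move (τ := id) contDiff_id (v := fun _ => w) contDiff_const).IsFlow a := by
  rintro ⟨x, t⟩
  rw [move_dt, move_vel, move_curv]
  simpa using h (x, t)

lemma volume_curve (t : ℝ) : volume (Γ.curve t) = 0 := by
  have hd : ∀ z : ℂ, HasFDerivAt (fun z : ℂ => Γ (z.re, t))
      ((ContinuousLinearMap.toSpanSingleton ℝ (Γ.vel (z.re, t))).comp Complex.reCLM) z :=
    fun z => (Γ.hasDerivAt_x z.re t).hasFDerivAt.comp z Complex.reCLM.hasFDerivAt
  have h := addHaar_image_eq_zero_of_det_fderivWithin_eq_zero (s := univ) volume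
    (fun z _ => (hd z).hasFDerivWithinAt) fun z _ => by
      by_contra hdet
      rw [← ne_eq] at hdet
      have := (LinearMap.equivOfDetNeZero _ hdet).injective
      have h0 : ((ContinuousLinearMap.toSpanSingleton ℝ (Γ.vel (z.re, t))).comp Complex.reCLM)
        Complex.I = 0 := by simp
      exact Complex.I_ne_zero (this (a₁ := Complex.I) (a₂ := 0) (by
        rw [map_zero]; exact h0))
  refine measure_mono_null ?_ h
  rintro _ ⟨x, rfl⟩
  exact ⟨x, trivial, by simp⟩

lemma isOpen_inside_track : IsOpen {q : ℂ × ℝ | q.1 ∈ Γ.inside q.2} := by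
  rw [isOpen_iff_eventually]
  rintro ⟨p, t⟩ hp
  filter_upwards [Γ.wn_eventually hp.1] with q hq
  exact ⟨hq.1, hq.2.trans hp.2⟩

lemma isOpen_inside (t : ℝ) : IsOpen (Γ.inside t) :=
  Γ.isOpen_inside_track.preimage (by fun_prop : Continuous fun z : ℂ => (z, t))

lemma exists_bound (a b : ℝ) : ∃ R, 0 < R ∧ ∀ t ∈ Icc a b, ∀ z ∈ Γ.curve t, ‖z‖ < R := by
  obtain ⟨R, h0, hR⟩ := ((isCompact_Icc (a := 0) (b := 2 * π)).prod
    (isCompact_Icc (a := a) (b := b))).image Γ.continuous |>.exists_norm_bound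
  refine ⟨R, h0, fun t ht z hz => hR z ?_⟩
  rw [curve_eq_image] at hz
  obtain ⟨x, hx, rfl⟩ := hz
  exact ⟨(x, t), ⟨hx, ht⟩, rfl⟩

lemma inside_subset_ball {t R : ℝ} (hR : ∀ z ∈ Γ.curve t, ‖z‖ < R) : Γ.inside t ⊆ ball 0 R := by
  intro z hz
  by_contra h
  rw [mem_ball_zero_iff, not_lt] at h
  have := Γ.wn_eq_zero_of_far hR h
  rw [hz.2] at this
  exact one_ne_zero this

lemma volume_inside_ne_top (t : ℝ) : volume (Γ.inside t) ≠ ⊤ := by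
  obtain ⟨R, -, hR⟩ := (Γ.isCompact_curve t).exists_norm_bound
  exact ((measure_mono (Γ.inside_subset_ball hR)).trans_lt measure_ball_lt_top).ne

variable {Γ} in
lemma Positive.integral_mul_wn_eq (h : Γ.Positive) (ψ : ℂ → ℝ) (t : ℝ) :
    ∫ z, ψ z * Γ.wn z t = ∫ z in Γ.inside t, ψ z := by
  rw [← integral_indicator (Γ.isOpen_inside t).measurableSet]
  refine integral_congr_ae ?_
  have h0 : ∀ᵐ z, z ∉ Γ.curve t := measure_eq_zero_iff_ae_notMem.1 (Γ.volume_curve t)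
  filter_upwards [h0] with z hz
  by_cases hi : z ∈ Γ.inside t
  · rw [indicator_of_mem hi, hi.2, mul_one]
  · rw [indicator_of_notMem hi]
    rcases h.wn_eq hz with h1 | h1
    · exact absurd ⟨hz, h1⟩ hi
    · rw [h1, mul_zero]

/-- The area enclosed decreases at rate `2π`. -/
theorem IsFlow.hasDerivAt_area {Γ : Fam} {a : ℝ → ℝ} (hf : Γ.IsFlow a) (h : Γ.Positive) (t : ℝ) :
    HasDerivAt (fun s => volume.real (Γ.inside s)) (-(2 * π * a t)) t := by
  obtain ⟨R, hR0, hR⟩ := Γ.exists_bound (t - 1) (t + 1)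
  let ψ : ContDiffBump (0 : ℂ) := ⟨R, R + 1, hR0, by linarith⟩
  have h1 := Γ.hasDerivAt_integral_mul_wn (ψ := ψ) ψ.contDiff ψ.hasCompactSupport t
  have hIcc : Icc (t - 1) (t + 1) ∈ 𝓝 t := Icc_mem_nhds (by linarith) (by linarith)
  have h2 : (fun s => ∫ z, ψ z * Γ.wn z s) =ᶠ[𝓝 t] fun s => volume.real (Γ.inside s) := by
    filter_upwards [hIcc] with s hs
    rw [h.integral_mul_wn_eq, setIntegral_congr_fun (g := fun _ => (1 : ℝ))
      (Γ.isOpen_inside s).measurableSet]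
    · simp
    · intro z hz
      exact ψ.one_of_mem_closedBall (ball_subset_closedBall (Γ.inside_subset_ball (hR s hs) hz))
  refine (h1.congr_of_eventuallyEq h2.symm).congr_deriv ?_
  rw [neg_inj]
  have h3 : ∀ x, ψ (Γ (x, t)) * cr (Γ.vel (x, t)) (dt Γ.F (x, t)) = a t * Γ.curv (x, t) := by
    intro x
    rw [hf.cr_eq, ψ.one_of_mem_closedBall, one_mul]
    exact mem_closedBall_zero_iff.2 (hR t (mem_of_mem_nhds hIcc) _ (Γ.mem_curve x t)).le
  simp only [h3]
  rw [intervalIntegral.integral_const_mul, h.turning, mul_comm]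

end Fam

/-- The real inner product of two complex numbers. -/
def ip (u v : ℂ) : ℝ := u.re * v.re + u.im * v.im

lemma ip_self_eq (u : ℂ) : ip u u = ‖u‖ ^ 2 := by
  rw [← Complex.normSq_eq_norm_sq, Complex.normSq_apply, ip]

lemma abs_ip_le (u v : ℂ) : |ip u v| ≤ ‖u‖ * ‖v‖ := by
  have h : (ip u v) ^ 2 + (cr u v) ^ 2 = (‖u‖ * ‖v‖) ^ 2 := by
    rw [mul_pow, ← ip_self_eq, ← ip_self_eq]
    simp only [ip, cr]; ring
  exact abs_le_of_sq_le_sq (by nlinarith [sq_nonneg (cr u v)]) (by positivity)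

lemma HasDerivAt.ip {f g : ℝ → ℂ} {f' g' : ℂ} {x : ℝ} (hf : HasDerivAt f f' x)
    (hg : HasDerivAt g g' x) :
    HasDerivAt (fun s => ip (f s) (g s)) (ip f' (g x) + ip (f x) g') x := by
  have hre : ∀ {f : ℝ → ℂ} {f' : ℂ}, HasDerivAt f f' x → HasDerivAt (fun s => (f s).re) f'.re x :=
    fun h => Complex.reCLM.hasFDerivAt.comp_hasDerivAt x h
  have him : ∀ {f : ℝ → ℂ} {f' : ℂ}, HasDerivAt f f' x → HasDerivAt (fun s => (f s).im) f'.im x :=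
    fun h => Complex.imCLM.hasFDerivAt.comp_hasDerivAt x h
  refine (((hre hf).mul (hre hg)).add ((him hf).mul (him hg))).congr_deriv ?_
  simp only [_root_.ip]
  ring

/-- Second derivative test at a local minimum. -/
lemma second_deriv_nonneg {g g' : ℝ → ℝ} {g'' : ℝ} (hg : ∀ s, HasDerivAt g (g' s) s)
    (hg' : HasDerivAt g' g'' 0) (hmin : IsLocalMin g 0) : g' 0 = 0 ∧ 0 ≤ g'' := by
  have h0 : g' 0 = 0 := hmin.hasDerivAt_eq_zero (hg 0)
  refine ⟨h0, ?_⟩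
  by_contra! hneg
  have h1 : ∀ᶠ s in 𝓝[>] (0 : ℝ), g' s < 0 := by
    have := (hasDerivAt_iff_tendsto_slope.1 hg').eventually (Iio_mem_nhds hneg)
    filter_upwards [nhdsWithin_mono 0 (fun s (hs : 0 < s) => hs.ne') this, self_mem_nhdsWithin]
      with s hs (hs0 : 0 < s)
    simp only [slope, sub_zero, h0, vsub_eq_sub, smul_eq_mul] at hs
    by_contra! h
    exact absurd hs (not_lt.2 (by positivity))
  obtain ⟨ε, hε, h2⟩ := mem_nhdsGT_iff_exists_Ioo_subset.1 h1
  obtain ⟨s, ⟨hs1, hs2⟩, hs3⟩ := ((show ∀ᶠ s in 𝓝[>] (0 : ℝ), s ∈ Ioo 0 ε from Ioo_mem_nhdsGT (mem_Ioi.1 hε)).and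
    (hmin.filter_mono nhdsWithin_le_nhds : ∀ᶠ s in 𝓝[>] (0 : ℝ), g 0 ≤ g s)).exists
  have hanti : StrictAntiOn g (Icc 0 s) := by
    refine strictAntiOn_of_deriv_neg (convex_Icc 0 s)
      (fun s _ => (hg s).continuousAt.continuousWithinAt) fun u hu => ?_
    rw [interior_Icc] at hu
    rw [(hg u).deriv]
    exact h2 ⟨hu.1, hu.2.trans hs2⟩
  exact absurd (hanti (left_mem_Icc.2 hs1.le) (right_mem_Icc.2 hs1.le) hs1) (not_lt.2 hs3)

/-- The pointwise inequality forced at a first interior touching of the squared distance between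
two flows and a barrier. -/
lemma touching_inequality {D A A2 B B2 T1 T2 : ℂ} {a b b1 b2 bt σ : ℝ} (ha : 0 < a) (hb : 0 < b)
    (hσ : 0 < σ) (hA : A ≠ 0) (hB : B ≠ 0) (h0 : ip D D = σ ^ 2 * b ^ 2)
    (h1 : ip D A = σ ^ 2 * b * b1) (h2 : ip D B = 0)
    (h3 : 0 ≤ ip (A - (ip A B / ip B B : ℝ) * B) (A - (ip A B / ip B B : ℝ) * B) +
      ip D (A2 - ((ip A B / ip B B) ^ 2 : ℝ) * B2) - σ ^ 2 * (b1 ^ 2 + b * b2))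
    (hT1 : T1 = (a * (A2 / A).im / ‖A‖ ^ 2) • (Complex.I * A))
    (hT2 : T2 = (a * (B2 / B).im / ‖B‖ ^ 2) • (Complex.I * B))
    (h4 : ip D (T1 - T2) ≤ σ ^ 2 * b * bt) :
    a / ‖A‖ ^ 2 * b2 - a * ‖B2‖ / (‖A‖ ^ 2 * ‖B‖ ^ 2) * σ * b1 ^ 2 -
      a * |ip A2 A| / ‖A‖ ^ 4 * |b1| ≤ bt := by
  set P := ‖A‖ ^ 2 with hP
  set R := ‖B‖ ^ 2 with hR
  have hP0 : 0 < P := by positivity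
  have hR0 : 0 < R := by positivity
  have hPe : A.re * A.re + A.im * A.im = P := ip_self_eq A
  have hRe : B.re * B.re + B.im * B.im = R := ip_self_eq B
  have hD : ‖D‖ = σ * b := by
    have : ‖D‖ ^ 2 = (σ * b) ^ 2 := by rw [← ip_self_eq, h0]; ring
    exact (pow_left_inj₀ (norm_nonneg _) (by positivity) two_ne_zero).1 this
  have hDB : ip D B2 ≤ σ * b * ‖B2‖ := by
    rw [← hD]; exact (le_abs_self _).trans (abs_ip_le _ _)
  have hcr : cr A B ^ 2 = σ ^ 2 * b1 ^ 2 * R := by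
    have e1 : ip D D * cr A B ^ 2 = ip D A ^ 2 * R := by
      have : cr A B * ip D D = cr A D * ip D B - ip D A * cr B D := by
        simp only [ip, cr]; ring
      rw [h2, mul_zero, zero_sub] at this
      have e2 : cr B D ^ 2 = R * ip D D := by
        have : cr B D ^ 2 + ip D B ^ 2 = R * ip D D := by
          rw [← hRe]; simp only [ip, cr]; ring
        rw [h2] at this; linarith
      have e3 : ip D D * (ip D D * cr A B ^ 2) = ip D D * (ip D A ^ 2 * R) := by
        have e4 := congrArg (· ^ 2) this
        linear_combination e4 + ip D A ^ 2 * e2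
      refine mul_left_cancel₀ ?_ e3
      rw [h0]; positivity
    rw [h0, h1] at e1
    have : σ ^ 2 * b ^ 2 ≠ 0 := by positivity
    apply mul_left_cancel₀ this
    linear_combination e1
  have hlag : ip A B ^ 2 = P * R - σ ^ 2 * b1 ^ 2 * R := by
    rw [← hcr, ← hPe, ← hRe]; simp only [ip, cr]; ring
  have hs : ip (A - (ip A B / ip B B : ℝ) * B) (A - (ip A B / ip B B : ℝ) * B) =
      σ ^ 2 * b1 ^ 2 := by
    rw [show ip B B = R from ip_self_eq B]
    have : ip (A - (ip A B / R : ℝ) * B) (A - (ip A B / R : ℝ) * B) =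
        P - 2 * (ip A B / R) * ip A B + (ip A B / R) ^ 2 * R := by
      rw [← hPe, ← hRe]
      simp only [ip, Complex.sub_re, Complex.sub_im, Complex.re_ofReal_mul, Complex.im_ofReal_mul]
      ring
    rw [this]
    field_simp
    linear_combination -hlag
  have hl2 : (ip A B / ip B B) ^ 2 = P / R - σ ^ 2 * b1 ^ 2 / R := by
    rw [show ip B B = R from ip_self_eq B, div_pow, hlag]; field_simp
  rw [hs, hl2] at h3
  have h5 : ip D (A2 - (P / R - σ ^ 2 * b1 ^ 2 / R : ℝ) * B2) =
      ip D A2 - (P / R - σ ^ 2 * b1 ^ 2 / R) * ip D B2 := by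
    simp only [ip, Complex.sub_re, Complex.sub_im, Complex.re_ofReal_mul, Complex.im_ofReal_mul]
    ring
  rw [h5] at h3
  have him : ∀ {u v : ℂ}, v ≠ 0 → (u / v).im = cr v u / ‖v‖ ^ 2 := by
    intro u v hv
    rw [Complex.div_im, Complex.normSq_eq_norm_sq, cr]; ring
  have h6 : ip D T1 = a * (ip D A2 / P - ip A2 A * ip D A / P ^ 2) := by
    rw [hT1, him hA, ← hP]
    have : ip D ((a * (cr A A2 / P) / P) • (Complex.I * A)) =
      a * (cr A A2 * cr A D) / P ^ 2 := by
      simp only [ip, cr, Complex.real_smul, Complex.re_ofReal_mul, Complex.im_ofReal_mul,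
        Complex.I_mul_re, Complex.I_mul_im]
      ring
    rw [this]
    have : cr A A2 * cr A D = ip D A2 * P - ip A2 A * ip D A := by
      rw [← hPe]; simp only [ip, cr]; ring
    rw [this]; field_simp
  have h7 : ip D T2 = a * (ip D B2 / R) := by
    rw [hT2, him hB, ← hR]
    have : ip D ((a * (cr B B2 / R) / R) • (Complex.I * B)) =
      a * (cr B B2 * cr B D) / R ^ 2 := by
      simp only [ip, cr, Complex.real_smul, Complex.re_ofReal_mul, Complex.im_ofReal_mul,
        Complex.I_mul_re, Complex.I_mul_im]
      ring
    rw [this]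
    have : cr B B2 * cr B D = ip D B2 * R - ip B2 B * ip D B := by
      rw [← hRe]; simp only [ip, cr]; ring
    rw [this, h2]; field_simp; ring
  have h8 : ip D (T1 - T2) = ip D T1 - ip D T2 := by
    simp only [ip, Complex.sub_re, Complex.sub_im]; ring
  rw [h8, h6, h7, h1] at h4
  have hb1 : ip A2 A * b1 ≤ |ip A2 A| * |b1| := by rw [← abs_mul]; exact le_abs_self _
  have key : σ ^ 2 * b * (a / P * b2 - a * ‖B2‖ / (P * R) * σ * b1 ^ 2 -
      a * |ip A2 A| / P ^ 2 * |b1|) ≤ σ ^ 2 * b * bt := by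
    refine le_trans ?_ h4
    have e1 : a / P * (σ ^ 2 * b * b2) ≤
        a / P * (ip D A2 - (P / R - σ ^ 2 * b1 ^ 2 / R) * ip D B2) :=
      mul_le_mul_of_nonneg_left (by linarith) (by positivity)
    have e2 : a / (P * R) * (σ ^ 2 * b1 ^ 2) * ip D B2 ≤
        a / (P * R) * (σ ^ 2 * b1 ^ 2) * (σ * b * ‖B2‖) :=
      mul_le_mul_of_nonneg_left hDB (by positivity)
    have e3 : a / P ^ 2 * (σ ^ 2 * b) * (ip A2 A * b1) ≤
        a / P ^ 2 * (σ ^ 2 * b) * (|ip A2 A| * |b1|) :=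
      mul_le_mul_of_nonneg_left hb1 (by positivity)
    have e4 : a * (ip D A2 / P - ip A2 A * (σ ^ 2 * b * b1) / P ^ 2) - a * (ip D B2 / R) =
      a / P * (ip D A2 - (P / R - σ ^ 2 * b1 ^ 2 / R) * ip D B2) -
      a / (P * R) * (σ ^ 2 * b1 ^ 2) * ip D B2 - a / P ^ 2 * (σ ^ 2 * b) * (ip A2 A * b1) := by
      field_simp; ring
    rw [e4]
    have e5 : σ ^ 2 * b * (a / P * b2 - a * ‖B2‖ / (P * R) * σ * b1 ^ 2 -
      a * |ip A2 A| / P ^ 2 * |b1|) = a / P * (σ ^ 2 * b * b2) -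
      a / (P * R) * (σ ^ 2 * b1 ^ 2) * (σ * b * ‖B2‖) -
      a / P ^ 2 * (σ ^ 2 * b) * (|ip A2 A| * |b1|) := by
      field_simp
    rw [e5]
    linarith
  have := le_of_mul_le_mul_left key (by positivity)
  have h44 : ‖A‖ ^ 4 = P ^ 2 := by rw [hP]; ring
  rw [h44]
  exact this

lemma hasDerivAt_line {f : ℝ × ℝ → ℂ} (hf : ContDiff ℝ ∞ f) (x p t s : ℝ) :
    HasDerivAt (fun s => f (x + p * s, t)) (p * dx f (x + p * s, t)) s := by
  have h := (hasDerivAt_dx hf (x + p * s) t).scomp s (((hasDerivAt_id s).const_mul p).const_add x)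
  refine h.congr_deriv ?_
  simp

lemma hasDerivAt_moving {f : ℝ × ℝ → ℂ} (hf : ContDiff ℝ ∞ f) (x κ t : ℝ) :
    HasDerivAt (fun s => f (κ * s + x, s)) (dt f (κ * t + x, t) + κ * dx f (κ * t + x, t)) t := by
  have h1 : HasDerivAt (fun s : ℝ => (κ * s + x, s)) (κ, 1) t := by
    simpa using (((hasDerivAt_id t).const_mul κ).add_const x).prodMk (hasDerivAt_id t)
  have h2 : HasFDerivAt f (fderiv ℝ f (κ * t + x, t)) ((fun s : ℝ => (κ * s + x, s)) t) :=
    (hf.differentiable (by simp) _).hasFDerivAt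
  have h := h2.comp_hasDerivAt (f := fun s : ℝ => (κ * s + x, s)) t h1
  refine h.congr_deriv ?_
  rw [fderiv_eq_dx_dt]
  simp [add_comm]

/-- The spatial barrier profile. -/
def bumpProfile (ρ z : ℝ) : ℝ := (ρ ^ 2 - z ^ 2) ^ 2

lemma hasDerivAt_bumpProfile (ρ z : ℝ) :
    HasDerivAt (bumpProfile ρ) (-(4 * z * (ρ ^ 2 - z ^ 2))) z := by
  have h : HasDerivAt (fun z : ℝ => ρ ^ 2 - z ^ 2) (-(2 * z)) z := by
    simpa using ((hasDerivAt_pow 2 z).const_sub (ρ ^ 2))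
  refine (h.fun_pow 2).congr_deriv ?_
  push_cast; ring

lemma hasDerivAt_bumpProfile_deriv (ρ z : ℝ) :
    HasDerivAt (fun z => -(4 * z * (ρ ^ 2 - z ^ 2))) (8 * z ^ 2 - 4 * (ρ ^ 2 - z ^ 2)) z := by
  have h : HasDerivAt (fun z : ℝ => ρ ^ 2 - z ^ 2) (-(2 * z)) z := by
    simpa using ((hasDerivAt_pow 2 z).const_sub (ρ ^ 2))
  refine ((((hasDerivAt_id z).const_mul 4).mul h).fun_neg).congr_deriv ?_
  simp; ring

/-- The arithmetic behind `Fam.no_touching`. -/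
lemma barrier_arith {α α₀ α₁ c1 c2 C₁ C₂ ρ κ K E Q z σ : ℝ} (hQ : Q = ρ ^ 2 - z ^ 2)
    (hQ0 : 0 < Q) (hρ : 0 < ρ) (hE : 0 < E) (hE1 : E ≤ 1) (hσ : 0 < σ) (hσ1 : σ ≤ 1)
    (hz : |z| < ρ) (hα₀ : 0 < α₀) (hA₀ : α₀ ≤ α) (hA₁ : α ≤ α₁) (hc1 : 0 ≤ c1) (hC₁ : c1 ≤ C₁)
    (hc2 : 0 ≤ c2) (hC₂ : c2 ≤ C₂)
    (hK : 16 * C₁ * ρ ^ 2 + (12 * α₁ + 4 * C₂ * ρ + 4 * |κ| * ρ) ^ 2 / (16 * α₀ * ρ ^ 2) ≤ K)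
    {b1 : ℝ} (hb1 : b1 = E * (-(4 * z * Q)))
    (key : α * (E * (8 * z ^ 2 - 4 * Q)) - c1 * σ * b1 ^ 2 - c2 * |b1| ≤
      -(K * (E * Q ^ 2)) - κ * b1) : False := by
  have hb1a : |b1| ≤ E * (4 * ρ * Q) := by
    rw [hb1, abs_mul, abs_neg, abs_mul, abs_mul, abs_of_pos hE, abs_of_pos hQ0,
      abs_of_pos (by norm_num : (0 : ℝ) < 4)]
    gcongr
  have hQρ : Q ≤ ρ ^ 2 := by rw [hQ]; nlinarith [sq_nonneg z]
  set M := 12 * α₁ + 4 * C₂ * ρ + 4 * |κ| * ρ with hM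
  set K' := M ^ 2 / (16 * α₀ * ρ ^ 2) with hK'
  have i1 : E * (8 * α₀ * ρ ^ 2 - 12 * α₁ * Q) ≤ α * (E * (8 * z ^ 2 - 4 * Q)) := by
    have : α * (E * (8 * z ^ 2 - 4 * Q)) = E * (8 * α * ρ ^ 2 - 12 * α * Q) := by
      rw [hQ]; ring
    rw [this]
    gcongr
  have i2 : c1 * σ * b1 ^ 2 ≤ E * (16 * C₁ * ρ ^ 2 * Q ^ 2) := by
    have : b1 ^ 2 ≤ (E * (4 * ρ * Q)) ^ 2 := sq_le_sq' (by linarith [neg_abs_le b1])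
      ((le_abs_self _).trans hb1a)
    have hC0 := hc1.trans hC₁
    calc c1 * σ * b1 ^ 2 ≤ C₁ * 1 * (E * (4 * ρ * Q)) ^ 2 := by gcongr
      _ = E * E * (16 * C₁ * ρ ^ 2 * Q ^ 2) := by ring
      _ ≤ E * 1 * (16 * C₁ * ρ ^ 2 * Q ^ 2) := by
        have := hc1.trans hC₁
        gcongr
      _ = _ := by ring
  have i3 : c2 * |b1| ≤ C₂ * (E * (4 * ρ * Q)) := by
    have := hc2.trans hC₂
    gcongr
  have i4 : -(κ * b1) ≤ |κ| * (E * (4 * ρ * Q)) := by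
    calc -(κ * b1) ≤ |κ * b1| := neg_le_abs _
      _ = |κ| * |b1| := abs_mul _ _
      _ ≤ _ := by gcongr
  have hKQ : K * (E * Q ^ 2) ≥ E * (16 * C₁ * ρ ^ 2 * Q ^ 2 + K' * Q ^ 2) := by
    have : (16 * C₁ * ρ ^ 2 + K') * (E * Q ^ 2) ≤ K * (E * Q ^ 2) := by gcongr
    linarith
  have hfin : 0 < 8 * α₀ * ρ ^ 2 - M * Q + K' * Q ^ 2 := by
    have : 8 * α₀ * ρ ^ 2 - M * Q + K' * Q ^ 2 =
        ((M * Q - 8 * α₀ * ρ ^ 2) ^ 2 + 64 * (α₀ * ρ ^ 2) ^ 2) / (16 * α₀ * ρ ^ 2) := by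
      rw [hK']; field_simp; ring
    rw [this]; positivity
  have := mul_pos hE hfin
  have h5 : E * (8 * α₀ * ρ ^ 2 - M * Q + K' * Q ^ 2) =
    E * (8 * α₀ * ρ ^ 2 - 12 * α₁ * Q) - E * (16 * C₁ * ρ ^ 2 * Q ^ 2) -
      C₂ * (E * (4 * ρ * Q)) - |κ| * (E * (4 * ρ * Q)) +
      E * (16 * C₁ * ρ ^ 2 * Q ^ 2 + K' * Q ^ 2) := by rw [hM]; ring
  linarith

namespace Fam
variable {Γ₁ Γ₂ : Fam} {a : ℝ → ℝ}

/-- No first interior touching of the squared distance of two flows with the barrier. -/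
lemma no_touching (h₁ : Γ₁.IsFlow a) (h₂ : Γ₂.IsFlow a) {ξ κ ρ t z y σ K E α₀ α₁ C₁ C₂ : ℝ}
    {b : ℝ → ℝ → ℝ} (c : ℂ)
    (hb : ∀ s z, b s z = E * exp (-(K * (s - t))) * bumpProfile ρ z)
    (ha : 0 < a t) (hσ : 0 < σ) (hσ1 : σ ≤ 1) (hE : 0 < E) (hE1 : E ≤ 1) (hz : |z| < ρ)
    (hα₀ : 0 < α₀) (hA₀ : α₀ ≤ a t / ‖Γ₁.vel (κ * t + (ξ + z), t)‖ ^ 2)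
    (hA₁ : a t / ‖Γ₁.vel (κ * t + (ξ + z), t)‖ ^ 2 ≤ α₁)
    (hC₁ : a t * ‖dx Γ₂.vel (y, t)‖ /
      (‖Γ₁.vel (κ * t + (ξ + z), t)‖ ^ 2 * ‖Γ₂.vel (y, t)‖ ^ 2) ≤ C₁)
    (hC₂ : a t * |ip (dx Γ₁.vel (κ * t + (ξ + z), t)) (Γ₁.vel (κ * t + (ξ + z), t))| /
      ‖Γ₁.vel (κ * t + (ξ + z), t)‖ ^ 4 ≤ C₂)
    (hK : 16 * C₁ * ρ ^ 2 + (12 * α₁ + 4 * C₂ * ρ + 4 * |κ| * ρ) ^ 2 / (16 * α₀ * ρ ^ 2) ≤ K)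
    {Φ : ℝ → ℝ → ℝ → ℝ} (hΦ : ∀ z y s, Φ z y s =
      ip (Γ₁ (κ * s + (ξ + z), s) - Γ₂ (y, s) - c) (Γ₁ (κ * s + (ξ + z), s) - Γ₂ (y, s) - c) -
        σ ^ 2 * (b s z) ^ 2)
    (h0 : Φ z y t = 0) (hsp : ∀ᶠ q : ℝ × ℝ in 𝓝 (z, y), 0 ≤ Φ q.1 q.2 t)
    (htm : ∀ᶠ s in 𝓝[<] t, 0 ≤ Φ z y s) : False := by
  set D := Γ₁ (κ * t + (ξ + z), t) - Γ₂ (y, t) - c with hD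
  set A := Γ₁.vel (κ * t + (ξ + z), t) with hA
  set A2 := dx Γ₁.vel (κ * t + (ξ + z), t) with hA2
  set B := Γ₂.vel (y, t) with hB
  set B2 := dx Γ₂.vel (y, t) with hB2
  set Q := ρ ^ 2 - z ^ 2 with hQ
  have hz2 : z ^ 2 < ρ ^ 2 := by
    rw [← sq_abs z]
    exact pow_lt_pow_left₀ hz (abs_nonneg _) two_ne_zero
  have hρ : 0 < ρ := (abs_nonneg z).trans_lt hz
  have hQ0 : 0 < Q := by rw [hQ]; linarith
  have hbt : b t z = E * Q ^ 2 := by rw [hb, sub_self, mul_zero, neg_zero, Real.exp_zero, mul_one]; rfl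
  have hbz : ∀ z', b t z' = E * bumpProfile ρ z' := by
    intro z'; rw [hb, sub_self, mul_zero, neg_zero, Real.exp_zero, mul_one]
  set b1 := E * (-(4 * z * Q)) with hb1
  set b2 := E * (8 * z ^ 2 - 4 * Q) with hb2
  have hb0 : 0 < b t z := by rw [hbt]; positivity
  -- directional derivatives
  have hdir : ∀ p q : ℝ, ip D (p * A - q * B) = σ ^ 2 * p * (b t z) * b1 ∧
      0 ≤ ip (p * A - q * B) (p * A - q * B) + ip D (p * (p * A2) - q * (q * B2)) -
        σ ^ 2 * p ^ 2 * (b1 ^ 2 + b t z * b2) := by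
    intro p q
    let Df : ℝ → ℂ := fun s => Γ₁ (κ * t + (ξ + z) + p * s, t) - Γ₂ (y + q * s, t) - c
    let D1 : ℝ → ℂ := fun s => p * Γ₁.vel (κ * t + (ξ + z) + p * s, t) - q * Γ₂.vel (y + q * s, t)
    let β : ℝ → ℝ := fun s => E * bumpProfile ρ (z + p * s)
    let β1 : ℝ → ℝ := fun s => E * (p * (-(4 * (z + p * s) * (ρ ^ 2 - (z + p * s) ^ 2))))
    have hDf : ∀ s, HasDerivAt Df (D1 s) s := fun s =>
      ((hasDerivAt_line Γ₁.smooth _ p t s).sub (hasDerivAt_line Γ₂.smooth _ q t s)).sub_const c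
    have hD1 : HasDerivAt D1 (p * (p * A2) - q * (q * B2)) 0 := by
      have := (((hasDerivAt_line Γ₁.contDiff_vel (κ * t + (ξ + z)) p t 0).const_mul (p : ℂ)).sub
        ((hasDerivAt_line Γ₂.contDiff_vel y q t 0).const_mul (q : ℂ)))
      refine this.congr_deriv ?_
      simp [hA2, hB2]
    have hlin : ∀ s, HasDerivAt (fun s => z + p * s) p s := fun s => by
      simpa using ((hasDerivAt_id s).const_mul p).const_add z
    have hβ : ∀ s, HasDerivAt β (β1 s) s := fun s => by
      refine (((hasDerivAt_bumpProfile ρ _).comp s (hlin s)).const_mul E).congr_deriv ?_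
      simp only [β1]; ring
    have hβ1 : HasDerivAt β1 (p ^ 2 * b2) 0 := by
      refine ((((hasDerivAt_bumpProfile_deriv ρ _).comp 0 (hlin 0)).const_mul p).const_mul
        E).congr_deriv ?_
      simp only [hb2, hQ, mul_zero, add_zero]; ring
    have hg : ∀ s, HasDerivAt (fun s => ip (Df s) (Df s) - σ ^ 2 * (β s) ^ 2)
        (2 * (ip (Df s) (D1 s) - σ ^ 2 * (β s * β1 s))) s := fun s => by
      refine (((hDf s).ip (hDf s)).fun_sub (((hβ s).fun_pow 2).const_mul (σ ^ 2))).congr_deriv ?_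
      simp only [ip]; push_cast; ring
    have hg' := ((((hDf 0).ip hD1).fun_sub
      (((hβ 0).fun_mul hβ1).const_mul (σ ^ 2))).const_mul 2)
    have hDf0 : Df 0 = D := by simp [Df, hD]
    have hD10 : D1 0 = p * A - q * B := by simp [D1, hA, hB]
    have hβ0 : β 0 = b t z := by simp [β, hbz]
    have hβ10 : β1 0 = p * b1 := by simp only [β1, hb1, hQ, mul_zero, add_zero]; ring
    have hmin : IsLocalMin (fun s => ip (Df s) (Df s) - σ ^ 2 * (β s) ^ 2) 0 := by
      have ht : Tendsto (fun s : ℝ => (z + p * s, y + q * s)) (𝓝 0) (𝓝 (z, y)) := by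
        have : Continuous fun s : ℝ => (z + p * s, y + q * s) := by fun_prop
        simpa using this.tendsto 0
      have hval : ∀ s, ip (Df s) (Df s) - σ ^ 2 * (β s) ^ 2 = Φ (z + p * s) (y + q * s) t := by
        intro s
        rw [hΦ, hbz]
        simp only [Df, β, add_assoc]
      filter_upwards [ht.eventually hsp] with s hs
      rw [hval, hval]
      simpa [h0] using hs
    obtain ⟨e1, e2⟩ := second_deriv_nonneg hg hg' hmin
    rw [hDf0, hD10, hβ0, hβ10] at e1 e2
    constructor
    · linarith
    · nlinarith
  have e0 : ip D D = σ ^ 2 * b t z ^ 2 := by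
    have := h0; rw [hΦ, ← hD] at this; linarith
  have e1 : ip D A = σ ^ 2 * b t z * b1 := by simpa using (hdir 1 0).1
  have e2 : ip D B = 0 := by
    have := (hdir 0 1).1
    simp only [ip] at this ⊢
    simp at this
    linarith
  have e3 := (hdir 1 (ip A B / ip B B)).2
  have e4 : ip D (dt Γ₁.F (κ * t + (ξ + z), t) - dt Γ₂.F (y, t)) ≤
      σ ^ 2 * b t z * (-(K * b t z) - κ * b1) := by
    have hDt : HasDerivAt (fun s => Γ₁ (κ * s + (ξ + z), s) - Γ₂ (y, s) - c)
        (dt Γ₁.F (κ * t + (ξ + z), t) + κ * A - dt Γ₂.F (y, t)) t :=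
      ((hasDerivAt_moving Γ₁.smooth (ξ + z) κ t).sub (hasDerivAt_dt Γ₂.smooth y t)).sub_const c
    have hbd : HasDerivAt (fun s => b s z) (-(K * b t z)) t := by
      have h1 : HasDerivAt (fun s => -(K * (s - t))) (-K) t := by
        simpa using (((hasDerivAt_id t).sub_const t).const_mul K).fun_neg
      simp only [hb]
      refine ((h1.exp.const_mul E).mul_const (bumpProfile ρ z)).congr_deriv ?_
      ring
    have hφ := (hDt.ip hDt).fun_sub ((hbd.fun_pow 2).const_mul (σ ^ 2))
    have hle : ∀ {g : ℝ → ℝ} {g' : ℝ}, HasDerivAt g g' t → g t = 0 → (∀ᶠ s in 𝓝[<] t, 0 ≤ g s) →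
        g' ≤ 0 := by
      intro g g' hg hg0 hev
      have := (hasDerivAt_iff_tendsto_slope.1 hg).mono_left
        (nhdsWithin_mono t (show Iio t ⊆ {t}ᶜ from fun s hs => (mem_Iio.1 hs).ne))
      refine le_of_tendsto this ?_
      filter_upwards [hev, self_mem_nhdsWithin] with s hs (hst : s < t)
      simp only [slope, hg0, vsub_eq_sub, sub_zero, smul_eq_mul]
      exact mul_nonpos_of_nonpos_of_nonneg (inv_nonpos.2 (by linarith)) hs
    have := hle hφ (by have := h0; rwa [hΦ] at this) (by simpa only [hΦ] using htm)
    have hs : ip (dt Γ₁.F (κ * t + (ξ + z), t) + κ * A - dt Γ₂.F (y, t)) D +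
        ip D (dt Γ₁.F (κ * t + (ξ + z), t) + κ * A - dt Γ₂.F (y, t)) =
        2 * (ip D (dt Γ₁.F (κ * t + (ξ + z), t) - dt Γ₂.F (y, t)) + κ * ip D A) := by
      simp only [ip, Complex.sub_re, Complex.sub_im, Complex.add_re, Complex.add_im,
        Complex.re_ofReal_mul, Complex.im_ofReal_mul]
      ring
    rw [← hD, hs, e1] at this
    norm_num at this
    linarith
  have key := touching_inequality (A2 := A2) (B2 := B2) ha hb0 hσ (Γ₁.vel_ne _) (Γ₂.vel_ne _)
    e0 e1 e2 (by
      have : ∀ x : ℝ, ((x ^ 2 : ℝ) : ℂ) * B2 = x * (x * B2) := fun x => by push_cast; ring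
      rw [this]
      simpa using e3) (h₁ _) (h₂ _) e4
  simp only [← hA] at key
  rw [hbt] at key
  exact barrier_arith hQ hQ0 hρ hE hE1 hσ hσ1 hz hα₀ hA₀ hA₁ (by positivity) hC₁ (by positivity)
    hC₂ hK hb1 key

lemma exists_bounds_of_continuous {X : Type*} [TopologicalSpace X] {f : X → ℝ} (hf : Continuous f)
    {S : Set X} (hS : IsCompact S) : ∃ C, ∀ x ∈ S, f x ≤ C :=
  (hS.bddAbove_image hf.continuousOn).imp fun _ hC _ hx => hC (mem_image_of_mem f hx)

/-- Barrier bound: if two flows are separated at time `t₁`, stay separated on the boundary of a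
moving rectangle of parameters, then they are quantitatively separated at its centre. -/
theorem barrier_bound (h₁ : Γ₁.IsFlow a) (h₂ : Γ₂.IsFlow a) (ha : ∀ t, 0 < a t)
    (hac : Continuous a) (ξ κ : ℝ) {t₁ t₂ ρ y₁ y₂ m : ℝ} (ht : t₁ < t₂) (hρ : 0 < ρ) (hm : 0 < m) :
    ∃ ν > 0, ∀ c : ℂ,
      (∀ z ∈ Icc (-ρ) ρ, ∀ y ∈ Icc y₁ y₂, m ≤ ‖Γ₁ (κ * t₁ + (ξ + z), t₁) - Γ₂ (y, t₁) - c‖ ^ 2) →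
      (∀ t ∈ Ico t₁ t₂, ∀ z ∈ Icc (-ρ) ρ, |z| = ρ → ∀ y ∈ Icc y₁ y₂,
        Γ₁ (κ * t + (ξ + z), t) - Γ₂ (y, t) - c ≠ 0) →
      (∀ t ∈ Ico t₁ t₂, ∀ z ∈ Icc (-ρ) ρ, ∀ y, y = y₁ ∨ y = y₂ →
        m ≤ ‖Γ₁ (κ * t + (ξ + z), t) - Γ₂ (y, t) - c‖ ^ 2) →
      ∀ t ∈ Icc t₁ t₂, ∀ y ∈ Icc y₁ y₂, ν ≤ ‖Γ₁ (κ * t + ξ, t) - Γ₂ (y, t) - c‖ ^ 2 := by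
  set R : Set (ℝ × ℝ × ℝ) := Icc (-ρ) ρ ×ˢ Icc y₁ y₂ ×ˢ Icc t₁ t₂ with hR
  have hRc : IsCompact R := isCompact_Icc.prod (isCompact_Icc.prod isCompact_Icc)
  have hv : ∀ p : ℝ × ℝ, ‖Γ₁.vel p‖ ^ 2 ≠ 0 := fun p =>
    pow_ne_zero _ (norm_ne_zero_iff.2 (Γ₁.vel_ne p))
  have hv2 : ∀ p : ℝ × ℝ, ‖Γ₂.vel p‖ ^ 2 ≠ 0 := fun p =>
    pow_ne_zero _ (norm_ne_zero_iff.2 (Γ₂.vel_ne p))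
  have hcA : Continuous fun r : ℝ × ℝ × ℝ =>
      a r.2.2 / ‖Γ₁.vel (κ * r.2.2 + (ξ + r.1), r.2.2)‖ ^ 2 :=
    Continuous.div (by fun_prop) (by fun_prop) fun r => hv _
  have hcAi : Continuous fun r : ℝ × ℝ × ℝ =>
      ‖Γ₁.vel (κ * r.2.2 + (ξ + r.1), r.2.2)‖ ^ 2 / a r.2.2 :=
    Continuous.div (by fun_prop) (by fun_prop) fun r => (ha _).ne'
  have hcC1 : Continuous fun r : ℝ × ℝ × ℝ => a r.2.2 * ‖dx Γ₂.vel (r.2.1, r.2.2)‖ /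
      (‖Γ₁.vel (κ * r.2.2 + (ξ + r.1), r.2.2)‖ ^ 2 * ‖Γ₂.vel (r.2.1, r.2.2)‖ ^ 2) :=
    Continuous.div (by fun_prop) (by fun_prop) fun r => mul_ne_zero (hv _) (hv2 _)
  have hip : Continuous fun p : ℂ × ℂ => |ip p.1 p.2| := by unfold ip; fun_prop
  have hcC2 : Continuous fun r : ℝ × ℝ × ℝ => a r.2.2 *
      |ip (dx Γ₁.vel (κ * r.2.2 + (ξ + r.1), r.2.2)) (Γ₁.vel (κ * r.2.2 + (ξ + r.1), r.2.2))| /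
      ‖Γ₁.vel (κ * r.2.2 + (ξ + r.1), r.2.2)‖ ^ 4 := by
    refine Continuous.div (Continuous.mul (by fun_prop) ?_) (by fun_prop) fun r =>
      pow_ne_zero _ (norm_ne_zero_iff.2 (Γ₁.vel_ne _))
    exact hip.comp (f := fun r : ℝ × ℝ × ℝ => (dx Γ₁.vel (κ * r.2.2 + (ξ + r.1), r.2.2),
      Γ₁.vel (κ * r.2.2 + (ξ + r.1), r.2.2))) (by fun_prop)
  obtain ⟨α₁, hα₁⟩ := exists_bounds_of_continuous hcA hRc
  obtain ⟨αi, hαi⟩ := exists_bounds_of_continuous hcAi hRc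
  obtain ⟨C₁, hC₁⟩ := exists_bounds_of_continuous hcC1 hRc
  obtain ⟨C₂, hC₂⟩ := exists_bounds_of_continuous hcC2 hRc
  set α₀ := (max αi 1)⁻¹ with hα₀
  have hα₀0 : 0 < α₀ := by positivity
  set K := max 0 (16 * C₁ * ρ ^ 2 + (12 * α₁ + 4 * C₂ * ρ + 4 * |κ| * ρ) ^ 2 / (16 * α₀ * ρ ^ 2))
  have hK0 : 0 ≤ K := le_max_left _ _
  obtain ⟨σ, hσ, hσ1, hσm⟩ : ∃ σ : ℝ, 0 < σ ∧ σ ≤ 1 ∧ σ ^ 2 * ((ρ ^ 2) ^ 2) ^ 2 < m := by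
    have : ∀ᶠ σ : ℝ in 𝓝[>] 0, σ ^ 2 * ((ρ ^ 2) ^ 2) ^ 2 < m := by
      have hc : Continuous fun σ : ℝ => σ ^ 2 * ((ρ ^ 2) ^ 2) ^ 2 := by fun_prop
      exact ((hc.tendsto 0).eventually_lt_const (by simpa using hm)).filter_mono nhdsWithin_le_nhds
    obtain ⟨σ, h1, h2⟩ := (this.and (show ∀ᶠ s in 𝓝[>] (0 : ℝ), s ∈ Ioo 0 1 from
      Ioo_mem_nhdsGT one_pos)).exists
    exact ⟨σ, h2.1, h2.2.le, h1⟩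
  let b : ℝ → ℝ → ℝ := fun t z => exp (-(K * (t - t₁))) * bumpProfile ρ z
  have hbc : Continuous fun r : ℝ × ℝ × ℝ => b r.2.2 r.1 := by
    simp only [b, bumpProfile]; fun_prop
  refine ⟨σ ^ 2 * (exp (-(K * (t₂ - t₁))) * bumpProfile ρ 0) ^ 2, ?_, ?_⟩
  · have : 0 < bumpProfile ρ 0 := by simp only [bumpProfile]; norm_num; positivity
    positivity
  intro c hi hii hiii
  let Φ : ℝ → ℝ → ℝ → ℝ := fun z y s =>
    ip (Γ₁ (κ * s + (ξ + z), s) - Γ₂ (y, s) - c) (Γ₁ (κ * s + (ξ + z), s) - Γ₂ (y, s) - c) -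
        σ ^ 2 * (b s z) ^ 2
  have hΦc : Continuous fun r : ℝ × ℝ × ℝ => Φ r.1 r.2.1 r.2.2 := by
    simp only [Φ, ip_self_eq, b, bumpProfile]; fun_prop
  have hbσ : ∀ s z, t₁ ≤ s → z ∈ Icc (-ρ) ρ → σ ^ 2 * (b s z) ^ 2 < m := by
    intro s z hs hz
    have h0 : 0 ≤ ρ ^ 2 - z ^ 2 := by nlinarith [hz.1, hz.2]
    have h1 : bumpProfile ρ z ≤ (ρ ^ 2) ^ 2 :=
      pow_le_pow_left₀ h0 (by linarith [sq_nonneg z]) 2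
    have h2 : exp (-(K * (s - t₁))) ≤ 1 := Real.exp_le_one_iff.2 (by
      have := mul_nonneg hK0 (sub_nonneg.2 hs); linarith)
    have h3 : b s z ≤ (ρ ^ 2) ^ 2 := by
      calc b s z ≤ 1 * (ρ ^ 2) ^ 2 := by
            have h0 : 0 ≤ bumpProfile ρ z := sq_nonneg _
            simp only [b]; gcongr
        _ = _ := one_mul _
    have h4 : 0 ≤ b s z := by simp only [b, bumpProfile]; positivity
    refine lt_of_le_of_lt ?_ hσm
    gcongr
  -- the barrier is never touched before time `t₂`
  have hpos : ∀ t ∈ Ico t₁ t₂, ∀ z ∈ Icc (-ρ) ρ, ∀ y ∈ Icc y₁ y₂, 0 < Φ z y t := by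
    by_contra! hcon
    obtain ⟨t', ht', z', hz', y', hy', hΦ'⟩ := hcon
    let S : Set (ℝ × ℝ × ℝ) := (Icc (-ρ) ρ ×ˢ Icc y₁ y₂ ×ˢ Icc t₁ t') ∩ {r | Φ r.1 r.2.1 r.2.2 ≤ 0}
    have hSc : IsCompact S := (isCompact_Icc.prod (isCompact_Icc.prod isCompact_Icc)).inter_right
      (isClosed_le hΦc continuous_const)
    obtain ⟨⟨z, y, t⟩, ⟨⟨hz, hy, ht3⟩, hΦt⟩, hmin⟩ := hSc.exists_isMinOn
      ⟨(z', y', t'), ⟨hz', hy', right_mem_Icc.2 ht'.1⟩, hΦ'⟩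
      (f := fun r => r.2.2) (by fun_prop)
    simp only [mem_ofPred_eq] at hΦt hz hy ht3
    have hearly : ∀ s ∈ Ico t₁ t, ∀ z ∈ Icc (-ρ) ρ, ∀ y ∈ Icc y₁ y₂, 0 < Φ z y s := by
      intro s hs z hz y hy
      by_contra! h
      have := hmin (show (z, y, s) ∈ S from ⟨⟨hz, hy, hs.1, hs.2.le.trans ht3.2⟩, h⟩)
      exact absurd hs.2 (not_lt.2 this)
    have htI : t ∈ Ico t₁ t₂ := ⟨ht3.1, ht3.2.trans_lt ht'.2⟩
    have hnm : ¬ m ≤ ‖Γ₁ (κ * t + (ξ + z), t) - Γ₂ (y, t) - c‖ ^ 2 := by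
      intro h
      rw [← ip_self_eq] at h
      have := hbσ t z ht3.1 hz
      simp only [Φ] at hΦt
      linarith
    have ht1 : t₁ < t := by
      refine lt_of_le_of_ne ht3.1 ?_
      rintro rfl
      exact hnm (hi z hz y hy)
    have hyI : y ∈ Ioo y₁ y₂ := ⟨lt_of_le_of_ne hy.1 fun h => hnm (hiii t htI z hz y (Or.inl h.symm)),
      lt_of_le_of_ne hy.2 fun h => hnm (hiii t htI z hz y (Or.inr h))⟩
    have hslice : ∀ z ∈ Icc (-ρ) ρ, ∀ y ∈ Icc y₁ y₂, 0 ≤ Φ z y t := by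
      intro z hz y hy
      have hc : Continuous fun s => Φ z y s := hΦc.comp (by fun_prop : Continuous fun s => (z, y, s))
      refine ge_of_tendsto ((hc.tendsto t).mono_left (nhdsWithin_le_nhds (s := Iio t))) ?_
      filter_upwards [Ioo_mem_nhdsLT ht1] with s hs
      exact (hearly s ⟨hs.1.le, hs.2⟩ z hz y hy).le
    have hΦ0 : Φ z y t = 0 := le_antisymm hΦt (hslice z hz y hy)
    have hzρ : |z| < ρ := by
      refine lt_of_le_of_ne (abs_le.2 hz) fun h => ?_
      have hD := hii t htI z hz h y hy
      have hb : bumpProfile ρ z = 0 := by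
        rw [bumpProfile, ← h, sq_abs, sub_self]; norm_num
      simp only [Φ, b, hb, mul_zero, ip_self_eq] at hΦ0
      norm_num at hΦ0
      exact hD hΦ0
    have hrm : (z, y, t) ∈ R := ⟨hz, hy, htI.1, htI.2.le⟩
    refine no_touching h₁ h₂ (Φ := Φ) (b := b) (E := exp (-(K * (t - t₁)))) (K := K) c ?_ (ha t) hσ hσ1
      (exp_pos _) ?_ hzρ hα₀0 ?_ (hα₁ _ hrm) (hC₁ _ hrm) (hC₂ _ hrm) (le_max_right _ _)
      (fun _ _ _ => rfl) hΦ0 ?_ ?_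
    · intro s z
      simp only [b]
      rw [← Real.exp_add]
      congr 2; ring
    · exact Real.exp_le_one_iff.2 (by
        have := mul_nonneg hK0 (sub_nonneg.2 ht1.le); linarith)
    · have h1 := hαi _ hrm
      simp only at h1
      have h2 : ‖Γ₁.vel (κ * t + (ξ + z), t)‖ ^ 2 / a t ≤ max αi 1 := h1.trans (le_max_left _ _)
      have h3 : 0 < ‖Γ₁.vel (κ * t + (ξ + z), t)‖ ^ 2 / a t :=
        div_pos (lt_of_le_of_ne (by positivity) (hv _).symm) (ha t)
      have h4 := inv_anti₀ h3 h2
      rwa [inv_div] at h4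
    · have hz' : Ioo (-ρ) ρ ∈ 𝓝 z := Ioo_mem_nhds (abs_lt.1 hzρ).1 (abs_lt.1 hzρ).2
      filter_upwards [prod_mem_nhds hz' (Ioo_mem_nhds hyI.1 hyI.2)] with q hq
      exact hslice _ (Ioo_subset_Icc_self hq.1) _ (Ioo_subset_Icc_self hq.2)
    · filter_upwards [Ioo_mem_nhdsLT ht1] with s hs
      exact (hearly s ⟨hs.1.le, hs.2⟩ z hz y hy).le
  have hnn : ∀ t ∈ Icc t₁ t₂, ∀ y ∈ Icc y₁ y₂, 0 ≤ Φ 0 y t := by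
    intro t ht' y hy
    have hz0 : (0 : ℝ) ∈ Icc (-ρ) ρ := ⟨by linarith, hρ.le⟩
    rcases ht'.2.lt_or_eq with h | h
    · exact (hpos t ⟨ht'.1, h⟩ 0 hz0 y hy).le
    · subst h
      have hc : Continuous fun s => Φ 0 y s := hΦc.comp (by fun_prop : Continuous fun s => ((0 : ℝ), y, s))
      refine ge_of_tendsto ((hc.tendsto t).mono_left (nhdsWithin_le_nhds (s := Iio t))) ?_
      filter_upwards [Ioo_mem_nhdsLT ht] with s hs
      exact (hpos s ⟨hs.1.le, hs.2⟩ 0 hz0 y hy).le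
  intro t ht' y hy
  have h1 := hnn t ht' y hy
  simp only [Φ, ip_self_eq, add_zero] at h1
  have h2 : σ ^ 2 * (exp (-(K * (t₂ - t₁))) * bumpProfile ρ 0) ^ 2 ≤ σ ^ 2 * (b t 0) ^ 2 := by
    simp only [b]
    have : exp (-(K * (t₂ - t₁))) ≤ exp (-(K * (t - t₁))) :=
      Real.exp_le_exp.2 (neg_le_neg (mul_le_mul_of_nonneg_left (by linarith [ht'.2]) hK0))
    have h0 : 0 ≤ bumpProfile ρ 0 := by unfold bumpProfile; positivity
    gcongr
  linarith

end Fam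

namespace Fam

variable {Γ₁ Γ₂ : Fam} {a : ℝ → ℝ}

lemma ne_of_abs_lt (Γ : Fam) {x y t : ℝ} (hne : y ≠ x) (h : |y - x| < 2 * π) :
    Γ (x, t) ≠ Γ (y, t) := by
  intro e
  obtain ⟨k, hk⟩ := Γ.inj _ _ _ e
  have hk0 : k ≠ 0 := by
    rintro rfl
    exact hne (by simpa using hk)
  have h1 : (1 : ℝ) ≤ |(k : ℝ)| := by exact_mod_cast Int.one_le_abs hk0
  rw [show y - x = 2 * π * k by linarith, abs_mul, abs_of_pos two_pi_pos] at h
  nlinarith [two_pi_pos]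

/-- Near a common point, two curves are separated on the lateral sides of a small box. -/
lemma exists_lateral {x₀ y₀ t₀ ε : ℝ} (hε : 0 < ε) (h : Γ₁ (x₀, t₀) = Γ₂ (y₀, t₀)) :
    ∃ η ∈ Ioo 0 ε, ∃ r > 0, ∃ m > 0, ∀ x t y : ℝ, ∀ c : ℂ, |x - x₀| < r → |t - t₀| < r → ‖c‖ < r →
      (y = y₀ - η ∨ y = y₀ + η) → m ≤ ‖Γ₁ (x, t) - Γ₂ (y, t) - c‖ ^ 2 := by
  obtain ⟨η, hη0, hη⟩ := exists_between (lt_min hε two_pi_pos)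
  have hη1 := hη.trans_le (min_le_left _ _)
  have hη2 := hη.trans_le (min_le_right _ _)
  have main : ∀ y : ℝ, y ≠ y₀ → |y - y₀| < 2 * π → ∃ m > 0, ∀ᶠ q : (ℝ × ℝ) × ℂ in 𝓝 ((x₀, t₀), 0),
      m ≤ ‖Γ₁ q.1 - Γ₂ (y, q.1.2) - q.2‖ ^ 2 := by
    intro y hy hy2
    have hp : 0 < ‖Γ₁ (x₀, t₀) - Γ₂ (y, t₀) - 0‖ ^ 2 := by
      rw [h, sub_zero]
      exact pow_pos (norm_pos_iff.2 (sub_ne_zero.2 (Γ₂.ne_of_abs_lt hy hy2))) 2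
    have hc : Continuous fun q : (ℝ × ℝ) × ℂ => ‖Γ₁ q.1 - Γ₂ (y, q.1.2) - q.2‖ ^ 2 := by fun_prop
    refine ⟨_, half_pos hp, ?_⟩
    exact (hc.tendsto ((x₀, t₀), 0)).eventually (Ici_mem_nhds (half_lt_self hp))
  obtain ⟨m₁, hm₁, e₁⟩ := main (y₀ - η) (by linarith) (by
    rw [abs_lt]; constructor <;> linarith)
  obtain ⟨m₂, hm₂, e₂⟩ := main (y₀ + η) (by linarith) (by
    rw [abs_lt]; constructor <;> linarith)
  obtain ⟨r, hr, hb⟩ := Metric.eventually_nhds_iff.1 (e₁.and e₂)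
  refine ⟨η, ⟨hη0, hη1⟩, r, hr, min m₁ m₂, lt_min hm₁ hm₂, fun x t y c hx ht hc hy => ?_⟩
  have := @hb ((x, t), c) (by
    simp only [Prod.dist_eq, Real.dist_eq, dist_zero_right]
    exact max_lt (max_lt hx ht) hc)
  rcases hy with rfl | rfl
  · exact (min_le_left _ _).trans this.1
  · exact (min_le_right _ _).trans this.2

/-- A common point of two flows comes from nearby common points at earlier times. -/
lemma exists_crossing_before (h₁ : Γ₁.IsFlow a) (h₂ : Γ₂.IsFlow a) (ha : ∀ t, 0 < a t)
    (hac : Continuous a) {x₀ y₀ t₀ ε : ℝ} (hε : 0 < ε) (h : Γ₁ (x₀, t₀) = Γ₂ (y₀, t₀)) :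
    ∃ x y t, t₀ - ε < t ∧ t < t₀ ∧ |x - x₀| < ε ∧ |y - y₀| < ε ∧ Γ₁ (x, t) = Γ₂ (y, t) := by
  by_contra! hcon
  obtain ⟨η, ⟨hη0, hη1⟩, r, hr, m, hm, hlat⟩ := exists_lateral hε h
  obtain ⟨ρ, hρ0, hρ⟩ := exists_between (lt_min hε hr)
  have hρ1 := hρ.trans_le (min_le_left _ _)
  have hρ2 := hρ.trans_le (min_le_right _ _)
  have hno : ∀ t ∈ Ico (t₀ - ρ) t₀, ∀ z ∈ Icc (-ρ) ρ, ∀ y ∈ Icc (y₀ - η) (y₀ + η),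
      Γ₁ (0 * t + (x₀ + z), t) - Γ₂ (y, t) - 0 ≠ 0 := by
    intro t ht z hz y hy
    rw [sub_zero, sub_ne_zero, zero_mul, zero_add]
    refine hcon _ _ _ (by linarith [ht.1]) ht.2 ?_ ?_
    · rw [add_sub_cancel_left]; exact (abs_le.2 hz).trans_lt hρ1
    · exact (abs_le.2 ⟨by linarith [hy.1], by linarith [hy.2]⟩).trans_lt hη1
  have hcomp : IsCompact (Icc (-ρ) ρ ×ˢ Icc (y₀ - η) (y₀ + η)) := isCompact_Icc.prod isCompact_Icc
  obtain ⟨q, hq, hmin⟩ := hcomp.exists_isMinOn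
    (f := fun q : ℝ × ℝ => ‖Γ₁ (0 * (t₀ - ρ) + (x₀ + q.1), t₀ - ρ) - Γ₂ (q.2, t₀ - ρ) - 0‖ ^ 2)
    ⟨(0, y₀), ⟨by simp [hρ0.le], by constructor <;> linarith⟩⟩ (by fun_prop)
  have hm' := pow_pos (norm_pos_iff.2 (hno (t₀ - ρ) ⟨le_rfl, by linarith⟩ q.1 hq.1 q.2 hq.2)) 2
  obtain ⟨ν, hν, hbar⟩ := barrier_bound (y₁ := y₀ - η) (y₂ := y₀ + η) h₁ h₂ ha hac x₀ 0
    (show t₀ - ρ < t₀ by linarith) hρ0 (lt_min hm hm')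
  have hmin' : ∀ z ∈ Icc (-ρ) ρ, ∀ y ∈ Icc (y₀ - η) (y₀ + η), _ :=
    fun z hz y hy => hmin (show (z, y) ∈ _ from ⟨hz, hy⟩)
  have := hbar 0 (fun z hz y hy => (min_le_right _ _).trans (hmin' z hz y hy))
    (fun t ht z hz _ y hy => hno t ht z hz y hy)
    (fun t ht z hz y hy => (min_le_left _ _).trans (hlat _ _ _ _ (by
      rw [zero_mul, zero_add, add_sub_cancel_left]; exact (abs_le.2 hz).trans_lt hρ2)
      (by rw [abs_lt]; constructor <;> linarith [ht.1, ht.2]) (by simpa using hr) hy))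
    t₀ ⟨by linarith, le_rfl⟩ y₀ ⟨by linarith, by linarith⟩
  rw [zero_mul, zero_add, h, sub_self, sub_zero, norm_zero] at this
  linarith

/-- Curves that are disjoint at some time remain disjoint. -/
lemma disjoint_forward (h₁ : Γ₁.IsFlow a) (h₂ : Γ₂.IsFlow a) (ha : ∀ t, 0 < a t)
    (hac : Continuous a) {t₁ t₂ : ℝ} (ht : t₁ ≤ t₂) (h : Disjoint (Γ₁.curve t₁) (Γ₂.curve t₁)) :
    Disjoint (Γ₁.curve t₂) (Γ₂.curve t₂) := by
  by_contra hcon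
  obtain ⟨z, hz1, hz2⟩ := not_disjoint_iff.1 hcon
  obtain ⟨x, hx, rfl⟩ := Γ₁.exists_param hz1 0
  obtain ⟨y, hy, e⟩ := Γ₂.exists_param hz2 0
  let K : Set (ℝ × ℝ × ℝ) := (Icc 0 (0 + 2 * π) ×ˢ Icc 0 (0 + 2 * π) ×ˢ Icc t₁ t₂) ∩
    {q | Γ₁ (q.1, q.2.2) = Γ₂ (q.2.1, q.2.2)}
  have hK : IsCompact K := (isCompact_Icc.prod (isCompact_Icc.prod isCompact_Icc)).inter_right
    (isClosed_eq (by fun_prop) (by fun_prop))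
  obtain ⟨q, ⟨⟨-, -, hq1, hq2⟩, hq⟩, hmin⟩ := hK.exists_isMinOn (f := fun q => q.2.2)
    ⟨(x, y, t₂), ⟨⟨Ico_subset_Icc_self hx, Ico_subset_Icc_self hy, ht, le_rfl⟩, e.symm⟩⟩
    (by fun_prop)
  have hq0 : t₁ < q.2.2 := by
    refine hq1.lt_of_ne fun e' => ?_
    refine disjoint_left.1 h (Γ₁.mem_curve q.1 t₁) ?_
    have hq' : Γ₁ (q.1, q.2.2) = Γ₂ (q.2.1, q.2.2) := hq
    rw [e', hq']
    exact Γ₂.mem_curve _ _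
  obtain ⟨x', y', t, ht1, ht2, -, -, e'⟩ := exists_crossing_before h₁ h₂ ha hac (sub_pos.2 hq0) hq
  obtain ⟨x'', hx'', ex⟩ := Γ₁.exists_param (Γ₁.mem_curve x' t) 0
  obtain ⟨y'', hy'', ey⟩ := Γ₂.exists_param (Γ₂.mem_curve y' t) 0
  have := hmin (show (x'', y'', t) ∈ K from ⟨⟨Ico_subset_Icc_self hx'', Ico_subset_Icc_self hy'',
    by simp only; linarith, by simp only; linarith⟩, by
      change Γ₁ (x'', t) = Γ₂ (y'', t); rw [ex, ey, e']⟩)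
  exact absurd this (not_le.2 ht2)

lemma mem_inside_or_mem_curve_of_mem_closure (Γ : Fam) {z : ℂ} {t : ℝ}
    (hz : z ∈ closure (Γ.inside t)) : z ∈ Γ.inside t ∨ z ∈ Γ.curve t := by
  by_cases hc : z ∈ Γ.curve t
  · exact Or.inr hc
  have h1 := Γ.wn_eventually hc
  have h2 : Tendsto (fun w : ℂ => (w, t)) (𝓝 z) (𝓝 (z, t)) :=
    (show Continuous fun w : ℂ => (w, t) by fun_prop).tendsto z
  obtain ⟨w, hw, hw'⟩ := ((mem_closure_iff_frequently.1 hz).and_eventually (h2.eventually h1)).exists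
  exact Or.inl ⟨hc, hw'.2.symm.trans hw.2⟩

/-- Near a point of the curve, moving to the left leads into the interior. -/
lemma Positive.exists_shift {Γ : Fam} (hΓ : Γ.Positive) {x₀ t₀ : ℝ} {e : ℂ}
    (he : 0 < cr (Γ.vel (x₀, t₀)) e) : ∃ r > 0, ∀ t z, |t - t₀| < r → ‖z - Γ (x₀, t₀)‖ < r →
      (z ∈ Γ.inside t ∨ z ∈ Γ.curve t) → ∀ s ∈ Ioo 0 r, z + s • e ∈ Γ.inside t := by
  obtain ⟨r₁, hr₁, h1⟩ := Metric.eventually_nhds_iff.1 (hΓ ((x₀, t₀), e) he)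
  obtain ⟨r₂, hr₂, h2⟩ := Metric.eventually_nhds_iff.1 (Γ.close x₀ t₀ hr₁)
  have hpos : 0 < 1 + ‖e‖ := by positivity
  set r := min r₁ (r₂ / (1 + ‖e‖)) with hr
  have hr0 : 0 < r := by positivity
  have hr2 : r * (1 + ‖e‖) ≤ r₂ := (le_div_iff₀ hpos).1 (min_le_right _ _)
  have side : ∀ t z, |t - t₀| < r → ‖z - Γ (x₀, t₀)‖ < r → ∀ s ∈ Ico 0 r, z + s • e ∈ Γ.curve t →
      ∃ x, |x - x₀| < r₁ ∧ Γ (x, t) = z + s • e := by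
    intro t z ht hz s hs hmem
    obtain ⟨x, hx⟩ := hmem
    have hd : dist (z + s • e, t) (Γ (x₀, t₀), t₀) < r₂ := by
      rw [Prod.dist_eq, Real.dist_eq, dist_eq_norm]
      refine max_lt ?_ ?_
      · calc ‖z + s • e - Γ (x₀, t₀)‖ = ‖(z - Γ (x₀, t₀)) + s • e‖ := by congr 1; ring
          _ ≤ ‖z - Γ (x₀, t₀)‖ + s * ‖e‖ := by
            refine (norm_add_le _ _).trans_eq ?_
            rw [norm_smul, Real.norm_of_nonneg hs.1]
          _ < r + r * ‖e‖ := add_lt_add_of_lt_of_le hz (by gcongr; exact hs.2.le)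
          _ ≤ r₂ := by linarith
      · calc |t - t₀| < r := ht
          _ ≤ r * (1 + ‖e‖) := le_mul_of_one_le_right hr0.le (by simp)
          _ ≤ r₂ := hr2
    obtain ⟨k, hk⟩ := h2 hd x hx
    exact ⟨_, hk, (Γ.per_int x t k).trans hx⟩
  have hle : r ≤ r₁ := min_le_left _ _
  have key : ∀ x t s, |x - x₀| < r₁ → |t - t₀| < r → |s| < r →
      dist ((x, t), e, s) ((x₀, t₀), e, 0) < r₁ := by
    intro x t s hx ht hs
    simp only [Prod.dist_eq, Real.dist_eq, dist_self, sub_zero]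
    exact max_lt (max_lt hx (ht.trans_le hle)) (max_lt hr₁ (hs.trans_le hle))
  refine ⟨r, hr0, fun t z ht hz hzm s hs => ?_⟩
  rcases hzm with hzi | hzc
  · have hoff : ∀ s ∈ Ico 0 r, z + s • e ∉ Γ.curve t := by
      intro s hs hmem
      rcases hs.1.eq_or_lt with rfl | hs0
      · rw [zero_smul, add_zero] at hmem
        exact hzi.1 hmem
      obtain ⟨x, hx, hxe⟩ := side t z ht hz s hs hmem
      have := ((h1 (key x t (-s) hx ht (by rw [abs_neg, abs_of_nonneg hs.1]; exact hs.2))).2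
        (by simpa using hs0)).2
      simp only [hxe, neg_smul, add_neg_cancel_right, hzi.2] at this
      norm_num at this
    refine ⟨hoff s ⟨hs.1.le, hs.2⟩, ?_⟩
    have hS : IsPreconnected ((fun u : ℝ => (z + u • e, t)) '' Ico 0 r) :=
      isPreconnected_Ico.image _ (by fun_prop)
    have := wn_eq_of_isPreconnected (Γ := Γ) hS (by rintro _ ⟨u, hu, rfl⟩; exact hoff u hu)
      (mem_image_of_mem _ (show s ∈ Ico 0 r from ⟨hs.1.le, hs.2⟩))
      (mem_image_of_mem _ (show (0:ℝ) ∈ Ico 0 r from ⟨le_rfl, hr0⟩))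
    simp only [zero_smul, add_zero] at this
    exact this.trans hzi.2
  · obtain ⟨x, hx, hxe⟩ := side t z ht hz 0 ⟨le_rfl, hr0⟩ (by simpa using hzc)
    rw [zero_smul, add_zero] at hxe
    have := (h1 (key x t s hx ht (by rw [abs_of_pos hs.1]; exact hs.2))).1 hs.1
    simp only [hxe] at this
    exact ⟨this.1, by simpa using this.2⟩

/-- If one flow stays in the closed interior of the other one, then contact at some time forces
contact nearby at previous times. -/
lemma contact_before (h₁ : Γ₁.IsFlow a) (h₂ : Γ₂.IsFlow a) (ha : ∀ t, 0 < a t)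
    (hac : Continuous a) (hP : Γ₂.Positive) {x₀ y₀ t₀ ε : ℝ} (hε : 0 < ε)
    (hin : ∀ t ∈ Icc (t₀ - ε) t₀, ∀ x, Γ₁ (x, t) ∈ Γ₂.inside t ∨ Γ₁ (x, t) ∈ Γ₂.curve t)
    (h : Γ₁ (x₀, t₀) = Γ₂ (y₀, t₀)) :
    ∃ r > 0, ∀ x t, |x - x₀| < r → t₀ - r < t → t < t₀ → Γ₁ (x, t) ∈ Γ₂.curve t := by
  obtain ⟨η, ⟨hη0, hη1⟩, r, hr, m, hm, hlat⟩ := exists_lateral hε h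
  set e := Complex.I * Γ₂.vel (y₀, t₀) with he
  have hecr : 0 < cr (Γ₂.vel (y₀, t₀)) e := cr_mul_I (Γ₂.vel_ne _)
  obtain ⟨r', hr', hsh⟩ := hP.exists_shift hecr
  have hcont : Continuous fun q : ℝ × ℝ => Γ₁ q := by fun_prop
  obtain ⟨r'', hr'', hc⟩ := Metric.eventually_nhds_iff.1
    ((hcont.tendsto (x₀, t₀)).eventually (Metric.ball_mem_nhds _ hr'))
  obtain ⟨R, hR0, hR⟩ := exists_between (show 0 < min (min r r') (min r'' ε) by positivity)
  have hRr : R < r := hR.trans_le ((min_le_left _ _).trans (min_le_left _ _))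
  have hRr' : R < r' := hR.trans_le ((min_le_left _ _).trans (min_le_right _ _))
  have hRr'' : R < r'' := hR.trans_le ((min_le_right _ _).trans (min_le_left _ _))
  have hRε : R < ε := hR.trans_le ((min_le_right _ _).trans (min_le_right _ _))
  refine ⟨R / 2, by positivity, fun x₁ t₁ hx₁ ht₁ ht₁' => ?_⟩
  by_contra hoff
  -- a segment at time `t₁` off the second curve
  have hopen : ∀ᶠ x in 𝓝 x₁, Γ₁ (x, t₁) ∉ Γ₂.curve t₁ :=
    (show Continuous fun x => Γ₁ (x, t₁) by fun_prop).tendsto x₁ |>.eventually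
      ((Γ₂.isClosed_curve t₁).isOpen_compl.mem_nhds hoff)
  obtain ⟨ρ₀, hρ₀, hρ₀'⟩ := Metric.eventually_nhds_iff.1 hopen
  obtain ⟨ρ, hρ, hρlt⟩ := exists_between (show 0 < min ρ₀ (R / 2) by positivity)
  have hρ1 := hρlt.trans_le (min_le_left _ _)
  have hρ2 := hρlt.trans_le (min_le_right _ _)
  set κ := (x₀ - x₁) / (t₀ - t₁) with hκ
  set ξ := x₁ - κ * t₁ with hξ
  have hκt : κ * t₀ + ξ = x₀ := by
    rw [hξ, hκ]
    field_simp [(sub_pos.2 ht₁').ne']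
    ring
  have hpath : ∀ t ∈ Icc t₁ t₀, |κ * t + ξ - x₀| < R / 2 := by
    intro t ht
    have : κ * t + ξ - x₀ = (x₁ - x₀) * ((t₀ - t) / (t₀ - t₁)) := by
      rw [hξ, hκ]
      field_simp [(sub_pos.2 ht₁').ne']
      ring
    have h1 : (t₀ - t) / (t₀ - t₁) ≤ 1 := (div_le_one (sub_pos.2 ht₁')).2 (by linarith [ht.1])
    have h0 : 0 ≤ (t₀ - t) / (t₀ - t₁) := div_nonneg (by linarith [ht.2]) (sub_pos.2 ht₁').le
    rw [this, abs_mul, abs_of_nonneg h0]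
    exact (mul_le_of_le_one_right (abs_nonneg _) h1).trans_lt hx₁
  have hbox : ∀ t ∈ Icc t₁ t₀, ∀ z ∈ Icc (-ρ) ρ, |κ * t + (ξ + z) - x₀| < R := by
    intro t ht z hz
    rw [show κ * t + (ξ + z) - x₀ = (κ * t + ξ - x₀) + z by ring]
    refine (abs_add_le _ _).trans_lt ?_
    linarith [hpath t ht, abs_le.2 hz]
  have htR : ∀ t ∈ Icc t₁ t₀, |t - t₀| < R := fun t ht => by
    rw [abs_lt]; constructor <;> linarith [ht.1, ht.2]
  have hcomp : IsCompact (Icc (-ρ) ρ ×ˢ Icc (y₀ - η) (y₀ + η)) := isCompact_Icc.prod isCompact_Icc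
  have hcf : Continuous fun q : ℝ × ℝ => ‖Γ₁ (κ * t₁ + (ξ + q.1), t₁) - Γ₂ (q.2, t₁)‖ := by
    fun_prop
  obtain ⟨q, hq, hmin⟩ := hcomp.exists_isMinOn
    ⟨(0, y₀), ⟨by simp [hρ.le], by constructor <;> linarith⟩⟩ hcf.continuousOn
  have hm' : 0 < ‖Γ₁ (κ * t₁ + (ξ + q.1), t₁) - Γ₂ (q.2, t₁)‖ := by
    rw [norm_pos_iff, sub_ne_zero]
    intro h'
    refine hρ₀' (y := κ * t₁ + (ξ + q.1)) ?_ (h' ▸ Γ₂.mem_curve _ _)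
    rw [Real.dist_eq, hξ, show κ * t₁ + (x₁ - κ * t₁ + q.1) - x₁ = q.1 by ring]
    exact (abs_le.2 hq.1).trans_lt hρ1
  set μ := ‖Γ₁ (κ * t₁ + (ξ + q.1), t₁) - Γ₂ (q.2, t₁)‖ with hμ
  obtain ⟨ν, hν, hbar⟩ := barrier_bound (y₁ := y₀ - η) (y₂ := y₀ + η) (m := min m ((μ / 2) ^ 2))
    h₁ h₂ ha hac ξ κ ht₁' hρ (by positivity)
  have hev : ∀ᶠ δ : ℝ in 𝓝[>] 0, δ < r' ∧ ‖δ • e‖ < r ∧ ‖δ • e‖ < μ / 2 ∧ ‖δ • e‖ ^ 2 < ν := by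
    have hc1 : Tendsto (fun δ : ℝ => ‖δ • e‖) (𝓝[>] 0) (𝓝 0) := by
      have : Continuous fun δ : ℝ => ‖δ • e‖ := by fun_prop
      simpa using (this.tendsto 0).mono_left (nhdsWithin_le_nhds (s := Ioi 0))
    have hc2 : Tendsto (fun δ : ℝ => ‖δ • e‖ ^ 2) (𝓝[>] 0) (𝓝 0) := by simpa using hc1.pow 2
    filter_upwards [Ioo_mem_nhdsGT hr', hc1.eventually (gt_mem_nhds hr),
      hc1.eventually (gt_mem_nhds (half_pos hm')), hc2.eventually (gt_mem_nhds hν)]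
      with δ h1 h2 h3 h4
    exact ⟨h1.2, h2, h3, h4⟩
  obtain ⟨δ, ⟨hδ1, hδ2, hδ3, hδ4⟩, hδ0⟩ := (hev.and self_mem_nhdsWithin).exists
  have := hbar (-(δ • e)) ?_ ?_ ?_ t₀ ⟨ht₁'.le, le_rfl⟩ y₀ ⟨by linarith, by linarith⟩
  · rw [hκt, h, sub_self, zero_sub, neg_neg] at this
    linarith
  · intro z hz y hy
    have hmz : μ ≤ ‖Γ₁ (κ * t₁ + (ξ + z), t₁) - Γ₂ (y, t₁)‖ :=
      hmin (show (z, y) ∈ _ from ⟨hz, hy⟩)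
    refine (min_le_right _ _).trans ?_
    have h3 := norm_sub_norm_le (Γ₁ (κ * t₁ + (ξ + z), t₁) - Γ₂ (y, t₁)) (-(δ • e))
    rw [norm_neg] at h3
    gcongr
    linarith
  · intro t ht z hz _ y hy h0
    have ht' : t ∈ Icc t₁ t₀ := Ico_subset_Icc_self ht
    have hd : dist (κ * t + (ξ + z), t) (x₀, t₀) < r'' := by
      rw [Prod.dist_eq, Real.dist_eq, Real.dist_eq]
      exact max_lt ((hbox t ht' z hz).trans hRr'') ((htR t ht').trans hRr'')
    have hball := hc hd
    rw [dist_eq_norm] at hball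
    rw [h] at hball
    have := hsh t _ ((htR t ht').trans hRr') hball (hin t ⟨by linarith [ht.1], ht.2.le⟩ _) δ
      ⟨hδ0, hδ1⟩
    refine this.1 ⟨y, ?_⟩
    rw [sub_neg_eq_add] at h0
    linear_combination -h0
  · intro t ht z hz y hy
    have ht' : t ∈ Icc t₁ t₀ := Ico_subset_Icc_self ht
    exact (min_le_left _ _).trans (hlat _ _ _ _ ((hbox t ht' z hz).trans hRr)
      ((htR t ht').trans hRr) (by rwa [norm_neg]) hy)

/-- Strong maximum principle: a flow staying in the closed interior of a flow of larger area
is disjoint from it. -/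
lemma disjoint_of_area_lt (h₁ : Γ₁.IsFlow a) (h₂ : Γ₂.IsFlow a) (ha : ∀ t, 0 < a t)
    (hac : Continuous a) (hP₁ : Γ₁.Positive) (hP : Γ₂.Positive) {t₀ ε : ℝ} (hε : 0 < ε)
    (hin : ∀ t ∈ Icc (t₀ - ε) t₀, ∀ x, Γ₁ (x, t) ∈ Γ₂.inside t ∨ Γ₁ (x, t) ∈ Γ₂.curve t)
    (hA : volume.real (Γ₁.inside t₀) < volume.real (Γ₂.inside t₀)) :
    Disjoint (Γ₁.curve t₀) (Γ₂.curve t₀) := by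
  by_contra hcon
  obtain ⟨z, ⟨x, hx⟩, hz⟩ := not_disjoint_iff.1 hcon
  have hclosed : IsClosed {x | Γ₁ (x, t₀) ∈ Γ₂.curve t₀} :=
    (Γ₂.isClosed_curve t₀).preimage (by fun_prop)
  have hopen : IsOpen {x | Γ₁ (x, t₀) ∈ Γ₂.curve t₀} := by
    rw [isOpen_iff_mem_nhds]
    rintro x ⟨y, hy⟩
    obtain ⟨r, hr, hrx⟩ := contact_before h₁ h₂ ha hac hP hε hin hy.symm
    filter_upwards [Metric.ball_mem_nhds x hr] with x' hx'
    have hc : Tendsto (fun t => (Γ₁ (x', t), t)) (𝓝[<] t₀) (𝓝 (Γ₁ (x', t₀), t₀)) :=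
      ((show Continuous fun t => (Γ₁ (x', t), t) by fun_prop).tendsto t₀).mono_left
        nhdsWithin_le_nhds
    refine Γ₂.isClosed_track.mem_of_tendsto hc ?_
    filter_upwards [Ioo_mem_nhdsLT (show t₀ - r < t₀ by linarith)] with t ht
    exact hrx x' t hx' ht.1 ht.2
  have huniv := IsClopen.eq_univ ⟨hclosed, hopen⟩ ⟨x, by
    change Γ₁ (x, t₀) ∈ Γ₂.curve t₀; rw [show Γ₁ (x, t₀) = z from hx]; exact hz⟩
  have hsub : Γ₁.curve t₀ ⊆ Γ₂.curve t₀ := by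
    rintro _ ⟨x, rfl⟩
    exact (huniv.symm ▸ mem_univ x : x ∈ {x | Γ₁ (x, t₀) ∈ Γ₂.curve t₀})
  obtain ⟨q, hq1, hq2⟩ : ∃ q ∈ Γ₁.inside t₀, q ∉ Γ₂.curve t₀ := by
    by_contra! hh
    have h0 : volume (Γ₁.inside t₀) = 0 := measure_mono_null hh (Γ₂.volume_curve t₀)
    exact ((Γ₁.isOpen_inside t₀).measure_pos volume (hP₁.nonempty_inside t₀)).ne' h0
  have hq3 : Γ₂.wn q t₀ = 1 := by
    rcases hP.wn_eq hq2 with h | h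
    · exact h
    · have h' := (Γ₁.hasLogOn_iff hq1.1).1 (((Γ₂.hasLogOn_iff hq2).2 h).mono hsub)
      rw [hq1.2] at h'
      exact absurd h' one_ne_zero
  refine absurd hA (not_lt.2 (measureReal_mono ?_ (Γ₁.volume_inside_ne_top t₀)))
  intro p hp
  have hp1 : p ∉ Γ₁.curve t₀ := fun h => hp.1 (hsub h)
  refine ⟨hp1, ?_⟩
  have := (Γ₁.hasLogOn_div_iff hp1 hq1.1).1
    (((Γ₂.hasLogOn_div_iff hp.1 hq2).2 (hp.2.trans hq3.symm)).mono hsub)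
  exact this.trans hq1.2

end Fam

namespace Fam

variable (Γ₁ Γ₂ : Fam)

/-- The component of the origin in the complement of two moving curves. -/
def core (t : ℝ) : Set ℂ := connectedComponentIn (Γ₁.curve t ∪ Γ₂.curve t)ᶜ 0

lemma isOpen_compl_union (t : ℝ) : IsOpen (Γ₁.curve t ∪ Γ₂.curve t)ᶜ :=
  ((Γ₁.isClosed_curve t).union (Γ₂.isClosed_curve t)).isOpen_compl

lemma isOpen_core (t : ℝ) : IsOpen (core Γ₁ Γ₂ t) := (isOpen_compl_union Γ₁ Γ₂ t).connectedComponentIn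

lemma core_comm (t : ℝ) : core Γ₁ Γ₂ t = core Γ₂ Γ₁ t := by rw [core, core, union_comm]

variable {Γ₁ Γ₂} {t t₀ : ℝ} {z P e : ℂ}

lemma core_subset_compl : core Γ₁ Γ₂ t ⊆ (Γ₁.curve t ∪ Γ₂.curve t)ᶜ := connectedComponentIn_subset _ _

lemma mem_core_of_isPreconnected {S : Set ℂ} (hS : IsPreconnected S)
    (hSc : S ⊆ (Γ₁.curve t ∪ Γ₂.curve t)ᶜ) {p q : ℂ} (hp : p ∈ S) (hq : q ∈ S)
    (h : p ∈ core Γ₁ Γ₂ t) : q ∈ core Γ₁ Γ₂ t := by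
  have h1 := hS.subset_connectedComponentIn hp hSc hq
  rwa [← connectedComponentIn_eq h] at h1

lemma inter_inside_subset : Γ₁.inside t ∩ Γ₂.inside t ⊆ (Γ₁.curve t ∪ Γ₂.curve t)ᶜ :=
  fun _ h hc => hc.elim h.1.1 h.2.1

lemma zero_mem_core (h1 : 0 ∈ Γ₁.inside t) (h2 : 0 ∈ Γ₂.inside t) : 0 ∈ core Γ₁ Γ₂ t :=
  mem_connectedComponentIn (inter_inside_subset ⟨h1, h2⟩)

lemma core_subset_inside (h1 : 0 ∈ Γ₁.inside t) (h2 : 0 ∈ Γ₂.inside t) :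
    core Γ₁ Γ₂ t ⊆ Γ₁.inside t := by
  intro z hz
  refine ⟨fun h => core_subset_compl hz (Or.inl h), ?_⟩
  have hS : IsPreconnected ((fun w : ℂ => (w, t)) '' core Γ₁ Γ₂ t) :=
    isPreconnected_connectedComponentIn.image _ (by fun_prop)
  have := wn_eq_of_isPreconnected (Γ := Γ₁) hS
    (by rintro _ ⟨u, hu, rfl⟩ h; exact core_subset_compl hu (Or.inl h))
    (mem_image_of_mem _ hz) (mem_image_of_mem _ (zero_mem_core h1 h2))
  exact this.trans h1.2

lemma mem_core_of_mem_closure (hz : z ∈ closure (core Γ₁ Γ₂ t)) (h1 : z ∉ Γ₁.curve t)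
    (h2 : z ∉ Γ₂.curve t) : z ∈ core Γ₁ Γ₂ t := by
  obtain ⟨r, hr, hb⟩ := Metric.isOpen_iff.1 (isOpen_compl_union Γ₁ Γ₂ t) z
    (fun h => h.elim h1 h2)
  obtain ⟨w, hw, hwz⟩ := Metric.mem_closure_iff.1 hz r hr
  exact mem_core_of_isPreconnected (convex_ball z r).isPreconnected hb
    (mem_ball'.2 hwz) (mem_ball_self hr) hw

lemma isOpen_compl_union_track : IsOpen {q : ℂ × ℝ | q.1 ∉ Γ₁.curve q.2 ∧ q.1 ∉ Γ₂.curve q.2} :=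
  Γ₁.isOpen_off.inter Γ₂.isOpen_off

/-- The core is open in space-time. -/
lemma core_eventually (hz : z ∈ core Γ₁ Γ₂ t) : ∀ᶠ q : ℂ × ℝ in 𝓝 (z, t), q.1 ∈ core Γ₁ Γ₂ q.2 := by
  have h0 : (0 : ℂ) ∈ core Γ₁ Γ₂ t := mem_connectedComponentIn (by
    by_contra h
    rw [core, connectedComponentIn_eq_empty h] at hz
    exact hz)
  have hconn : IsConnected (core Γ₁ Γ₂ t) := ⟨⟨0, h0⟩, isPreconnected_connectedComponentIn⟩
  have hpath := ((isOpen_core Γ₁ Γ₂ t).isConnected_iff_isPathConnected.1 hconn).joinedIn 0 h0 z hz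
  obtain ⟨γ, hγ⟩ := hpath
  have hK : IsCompact (range γ) := isCompact_range γ.continuous
  obtain ⟨V, W, hV, hW, hKV, htW, hVW⟩ := generalized_tube_lemma hK (isCompact_singleton (x := t))
    (isOpen_compl_union_track (Γ₁ := Γ₁) (Γ₂ := Γ₂)) (by
      rintro ⟨w, s⟩ ⟨⟨u, rfl⟩, hs⟩
      obtain rfl : s = t := hs
      have := core_subset_compl (hγ u)
      exact ⟨fun h => this (Or.inl h), fun h => this (Or.inr h)⟩)
  obtain ⟨r, hr, hb⟩ := Metric.isOpen_iff.1 hV z (hKV ⟨1, γ.target⟩)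
  filter_upwards [prod_mem_nhds (ball_mem_nhds z hr) (hW.mem_nhds (htW rfl))]
  rintro ⟨w, s⟩ ⟨hw, hs⟩
  have hsub : ∀ u ∈ range γ ∪ ball z r, u ∈ (Γ₁.curve s ∪ Γ₂.curve s)ᶜ := by
    intro u hu h
    have : (u, s) ∈ V ×ˢ W := ⟨hu.elim (fun h => hKV h) (fun h => hb h), hs⟩
    exact h.elim (hVW this).1 (hVW this).2
  have hpre : IsPreconnected (range γ ∪ ball z r) :=
    IsPreconnected.union z ⟨1, γ.target⟩ (mem_ball_self hr)
      (isPreconnected_range γ.continuous) (convex_ball z r).isPreconnected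
  have hz0 : (0 : ℂ) ∈ range γ ∪ ball z r := Or.inl ⟨0, γ.source⟩
  exact mem_core_of_isPreconnected hpre hsub hz0 (Or.inr hw) (mem_connectedComponentIn (hsub 0 hz0))

/-- Near `P` and near time `t`, moving in direction `e` does not leave the interior. -/
def ShiftAt (Γ : Fam) (P : ℂ) (t₀ : ℝ) (e : ℂ) : Prop :=
  ∃ r > 0, ∀ t z, |t - t₀| < r → ‖z - P‖ < r →
      (z ∈ Γ.inside t ∨ z ∈ Γ.curve t) → ∀ s ∈ Ioo 0 r, z + s • e ∈ Γ.inside t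

lemma Positive.shiftAt {Γ : Fam} (hΓ : Γ.Positive) {x : ℝ} (he : 0 < cr (Γ.vel (x, t₀)) e) :
    Γ.ShiftAt (Γ (x, t₀)) t₀ e := hΓ.exists_shift he

lemma shiftAt_of_mem_inside {Γ : Fam} (hP : P ∈ Γ.inside t₀) : Γ.ShiftAt P t₀ e := by
  obtain ⟨r, hr, hb⟩ := Metric.isOpen_iff.1 Γ.isOpen_inside_track (P, t₀) hP
  have hpos : 0 < 1 + ‖e‖ := by positivity
  have hle : r / (1 + ‖e‖) ≤ r := div_le_self hr.le (by simp)
  have hq : 0 < r / (1 + ‖e‖) := by positivity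
  refine ⟨r / (1 + ‖e‖) / 2, by positivity, fun t z ht hz _ s hs => ?_⟩
  have : (z + s • e, t) ∈ ball (P, t₀) r := by
    rw [mem_ball, Prod.dist_eq, Real.dist_eq, dist_eq_norm]
    refine max_lt ?_ (by linarith)
    calc ‖z + s • e - P‖ = ‖(z - P) + s • e‖ := by congr 1; ring
      _ ≤ ‖z - P‖ + s * ‖e‖ := by
        refine (norm_add_le _ _).trans_eq ?_
        rw [norm_smul, Real.norm_of_nonneg hs.1.le]
      _ < r / (1 + ‖e‖) + r / (1 + ‖e‖) * ‖e‖ := by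
        refine add_lt_add_of_lt_of_le (by linarith) ?_
        gcongr
        linarith [hs.2]
      _ = r := by field_simp
  exact hb this

/-- Near a point of its closure admitting a common inward direction, the core contains the
intersection of the interiors. -/
lemma exists_inter_subset_core (h1 : 0 ∈ Γ₁.inside t₀) (h2 : 0 ∈ Γ₂.inside t₀)
    (hP : P ∈ closure (core Γ₁ Γ₂ t₀)) (hs1 : Γ₁.ShiftAt P t₀ e) (hs2 : Γ₂.ShiftAt P t₀ e) :
    ∃ r > 0, ∀ t z, |t - t₀| < r → ‖z - P‖ < r → z ∈ Γ₁.inside t → z ∈ Γ₂.inside t →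
      z ∈ core Γ₁ Γ₂ t := by
  have hsub1 := core_subset_inside h1 h2
  have hsub2 : core Γ₁ Γ₂ t₀ ⊆ Γ₂.inside t₀ := core_comm Γ₁ Γ₂ t₀ ▸ core_subset_inside h2 h1
  have hP1 := Γ₁.mem_inside_or_mem_curve_of_mem_closure (closure_mono hsub1 hP)
  have hP2 := Γ₂.mem_inside_or_mem_curve_of_mem_closure (closure_mono hsub2 hP)
  obtain ⟨r₁, hr₁, H1⟩ := hs1
  obtain ⟨r₂, hr₂, H2⟩ := hs2
  set s := min r₁ r₂ / 2 with hs
  have hs0 : 0 < s := by positivity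
  have hs1' : s < r₁ := (half_lt_self (by positivity)).trans_le (min_le_left _ _)
  have hs2' : s < r₂ := (half_lt_self (by positivity)).trans_le (min_le_right _ _)
  have seg : ∀ t z, |t - t₀| < min r₁ r₂ → ‖z - P‖ < min r₁ r₂ → z ∈ Γ₁.inside t →
      z ∈ Γ₂.inside t → (fun u : ℝ => z + u • e) '' Icc 0 s ⊆ (Γ₁.curve t ∪ Γ₂.curve t)ᶜ := by
    rintro t z ht hz hz1 hz2 _ ⟨u, hu, rfl⟩
    rcases hu.1.eq_or_lt with rfl | hu0
    · simpa using inter_inside_subset ⟨hz1, hz2⟩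
    · exact inter_inside_subset
        ⟨H1 t z (ht.trans_le (min_le_left _ _)) (hz.trans_le (min_le_left _ _)) (Or.inl hz1) u
          ⟨hu0, hu.2.trans_lt hs1'⟩,
        H2 t z (ht.trans_le (min_le_right _ _)) (hz.trans_le (min_le_right _ _)) (Or.inl hz2) u
          ⟨hu0, hu.2.trans_lt hs2'⟩⟩
  have hpre : ∀ z : ℂ, IsPreconnected ((fun u : ℝ => z + u • e) '' Icc 0 s) := fun z =>
    isPreconnected_Icc.image _ (by fun_prop)
  have m0 : ∀ z : ℂ, z ∈ (fun u : ℝ => z + u • e) '' Icc 0 s := fun z =>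
    ⟨0, ⟨le_rfl, hs0.le⟩, by simp⟩
  have ms : ∀ z : ℂ, z + s • e ∈ (fun u : ℝ => z + u • e) '' Icc 0 s := fun z =>
    ⟨s, ⟨hs0.le, le_rfl⟩, rfl⟩
  have hQ : P + s • e ∈ closure (core Γ₁ Γ₂ t₀) := by
    rw [Metric.mem_closure_iff]
    intro ε hε
    obtain ⟨w, hw, hwP⟩ := Metric.mem_closure_iff.1 hP (min ε (min r₁ r₂)) (by positivity)
    refine ⟨w + s • e, ?_, by simpa using hwP.trans_le (min_le_left _ _)⟩
    rw [dist_comm, dist_eq_norm] at hwP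
    exact mem_core_of_isPreconnected (hpre w) (seg t₀ w (by simpa using ⟨hr₁, hr₂⟩)
      (hwP.trans_le (min_le_right _ _)) (hsub1 hw) (hsub2 hw)) (m0 w) (ms w) hw
  have hQc : P + s • e ∈ core Γ₁ Γ₂ t₀ := mem_core_of_mem_closure hQ
    (H1 t₀ P (by simpa) (by simpa) hP1 s ⟨hs0, hs1'⟩).1
    (H2 t₀ P (by simpa) (by simpa) hP2 s ⟨hs0, hs2'⟩).1
  obtain ⟨r, hr, hb⟩ := Metric.eventually_nhds_iff.1 (core_eventually hQc)
  refine ⟨min r (min r₁ r₂), by positivity, fun t z ht hz hz1 hz2 => ?_⟩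
  have hzc : z + s • e ∈ core Γ₁ Γ₂ t := @hb (z + s • e, t) (by
    rw [Prod.dist_eq, Real.dist_eq, dist_eq_norm, add_sub_add_right_eq_sub]
    exact max_lt (hz.trans_le (min_le_left _ _)) (ht.trans_le (min_le_left _ _)))
  exact mem_core_of_isPreconnected (hpre z) (seg t z (ht.trans_le (min_le_right _ _))
    (hz.trans_le (min_le_right _ _)) hz1 hz2) (ms z) (m0 z) hzc

end Fam

lemma one_le_norm_sub_of_exp_eq {a b : ℂ} (h : Complex.exp a = Complex.exp b) (hne : a ≠ b) :
    1 ≤ ‖a - b‖ := by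
  obtain ⟨n, hn⟩ := Complex.exp_eq_exp_iff_exists_int.1 h
  have hn0 : n ≠ 0 := by rintro rfl; exact hne (by simpa using hn)
  have h1 : (1 : ℝ) ≤ |(n : ℝ)| := by exact_mod_cast Int.one_le_abs hn0
  rw [hn, add_sub_cancel_left, norm_mul, norm_mul, norm_mul, Complex.norm_I, Complex.norm_real,
    Complex.norm_intCast, Real.norm_of_nonneg pi_pos.le]
  norm_num
  nlinarith [pi_gt_three]

namespace Fam

variable {Γ₁ Γ₂ : Fam} {a : ℝ → ℝ}

/-- A logarithm on the initial curve extends continuously along a motion avoiding two points. -/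
lemma exists_lift_family (Γ : Fam) {p r : ℂ} {t₀ t₁ : ℝ} (ht : t₀ ≤ t₁)
    (hp : ∀ s ∈ Icc t₀ t₁, p ∉ Γ.curve s) (hr : ∀ s ∈ Icc t₀ t₁, r ∉ Γ.curve s) {l : ℂ → ℂ}
    (hl : ContinuousOn l (Γ.curve t₀))
    (hexp : ∀ z ∈ Γ.curve t₀, Complex.exp (l z) = (z - p) / (z - r)) :
    ∃ Λ : ℝ × ℝ → ℂ, Continuous Λ ∧ (∀ x, Λ (x, t₀) = l (Γ (x, t₀))) ∧
      (∀ x, ∀ s ∈ Icc t₀ t₁, Complex.exp (Λ (x, s)) = (Γ (x, s) - p) / (Γ (x, s) - r)) ∧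
      ∀ x s, ∀ k : ℤ, Λ (x + 2 * π * k, s) = Λ (x, s) := by
  set c : ℝ → ℝ := fun s => max t₀ (min s t₁) with hc
  have hcc : Continuous c := by fun_prop
  have hcm : ∀ s, c s ∈ Icc t₀ t₁ := fun s => ⟨le_max_left _ _, max_le ht (min_le_right _ _)⟩
  have hci : ∀ s ∈ Icc t₀ t₁, c s = s := fun s hs => by
    rw [hc]; simp only; rw [min_eq_left hs.2, max_eq_right hs.1]
  set f : ℝ × ℝ → ℂ := fun q => (Γ (q.1, c q.2) - p) / (Γ (q.1, c q.2) - r) with hf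
  have hpn : ∀ q : ℝ × ℝ, Γ (q.1, c q.2) - p ≠ 0 := fun q =>
    sub_ne_zero.2 fun h => hp _ (hcm q.2) (h ▸ Γ.mem_curve _ _)
  have hrn : ∀ q : ℝ × ℝ, Γ (q.1, c q.2) - r ≠ 0 := fun q =>
    sub_ne_zero.2 fun h => hr _ (hcm q.2) (h ▸ Γ.mem_curve _ _)
  have hfc : Continuous f := Continuous.div (by fun_prop) (by fun_prop) hrn
  obtain ⟨M, hM, hMe⟩ := exists_log_of_simplyConnected hfc fun q => div_ne_zero (hpn q) (hrn q)
  have hlc : Continuous fun x : ℝ => l (Γ (x, t₀)) :=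
    hl.comp_continuous (by fun_prop) fun x => Γ.mem_curve x t₀
  have hle : ∀ x : ℝ, Complex.exp (M (x, t₀)) = Complex.exp (l (Γ (x, t₀))) := fun x => by
    rw [hMe, hexp _ (Γ.mem_curve x t₀), hf]
    simp only [hci t₀ ⟨le_rfl, ht⟩]
  have hdiff : ∀ x : ℝ, M (x, t₀) - l (Γ (x, t₀)) = M (0, t₀) - l (Γ (0, t₀)) := fun x =>
    log_branch_sub_eq (isPreconnected_univ (α := ℝ))
      (a := fun x => M (x, t₀)) (b := fun x => l (Γ (x, t₀)))
      (by fun_prop) hlc.continuousOn (fun x _ => hle x) (mem_univ x) (mem_univ 0)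
  have hinit : ∀ x, M (x, t₀) - (M (0, t₀) - l (Γ (0, t₀))) = l (Γ (x, t₀)) := fun x => by
    rw [← hdiff x]; ring
  refine ⟨fun q => M q - (M (0, t₀) - l (Γ (0, t₀))), by fun_prop, hinit, ?_, ?_⟩
  · intro x s hs
    rw [Complex.exp_sub, Complex.exp_sub, hle, div_self (Complex.exp_ne_zero _), div_one, hMe, hf]
    simp only [hci s hs]
  · intro x s k
    have hk := log_branch_sub_eq (isPreconnected_univ (α := ℝ × ℝ))
      (a := fun q => M (q.1 + 2 * π * k, q.2)) (b := M)
      (by fun_prop) hM.continuousOn (fun q _ => by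
        rw [hMe, hMe, hf]; simp only [Γ.per_int]) (mem_univ (x, s)) (mem_univ (x, t₀))
    simp only at hk
    have h3 := hinit (x + 2 * π * k)
    rw [Γ.per_int, ← hinit x] at h3
    linear_combination hk + h3

/-- A point of the core that is not swept by two flows stays in the core. -/
theorem mem_core_of_not_swept (h₁ : Γ₁.IsFlow a) (h₂ : Γ₂.IsFlow a) (ha : ∀ t, 0 < a t)
    (hac : Continuous a) {t₀ t₁ : ℝ} (ht : t₀ ≤ t₁) {p : ℂ} (hp : p ∈ core Γ₁ Γ₂ t₀)
    (h01 : ∀ s ∈ Icc t₀ t₁, 0 ∉ Γ₁.curve s) (h02 : ∀ s ∈ Icc t₀ t₁, 0 ∉ Γ₂.curve s)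
    (hp1 : ∀ s ∈ Icc t₀ t₁, p ∉ Γ₁.curve s) (hp2 : ∀ s ∈ Icc t₀ t₁, p ∉ Γ₂.curve s) :
    p ∈ core Γ₁ Γ₂ t₁ := by
  obtain ⟨l, hl, hle⟩ := hasLogOn_div_of_mem_component
    ((Γ₁.isClosed_curve t₀).union (Γ₂.isClosed_curve t₀)) hp
  obtain ⟨Λ₁, c₁, i₁, e₁, p₁⟩ := Γ₁.exists_lift_family ht h01 hp1
    (hl.mono subset_union_left) (fun z hz => hle z (Or.inl hz))
  obtain ⟨Λ₂, c₂, i₂, e₂, p₂⟩ := Γ₂.exists_lift_family ht h02 hp2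
    (hl.mono subset_union_right) (fun z hz => hle z (Or.inr hz))
  have hexp : ∀ s ∈ Icc t₀ t₁, ∀ x y, Γ₁ (x, s) = Γ₂ (y, s) →
      Complex.exp (Λ₁ (x, s)) = Complex.exp (Λ₂ (y, s)) := fun s hs x y h => by
    rw [e₁ x s hs, e₂ y s hs, h]
  have main : ∀ s ∈ Icc t₀ t₁, ∀ x y, Γ₁ (x, s) = Γ₂ (y, s) → Λ₁ (x, s) = Λ₂ (y, s) := by
    by_contra! hcon
    obtain ⟨s, hs, x, y, hxy, hne⟩ := hcon
    let K : Set (ℝ × ℝ × ℝ) := (Icc 0 (0 + 2 * π) ×ˢ Icc 0 (0 + 2 * π) ×ˢ Icc t₀ t₁) ∩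
      ({q | Γ₁ (q.1, q.2.2) = Γ₂ (q.2.1, q.2.2)} ∩
        {q | 1 ≤ ‖Λ₁ (q.1, q.2.2) - Λ₂ (q.2.1, q.2.2)‖})
    have hK : IsCompact K := (isCompact_Icc.prod (isCompact_Icc.prod isCompact_Icc)).inter_right
      ((isClosed_eq (by fun_prop) (by fun_prop)).inter
        (isClosed_le (by fun_prop) (by fun_prop)))
    have red : ∀ s ∈ Icc t₀ t₁, ∀ x y, Γ₁ (x, s) = Γ₂ (y, s) → Λ₁ (x, s) ≠ Λ₂ (y, s) →
        ∃ x' y', (x', y', s) ∈ K := by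
      intro s hs x y hxy hne
      obtain ⟨x', hx', ex⟩ := Γ₁.exists_param (Γ₁.mem_curve x s) 0
      obtain ⟨y', hy', ey⟩ := Γ₂.exists_param (Γ₂.mem_curve y s) 0
      obtain ⟨k, hk⟩ := Γ₁.inj _ _ _ ex
      obtain ⟨m, hm⟩ := Γ₂.inj _ _ _ ey
      have hx2 : Λ₁ (x', s) = Λ₁ (x, s) := by rw [hk, p₁]
      have hy2 : Λ₂ (y', s) = Λ₂ (y, s) := by rw [hm, p₂]
      refine ⟨x', y', ⟨Ico_subset_Icc_self hx', Ico_subset_Icc_self hy', hs⟩, ?_, ?_⟩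
      · change Γ₁ (x', s) = Γ₂ (y', s)
        rw [ex, ey, hxy]
      · change 1 ≤ ‖Λ₁ (x', s) - Λ₂ (y', s)‖
        rw [hx2, hy2]
        exact one_le_norm_sub_of_exp_eq (hexp s hs x y hxy) hne
    obtain ⟨x', y', hxyK⟩ := red s hs x y hxy hne
    obtain ⟨⟨u, v, τ⟩, ⟨⟨-, -, hq1, hq2⟩, hq, hqn⟩, hmin⟩ :=
      hK.exists_isMinOn (f := fun q => q.2.2) ⟨_, hxyK⟩ (by fun_prop)
    simp only at hq1 hq2
    replace hq : Γ₁ (u, τ) = Γ₂ (v, τ) := hq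
    replace hqn : 1 ≤ ‖Λ₁ (u, τ) - Λ₂ (v, τ)‖ := hqn
    have hq0 : t₀ < τ := by
      refine hq1.lt_of_ne fun e' => ?_
      rw [← e'] at hqn hq
      rw [i₁, i₂, hq, sub_self, norm_zero] at hqn
      norm_num at hqn
    have hcont : Continuous fun q : ℝ × ℝ × ℝ => ‖Λ₁ (q.1, q.2.2) - Λ₂ (q.2.1, q.2.2)‖ := by
      fun_prop
    obtain ⟨r, hr, hb⟩ := Metric.eventually_nhds_iff.1 ((hcont.tendsto (u, v, τ)).eventually
      (lt_mem_nhds (show (0 : ℝ) < _ by linarith)))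
    obtain ⟨u', v', τ', h1, h2, h3, h4, h5⟩ := exists_crossing_before h₁ h₂ ha hac
      (lt_min hr (sub_pos.2 hq0)) hq
    have hm1 := min_le_left r (τ - t₀)
    have hm2 := min_le_right r (τ - t₀)
    have hne' := @hb (u', v', τ') (by
      simp only [Prod.dist_eq, Real.dist_eq]
      refine max_lt (h3.trans_le hm1) (max_lt (h4.trans_le hm1) ?_)
      rw [abs_lt]; constructor <;> linarith)
    simp only at hne'
    obtain ⟨x'', y'', hK''⟩ := red τ' ⟨by linarith, by linarith⟩ u' v' h5
      (sub_ne_zero.1 (norm_pos_iff.1 hne'))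
    exact absurd (hmin hK'') (not_le.2 h2)
  have hX : IsCompact (Γ₁.curve t₁ ∪ Γ₂.curve t₁) :=
    (Γ₁.isCompact_curve t₁).union (Γ₂.isCompact_curve t₁)
  have ht1 : t₁ ∈ Icc t₀ t₁ := ⟨ht, le_rfl⟩
  refine mem_component_of_hasLogOn hX (fun h => h.elim (h01 t₁ ht1) (h02 t₁ ht1))
    (fun h => h.elim (hp1 t₁ ht1) (hp2 t₁ ht1)) ?_
  let φ : Icc (0 : ℝ) (2 * π) ⊕ Icc (0 : ℝ) (2 * π) → ℂ :=
    Sum.elim (fun x => Γ₁ (x, t₁)) (fun y => Γ₂ (y, t₁))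
  let L : Icc (0 : ℝ) (2 * π) ⊕ Icc (0 : ℝ) (2 * π) → ℂ :=
    Sum.elim (fun x => Λ₁ (x, t₁)) (fun y => Λ₂ (y, t₁))
  have hφ : Continuous φ := Continuous.sumElim (by fun_prop) (by fun_prop)
  have hL : Continuous L := Continuous.sumElim (by fun_prop) (by fun_prop)
  have hrange : range φ = Γ₁.curve t₁ ∪ Γ₂.curve t₁ := by
    rw [Sum.elim_range, curve_eq_image, curve_eq_image, image_eq_range, image_eq_range]
  rw [← hrange]
  refine HasLogOn.of_comp hφ hL ?_ ?_
  · rintro (x | x) (y | y) hxy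
    · obtain ⟨k, hk⟩ := Γ₁.inj _ _ _ hxy
      change Λ₁ (x, t₁) = Λ₁ (y, t₁)
      rw [hk, p₁]
    · exact main t₁ ht1 _ _ hxy
    · exact (main t₁ ht1 _ _ hxy.symm).symm
    · obtain ⟨k, hk⟩ := Γ₂.inj _ _ _ hxy
      change Λ₂ (x, t₁) = Λ₂ (y, t₁)
      rw [hk, p₂]
  · rintro (x | x)
    · exact e₁ _ t₁ ht1
    · exact e₂ _ t₁ ht1

end Fam

namespace Fam

variable {Γ₁ Γ₂ : Fam} {a : ℝ → ℝ}

/-- The region swept by a moving curve has area bounded by the elapsed time. -/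
lemma exists_swept_bound (Γ : Fam) (A B : ℝ) : ∃ C > 0, ∀ s t, A ≤ s → t ≤ B →
    ∀ S ⊆ Icc 0 (2 * π), MeasurableSet S →
      volume (Γ.F '' (S ×ˢ Icc s t)) ≤ ENNReal.ofReal C * (volume S * ENNReal.ofReal (t - s)) := by
  let L : ℂ →L[ℝ] ℝ × ℝ := Complex.reCLM.prod Complex.imCLM
  let f : ℂ → ℂ := fun z => Γ.F (L z)
  have hΓ : ContDiff ℝ 1 Γ.F := Γ.smooth.of_le (by norm_num)
  have hf : ContDiff ℝ 1 f := hΓ.comp L.contDiff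
  have hdet : Continuous fun q : ℝ × ℝ => |(fderiv ℝ f (q.1 + q.2 * Complex.I)).det| := by
    have h1 : Continuous (fderiv ℝ f) := hf.continuous_fderiv (by norm_num)
    have h2 : Continuous fun q : ℝ × ℝ => (q.1 + q.2 * Complex.I : ℂ) := by fun_prop
    exact (ContinuousLinearMap.continuous_det.comp (h1.comp h2)).abs
  obtain ⟨C, hC⟩ := (isCompact_Icc.prod isCompact_Icc : IsCompact (Icc 0 (2 * π) ×ˢ Icc A B)).exists_bound_of_continuousOn hdet.continuousOn
  refine ⟨max C 1, by positivity, fun s t hs ht S hS hSm => ?_⟩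
  set E : Set ℂ := Complex.measurableEquivRealProd ⁻¹' (S ×ˢ Icc s t) with hE
  have hEm : MeasurableSet E := Complex.measurableEquivRealProd.measurable (hSm.prod measurableSet_Icc)
  have hvol : volume E = volume S * ENNReal.ofReal (t - s) := by
    rw [hE, Complex.volume_preserving_equiv_real_prod.measure_preimage
      (hSm.prod measurableSet_Icc).nullMeasurableSet, Measure.volume_eq_prod, Measure.prod_prod,
      Real.volume_Icc]
  have himg : Γ.F '' (S ×ˢ Icc s t) ⊆ f '' E := by
    rintro _ ⟨⟨x, u⟩, hq, rfl⟩
    exact ⟨⟨x, u⟩, hq, rfl⟩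
  calc volume (Γ.F '' (S ×ˢ Icc s t)) ≤ volume (f '' E) := measure_mono himg
    _ ≤ ∫⁻ z in E, ENNReal.ofReal |(fderiv ℝ f z).det| :=
      addHaar_image_le_lintegral_abs_det_fderiv volume hEm fun z _ =>
        (hf.differentiable (by norm_num) z).hasFDerivAt.hasFDerivWithinAt
    _ ≤ ∫⁻ _ in E, ENNReal.ofReal (max C 1) := by
      refine setLIntegral_mono' hEm fun z hz => ENNReal.ofReal_le_ofReal ?_
      have := hC (z.re, z.im) ⟨hS hz.1, hs.trans hz.2.1, hz.2.2.trans ht⟩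
      rw [Real.norm_eq_abs, abs_abs, Complex.re_add_im] at this
      exact this.trans (le_max_left _ _)
    _ = _ := by rw [setLIntegral_const, hvol]

/-- The core can only lose points that are swept by one of the curves. -/
lemma core_subset_union_swept (h₁ : Γ₁.IsFlow a) (h₂ : Γ₂.IsFlow a) (ha : ∀ t, 0 < a t)
    (hac : Continuous a) {t₀ t₁ : ℝ} (ht : t₀ ≤ t₁)
    (h01 : ∀ s ∈ Icc t₀ t₁, 0 ∉ Γ₁.curve s) (h02 : ∀ s ∈ Icc t₀ t₁, 0 ∉ Γ₂.curve s) :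
    core Γ₁ Γ₂ t₀ ⊆ core Γ₁ Γ₂ t₁ ∪ (Γ₁.F '' (Icc 0 (2 * π) ×ˢ Icc t₀ t₁) ∪
      Γ₂.F '' (Icc 0 (2 * π) ×ˢ Icc t₀ t₁)) := by
  intro p hp
  by_contra hcon
  simp only [mem_union, not_or] at hcon
  obtain ⟨hc, hs1, hs2⟩ := hcon
  have key : ∀ Γ : Fam, p ∉ Γ.F '' (Icc 0 (2 * π) ×ˢ Icc t₀ t₁) →
      ∀ s ∈ Icc t₀ t₁, p ∉ Γ.curve s := by
    intro Γ hn s hs hmem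
    rw [curve_eq_image] at hmem
    obtain ⟨x, hx, rfl⟩ := hmem
    exact hn ⟨(x, s), ⟨hx, hs⟩, rfl⟩
  exact hc (mem_core_of_not_swept h₁ h₂ ha hac ht hp h01 h02 (key _ hs1) (key _ hs2))

lemma volume_core_ne_top {t : ℝ} (h1 : 0 ∈ Γ₁.inside t) (h2 : 0 ∈ Γ₂.inside t) :
    volume (core Γ₁ Γ₂ t) ≠ ⊤ :=
  measure_ne_top_of_subset (core_subset_inside h1 h2) (Γ₁.volume_inside_ne_top t)

/-- The area of the core decreases at most at a bounded rate. -/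
lemma exists_core_bound (h₁ : Γ₁.IsFlow a) (h₂ : Γ₂.IsFlow a) (ha : ∀ t, 0 < a t)
    (hac : Continuous a) {A B : ℝ} (h01 : ∀ s ∈ Icc A B, 0 ∈ Γ₁.inside s)
    (h02 : ∀ s ∈ Icc A B, 0 ∈ Γ₂.inside s) : ∃ C, ∀ s t, A ≤ s → s ≤ t → t ≤ B →
      volume.real (core Γ₁ Γ₂ s) - C * (t - s) ≤ volume.real (core Γ₁ Γ₂ t) := by
  obtain ⟨C₁, hC₁, H₁⟩ := Γ₁.exists_swept_bound A B
  obtain ⟨C₂, hC₂, H₂⟩ := Γ₂.exists_swept_bound A B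
  refine ⟨(C₁ + C₂) * (2 * π), fun s t hs hst ht => ?_⟩
  have hsub := core_subset_union_swept h₁ h₂ ha hac hst
    (fun u hu => (h01 u ⟨hs.trans hu.1, hu.2.trans ht⟩).1)
    (fun u hu => (h02 u ⟨hs.trans hu.1, hu.2.trans ht⟩).1)
  have k : ∀ {Γ : Fam} {C : ℝ}, 0 < C → (∀ s t, A ≤ s → t ≤ B →
    ∀ S ⊆ Icc 0 (2 * π), MeasurableSet S →
      volume (Γ.F '' (S ×ˢ Icc s t)) ≤ ENNReal.ofReal C * (volume S * ENNReal.ofReal (t - s))) →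
      volume (Γ.F '' (Icc 0 (2 * π) ×ˢ Icc s t)) ≤ ENNReal.ofReal (C * (2 * π) * (t - s)) := by
    intro Γ C hC H
    refine (H s t hs ht _ subset_rfl measurableSet_Icc).trans_eq ?_
    rw [Real.volume_Icc, sub_zero, ← ENNReal.ofReal_mul (by positivity), ← ENNReal.ofReal_mul (by positivity)]
    congr 1; ring
  have hst' : 0 ≤ t - s := sub_nonneg.2 hst
  have h1 : volume (core Γ₁ Γ₂ s) ≤ volume (core Γ₁ Γ₂ t) +
      ENNReal.ofReal ((C₁ + C₂) * (2 * π) * (t - s)) := by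
    refine (measure_mono hsub).trans ((measure_union_le _ _).trans ?_)
    gcongr
    refine (measure_union_le _ _).trans ((add_le_add (k hC₁ H₁) (k hC₂ H₂)).trans_eq ?_)
    rw [← ENNReal.ofReal_add (by positivity) (by positivity)]
    congr 1; ring
  have hfin := volume_core_ne_top (h01 t ⟨hs.trans hst, ht⟩) (h02 t ⟨hs.trans hst, ht⟩)
  have h2 := ENNReal.toReal_mono (ENNReal.add_ne_top.2 ⟨hfin, ENNReal.ofReal_ne_top⟩) h1
  rw [ENNReal.toReal_add hfin ENNReal.ofReal_ne_top, ENNReal.toReal_ofReal (by positivity)] at h2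
  simp only [Measure.real]
  linarith

end Fam

namespace Fam

section flux

variable (Γ : Fam) (S : Set ℂ) (t : ℝ)

/-- The parameters in one period at which the curve meets `S`. -/
def bdry : Set ℝ := {x | x ∈ Ioc 0 (2 * π) ∧ Γ (x, t) ∈ S}

/-- The flux of `χ` through the part of the curve in `S`. -/
def flux (χ : ℂ → ℝ) : ℝ :=
  -∫ x in Γ.bdry S t, χ (Γ (x, t)) * cr (Γ.vel (x, t)) (dt Γ.F (x, t))

lemma bdry_subset : Γ.bdry S t ⊆ Ioc 0 (2 * π) := fun _ h => h.1

variable {S} in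
lemma measurableSet_bdry (hS : IsClosed S) : MeasurableSet (Γ.bdry S t) :=
  measurableSet_Ioc.inter
    ((hS.preimage (by fun_prop : Continuous fun x : ℝ => Γ (x, t))).measurableSet)

lemma integrableOn_bdry {f : ℝ → ℝ} (hf : Continuous f) : IntegrableOn f (Γ.bdry S t) :=
  (hf.continuousOn.integrableOn_Icc (a := 0) (b := 2 * π)).mono_set
    ((Γ.bdry_subset S t).trans Ioc_subset_Icc_self)

lemma continuous_flux {χ : ℂ → ℝ} (hχ : Continuous χ) :
    Continuous fun x : ℝ => χ (Γ (x, t)) * cr (Γ.vel (x, t)) (dt Γ.F (x, t)) := by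
  have h1 := Γ.continuous_dt
  have h2 := Γ.continuous_vel
  have h3 := Γ.continuous
  exact (hχ.comp (by fun_prop)).mul (Continuous.cr (by fun_prop) (by fun_prop))

lemma flux_add {χ χ' : ℂ → ℝ} (hχ : Continuous χ) (hχ' : Continuous χ') :
    Γ.flux S t (fun z => χ z + χ' z) = Γ.flux S t χ + Γ.flux S t χ' := by
  simp only [flux, add_mul]
  rw [integral_add (Γ.integrableOn_bdry S t (Γ.continuous_flux t hχ))
    (Γ.integrableOn_bdry S t (Γ.continuous_flux t hχ')), neg_add]

variable {S t} in
lemma flux_eq_zero {χ : ℂ → ℝ} (h : ∀ x, Γ (x, t) ∈ S → χ (Γ (x, t)) = 0) :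
    Γ.flux S t χ = 0 := by
  rw [flux, setIntegral_eq_zero_of_forall_eq_zero, neg_zero]
  intro x hx
  rw [h x hx.2, zero_mul]

end flux

variable (Γ₁ Γ₂ : Fam)

/-- A first order lower bound for the `χ`-weighted area of the core. -/
def LowerRate (t₀ : ℝ) (χ : ℂ → ℝ) : Prop := ∃ l : ℝ → ℝ, l t₀ = 0 ∧
  HasDerivAt l (Γ₁.flux (closure (core Γ₁ Γ₂ t₀)) t₀ χ +
    Γ₂.flux (closure (core Γ₁ Γ₂ t₀)) t₀ χ) t₀ ∧
  ∀ᶠ t in 𝓝 t₀, (∫ z in core Γ₁ Γ₂ t₀, χ z) + l t ≤ ∫ z in core Γ₁ Γ₂ t, χ z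

variable {Γ₁ Γ₂} {t₀ : ℝ} {χ χ' : ℂ → ℝ}

lemma LowerRate.symm (h : LowerRate Γ₁ Γ₂ t₀ χ) : LowerRate Γ₂ Γ₁ t₀ χ := by
  obtain ⟨l, h1, h2, h3⟩ := h
  refine ⟨l, h1, ?_, ?_⟩
  · rwa [core_comm, add_comm]
  · simpa only [core_comm Γ₂ Γ₁] using h3

lemma LowerRate.add (h : LowerRate Γ₁ Γ₂ t₀ χ) (h' : LowerRate Γ₁ Γ₂ t₀ χ')
    (hc : Continuous χ) (hc' : Continuous χ') (hs : HasCompactSupport χ)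
    (hs' : HasCompactSupport χ') : LowerRate Γ₁ Γ₂ t₀ (fun z => χ z + χ' z) := by
  obtain ⟨l, h1, h2, h3⟩ := h
  obtain ⟨l', h1', h2', h3'⟩ := h'
  refine ⟨fun t => l t + l' t, by simp only [h1, h1', add_zero], ?_, ?_⟩
  · rw [flux_add _ _ _ hc hc', flux_add _ _ _ hc hc']
    exact (h2.add h2').congr_deriv (by ring)
  · have hi := hc.integrable_of_hasCompactSupport hs (μ := volume)
    have hi' := hc'.integrable_of_hasCompactSupport hs' (μ := volume)
    filter_upwards [h3, h3'] with t e e'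
    rw [integral_add hi.integrableOn hi'.integrableOn, integral_add hi.integrableOn hi'.integrableOn]
    linarith

lemma lowerRate_of_notMem_closure
    (h : ∀ z, χ z ≠ 0 → z ∉ closure (core Γ₁ Γ₂ t₀)) (hχ : ∀ z, 0 ≤ χ z) :
    LowerRate Γ₁ Γ₂ t₀ χ := by
  refine ⟨fun _ => 0, rfl, ?_, Eventually.of_forall fun t => ?_⟩
  · rw [flux_eq_zero _ fun x hx => by_contra fun hn => h _ hn hx,
      flux_eq_zero _ fun x hx => by_contra fun hn => h _ hn hx, add_zero]
    exact hasDerivAt_const _ _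
  · rw [setIntegral_eq_zero_of_forall_eq_zero
      fun z hz => by_contra fun hn => h z hn (subset_closure hz), add_zero]
    exact integral_nonneg hχ

lemma lowerRate_of_mem {U : Set ℂ} (hU : ∀ᶠ t in 𝓝 t₀, U ⊆ core Γ₁ Γ₂ t) (h : ∀ z ∉ U, χ z = 0) :
    LowerRate Γ₁ Γ₂ t₀ χ := by
  have hU0 := hU.self_of_nhds
  have key : ∀ t, U ⊆ core Γ₁ Γ₂ t → ∫ z in core Γ₁ Γ₂ t, χ z = ∫ z, χ z := fun t ht =>
    setIntegral_eq_integral_of_forall_compl_eq_zero fun z hz => h z fun hzU => hz (ht hzU)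
  refine ⟨fun _ => 0, rfl, ?_, ?_⟩
  · rw [flux_eq_zero _ fun x _ => h _ fun hx =>
        core_subset_compl (hU0 hx) (Or.inl ⟨x, rfl⟩),
      flux_eq_zero _ fun x _ => h _ fun hx =>
        core_subset_compl (hU0 hx) (Or.inr ⟨x, rfl⟩), add_zero]
    exact hasDerivAt_const _ _
  · filter_upwards [hU] with t ht
    rw [key t ht, key t₀ hU0, add_zero]

/-- Points of a positively oriented curve are limits of its inside. -/
lemma Positive.mem_closure_inside {Γ : Fam} (h : Γ.Positive) (x t : ℝ) :
    Γ (x, t) ∈ closure (Γ.inside t) := by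
  have h1 := eventually_small _ (h ((x, t), Complex.I * Γ.vel (x, t)) (cr_mul_I (Γ.vel_ne _)))
  have h2 : Tendsto (fun s : ℝ => Γ (x, t) + s • (Complex.I * Γ.vel (x, t))) (𝓝[>] 0)
      (𝓝 (Γ (x, t))) := by
    have : Continuous fun s : ℝ => Γ (x, t) + s • (Complex.I * Γ.vel (x, t)) := by fun_prop
    simpa using (this.tendsto 0).mono_left nhdsWithin_le_nhds
  refine mem_closure_of_tendsto h2 ?_
  filter_upwards [h1.filter_mono nhdsWithin_le_nhds, self_mem_nhdsWithin] with s hs hs0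
  have := hs.1 hs0
  exact ⟨this.1, by simpa using this.2⟩

lemma exists_lowerRate_of_mem_curve (hp1 : Γ₁.Positive) (h1 : 0 ∈ Γ₁.inside t₀)
    (h2 : 0 ∈ Γ₂.inside t₀) {P : ℂ} (hP : P ∈ closure (core Γ₁ Γ₂ t₀)) (hP1 : P ∈ Γ₁.curve t₀)
    (hP2 : P ∉ Γ₂.curve t₀) : ∃ V, IsOpen V ∧ P ∈ V ∧ ∀ χ : ℂ → ℝ, ContDiff ℝ ∞ χ →
      HasCompactSupport χ → (∀ z ∉ V, χ z = 0) → LowerRate Γ₁ Γ₂ t₀ χ := by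
  have hsub2 : core Γ₁ Γ₂ t₀ ⊆ Γ₂.inside t₀ := core_comm Γ₁ Γ₂ t₀ ▸ core_subset_inside h2 h1
  have hPin : P ∈ Γ₂.inside t₀ :=
    (Γ₂.mem_inside_or_mem_curve_of_mem_closure (closure_mono hsub2 hP)).resolve_right hP2
  obtain ⟨x₀, rfl⟩ := hP1
  obtain ⟨r, hr, H⟩ := exists_inter_subset_core h1 h2 hP
    (hp1.shiftAt (e := Complex.I * Γ₁.vel (x₀, t₀)) (cr_mul_I (Γ₁.vel_ne _)))
    (shiftAt_of_mem_inside hPin)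
  obtain ⟨ρ, hρ, hb⟩ := Metric.isOpen_iff.1 Γ₂.isOpen_inside_track (Γ₁ (x₀, t₀), t₀) hPin
  set d := min r ρ with hd
  have hd0 : 0 < d := lt_min hr hρ
  have hin : ∀ t z, |t - t₀| < d → z ∈ ball (Γ₁ (x₀, t₀)) d → z ∈ Γ₂.inside t := by
    intro t z ht hz
    refine @hb (z, t) ?_
    rw [mem_ball, Prod.dist_eq, Real.dist_eq]
    exact max_lt (lt_of_lt_of_le hz (min_le_right _ _)) (ht.trans_le (min_le_right _ _))
  have hiff : ∀ t z, |t - t₀| < d → z ∈ ball (Γ₁ (x₀, t₀)) d →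
      0 ∈ Γ₁.inside t → 0 ∈ Γ₂.inside t → (z ∈ core Γ₁ Γ₂ t ↔ z ∈ Γ₁.inside t) := by
    intro t z ht hz g1 g2
    refine ⟨fun h => core_subset_inside g1 g2 h, fun h => H t z (ht.trans_le (min_le_left _ _)) ?_ h
      (hin t z ht hz)⟩
    rw [← dist_eq_norm]
    exact lt_of_lt_of_le hz (min_le_left _ _)
  refine ⟨ball (Γ₁ (x₀, t₀)) d, isOpen_ball, mem_ball_self hd0, fun χ hχ hs hV => ?_⟩
  have hintg : ∀ t, |t - t₀| < d → 0 ∈ Γ₁.inside t → 0 ∈ Γ₂.inside t →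
      ∫ z in core Γ₁ Γ₂ t, χ z = ∫ z, χ z * Γ₁.wn z t := by
    intro t ht g1 g2
    rw [hp1.integral_mul_wn_eq, ← integral_indicator (isOpen_core Γ₁ Γ₂ t).measurableSet,
      ← integral_indicator (Γ₁.isOpen_inside t).measurableSet]
    congr 1
    ext z
    by_cases hz : z ∈ ball (Γ₁ (x₀, t₀)) d
    · by_cases hzc : z ∈ Γ₁.inside t
      · rw [indicator_of_mem ((hiff t z ht hz g1 g2).2 hzc), indicator_of_mem hzc]
      · rw [indicator_of_notMem (fun h => hzc ((hiff t z ht hz g1 g2).1 h)),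
          indicator_of_notMem hzc]
    · simp [indicator, hV z hz]
  have ht0 : |t₀ - t₀| < d := by simpa using hd0
  refine ⟨fun t => (∫ z, χ z * Γ₁.wn z t) - ∫ z, χ z * Γ₁.wn z t₀, sub_self _, ?_, ?_⟩
  · refine ((Γ₁.hasDerivAt_integral_mul_wn hχ hs t₀).sub_const _).congr_deriv ?_
    rw [Γ₂.flux_eq_zero fun x _ => hV _ fun hx => (hin t₀ _ ht0 hx).1 ⟨x, rfl⟩,
      add_zero, flux, intervalIntegral.integral_of_le (by positivity)]
    congr 1
    refine setIntegral_eq_of_subset_of_forall_sdiff_eq_zero measurableSet_Ioc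
      (Γ₁.bdry_subset _ _) fun x hx => ?_
    rw [hV, zero_mul]
    intro hxV
    refine hx.2 ⟨hx.1, ?_⟩
    refine mem_closure_iff_nhds.2 fun W hW => ?_
    obtain ⟨z, hz, hzi⟩ := mem_closure_iff_nhds.1 (hp1.mem_closure_inside x t₀) _
      (inter_mem hW (isOpen_ball.mem_nhds hxV))
    exact ⟨z, hz.1, (hiff t₀ z ht0 hz.2 h1 h2).2 hzi⟩
  · have e0 : ∀ᶠ t in 𝓝 t₀, |t - t₀| < d := by
      filter_upwards [Metric.ball_mem_nhds t₀ hd0] with t ht using by rwa [mem_ball, Real.dist_eq] at ht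
    have c0 : Continuous fun t : ℝ => ((0 : ℂ), t) := by fun_prop
    filter_upwards [e0, (Γ₁.isOpen_inside_track.preimage c0).mem_nhds h1,
      (Γ₂.isOpen_inside_track.preimage c0).mem_nhds h2] with t ht g1 g2
    rw [hintg t ht g1 g2, hintg t₀ ht0 h1 h2]
    simp

lemma exists_lowerRate (hp1 : Γ₁.Positive) (hp2 : Γ₂.Positive) (h1 : 0 ∈ Γ₁.inside t₀)
    (h2 : 0 ∈ Γ₂.inside t₀) {P : ℂ} (hP : P ∉ Γ₁.curve t₀ ∩ Γ₂.curve t₀) :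
    ∃ V, IsOpen V ∧ P ∈ V ∧ ∀ χ : ℂ → ℝ, ContDiff ℝ ∞ χ → (∀ z, 0 ≤ χ z) →
      HasCompactSupport χ → (∀ z ∉ V, χ z = 0) → LowerRate Γ₁ Γ₂ t₀ χ := by
  by_cases hcl : P ∈ closure (core Γ₁ Γ₂ t₀)
  · by_cases hc1 : P ∈ Γ₁.curve t₀
    · obtain ⟨V, hV, hPV, H⟩ := exists_lowerRate_of_mem_curve hp1 h1 h2 hcl hc1 fun h => hP ⟨hc1, h⟩
      exact ⟨V, hV, hPV, fun χ a _ b c => H χ a b c⟩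
    by_cases hc2 : P ∈ Γ₂.curve t₀
    · rw [core_comm] at hcl
      obtain ⟨V, hV, hPV, H⟩ := exists_lowerRate_of_mem_curve hp2 h2 h1 hcl hc2 hc1
      exact ⟨V, hV, hPV, fun χ a _ b c => (H χ a b c).symm⟩
    · have := core_eventually (mem_core_of_mem_closure hcl hc1 hc2)
      rw [nhds_prod_eq] at this
      obtain ⟨V, hV, pb, hpb, H⟩ := Filter.eventually_prod_iff.1 this
      obtain ⟨U, hU, hUo, hPU⟩ := _root_.mem_nhds_iff.1 hV
      refine ⟨U, hUo, hPU, fun χ _ _ _ hs => lowerRate_of_mem (U := U) ?_ hs⟩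
      filter_upwards [hpb] with t ht z hz
      exact H (hU hz) ht
  · exact ⟨_, isClosed_closure.isOpen_compl, hcl, fun χ _ h0 _ hs =>
      lowerRate_of_notMem_closure (fun z hz hzc => hz (hs z (fun h => h hzc))) h0⟩

theorem lowerRate_of_disjoint (hp1 : Γ₁.Positive) (hp2 : Γ₂.Positive) (h1 : 0 ∈ Γ₁.inside t₀)
    (h2 : 0 ∈ Γ₂.inside t₀) (hχ : ContDiff ℝ ∞ χ) (h0 : ∀ z, 0 ≤ χ z) (hs : HasCompactSupport χ)
    (hd : ∀ z ∈ tsupport χ, z ∉ Γ₁.curve t₀ ∩ Γ₂.curve t₀) : LowerRate Γ₁ Γ₂ t₀ χ := by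
  suffices ∃ U, IsOpen U ∧ tsupport χ ⊆ U ∧ ∀ χ : ℂ → ℝ, ContDiff ℝ ∞ χ → (∀ z, 0 ≤ χ z) →
      HasCompactSupport χ → tsupport χ ⊆ U → LowerRate Γ₁ Γ₂ t₀ χ by
    obtain ⟨U, -, hU, H⟩ := this
    exact H χ hχ h0 hs hU
  refine IsCompact.induction_on (p := fun K => ∃ U, IsOpen U ∧ K ⊆ U ∧ ∀ χ : ℂ → ℝ,
    ContDiff ℝ ∞ χ → (∀ z, 0 ≤ χ z) → HasCompactSupport χ → tsupport χ ⊆ U →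
      LowerRate Γ₁ Γ₂ t₀ χ) hs ?_ ?_ ?_ ?_
  · refine ⟨∅, isOpen_empty, subset_rfl, fun χ _ h0 _ he => ?_⟩
    exact lowerRate_of_notMem_closure (fun z hz => absurd (he (subset_tsupport _ hz)) (by simp)) h0
  · rintro K L hKL ⟨U, hU, hLU, H⟩
    exact ⟨U, hU, hKL.trans hLU, H⟩
  · rintro K L ⟨U, hU, hKU, H⟩ ⟨V, hV, hLV, H'⟩
    refine ⟨U ∪ V, hU.union hV, union_subset_union hKU hLV, fun χ hχ h0 hs hsub => ?_⟩
    have hcl := isClosed_tsupport χ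
    obtain ⟨f, hf0, hf1, hf⟩ := exists_contMDiffMap_zero_one_nhds_of_isClosed (n := (⊤ : ℕ∞))
      (modelWithCornersSelf ℝ ℂ) (s := tsupport χ \ U) (t := tsupport χ \ V)
      (hcl.sdiff hU) (hcl.sdiff hV)
      (disjoint_left.2 fun z hz hz' => (hsub hz.1).elim hz.2 hz'.2)
    have hfs : ContDiff ℝ ∞ f := f.contMDiff.contDiff
    have ha : ContDiff ℝ ∞ fun z => χ z * f z := hχ.mul hfs
    have hb : ContDiff ℝ ∞ fun z => χ z * (1 - f z) := hχ.mul (contDiff_const.sub hfs)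
    have hsa : HasCompactSupport fun z => χ z * f z := hs.mul_right
    have hsb : HasCompactSupport fun z => χ z * (1 - f z) := hs.mul_right
    have hsubl : ∀ g : ℂ → ℝ, tsupport (fun z => χ z * g z) ⊆ tsupport χ := fun g =>
      closure_mono fun z hz h => hz (by simp only [h, zero_mul])
    have key : ∀ (g : ℂ → ℝ) (W : Set ℂ), (∀ᶠ x in 𝓝ˢ (tsupport χ \ W), g x = 0) →
        tsupport (fun z => χ z * g z) ⊆ W := by
      intro g W hg z hz
      by_contra hzW
      have h1 := (eventually_nhdsSet_iff_forall.1 hg) z ⟨hsubl g hz, hzW⟩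
      refine notMem_tsupport_iff_eventuallyEq.2 ?_ hz
      filter_upwards [h1] with y hy
      simp [hy]
    have hA := H _ ha (fun z => mul_nonneg (h0 z) (hf z).1) hsa (key f U hf0)
    have hB := H' _ hb (fun z => mul_nonneg (h0 z) (sub_nonneg.2 (hf z).2)) hsb
      (key (fun z => 1 - f z) V (hf1.mono fun z hz => by rw [hz, sub_self]))
    have := hA.add hB ha.continuous hb.continuous hsa hsb
    refine (congrArg (LowerRate Γ₁ Γ₂ t₀) ?_).mp this
    ext z; ring
  · intro P hP
    obtain ⟨V, hV, hPV, H⟩ := exists_lowerRate hp1 hp2 h1 h2 (hd P hP)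
    exact ⟨V, mem_nhdsWithin_of_mem_nhds (hV.mem_nhds hPV), V, hV, subset_rfl,
      fun χ a b c d => H χ a b c fun z hz => image_eq_zero_of_notMem_tsupport fun h => hz (d h)⟩

end Fam

namespace Fam

variable {Γ₁ Γ₂ : Fam} {t₀ : ℝ} {χ ψ : ℂ → ℝ}

/-- The core at `t₀` only loses swept points shortly after `t₀`. -/
def LosesSwept (Γ₁ Γ₂ : Fam) (t₀ : ℝ) : Prop := ∃ δ > 0, ∀ t ∈ Icc t₀ (t₀ + δ),
  core Γ₁ Γ₂ t₀ ⊆ core Γ₁ Γ₂ t ∪ (Γ₁.F '' (Icc 0 (2 * π) ×ˢ Icc t₀ t) ∪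
      Γ₂.F '' (Icc 0 (2 * π) ×ˢ Icc t₀ t))

/-- The curve spends no time in `Z`. -/
def Avoids (Γ : Fam) (Z : Set ℂ) (t : ℝ) : Prop :=
  volume {x | x ∈ Icc 0 (2 * π) ∧ Γ (x, t) ∈ Z} = 0

lemma Avoids.exists_cthickening {Γ : Fam} {Z : Set ℂ} (hZ : IsClosed Z) (h : Γ.Avoids Z t₀)
    {η : ℝ} (hη : 0 < η) : ∃ r > 0, ∀ r' ≤ r,
      volume {x | x ∈ Icc 0 (2 * π) ∧ Γ (x, t₀) ∈ cthickening r' Z} ≤ ENNReal.ofReal η := by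
  have hm : Measurable fun x : ℝ => Γ (x, t₀) :=
    (by fun_prop : Continuous fun x : ℝ => Γ (x, t₀)).measurable
  set μ : Measure ℂ := (volume.restrict (Icc 0 (2 * π))).map fun x : ℝ => Γ (x, t₀) with hμ
  have hval : ∀ W : Set ℂ, IsClosed W →
      μ W = volume {x | x ∈ Icc 0 (2 * π) ∧ Γ (x, t₀) ∈ W} := by
    intro W hW
    rw [hμ, Measure.map_apply hm hW.measurableSet, Measure.restrict_apply (hm hW.measurableSet)]
    congr 1
    ext x
    exact and_comm
  have ht := tendsto_measure_cthickening_of_isClosed (μ := μ)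
    ⟨1, one_pos, measure_ne_top _ _⟩ hZ
  rw [hval Z hZ, h] at ht
  have he := ht.eventually (gt_mem_nhds (ENNReal.ofReal_pos.2 hη))
  obtain ⟨r, hr, H⟩ := Metric.eventually_nhds_iff.1 he
  refine ⟨r / 2, by positivity, fun r' hr' => ?_⟩
  rw [← hval _ isClosed_cthickening]
  refine (measure_mono (cthickening_mono hr' Z)).trans (H ?_).le
  rw [Real.dist_eq, sub_zero, abs_of_pos (by positivity)]
  linarith

lemma exists_close_time (Γ : Fam) (t₀ : ℝ) {r : ℝ} (hr : 0 < r) :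
    ∀ᶠ t in 𝓝 t₀, ∀ x ∈ Icc 0 (2 * π), dist (Γ (x, t)) (Γ (x, t₀)) < r := by
  have := isCompact_Icc.eventually_forall_of_forall_eventually (X := ℝ) (Y := ℝ)
    (x₀ := t₀) (K := Icc 0 (2 * π)) (P := fun t x => dist (Γ (x, t)) (Γ (x, t₀)) < r) ?_
  · exact this
  · intro x _
    have hc : Continuous fun q : ℝ × ℝ => dist (Γ (q.2, q.1)) (Γ (q.2, t₀)) := by fun_prop
    refine (isOpen_Iio.preimage hc).mem_nhds ?_
    simpa using hr

lemma flux_sub_le {Γ : Fam} {S : Set ℂ} (hS : IsClosed S) (hχ : Continuous χ) (hψ : Continuous ψ)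
    {K η : ℝ} (hη : 0 ≤ η) (hK : 0 ≤ K)
    {W : Set ℂ}
    (hb : ∀ x ∈ Icc 0 (2 * π),
      |(ψ (Γ (x, t₀)) - χ (Γ (x, t₀))) * cr (Γ.vel (x, t₀)) (dt Γ.F (x, t₀))| ≤ K)
    (h0 : ∀ z ∉ W, χ z = ψ z)
    (hm : volume {x | x ∈ Icc 0 (2 * π) ∧ Γ (x, t₀) ∈ W} ≤ ENNReal.ofReal η) :
    Γ.flux S t₀ ψ - K * η ≤ Γ.flux S t₀ χ := by
  have hi : ∀ {g : ℂ → ℝ}, Continuous g → IntegrableOn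
      (fun x : ℝ => g (Γ (x, t₀)) * cr (Γ.vel (x, t₀)) (dt Γ.F (x, t₀))) (Γ.bdry S t₀) :=
    fun hg => Γ.integrableOn_bdry S t₀ (Γ.continuous_flux t₀ hg)
  have h1 : Γ.flux S t₀ χ - Γ.flux S t₀ ψ = ∫ x in Γ.bdry S t₀,
      (ψ (Γ (x, t₀)) - χ (Γ (x, t₀))) * cr (Γ.vel (x, t₀)) (dt Γ.F (x, t₀)) := by
    simp only [flux, sub_mul]
    rw [integral_sub (hi hψ) (hi hχ)]; ring
  set E : Set ℝ := {x | x ∈ Icc 0 (2 * π) ∧ Γ (x, t₀) ∈ W} with hE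
  have h2 : ∫ x in Γ.bdry S t₀,
      (ψ (Γ (x, t₀)) - χ (Γ (x, t₀))) * cr (Γ.vel (x, t₀)) (dt Γ.F (x, t₀)) =
      ∫ x in Γ.bdry S t₀ ∩ E,
      (ψ (Γ (x, t₀)) - χ (Γ (x, t₀))) * cr (Γ.vel (x, t₀)) (dt Γ.F (x, t₀)) := by
    refine setIntegral_eq_of_subset_of_forall_sdiff_eq_zero (Γ.measurableSet_bdry t₀ hS)
      inter_subset_left fun x hx => ?_
    have : Γ (x, t₀) ∉ W := fun h => hx.2 ⟨hx.1, Ioc_subset_Icc_self hx.1.1, h⟩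
    rw [h0 _ this, sub_self, zero_mul]
  have hfin : volume (Γ.bdry S t₀ ∩ E) < ⊤ :=
    (measure_mono inter_subset_right).trans_lt (hm.trans_lt ENNReal.ofReal_lt_top)
  have h3 := norm_setIntegral_le_of_norm_le_const (μ := volume) (s := Γ.bdry S t₀ ∩ E) (C := K)
    (f := fun x => (ψ (Γ (x, t₀)) - χ (Γ (x, t₀))) * cr (Γ.vel (x, t₀)) (dt Γ.F (x, t₀)))
    hfin (fun x hx => hb x hx.2.1)
  have h4 : volume.real (Γ.bdry S t₀ ∩ E) ≤ η :=
    ENNReal.toReal_le_of_le_ofReal hη ((measure_mono inter_subset_right).trans hm)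
  have h5 : K * volume.real (Γ.bdry S t₀ ∩ E) ≤ K * η := by gcongr
  rw [h2] at h1
  rw [Real.norm_eq_abs, ← h1] at h3
  linarith [neg_abs_le (Γ.flux S t₀ χ - Γ.flux S t₀ ψ)]

/-- A one-sided derivative bound for weighted areas of the core. -/
theorem LosesSwept.eventually_le (hp1 : Γ₁.Positive) (hp2 : Γ₂.Positive)
    (hls : LosesSwept Γ₁ Γ₂ t₀) (h1 : 0 ∈ Γ₁.inside t₀)
    (h2 : 0 ∈ Γ₂.inside t₀) (hZ1 : Γ₁.Avoids (Γ₁.curve t₀ ∩ Γ₂.curve t₀) t₀)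
    (hZ2 : Γ₂.Avoids (Γ₁.curve t₀ ∩ Γ₂.curve t₀) t₀)
    (hψ : ContDiff ℝ ∞ ψ) (h0 : ∀ z, 0 ≤ ψ z) (hs : HasCompactSupport ψ) {ε : ℝ} (hε : 0 < ε) :
    ∀ᶠ t in 𝓝[>] t₀, (∫ z in core Γ₁ Γ₂ t₀, ψ z) +
      (Γ₁.flux (closure (core Γ₁ Γ₂ t₀)) t₀ ψ + Γ₂.flux (closure (core Γ₁ Γ₂ t₀)) t₀ ψ - ε) *
        (t - t₀) ≤ ∫ z in core Γ₁ Γ₂ t, ψ z := by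
  set Z := Γ₁.curve t₀ ∩ Γ₂.curve t₀ with hZdef
  have hZ : IsClosed Z := (Γ₁.isClosed_curve t₀).inter (Γ₂.isClosed_curve t₀)
  obtain ⟨δ, hδ, hls⟩ := hls
  obtain ⟨C₁, hC₁, H₁⟩ := Γ₁.exists_swept_bound t₀ (t₀ + 1)
  obtain ⟨C₂, hC₂, H₂⟩ := Γ₂.exists_swept_bound t₀ (t₀ + 1)
  obtain ⟨M, hM⟩ := hψ.continuous.bounded_above_of_compact_support hs
  have hM0 : 0 ≤ M := (norm_nonneg _).trans (hM 0)
  have hKex : ∀ Γ : Fam, ∃ K, ∀ x ∈ Icc 0 (2 * π), ‖cr (Γ.vel (x, t₀)) (dt Γ.F (x, t₀))‖ ≤ K := by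
    intro Γ
    have hc := Γ.continuous_flux t₀ (χ := fun _ => 1) continuous_const
    simp only [one_mul] at hc
    exact isCompact_Icc.exists_bound_of_continuousOn hc.continuousOn
  obtain ⟨K₁, hK₁⟩ := hKex Γ₁
  obtain ⟨K₂, hK₂⟩ := hKex Γ₂
  have h0mem : (0 : ℝ) ∈ Icc 0 (2 * π) := ⟨le_rfl, by positivity⟩
  have hK₁0 : 0 ≤ K₁ := (norm_nonneg _).trans (hK₁ 0 h0mem)
  have hK₂0 : 0 ≤ K₂ := (norm_nonneg _).trans (hK₂ 0 h0mem)
  set η := ε / (2 * (M * (K₁ + K₂ + C₁ + C₂) + 1)) with hη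
  have hden : 0 < M * (K₁ + K₂ + C₁ + C₂) + 1 := by positivity
  have hη0 : 0 < η := by positivity
  have hηε : M * (K₁ + K₂ + C₁ + C₂) * η ≤ ε / 2 := by
    rw [hη, ← mul_div_assoc, div_le_div_iff₀ (by positivity) (by positivity)]
    nlinarith
  obtain ⟨r₁, hr₁, R₁⟩ := hZ1.exists_cthickening hZ hη0
  obtain ⟨r₂, hr₂, R₂⟩ := hZ2.exists_cthickening hZ hη0
  set r := min r₁ r₂ / 3 with hr
  have hr0 : 0 < r := by have := lt_min hr₁ hr₂; positivity
  have hr3 : 3 * r = min r₁ r₂ := by rw [hr]; ring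
  replace R₁ := R₁ (3 * r) (hr3 ▸ min_le_left _ _)
  replace R₂ := R₂ (3 * r) (hr3 ▸ min_le_right _ _)
  have hdisj : Disjoint (cthickening r Z) (thickening (2 * r) Z)ᶜ := by
    rw [disjoint_compl_right_iff_subset]
    exact cthickening_subset_thickening' (by positivity) (by linarith) Z
  obtain ⟨f, hf0, hf1, hf⟩ := exists_contMDiffMap_zero_one_nhds_of_isClosed (n := (⊤ : ℕ∞))
      (modelWithCornersSelf ℝ ℂ) isClosed_cthickening isOpen_thickening.isClosed_compl hdisj
  have hfs : ContDiff ℝ ∞ f := f.contMDiff.contDiff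
  have hfc := hfs.continuous
  have hχ : ContDiff ℝ ∞ fun z => ψ z * f z := hψ.mul hfs
  have hsχ : HasCompactSupport fun z => ψ z * f z := hs.mul_right
  have hf1' : ∀ z ∉ thickening (2 * r) Z, f z = 1 := fun z hz => hf1.self_of_nhdsSet z hz
  have hf1'' : ∀ z ∉ cthickening (3 * r) Z, ψ z * f z = ψ z := fun z hz => by
    rw [hf1' z fun h => hz (thickening_subset_cthickening_of_le (by linarith) Z h), mul_one]
  obtain ⟨l, hl0, hl, hle⟩ := lowerRate_of_disjoint hp1 hp2 h1 h2 hχ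
    (fun z => mul_nonneg (h0 z) (hf z).1) hsχ (by
      intro z hz hzZ
      refine notMem_tsupport_iff_eventuallyEq.2 ?_ hz
      have := (eventually_nhdsSet_iff_forall.1 hf0) z (self_subset_cthickening Z hzZ)
      filter_upwards [this] with y hy
      simp [hy])
  set D := closure (core Γ₁ Γ₂ t₀)
  have hbd : ∀ {Γ : Fam} {K : ℝ},
      (∀ x ∈ Icc 0 (2 * π), ‖cr (Γ.vel (x, t₀)) (dt Γ.F (x, t₀))‖ ≤ K) →
      ∀ x ∈ Icc 0 (2 * π), |(ψ (Γ (x, t₀)) - ψ (Γ (x, t₀)) * f (Γ (x, t₀))) *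
        cr (Γ.vel (x, t₀)) (dt Γ.F (x, t₀))| ≤ M * K := by
    intro Γ K h x hx
    rw [abs_mul]
    refine mul_le_mul ?_ (h x hx) (abs_nonneg _) hM0
    have := hM (Γ (x, t₀))
    rw [← mul_one_sub, abs_mul]
    have g := hf (Γ (x, t₀))
    calc _ ≤ M * 1 := mul_le_mul this (abs_le.2 ⟨by linarith [g.2], by linarith [g.1]⟩)
          (abs_nonneg _) hM0
      _ = M := mul_one M
  have F₁ := flux_sub_le (Γ := Γ₁) (S := D) isClosed_closure hχ.continuous hψ.continuous hη0.le
    (mul_nonneg hM0 hK₁0) (hbd hK₁) hf1'' R₁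
  have F₂ := flux_sub_le (Γ := Γ₂) (S := D) isClosed_closure hχ.continuous hψ.continuous hη0.le
    (mul_nonneg hM0 hK₂0) (hbd hK₂) hf1'' R₂
  have hlin := (hasDerivAt_iff_isLittleO.1 hl).def (half_pos hε)
  have hev : ∀ᶠ t in 𝓝 t₀, ∀ s ∈ Icc t₀ t,
      (∀ x ∈ Icc 0 (2 * π), dist (Γ₁ (x, s)) (Γ₁ (x, t₀)) < r) ∧
      ∀ x ∈ Icc 0 (2 * π), dist (Γ₂ (x, s)) (Γ₂ (x, t₀)) < r := by
    obtain ⟨d, hd, H⟩ := Metric.eventually_nhds_iff.1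
      ((Γ₁.exists_close_time t₀ hr0).and (Γ₂.exists_close_time t₀ hr0))
    filter_upwards [Metric.ball_mem_nhds t₀ hd] with t ht s hs
    refine H (lt_of_le_of_lt ?_ ht)
    rw [Real.dist_eq, Real.dist_eq, abs_of_nonneg (by linarith [hs.1]),
      abs_of_nonneg (by linarith [hs.1, hs.2])]
    linarith [hs.2]
  filter_upwards [hle.filter_mono nhdsWithin_le_nhds, hlin.filter_mono nhdsWithin_le_nhds,
    hev.filter_mono nhdsWithin_le_nhds, self_mem_nhdsWithin,
    show ∀ᶠ t in 𝓝[>] t₀, t ∈ Ioo t₀ (t₀ + min δ 1) from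
      Ioo_mem_nhdsGT (by linarith [lt_min hδ one_pos])] with t e1 e2 e3 e4 e5
  have hh : 0 < t - t₀ := sub_pos.2 e4
  have htδ : t ∈ Icc t₀ (t₀ + δ) := ⟨e5.1.le, by linarith [e5.2, min_le_left δ 1]⟩
  have ht1 : t ≤ t₀ + 1 := by linarith [e5.2, min_le_right δ 1]
  rw [hl0, sub_zero, Real.norm_eq_abs, Real.norm_eq_abs, abs_of_pos hh, smul_eq_mul] at e2
  have e2' := (abs_le.1 e2).1
  have hiψ : Integrable ψ volume := hψ.continuous.integrable_of_hasCompactSupport hs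
  have hiχ : Integrable (fun z => ψ z * f z) volume :=
    hχ.continuous.integrable_of_hasCompactSupport hsχ
  have hiξ : Integrable (fun z => ψ z * (1 - f z)) volume :=
    (hψ.continuous.mul (continuous_const.sub hfc)).integrable_of_hasCompactSupport hs.mul_right
  have hsplit : ∀ S : Set ℂ, ∫ z in S, ψ z =
      (∫ z in S, ψ z * f z) + ∫ z in S, ψ z * (1 - f z) := by
    intro S
    rw [← integral_add hiχ.integrableOn hiξ.integrableOn]
    congr 1; ext z; ring
  have hξ0 : ∀ z, 0 ≤ ψ z * (1 - f z) := fun z => mul_nonneg (h0 z) (sub_nonneg.2 (hf z).2)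
  -- the loss near the crossings
  set Q := (core Γ₁ Γ₂ t₀ ∩ thickening (2 * r) Z) \ core Γ₁ Γ₂ t with hQ
  have hQm : MeasurableSet Q := ((isOpen_core Γ₁ Γ₂ t₀).measurableSet.inter
    isOpen_thickening.measurableSet).diff (isOpen_core Γ₁ Γ₂ t).measurableSet
  have hvol : ∀ {Γ : Fam} {C : ℝ}, 0 < C → (∀ s u, t₀ ≤ s → u ≤ t₀ + 1 →
      ∀ S ⊆ Icc 0 (2 * π), MeasurableSet S →
      volume (Γ.F '' (S ×ˢ Icc s u)) ≤ ENNReal.ofReal C * (volume S * ENNReal.ofReal (u - s))) →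
      volume {x | x ∈ Icc 0 (2 * π) ∧ Γ (x, t₀) ∈ cthickening (3 * r) Z} ≤ ENNReal.ofReal η →
      volume (Γ.F '' ({x | x ∈ Icc 0 (2 * π) ∧ Γ (x, t₀) ∈ cthickening (3 * r) Z} ×ˢ Icc t₀ t)) ≤
        ENNReal.ofReal (C * η * (t - t₀)) := by
    intro Γ C hC H hS
    refine (H t₀ t le_rfl ht1 _ (fun x hx => hx.1) (measurableSet_Icc.inter
      ((isClosed_cthickening.preimage
        (by fun_prop : Continuous fun x : ℝ => Γ (x, t₀))).measurableSet))).trans ?_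
    rw [mul_assoc, ENNReal.ofReal_mul hC.le, ENNReal.ofReal_mul hη0.le]
    gcongr
    exact hS
  have hQsub : Q ⊆ Γ₁.F '' ({x | x ∈ Icc 0 (2 * π) ∧ Γ₁ (x, t₀) ∈ cthickening (3 * r) Z} ×ˢ Icc t₀ t)
      ∪ Γ₂.F '' ({x | x ∈ Icc 0 (2 * π) ∧ Γ₂ (x, t₀) ∈ cthickening (3 * r) Z} ×ˢ Icc t₀ t) := by
    have key : ∀ {Γ : Fam} {x s : ℝ}, dist (Γ (x, s)) (Γ (x, t₀)) < r →
        Γ.F (x, s) ∈ thickening (2 * r) Z → Γ (x, t₀) ∈ cthickening (3 * r) Z := by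
      intro Γ x s hd hz
      obtain ⟨z, hz, hdz⟩ := mem_thickening_iff.1 hz
      refine thickening_subset_cthickening _ _ (mem_thickening_iff.2 ⟨z, hz, ?_⟩)
      have h3 : dist (Γ (x, t₀)) z ≤ dist (Γ (x, s)) (Γ (x, t₀)) + dist (Γ.F (x, s)) z := by
        rw [dist_comm (Γ (x, s))]
        exact dist_triangle _ _ _
      linarith
    rintro p ⟨⟨hp, hpt⟩, hpc⟩
    rcases hls t htδ hp with h | h | h
    · exact absurd h hpc
    · obtain ⟨⟨x, s⟩, hx, rfl⟩ := h
      exact Or.inl ⟨(x, s), ⟨⟨hx.1, key ((e3 s hx.2).1 x hx.1) hpt⟩, hx.2⟩, rfl⟩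
    · obtain ⟨⟨x, s⟩, hx, rfl⟩ := h
      exact Or.inr ⟨(x, s), ⟨⟨hx.1, key ((e3 s hx.2).2 x hx.1) hpt⟩, hx.2⟩, rfl⟩
  have hQvol : volume Q ≤ ENNReal.ofReal ((C₁ + C₂) * η * (t - t₀)) := by
    refine (measure_mono hQsub).trans ((measure_union_le _ _).trans
      ((add_le_add (hvol hC₁ H₁ R₁) (hvol hC₂ H₂ R₂)).trans_eq ?_))
    rw [← ENNReal.ofReal_add (by positivity) (by positivity)]
    congr 1; ring
  have hQreal : volume.real Q ≤ (C₁ + C₂) * η * (t - t₀) :=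
    ENNReal.toReal_le_of_le_ofReal (by positivity) hQvol
  have hQint : ∫ z in Q, ψ z * (1 - f z) ≤ M * ((C₁ + C₂) * η * (t - t₀)) := by
    have h3 := norm_setIntegral_le_of_norm_le_const (μ := volume) (s := Q) (C := M)
      (f := fun z => ψ z * (1 - f z)) (hQvol.trans_lt ENNReal.ofReal_lt_top) (fun z _ => by
        rw [Real.norm_of_nonneg (hξ0 z)]
        have := (le_abs_self _).trans (hM z)
        nlinarith [h0 z, (hf z).1, (hf z).2])
    refine ((le_abs_self _).trans h3).trans ?_
    gcongr
  have hloss : ∫ z in core Γ₁ Γ₂ t₀, ψ z * (1 - f z) ≤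
      (∫ z in core Γ₁ Γ₂ t, ψ z * (1 - f z)) + ∫ z in Q, ψ z * (1 - f z) := by
    have hmt := (isOpen_core Γ₁ Γ₂ t).measurableSet
    rw [← setIntegral_union (disjoint_left.2 fun z hz hz' => hz'.2 hz) hQm hiξ.integrableOn
      hiξ.integrableOn, ← integral_indicator (isOpen_core Γ₁ Γ₂ t₀).measurableSet,
      ← integral_indicator (hmt.union hQm)]
    refine integral_mono (hiξ.indicator (isOpen_core Γ₁ Γ₂ t₀).measurableSet)
      (hiξ.indicator (hmt.union hQm)) fun z => ?_
    by_cases hz : z ∈ core Γ₁ Γ₂ t₀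
    · rw [indicator_of_mem hz]
      by_cases hzt : z ∈ thickening (2 * r) Z
      · rw [indicator_of_mem]
        by_cases hzc : z ∈ core Γ₁ Γ₂ t
        · exact Or.inl hzc
        · exact Or.inr ⟨⟨hz, hzt⟩, hzc⟩
      · rw [hf1' z hzt, sub_self, mul_zero]
        exact indicator_nonneg (fun z _ => hξ0 z) z
    · rw [indicator_of_notMem hz]
      exact indicator_nonneg (fun z _ => hξ0 z) z
  rw [hsplit, hsplit (core Γ₁ Γ₂ t)]
  have hfin : M * (K₁ + K₂ + C₁ + C₂) * η * (t - t₀) ≤ ε / 2 * (t - t₀) := by gcongr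
  have hF : (Γ₁.flux D t₀ ψ + Γ₂.flux D t₀ ψ - M * (K₁ + K₂) * η) * (t - t₀) ≤
      (Γ₁.flux D t₀ (fun z => ψ z * f z) + Γ₂.flux D t₀ fun z => ψ z * f z) * (t - t₀) := by
    refine mul_le_mul_of_nonneg_right ?_ hh.le
    linarith
  nlinarith

end Fam

namespace Fam

/-- The family of translates of a fixed curve. -/
def slide (Γ : Fam) (t₀ : ℝ) (v : ℂ) : Fam :=
  Γ.move (τ := fun _ => t₀) contDiff_const (v := fun s => s • v) (by fun_prop)

section slide

variable {Γ Γ₁ Γ₂ : Fam} {t₀ : ℝ} {v z : ℂ} {s x : ℝ} {ψ : ℂ → ℝ}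

lemma slide_apply : Γ.slide t₀ v (x, s) = Γ (x, t₀) + s • v := rfl

lemma slide_vel : (Γ.slide t₀ v).vel (x, s) = Γ.vel (x, t₀) := Γ.move_vel _ _ x s

lemma slide_dt : dt (Γ.slide t₀ v).F (x, s) = v := by
  have h := (hasDerivAt_id s).smul_const v
  have h2 : deriv (fun s : ℝ => s • v) s = v := by simpa using h.deriv
  rw [slide, move_dt, h2, deriv_const, zero_smul, zero_add]

lemma mem_slide_curve : z ∈ (Γ.slide t₀ v).curve s ↔ z - s • v ∈ Γ.curve t₀ :=
  Γ.mem_move_curve _ _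

lemma mem_slide_inside : z ∈ (Γ.slide t₀ v).inside s ↔ z - s • v ∈ Γ.inside t₀ :=
  Γ.mem_move_inside _ _

lemma Positive.slide (h : Γ.Positive) : (Γ.slide t₀ v).Positive := h.move _ _

lemma mem_slide_core (h : -(s • v) ∈ core Γ₁ Γ₂ t₀) :
    z ∈ core (Γ₁.slide t₀ v) (Γ₂.slide t₀ v) s ↔ z - s • v ∈ core Γ₁ Γ₂ t₀ := by
  constructor
  · intro hz
    have h0 : (0 : ℂ) ∈ core (Γ₁.slide t₀ v) (Γ₂.slide t₀ v) s := by
      refine mem_connectedComponentIn ?_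
      rintro (hc | hc) <;> rw [mem_slide_curve, zero_sub] at hc
      · exact core_subset_compl h (Or.inl hc)
      · exact core_subset_compl h (Or.inr hc)
    have hS : IsPreconnected ((fun w => w - s • v) '' core (Γ₁.slide t₀ v) (Γ₂.slide t₀ v) s) :=
      isPreconnected_connectedComponentIn.image _ (by fun_prop)
    refine mem_core_of_isPreconnected hS ?_ ⟨0, h0, zero_sub _⟩ (mem_image_of_mem _ hz) h
    rintro _ ⟨w, hw, rfl⟩ hc
    refine core_subset_compl hw (hc.imp ?_ ?_) <;> exact mem_slide_curve.2
  · intro hz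
    have hS : IsPreconnected ((fun w => w + s • v) '' core Γ₁ Γ₂ t₀) :=
      isPreconnected_connectedComponentIn.image _ (by fun_prop)
    refine hS.subset_connectedComponentIn ⟨_, h, neg_add_cancel _⟩ ?_ ⟨_, hz, sub_add_cancel _ _⟩
    rintro _ ⟨w, hw, rfl⟩ hc
    refine core_subset_compl hw (hc.imp ?_ ?_) <;> · rw [mem_slide_curve]; simp

lemma slide_core_zero (h : 0 ∈ core Γ₁ Γ₂ t₀) :
    core (Γ₁.slide t₀ v) (Γ₂.slide t₀ v) 0 = core Γ₁ Γ₂ t₀ := by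
  ext z
  rw [mem_slide_core (by simpa using h)]
  simp

lemma eventually_slide_mem (h : 0 ∈ core Γ₁ Γ₂ t₀) (v : ℂ) :
    ∀ᶠ s : ℝ in 𝓝 0, -(s • v) ∈ core Γ₁ Γ₂ t₀ := by
  have hc : Continuous fun s : ℝ => -(s • v) := by fun_prop
  refine ((isOpen_core Γ₁ Γ₂ t₀).preimage hc).mem_nhds ?_
  simpa using h

lemma slide_losesSwept (h : 0 ∈ core Γ₁ Γ₂ t₀) (v : ℂ) :
    LosesSwept (Γ₁.slide t₀ v) (Γ₂.slide t₀ v) 0 := by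
  obtain ⟨d, hd, H⟩ := Metric.eventually_nhds_iff.1 (eventually_slide_mem h v)
  refine ⟨d / 2, by positivity, fun s hs p hp => ?_⟩
  rw [slide_core_zero h] at hp
  by_contra hcon
  simp only [mem_union, not_or] at hcon
  obtain ⟨hc, hs1, hs2⟩ := hcon
  have hsv : -(s • v) ∈ core Γ₁ Γ₂ t₀ := H (by
    rw [Real.dist_eq, sub_zero, abs_of_nonneg hs.1]; linarith [hs.2])
  rw [mem_slide_core hsv] at hc
  have key : ∀ Γ : Fam, p ∉ (Γ.slide t₀ v).F '' (Icc 0 (2 * π) ×ˢ Icc 0 s) →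
      ∀ u ∈ Icc 0 s, p - u • v ∉ Γ.curve t₀ := by
    intro Γ hn u hu hmem
    rw [curve_eq_image] at hmem
    obtain ⟨x, hx, hxp⟩ := hmem
    refine hn ⟨(x, u), ⟨hx, hu⟩, ?_⟩
    change Γ (x, t₀) + u • v = p
    replace hxp : Γ.F (x, t₀) = p - u • v := hxp
    rw [hxp, sub_add_cancel]
  refine hc (mem_core_of_isPreconnected (S := (fun u : ℝ => p - u • v) '' Icc 0 s)
    (isPreconnected_Icc.image _ (by fun_prop)) ?_ ⟨0, left_mem_Icc.2 hs.1, by simp⟩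
    ⟨s, right_mem_Icc.2 hs.1, rfl⟩ hp)
  rintro _ ⟨u, hu, rfl⟩ (hcu | hcu)
  · exact key _ hs1 u hu hcu
  · exact key _ hs2 u hu hcu

lemma hasDerivAt_integral_translate (hψ : ContDiff ℝ ∞ ψ) (hs : HasCompactSupport ψ) {S : Set ℂ}
    (hS : volume S ≠ ⊤) (v : ℂ) :
    HasDerivAt (fun s : ℝ => ∫ z in S, ψ (z + s • v)) (∫ z in S, fderiv ℝ ψ z v) 0 := by
  have hψ1 : ContDiff ℝ 1 ψ := hψ.of_le (by exact_mod_cast le_top)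
  have hf : Continuous (fderiv ℝ ψ) := hψ1.continuous_fderiv one_ne_zero
  obtain ⟨C, hC⟩ := hf.bounded_above_of_compact_support (hs.fderiv ℝ)
  have hfin : Integrable (fun _ : ℂ => C * ‖v‖) (volume.restrict S) :=
    integrableOn_const hS
  have h := (hasDerivAt_integral_of_dominated_loc_of_deriv_le (μ := volume.restrict S)
    (F := fun (s : ℝ) z => ψ (z + s • v)) (F' := fun s z => fderiv ℝ ψ (z + s • v) v)
    (bound := fun _ => C * ‖v‖) (x₀ := 0) univ_mem ?_ ?_ ?_ ?_ hfin ?_).2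
  · simpa using h
  · exact Eventually.of_forall fun s => (hψ.continuous.comp (by fun_prop)).aestronglyMeasurable
  · have hintg : Integrable ψ (volume.restrict S) :=
      (hψ.continuous.integrable_of_hasCompactSupport hs).integrableOn
    simpa using hintg
  · exact ((hf.comp (by fun_prop)).clm_apply continuous_const).aestronglyMeasurable
  · exact Eventually.of_forall fun z s _ => (ContinuousLinearMap.le_opNorm _ _).trans (by
      gcongr; exact hC _)
  · refine Eventually.of_forall fun z s _ => ?_
    have h1 : HasDerivAt (fun s : ℝ => z + s • v) v s := by
      simpa using ((hasDerivAt_id s).smul_const v).const_add z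
    exact HasFDerivAt.comp_hasDerivAt (f := fun s : ℝ => z + s • v) s
      (hψ1.differentiable one_ne_zero _).hasFDerivAt h1

lemma setIntegral_translate (ψ : ℂ → ℝ) (S : Set ℂ) {T : Set ℂ} (hS : MeasurableSet S)
    (hT : MeasurableSet T) (w : ℂ) (h : ∀ z, z ∈ T ↔ z - w ∈ S) :
    ∫ z in T, ψ z = ∫ z in S, ψ (z + w) := by
  rw [← integral_indicator hS, ← integral_indicator hT, ← integral_add_right_eq_self _ w]
  congr 1
  ext z
  have : z + w ∈ T ↔ z ∈ S := by rw [h, add_sub_cancel_right]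
  by_cases hz : z ∈ S
  · rw [indicator_of_mem (this.2 hz), indicator_of_mem hz]
  · rw [indicator_of_notMem (fun h => hz (this.1 h)), indicator_of_notMem hz]

/-- The Gauss--Green formula for the inside of a curve. -/
lemma Positive.integral_fderiv (hp : Γ.Positive) (hψ : ContDiff ℝ ∞ ψ) (hs : HasCompactSupport ψ)
    (v : ℂ) : ∫ z in Γ.inside t₀, fderiv ℝ ψ z v =
      -∫ x in (0 : ℝ)..2 * π, ψ (Γ (x, t₀)) * cr (Γ.vel (x, t₀)) v := by
  have h1 := (Γ.slide t₀ v).hasDerivAt_integral_mul_wn hψ hs 0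
  have h2 := hasDerivAt_integral_translate hψ hs (Γ.volume_inside_ne_top t₀) v
  have e : (fun s : ℝ => ∫ z, ψ z * (Γ.slide t₀ v).wn z s) =
      fun s : ℝ => ∫ z in Γ.inside t₀, ψ (z + s • v) := by
    ext s
    rw [hp.slide.integral_mul_wn_eq]
    exact setIntegral_translate _ _ (Γ.isOpen_inside _).measurableSet
      ((Γ.slide t₀ v).isOpen_inside _).measurableSet _ fun z => mem_slide_inside
  rw [e] at h1
  rw [h2.unique h1]
  simp only [slide_apply, slide_vel, slide_dt, zero_smul, add_zero]

/-- The flux of a constant vector field with weight `ψ` through part of a curve. -/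
def push (Γ : Fam) (S : Set ℂ) (t : ℝ) (v : ℂ) (ψ : ℂ → ℝ) : ℝ :=
  ∫ x in Γ.bdry S t, ψ (Γ (x, t)) * cr (Γ.vel (x, t)) v

lemma continuous_push (hψ : Continuous ψ) (v : ℂ) (t : ℝ) :
    Continuous fun x : ℝ => ψ (Γ (x, t)) * cr (Γ.vel (x, t)) v := by
  have h2 := Γ.continuous_vel
  have h3 := Γ.continuous
  exact (hψ.comp (by fun_prop)).mul (Continuous.cr (by fun_prop) continuous_const)

lemma push_le_of_nonneg (hp1 : Γ₁.Positive) (hp2 : Γ₂.Positive) (h1 : 0 ∈ Γ₁.inside t₀)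
    (h2 : 0 ∈ Γ₂.inside t₀) (hZ1 : Γ₁.Avoids (Γ₁.curve t₀ ∩ Γ₂.curve t₀) t₀)
    (hZ2 : Γ₂.Avoids (Γ₁.curve t₀ ∩ Γ₂.curve t₀) t₀)
    (hψ : ContDiff ℝ ∞ ψ) (h0 : ∀ z, 0 ≤ ψ z) (hs : HasCompactSupport ψ) (v : ℂ) :
    -(Γ₁.push (closure (core Γ₁ Γ₂ t₀)) t₀ v ψ + Γ₂.push (closure (core Γ₁ Γ₂ t₀)) t₀ v ψ) ≤
      ∫ z in core Γ₁ Γ₂ t₀, fderiv ℝ ψ z v := by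
  have hc0 := zero_mem_core h1 h2
  have hcz : ∀ Γ : Fam, (Γ.slide t₀ v).curve 0 = Γ.curve t₀ := fun Γ => by
    ext z; rw [mem_slide_curve, zero_smul, sub_zero]
  have hin : ∀ {Γ : Fam}, 0 ∈ Γ.inside t₀ → 0 ∈ (Γ.slide t₀ v).inside 0 := fun h => by
    rw [mem_slide_inside]; simpa using h
  have hav : ∀ {Γ : Fam} {Z}, Γ.Avoids Z t₀ → (Γ.slide t₀ v).Avoids Z 0 := fun h => by
    simpa [Avoids, slide_apply] using h
  have hder := hasDerivAt_integral_translate hψ hs (volume_core_ne_top h1 h2) v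
  refine le_of_forall_pos_le_add fun ε hε => ?_
  have hev := (slide_losesSwept hc0 v).eventually_le hp1.slide hp2.slide (hin h1) (hin h2)
    (by rw [hcz, hcz]; exact hav hZ1) (by rw [hcz, hcz]; exact hav hZ2) hψ h0 hs (half_pos hε)
  have hflux : ∀ (Γ : Fam) S, (Γ.slide t₀ v).flux S 0 ψ = -Γ.push S t₀ v ψ := by
    intro Γ S
    simp only [flux, push, bdry, slide_apply, slide_vel, slide_dt, zero_smul, add_zero]
  rw [slide_core_zero hc0, hflux, hflux] at hev
  have hlin := (hasDerivAt_iff_isLittleO.1 hder).def (half_pos hε)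
  obtain ⟨s, e1, e2, e3, e4⟩ := (hev.and ((hlin.filter_mono nhdsWithin_le_nhds).and
    (((eventually_slide_mem hc0 v).filter_mono nhdsWithin_le_nhds).and
      self_mem_nhdsWithin))).exists
  have hs0 : 0 < s := e4
  rw [setIntegral_translate ψ (core Γ₁ Γ₂ t₀) (isOpen_core _ _ _).measurableSet
    (isOpen_core _ _ _).measurableSet (s • v) (fun z => mem_slide_core e3)] at e1
  simp only [zero_smul, add_zero, sub_zero, smul_eq_mul, Real.norm_eq_abs, abs_of_pos hs0] at e1 e2
  have e2' := (abs_le.1 e2).2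
  by_contra! hcon
  nlinarith

lemma push_le (hp1 : Γ₁.Positive) (hp2 : Γ₂.Positive) (h1 : 0 ∈ Γ₁.inside t₀)
    (h2 : 0 ∈ Γ₂.inside t₀) (hZ1 : Γ₁.Avoids (Γ₁.curve t₀ ∩ Γ₂.curve t₀) t₀)
    (hZ2 : Γ₂.Avoids (Γ₁.curve t₀ ∩ Γ₂.curve t₀) t₀)
    (hψ : ContDiff ℝ ∞ ψ) (hs : HasCompactSupport ψ) (v : ℂ) :
    -(Γ₁.push (closure (core Γ₁ Γ₂ t₀)) t₀ v ψ + Γ₂.push (closure (core Γ₁ Γ₂ t₀)) t₀ v ψ) ≤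
      ∫ z in core Γ₁ Γ₂ t₀, fderiv ℝ ψ z v := by
  set D := closure (core Γ₁ Γ₂ t₀)
  obtain ⟨R₁, hR₁0, hR₁⟩ := hs.isCompact.exists_norm_bound
  obtain ⟨R₂, hR₂0, hR₂⟩ := (Γ₁.isCompact_curve t₀).exists_norm_bound
  obtain ⟨M, hM⟩ := hψ.continuous.bounded_above_of_compact_support hs
  have hM0 : 0 ≤ M := (norm_nonneg _).trans (hM 0)
  set R := max R₁ R₂ with hR
  have hR0 : 0 < R := lt_max_of_lt_left hR₁0
  let β : ContDiffBump (0 : ℂ) := ⟨R, R + 1, hR0, by linarith⟩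
  have hβ : ContDiff ℝ ∞ β := β.contDiff
  have hβ1 : ∀ z, ‖z‖ ≤ R → β z = 1 := fun z hz =>
    β.one_of_mem_closedBall (by simpa using hz)
  have hcore : ∀ z ∈ core Γ₁ Γ₂ t₀, ‖z‖ < R := fun z hz => by
    have := Γ₁.inside_subset_ball hR₂ (core_subset_inside h1 h2 hz)
    rw [mem_ball_zero_iff] at this
    exact this.trans_le (le_max_right _ _)
  have hβ' : ∀ v, ∀ z ∈ core Γ₁ Γ₂ t₀, fderiv ℝ β z v = 0 := fun v z hz => by
    have : (β : ℂ → ℝ) =ᶠ[𝓝 z] fun _ => 1 := by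
      filter_upwards [isOpen_ball.mem_nhds (mem_ball_zero_iff.2 (hcore z hz))] with y hy
      exact hβ1 y (mem_ball_zero_iff.1 hy).le
    rw [this.fderiv_eq]
    simp
  have hb : ∀ v, 0 ≤ Γ₁.push D t₀ v β + Γ₂.push D t₀ v β := fun v => by
    have := push_le_of_nonneg hp1 hp2 h1 h2 hZ1 hZ2 hβ (fun z => β.nonneg) β.hasCompactSupport v
    rw [setIntegral_eq_zero_of_forall_eq_zero (hβ' v)] at this
    linarith
  have hneg : ∀ Γ : Fam, Γ.push D t₀ (-v) β = -Γ.push D t₀ v β := fun Γ => by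
    simp only [push, cr_neg_right, mul_neg, integral_neg]
  have hb0 : Γ₁.push D t₀ v β + Γ₂.push D t₀ v β = 0 := by
    have g1 := hb v
    have g2 := hb (-v)
    rw [hneg, hneg] at g2
    linarith
  have hadd : ∀ Γ : Fam, Γ.push D t₀ v (fun z => ψ z + M * β z) =
      Γ.push D t₀ v ψ + M * Γ.push D t₀ v β := fun Γ => by
    simp only [push, add_mul, mul_assoc]
    rw [integral_add (Γ.integrableOn_bdry D t₀ (continuous_push hψ.continuous v t₀))
      ((Γ.integrableOn_bdry D t₀ (continuous_push hβ.continuous v t₀)).const_mul M),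
      integral_const_mul]
  have hmain := push_le_of_nonneg hp1 hp2 h1 h2 hZ1 hZ2 (hψ.add (contDiff_const.mul hβ))
    (ψ := fun z => ψ z + M * β z) (fun z => by
      by_cases hz : z ∈ tsupport ψ
      · rw [hβ1 z ((hR₁ z hz).le.trans (le_max_left _ _)), mul_one]
        linarith [neg_le_of_abs_le (hM z)]
      · rw [image_eq_zero_of_notMem_tsupport hz, zero_add]
        exact mul_nonneg hM0 β.nonneg)
    (hs.add β.hasCompactSupport.mul_left) v
  rw [hadd, hadd, setIntegral_congr_fun (isOpen_core Γ₁ Γ₂ t₀).measurableSet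
    (g := fun z => fderiv ℝ ψ z v) fun z hz => ?_] at hmain
  · have : M * (Γ₁.push D t₀ v β + Γ₂.push D t₀ v β) = 0 := by rw [hb0, mul_zero]
    linarith
  · have hd1 := (hψ.differentiable (by simp) z)
    have hd2 := (hβ.differentiable (by simp) z)
    change fderiv ℝ (fun z => ψ z + M * β z) z v = _
    rw [fderiv_fun_add hd1 (hd2.const_mul M), fderiv_const_mul hd2]
    simp [hβ' v z hz]

end slide

end Fam

namespace Fam

variable {Γ₁ Γ₂ : Fam} {t₀ : ℝ}

lemma exists_bump {r R : ℝ} (hr : 0 < r) (hR : r < R) : ∃ β : ℂ → ℝ, ContDiff ℝ ∞ β ∧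
    HasCompactSupport β ∧ (∀ z, 0 ≤ β z) ∧ (∀ z, ‖z‖ ≤ r → β z = 1) ∧ ∀ z, R ≤ ‖z‖ → β z = 0 := by
  let β : ContDiffBump (0 : ℂ) := ⟨r, R, hr, hR⟩
  exact ⟨β, β.contDiff, β.hasCompactSupport, fun z => β.nonneg,
    fun z hz => β.one_of_mem_closedBall (mem_closedBall_zero_iff.2 hz),
    fun z hz => β.zero_of_le_dist (by rwa [dist_zero_right])⟩

lemma exists_inv_cutoff {ρ R : ℝ} (hρ : 0 < ρ) (hR : 0 < R) : ∃ ψ χ : ℂ → ℝ,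
    ContDiff ℝ ∞ ψ ∧ HasCompactSupport ψ ∧ ContDiff ℝ ∞ χ ∧ HasCompactSupport χ ∧
    ∀ z, ρ ≤ ‖z‖ → ‖z‖ < R → ψ z = (z⁻¹).re ∧ χ z = -(z⁻¹).im ∧
      fderiv ℝ ψ z 1 + fderiv ℝ χ z Complex.I = 0 := by
  obtain ⟨β, hβ, hβs, -, hβ1, -⟩ := exists_bump hR (lt_add_one R)
  obtain ⟨b, hb, -, -, hb1, hb0⟩ := exists_bump (show 0 < ρ / 4 by linarith)
    (show ρ / 4 < ρ / 2 by linarith)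
  obtain ⟨f, hfdef⟩ : ∃ f : ℂ → ℂ, f = fun z => (β z * (1 - b z)) • z⁻¹ := ⟨_, rfl⟩
  have hf : ContDiff ℝ ∞ f := by
    refine contDiff_iff_contDiffAt.2 fun z => ?_
    by_cases hz : z = 0
    · have h0 : f =ᶠ[𝓝 z] fun _ => 0 := by
        filter_upwards [isOpen_ball.mem_nhds (show z ∈ ball (0 : ℂ) (ρ / 4) by simp [hz, hρ])]
          with y hy
        have : b y = 1 := hb1 y (mem_ball_zero_iff.1 hy).le
        simp [hfdef, this]
      exact contDiffAt_const.congr_of_eventuallyEq h0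
    · have g1 : ContDiffAt ℝ ∞ (fun z => β z * (1 - b z)) z :=
        (hβ.mul (contDiff_const.sub hb)).contDiffAt
      have g2 : ContDiffAt ℝ ∞ (fun z : ℂ => z⁻¹) z := contDiffAt_inv ℝ hz
      rw [hfdef]
      exact g1.smul g2
  have hfs : HasCompactSupport f := by
    rw [hfdef]
    exact (hβs.mul_right (f' := fun z => 1 - b z)).smul_right
  have hloc : ∀ z, ρ ≤ ‖z‖ → ‖z‖ < R → f =ᶠ[𝓝 z] fun z => z⁻¹ := fun z h1 h2 => by
    have hc : Continuous fun z : ℂ => ‖z‖ := continuous_norm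
    filter_upwards [hc.continuousAt.eventually (lt_mem_nhds (show ρ / 2 < ‖z‖ by linarith)),
      hc.continuousAt.eventually (gt_mem_nhds h2)] with y hy1 hy2
    have e1 : β y = 1 := hβ1 y hy2.le
    have e2 : b y = 0 := hb0 y hy1.le
    simp [hfdef, e1, e2]
  have c1 : ContDiff ℝ ∞ fun z => (f z).re := Complex.reCLM.contDiff.comp hf
  have c2 : ContDiff ℝ ∞ fun z => (f z).im := Complex.imCLM.contDiff.comp hf
  have s1 : HasCompactSupport fun z => (f z).re :=
    hfs.comp_left (g := Complex.re) Complex.zero_re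
  have s2 : HasCompactSupport fun z => -(f z).im :=
    (hfs.comp_left (g := Complex.im) Complex.zero_im).comp_left (g := fun u : ℝ => -u) neg_zero
  refine ⟨fun z => (f z).re, fun z => -(f z).im, c1, s1, c2.neg, s2, fun z h1 h2 => ?_⟩
  have he := hloc z h1 h2
  have hz : z ≠ 0 := norm_pos_iff.1 (hρ.trans_le h1)
  refine ⟨congrArg Complex.re he.self_of_nhds,
    congrArg (fun z => -Complex.im z) he.self_of_nhds, ?_⟩
  have hd : HasFDerivAt f ((ContinuousLinearMap.toSpanSingleton ℂ (-(z ^ 2)⁻¹)).restrictScalars ℝ)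
      z := ((hasDerivAt_inv hz).hasFDerivAt.restrictScalars ℝ).congr_of_eventuallyEq he
  have d1 := Complex.reCLM.hasFDerivAt.comp z hd
  have d2 := (Complex.imCLM.hasFDerivAt.comp z hd).neg
  have e1 : fderiv ℝ (fun z => (f z).re) z = _ := d1.fderiv
  have e2 : fderiv ℝ (fun z => -(f z).im) z = _ := d2.fderiv
  rw [e1, e2]
  simp

/-- The boundary of the core winds at most once around the origin. -/
lemma core_winding_le (hp1 : Γ₁.Positive) (hp2 : Γ₂.Positive) (h1 : 0 ∈ Γ₁.inside t₀)
    (h2 : 0 ∈ Γ₂.inside t₀) (hZ1 : Γ₁.Avoids (Γ₁.curve t₀ ∩ Γ₂.curve t₀) t₀)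
    (hZ2 : Γ₂.Avoids (Γ₁.curve t₀ ∩ Γ₂.curve t₀) t₀) :
    (∫ x in Γ₁.bdry (closure (core Γ₁ Γ₂ t₀)) t₀, (Γ₁.vel (x, t₀) / Γ₁ (x, t₀)).im) +
      ∫ x in Γ₂.bdry (closure (core Γ₁ Γ₂ t₀)) t₀, (Γ₂.vel (x, t₀) / Γ₂ (x, t₀)).im ≤ 2 * π := by
  set D := closure (core Γ₁ Γ₂ t₀)
  obtain ⟨ρ, hρ, hb⟩ := Metric.isOpen_iff.1 (isOpen_core Γ₁ Γ₂ t₀) 0 (zero_mem_core h1 h2)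
  obtain ⟨R₁, hR₁0, hR₁⟩ := (Γ₁.isCompact_curve t₀).exists_norm_bound
  obtain ⟨R₂, hR₂0, hR₂⟩ := (Γ₂.isCompact_curve t₀).exists_norm_bound
  obtain ⟨ψ, χ, hψ, hψs, hχ, hχs, H⟩ := exists_inv_cutoff hρ (R := max R₁ R₂)
    (lt_max_of_lt_left hR₁0)
  have hout : ∀ z ∉ core Γ₁ Γ₂ t₀, ρ ≤ ‖z‖ := fun z hz => by
    by_contra! h
    exact hz (hb (mem_ball_zero_iff.2 h))
  have hon : ∀ Γ : Fam, (∀ x, Γ (x, t₀) ∉ core Γ₁ Γ₂ t₀ ∧ ‖Γ (x, t₀)‖ < max R₁ R₂) → ∀ x,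
      ψ (Γ (x, t₀)) * cr (Γ.vel (x, t₀)) 1 + χ (Γ (x, t₀)) * cr (Γ.vel (x, t₀)) Complex.I =
        -(Γ.vel (x, t₀) / Γ (x, t₀)).im := by
    intro Γ h x
    obtain ⟨e1, e2, -⟩ := H _ (hout _ (h x).1) (h x).2
    rw [e1, e2, div_eq_mul_inv, Complex.mul_im]
    simp only [cr, Complex.one_re, Complex.one_im, Complex.I_re, Complex.I_im]
    ring
  have hΓ₁ : ∀ x, Γ₁ (x, t₀) ∉ core Γ₁ Γ₂ t₀ ∧ ‖Γ₁ (x, t₀)‖ < max R₁ R₂ := fun x =>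
    ⟨fun h => core_subset_compl h (Or.inl (Γ₁.mem_curve x t₀)),
      (hR₁ _ (Γ₁.mem_curve x t₀)).trans_le (le_max_left _ _)⟩
  have hΓ₂ : ∀ x, Γ₂ (x, t₀) ∉ core Γ₁ Γ₂ t₀ ∧ ‖Γ₂ (x, t₀)‖ < max R₁ R₂ := fun x =>
    ⟨fun h => core_subset_compl h (Or.inr (Γ₂.mem_curve x t₀)),
      (hR₂ _ (Γ₂.mem_curve x t₀)).trans_le (le_max_right _ _)⟩
  have hpush : ∀ Γ : Fam, (∀ x, Γ (x, t₀) ∉ core Γ₁ Γ₂ t₀ ∧ ‖Γ (x, t₀)‖ < max R₁ R₂) →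
      ∫ x in Γ.bdry D t₀, (Γ.vel (x, t₀) / Γ (x, t₀)).im =
        -(Γ.push D t₀ 1 ψ + Γ.push D t₀ Complex.I χ) := by
    intro Γ h
    rw [push, push, ← integral_add (Γ.integrableOn_bdry D t₀ (continuous_push hψ.continuous _ _))
      (Γ.integrableOn_bdry D t₀ (continuous_push hχ.continuous _ _)), ← integral_neg]
    simp only [hon Γ h, neg_neg]
  have hintg : ∀ {φ : ℂ → ℝ} {S : Set ℂ} (v : ℂ), ContDiff ℝ ∞ φ → HasCompactSupport φ →
      IntegrableOn (fun z => fderiv ℝ φ z v) S := fun v h hs =>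
    ((((h.of_le (by exact_mod_cast le_top : (1 : WithTop ℕ∞) ≤ ∞)).continuous_fderiv
      one_ne_zero).clm_apply continuous_const).integrable_of_hasCompactSupport
      (hs.fderiv_apply ℝ v)).integrableOn
  have g1 := push_le hp1 hp2 h1 h2 hZ1 hZ2 hψ hψs 1
  have g2 := push_le hp1 hp2 h1 h2 hZ1 hZ2 hχ hχs Complex.I
  have hdiv : (∫ z in core Γ₁ Γ₂ t₀, (fderiv ℝ ψ z 1 + fderiv ℝ χ z Complex.I)) =
      ∫ z in Γ₁.inside t₀, (fderiv ℝ ψ z 1 + fderiv ℝ χ z Complex.I) := by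
    refine (setIntegral_eq_of_subset_of_forall_sdiff_eq_zero
      (Γ₁.isOpen_inside t₀).measurableSet (core_subset_inside h1 h2) fun z hz => ?_).symm
    have := Γ₁.inside_subset_ball hR₁ hz.1
    exact (H z (hout z hz.2) ((mem_ball_zero_iff.1 this).trans_le (le_max_left _ _))).2.2
  rw [integral_add (hintg _ hψ hψs) (hintg _ hχ hχs), integral_add (hintg _ hψ hψs) (hintg _ hχ hχs),
    hp1.integral_fderiv hψ hψs, hp1.integral_fderiv hχ hχs, ← neg_add,
    ← intervalIntegral.integral_add ((continuous_push hψ.continuous _ _).intervalIntegrable _ _)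
      ((continuous_push hχ.continuous _ _).intervalIntegrable _ _),
    intervalIntegral.integral_congr (fun x _ => hon Γ₁ hΓ₁ x), intervalIntegral.integral_neg,
    neg_neg] at hdiv
  have hwn : ∫ x in (0 : ℝ)..2 * π, (Γ₁.vel (x, t₀) / Γ₁ (x, t₀)).im = 2 * π := by
    have := h1.2
    rw [wn] at this
    simp only [sub_zero] at this
    have hpi : (2 * π) ≠ 0 := by positivity
    field_simp at this
    linarith
  rw [hpush _ hΓ₁, hpush _ hΓ₂]
  linarith

end Fam

namespace Fam

/-- The part in `S` of the integral of the derivative of a localized function on a curve. -/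
def locInt (Γ : Fam) (S : Set ℂ) (t : ℝ) (φ : ℂ → ℝ) (H : ℝ → ℝ) : ℝ :=
  ∫ x in Γ.bdry S t, deriv (fun y => φ (Γ (y, t)) * H y) x

section locInt

variable {Γ : Fam} {S : Set ℂ} {t x₀ : ℝ} {φ : ℂ → ℝ} {H : ℝ → ℝ}

lemma contDiff_loc (hφ : ContDiff ℝ ∞ φ) (hH : ContDiff ℝ 1 H) :
    ContDiff ℝ 1 fun y => φ (Γ (y, t)) * H y := by
  have h1 : ContDiff ℝ ∞ fun y : ℝ => Γ (y, t) := Γ.smooth.comp (by fun_prop)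
  exact ((hφ.comp h1).of_le (by exact_mod_cast le_top)).mul hH

lemma continuous_deriv_loc (hφ : ContDiff ℝ ∞ φ) (hH : ContDiff ℝ 1 H) :
    Continuous (deriv fun y => φ (Γ (y, t)) * H y) :=
  (contDiff_loc hφ hH).continuous_deriv le_rfl

lemma locInt_sum {ι : Type*} (s : Finset ι) {f : ι → ℂ → ℝ} (hf : ∀ i, ContDiff ℝ ∞ (f i))
    (hH : ContDiff ℝ 1 H) (hφ : ∀ x, ∑ i ∈ s, f i (Γ (x, t)) = φ (Γ (x, t))) :
    Γ.locInt S t φ H = ∑ i ∈ s, Γ.locInt S t (f i) H := by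
  unfold locInt
  rw [← integral_finsetSum _ fun i _ => Γ.integrableOn_bdry S t (continuous_deriv_loc (hf i) hH)]
  congr 1
  ext x
  rw [← deriv_fun_sum fun i _ => ((contDiff_loc (hf i) hH).differentiable one_ne_zero) x]
  congr 1
  ext y
  rw [← Finset.sum_mul, hφ]

lemma locInt_eq_zero (h : ∀ x, Γ (x, t) ∉ tsupport φ ∨ Γ (x, t) ∉ S) :
    Γ.locInt S t φ H = 0 := by
  refine setIntegral_eq_zero_of_forall_eq_zero fun x hx => ?_
  have h0 : (fun y => φ (Γ (y, t)) * H y) =ᶠ[𝓝 x] fun _ => 0 := by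
    have h1 := notMem_tsupport_iff_eventuallyEq.1 ((h x).resolve_right fun h => h hx.2)
    have hc : Continuous fun y : ℝ => Γ (y, t) := by fun_prop
    filter_upwards [hc.continuousAt.eventually h1] with y hy
    rw [hy]; simp
  rw [h0.deriv_eq, deriv_const]

open scoped Classical in
lemma exists_locInt_eq {a b : Prop} (hS : IsClosed S)
    (ha : ∀ᶠ x in 𝓝[>] x₀, Γ (x, t) ∈ S ↔ a) (hb : ∀ᶠ x in 𝓝[<] x₀, Γ (x, t) ∈ S ↔ b) :
    ∃ V, IsOpen V ∧ Γ (x₀, t) ∈ V ∧ ∀ (φ : ℂ → ℝ) (H : ℝ → ℝ), ContDiff ℝ ∞ φ → ContDiff ℝ 1 H →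
      Function.Periodic H (2 * π) → tsupport φ ⊆ V → Γ.locInt S t φ H =
        ((if b then 1 else 0) - (if a then 1 else 0)) * (φ (Γ (x₀, t)) * H x₀) := by
  obtain ⟨u₁, hu₁, hu₁'⟩ := mem_nhdsGT_iff_exists_Ioo_subset.1 ha
  obtain ⟨u₂, hu₂, hu₂'⟩ := mem_nhdsLT_iff_exists_Ioo_subset.1 hb
  simp only [mem_Ioi, mem_Iio] at hu₁ hu₂
  obtain ⟨δ, hδ0, hδπ, hδ1, hδ2⟩ : ∃ δ : ℝ, 0 < δ ∧ δ ≤ π ∧ x₀ + δ ≤ u₁ ∧ u₂ ≤ x₀ - δ :=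
    ⟨min π (min (u₁ - x₀) (x₀ - u₂)), by
      refine lt_min pi_pos (lt_min ?_ ?_) <;> linarith, min_le_left _ _,
      by linarith [(min_le_right π (min (u₁ - x₀) (x₀ - u₂))).trans (min_le_left _ _)],
      by linarith [(min_le_right π (min (u₁ - x₀) (x₀ - u₂))).trans (min_le_right _ _)]⟩
  have hcl := (show Continuous fun z : ℂ => (z, t) by fun_prop).continuousAt.eventually
    (Γ.close x₀ t hδ0)
  obtain ⟨V, hV, hVo, hxV⟩ := _root_.mem_nhds_iff.1 hcl
  refine ⟨V, hVo, hxV, fun φ H hφ hH hper hsupp => ?_⟩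
  have hfar : ∀ x ∈ Icc (x₀ + δ) (x₀ - δ + 2 * π), Γ (x, t) ∉ tsupport φ := by
    intro x hx hxs
    obtain ⟨k, hk⟩ := hV (hsupp hxs) x rfl
    rw [abs_lt] at hk
    have k1 : (k : ℝ) < 0 := by
      by_contra! h
      nlinarith [hx.1, hx.2, pi_pos]
    have k2 : (-1 : ℝ) < k := by
      by_contra! h
      nlinarith [hx.1, hx.2, pi_pos]
    have k1' : k < 0 := by exact_mod_cast k1
    have k2' : -1 < k := by exact_mod_cast k2
    omega
  obtain ⟨u, hu⟩ : ∃ u : ℝ → ℝ, u = fun y => φ (Γ (y, t)) * H y := ⟨_, rfl⟩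
  have huc : ContDiff ℝ 1 u := hu ▸ contDiff_loc hφ hH
  have hud : Continuous (deriv u) := huc.continuous_deriv le_rfl
  have huper : Function.Periodic u (2 * π) := fun y => by rw [hu]; simp only [Γ.per, hper y]
  have hu0 : ∀ x ∈ Icc (x₀ + δ) (x₀ - δ + 2 * π), u x = 0 := fun x hx => by
    rw [hu]
    simp only [image_eq_zero_of_notMem_tsupport (hfar x hx), zero_mul]
  have hdu0 : ∀ x ∈ Icc (x₀ + δ) (x₀ - δ + 2 * π), deriv u x = 0 := fun x hx => by
    have h0 : u =ᶠ[𝓝 x] fun _ => 0 := by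
      have h1 := notMem_tsupport_iff_eventuallyEq.1 (hfar x hx)
      have hc : Continuous fun y : ℝ => Γ (y, t) := by fun_prop
      filter_upwards [hc.continuousAt.eventually h1] with y hy
      rw [hu]; simp only [hy, Pi.zero_apply, zero_mul]
    rw [h0.deriv_eq, deriv_const]
  have hR0 : u (x₀ + δ) = 0 := hu0 _ ⟨le_rfl, by linarith⟩
  have hL0 : u (x₀ - δ) = 0 := by
    rw [← huper]; exact hu0 _ ⟨by linarith, le_rfl⟩
  have hJc : IsClosed {x : ℝ | Γ (x, t) ∈ S} :=
    hS.preimage (by fun_prop : Continuous fun x : ℝ => Γ (x, t))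
  set J : Set ℝ := {x : ℝ | Γ (x, t) ∈ S} with hJ
  have hintg : ∀ c d, IntervalIntegrable (J.indicator (deriv u)) volume c d := fun c d =>
    ⟨(hud.integrableOn_Ioc (a := c) (b := d)).indicator hJc.measurableSet,
      (hud.integrableOn_Ioc (a := d) (b := c)).indicator hJc.measurableSet⟩
  have hiper : Function.Periodic (J.indicator (deriv u)) (2 * π) := fun x => by
    have hd : deriv u (x + 2 * π) = deriv u x := by
      rw [← deriv_comp_add_const u (2 * π) x]
      congr 1
      ext y; exact huper y
    by_cases hx : x ∈ J
    · rw [indicator_of_mem hx, indicator_of_mem (by rw [hJ, mem_ofPred_eq, Γ.per]; exact hx), hd]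
    · rw [indicator_of_notMem hx, indicator_of_notMem (by rw [hJ, mem_ofPred_eq, Γ.per]; exact hx)]
  have e1 : Γ.locInt S t φ H = ∫ x in (0 : ℝ)..0 + 2 * π, J.indicator (deriv u) x := by
    rw [zero_add, intervalIntegral.integral_of_le (by positivity), setIntegral_indicator
      hJc.measurableSet, locInt, hu]
    rfl
  have side : ∀ {c d : ℝ} {p : Prop}, c ≤ d → (∀ x ∈ Ioo c d, x ∈ J ↔ p) →
      ∫ x in c..d, J.indicator (deriv u) x = (if p then 1 else 0) * (u d - u c) := by
    intro c d p hcd h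
    have hftc : ∫ x in c..d, deriv u x = u d - u c :=
      intervalIntegral.integral_deriv_eq_sub
        (fun x _ => huc.differentiable one_ne_zero x) (hud.intervalIntegrable _ _)
    rw [← hftc, ← intervalIntegral.integral_const_mul, intervalIntegral.integral_of_le hcd,
      intervalIntegral.integral_of_le hcd, integral_Ioc_eq_integral_Ioo,
      integral_Ioc_eq_integral_Ioo]
    refine setIntegral_congr_fun measurableSet_Ioo fun x hx => ?_
    by_cases hp : p
    · simp only [indicator_of_mem ((h x hx).2 hp), if_pos hp, one_mul]
    · simp only [indicator_of_notMem (fun g => hp ((h x hx).1 g)), if_neg hp, zero_mul]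
  rw [e1, hiper.intervalIntegral_add_eq 0 (x₀ - δ),
    ← intervalIntegral.integral_add_adjacent_intervals (hintg (x₀ - δ) (x₀ + δ)) (hintg _ _),
    ← intervalIntegral.integral_add_adjacent_intervals (hintg (x₀ - δ) x₀) (hintg _ _),
    side (p := b) (by linarith) fun x hx => hu₂' ⟨by linarith [hx.1], hx.2⟩,
    side (p := a) (by linarith) fun x hx => hu₁' ⟨hx.1, by linarith [hx.2]⟩, hR0, hL0]
  rw [intervalIntegral.integral_of_le (by linarith),
    setIntegral_eq_zero_of_forall_eq_zero fun x hx => ?_]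
  · have : u x₀ = φ (Γ (x₀, t)) * H x₀ := by rw [hu]
    rw [this]; ring
  · by_cases hxJ : x ∈ J
    · rw [indicator_of_mem hxJ, hdu0 x ⟨hx.1.le, hx.2⟩]
    · rw [indicator_of_notMem hxJ]

end locInt

end Fam

lemma arg_lt_arg_of_im_div_pos {z w : ℂ} (hz : 0 < z.im) (hw : 0 < w.im) (h : 0 < (w / z).im) :
    z.arg < w.arg := by
  have hz0 : z ≠ 0 := fun h => by simp [h] at hz
  have hw0 : w ≠ 0 := fun h => by simp [h] at hw
  by_contra! hle
  have h1 : (w / z).im * Complex.normSq z = w.im * z.re - w.re * z.im := by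
    have := (Complex.normSq_pos.2 hz0).ne'
    rw [Complex.div_im]
    field_simp
  have h2 : w.im * z.re - w.re * z.im = ‖w‖ * ‖z‖ * Real.sin (w.arg - z.arg) := by
    rw [← Complex.norm_mul_cos_arg z, ← Complex.norm_mul_cos_arg w, ← Complex.norm_mul_sin_arg z,
      ← Complex.norm_mul_sin_arg w, Real.sin_sub]
    ring
  have h3 : Real.sin (w.arg - z.arg) ≤ 0 :=
    Real.sin_nonpos_of_nonpos_of_neg_pi_le (by linarith)
      (by linarith [Complex.arg_nonneg_iff.2 hw.le, Complex.arg_le_pi z])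
  have h4 : 0 < (w / z).im * Complex.normSq z := mul_pos h (Complex.normSq_pos.2 hz0)
  rw [h1, h2] at h4
  exact absurd (mul_nonpos_of_nonneg_of_nonpos (by positivity) h3) (not_le.2 h4)

namespace Fam

variable {Γ Γ₁ Γ₂ : Fam} {t₀ t x₀ y₀ σ : ℝ} {P : ℂ}

/-- A curve crossing another one from right to left enters its inside. -/
lemma Positive.eventually_crossing (hp : Γ₂.Positive) (hxy : Γ₁ (x₀, t) = Γ₂ (y₀, t))
    (hσ : 0 < σ * cr (Γ₂.vel (y₀, t)) (Γ₁.vel (x₀, t))) :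
    ∀ᶠ x in 𝓝[≠] x₀, (0 < σ * (x - x₀) → Γ₁ (x, t) ∈ Γ₂.inside t) ∧
      (σ * (x - x₀) < 0 → Γ₁ (x, t) ∉ closure (Γ₂.inside t)) := by
  have hσ0 : σ ≠ 0 := fun h => by simp [h] at hσ
  have hs := hp ((y₀, t), σ⁻¹ • Γ₁.vel (x₀, t)) (by
    have : σ⁻¹ * cr (Γ₂.vel (y₀, t)) (Γ₁.vel (x₀, t)) =
        (σ⁻¹) ^ 2 * (σ * cr (Γ₂.vel (y₀, t)) (Γ₁.vel (x₀, t))) := by field_simp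
    rw [cr_smul_right, this]
    positivity)
  obtain ⟨e, hedef⟩ : ∃ e : ℝ → ℂ, e = fun x => σ⁻¹ • slope (fun y => Γ₁ (y, t)) x₀ x := ⟨_, rfl⟩
  have he : Tendsto e (𝓝[≠] x₀) (𝓝 (σ⁻¹ • Γ₁.vel (x₀, t))) := by
    rw [hedef]
    exact (hasDerivAt_iff_tendsto_slope.1 (Γ₁.hasDerivAt_x x₀ t)).const_smul _
  have hsc : Tendsto (fun x => σ * (x - x₀)) (𝓝[≠] x₀) (𝓝 0) := by
    have : Continuous fun x : ℝ => σ * (x - x₀) := by fun_prop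
    simpa using (this.tendsto x₀).mono_left nhdsWithin_le_nhds
  have key := (Tendsto.prodMk_nhds (tendsto_const_nhds (x := (y₀, t)))
    (he.prodMk_nhds hsc)).eventually hs
  filter_upwards [key, self_mem_nhdsWithin] with x hx hne
  have hx0 : x - x₀ ≠ 0 := sub_ne_zero.2 hne
  have heq : Γ₂ (y₀, t) + (σ * (x - x₀)) • e x = Γ₁ (x, t) := by
    rw [hedef, ← hxy]
    simp only [slope_def_module, smul_smul]
    rw [show σ * (x - x₀) * (σ⁻¹ * (x - x₀)⁻¹) = 1 by field_simp, one_smul, add_sub_cancel]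
  simp only [heq] at hx
  refine ⟨fun h => ⟨(hx.1 h).1, by exact_mod_cast (hx.1 h).2⟩, fun h hc => ?_⟩
  rcases Γ₂.mem_inside_or_mem_curve_of_mem_closure hc with h' | h'
  · have h1 := (hx.2 h).2
    rw [h'.2] at h1
    norm_num at h1
  · exact (hx.2 h).1 h'

/-- The two curves cross transversally at time `t`. -/
def Transversal (Γ₁ Γ₂ : Fam) (t : ℝ) : Prop :=
  ∀ x y, Γ₁ (x, t) = Γ₂ (y, t) → cr (Γ₁.vel (x, t)) (Γ₂.vel (y, t)) ≠ 0

lemma Transversal.symm (h : Transversal Γ₁ Γ₂ t) : Transversal Γ₂ Γ₁ t := fun x y hxy hc =>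
  h y x hxy.symm (by rw [cr_comm, hc, neg_zero])

lemma Transversal.avoids (hp : Γ₂.Positive) (h : Transversal Γ₁ Γ₂ t) :
    Γ₁.Avoids (Γ₁.curve t ∩ Γ₂.curve t) t := by
  refine measure_null_of_locally_null _ fun x hx => ?_
  obtain ⟨-, -, y, hy⟩ := hx
  obtain ⟨σ, hσ⟩ : ∃ σ, 0 < σ * cr (Γ₂.vel (y, t)) (Γ₁.vel (x, t)) :=
    ⟨_, mul_self_pos.2 (h.symm y x hy)⟩
  have hσ0 : σ ≠ 0 := fun h => by simp [h] at hσ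
  have hev := hp.eventually_crossing hy.symm hσ
  have hev' : ∀ᶠ z in 𝓝[≠] x, Γ₁ (z, t) ∉ Γ₂.curve t := by
    filter_upwards [hev, self_mem_nhdsWithin] with z hz hne
    rcases lt_or_gt_of_ne (mul_ne_zero hσ0 (sub_ne_zero.2 hne)) with h' | h'
    · rintro ⟨w, hw⟩
      exact hz.2 h' (hw ▸ hp.mem_closure_inside w t)
    · exact (hz.1 h').1
  refine ⟨{x}, ?_, measure_singleton x⟩
  rw [mem_nhdsWithin_iff_eventually]
  filter_upwards [eventually_nhdsWithin_iff.1 hev'] with z hz hzs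
  by_contra hne
  exact hz hne hzs.2.2

lemma mem_closure_core (hp1 : Γ₁.Positive) {x r : ℝ} (hin : Γ₁ (x, t) ∈ Γ₂.inside t)
    (hr : ‖Γ₁ (x, t) - P‖ < r)
    (H : ∀ z, ‖z - P‖ < r → z ∈ Γ₁.inside t → z ∈ Γ₂.inside t → z ∈ core Γ₁ Γ₂ t) :
    Γ₁ (x, t) ∈ closure (core Γ₁ Γ₂ t) := by
  refine mem_closure_iff_nhds.2 fun W hW => ?_
  have hc : Continuous fun z : ℂ => ‖z - P‖ := by fun_prop
  obtain ⟨z, ⟨hz1, hz2, hz3⟩, hzi⟩ := mem_closure_iff_nhds.1 (hp1.mem_closure_inside x t) _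
    (inter_mem hW (inter_mem ((Γ₂.isOpen_inside t).mem_nhds hin)
      (hc.continuousAt.eventually (gt_mem_nhds hr))))
  exact ⟨z, hz1, H z hz3 hzi hz2⟩

lemma exists_common_normal {u v : ℂ} (hu : u ≠ 0) (h : 0 < cr v u) :
    ∃ e, 0 < cr u e ∧ 0 < cr v e := by
  refine ⟨Complex.I * u + ((1 + |cr v (Complex.I * u)|) / cr v u) • u, ?_, ?_⟩
  · rw [cr_add_right, cr_smul_right, cr_self, mul_zero, add_zero]
    exact cr_mul_I hu
  · rw [cr_add_right, cr_smul_right, div_mul_cancel₀ _ h.ne']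
    linarith [neg_abs_le (cr v (Complex.I * u))]

lemma exists_core_corner (hp1 : Γ₁.Positive) (hp2 : Γ₂.Positive) (h1 : 0 ∈ Γ₁.inside t)
    (h2 : 0 ∈ Γ₂.inside t) (hxy : Γ₁ (x₀, t) = Γ₂ (y₀, t))
    (hD : Γ₁ (x₀, t) ∈ closure (core Γ₁ Γ₂ t))
    (hcr : 0 < cr (Γ₂.vel (y₀, t)) (Γ₁.vel (x₀, t))) :
    ∃ e, 0 < cr (Γ₁.vel (x₀, t)) e ∧ 0 < cr (Γ₂.vel (y₀, t)) e ∧ ∃ r > 0,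
      ∀ z, ‖z - Γ₁ (x₀, t)‖ < r → z ∈ Γ₁.inside t → z ∈ Γ₂.inside t → z ∈ core Γ₁ Γ₂ t := by
  obtain ⟨e, he1, he2⟩ := exists_common_normal (Γ₁.vel_ne _) hcr
  obtain ⟨r, hr, H⟩ := exists_inter_subset_core h1 h2 hD (hp1.shiftAt he1)
    (hxy ▸ hp2.shiftAt he2)
  exact ⟨e, he1, he2, r, hr, fun z => H t z (by simpa using hr)⟩

lemma eventually_mem_closure_core (hp1 : Γ₁.Positive) (hp2 : Γ₂.Positive)
    (h1 : 0 ∈ Γ₁.inside t) (h2 : 0 ∈ Γ₂.inside t) (hxy : Γ₁ (x₀, t) = Γ₂ (y₀, t))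
    (hD : Γ₁ (x₀, t) ∈ closure (core Γ₁ Γ₂ t))
    (hcr : 0 < cr (Γ₂.vel (y₀, t)) (Γ₁.vel (x₀, t))) :
    (∀ᶠ x in 𝓝[>] x₀, Γ₁ (x, t) ∈ closure (core Γ₁ Γ₂ t) ↔ True) ∧
    (∀ᶠ x in 𝓝[<] x₀, Γ₁ (x, t) ∈ closure (core Γ₁ Γ₂ t) ↔ False) ∧
    (∀ᶠ y in 𝓝[>] y₀, Γ₂ (y, t) ∈ closure (core Γ₁ Γ₂ t) ↔ False) ∧
    (∀ᶠ y in 𝓝[<] y₀, Γ₂ (y, t) ∈ closure (core Γ₁ Γ₂ t) ↔ True) := by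
  obtain ⟨e, he1, he2, r, hr, H⟩ := exists_core_corner hp1 hp2 h1 h2 hxy hD hcr
  have hsub1 : core Γ₁ Γ₂ t ⊆ Γ₁.inside t := core_subset_inside h1 h2
  have hsub2 : core Γ₁ Γ₂ t ⊆ Γ₂.inside t := core_comm Γ₁ Γ₂ t ▸ core_subset_inside h2 h1
  have near : ∀ (Γ : Fam) x, Γ (x, t) = Γ₁ (x₀, t) → ∀ᶠ y in 𝓝 x, ‖Γ (y, t) - Γ₁ (x₀, t)‖ < r := by
    intro Γ x hx
    have hc : Continuous fun y : ℝ => ‖Γ (y, t) - Γ₁ (x₀, t)‖ := by fun_prop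
    exact hc.continuousAt.eventually (gt_mem_nhds (by simpa [hx] using hr))
  have k1 := hp2.eventually_crossing (σ := 1) hxy (by rwa [one_mul])
  have k2 := hp1.eventually_crossing (σ := -1) hxy.symm (by rw [cr_comm]; linarith)
  have hgt : ∀ a : ℝ, 𝓝[>] a ≤ 𝓝[≠] a := fun a => nhdsWithin_mono _ fun _ h => ne_of_gt h
  have hlt : ∀ a : ℝ, 𝓝[<] a ≤ 𝓝[≠] a := fun a => nhdsWithin_mono _ fun _ h => ne_of_lt h
  refine ⟨?_, ?_, ?_, ?_⟩
  · filter_upwards [k1.filter_mono (hgt _), (near Γ₁ x₀ rfl).filter_mono nhdsWithin_le_nhds,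
      self_mem_nhdsWithin] with x hx hxr hlt
    have : x₀ < x := hlt
    exact iff_true_intro (mem_closure_core hp1 (hx.1 (by linarith)) hxr H)
  · filter_upwards [k1.filter_mono (hlt _), self_mem_nhdsWithin] with x hx hlt
    have : x < x₀ := hlt
    exact iff_false_intro fun h => hx.2 (by linarith) (closure_mono hsub2 h)
  · filter_upwards [k2.filter_mono (hgt _), self_mem_nhdsWithin] with x hx hlt
    have : y₀ < x := hlt
    exact iff_false_intro fun h => hx.2 (by linarith) (closure_mono hsub1 h)
  · filter_upwards [k2.filter_mono (hlt _), (near Γ₂ y₀ hxy.symm).filter_mono nhdsWithin_le_nhds,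
      self_mem_nhdsWithin] with x hx hxr hlt
    have : x < y₀ := hlt
    refine iff_true_intro ?_
    rw [core_comm]
    exact mem_closure_core hp2 (hx.1 (by linarith)) hxr fun z a b c => core_comm Γ₁ Γ₂ t ▸ H z a c b

lemma eventually_mem_closure_core_of_notMem (hp1 : Γ₁.Positive)
    (h1 : 0 ∈ Γ₁.inside t) (h2 : 0 ∈ Γ₂.inside t)
    (hD : Γ₁ (x₀, t) ∈ closure (core Γ₁ Γ₂ t)) (hn : Γ₁ (x₀, t) ∉ Γ₂.curve t) :
    ∀ᶠ x in 𝓝 x₀, Γ₁ (x, t) ∈ closure (core Γ₁ Γ₂ t) ↔ True := by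
  have hsub2 : core Γ₁ Γ₂ t ⊆ Γ₂.inside t := core_comm Γ₁ Γ₂ t ▸ core_subset_inside h2 h1
  have hin : Γ₁ (x₀, t) ∈ Γ₂.inside t :=
    (Γ₂.mem_inside_or_mem_curve_of_mem_closure (closure_mono hsub2 hD)).resolve_right hn
  obtain ⟨r, hr, H⟩ := exists_inter_subset_core h1 h2 hD
    (hp1.shiftAt (e := Complex.I * Γ₁.vel (x₀, t)) (cr_mul_I (Γ₁.vel_ne _)))
    (shiftAt_of_mem_inside hin)
  have hc : Continuous fun y : ℝ => ‖Γ₁ (y, t) - Γ₁ (x₀, t)‖ := by fun_prop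
  have hc' : Continuous fun y : ℝ => Γ₁ (y, t) := by fun_prop
  filter_upwards [hc.continuousAt.eventually (gt_mem_nhds (show _ < r by simpa using hr)),
    hc'.continuousAt.eventually ((Γ₂.isOpen_inside t).mem_nhds hin)] with x hx hx2
  exact iff_true_intro (mem_closure_core hp1 hx2 hx fun z => H t z (by simpa using hr))

/-- Boundary values on two curves, ordered at the corners of the core. -/
def Ordered (Γ₁ Γ₂ : Fam) (t : ℝ) (H₁ H₂ : ℝ → ℝ) : Prop :=
  ∀ x y, Γ₁ (x, t) = Γ₂ (y, t) → Γ₁ (x, t) ∈ closure (core Γ₁ Γ₂ t) →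
    0 < cr (Γ₂.vel (y, t)) (Γ₁.vel (x, t)) → H₂ y ≤ H₁ x

variable {H₁ H₂ : ℝ → ℝ}

lemma exists_locInt_le_of_corner (hp1 : Γ₁.Positive) (hp2 : Γ₂.Positive)
    (h1 : 0 ∈ Γ₁.inside t) (h2 : 0 ∈ Γ₂.inside t) (hH1 : ContDiff ℝ 1 H₁)
    (hH2 : ContDiff ℝ 1 H₂) (hP1 : Function.Periodic H₁ (2 * π))
    (hP2 : Function.Periodic H₂ (2 * π)) (ho : Ordered Γ₁ Γ₂ t H₁ H₂)
    (hxy : Γ₁ (x₀, t) = Γ₂ (y₀, t)) (hD : Γ₁ (x₀, t) ∈ closure (core Γ₁ Γ₂ t))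
    (hcr : 0 < cr (Γ₂.vel (y₀, t)) (Γ₁.vel (x₀, t))) :
    ∃ V, IsOpen V ∧ Γ₁ (x₀, t) ∈ V ∧ ∀ φ : ℂ → ℝ, ContDiff ℝ ∞ φ → (∀ z, 0 ≤ φ z) → tsupport φ ⊆ V →
      Γ₁.locInt (closure (core Γ₁ Γ₂ t)) t φ H₁ + Γ₂.locInt (closure (core Γ₁ Γ₂ t)) t φ H₂ ≤ 0 := by
  obtain ⟨a, b, c, d⟩ := eventually_mem_closure_core hp1 hp2 h1 h2 hxy hD hcr
  obtain ⟨V₁, hV₁, hx₁, E₁⟩ := exists_locInt_eq isClosed_closure a b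
  obtain ⟨V₂, hV₂, hx₂, E₂⟩ := exists_locInt_eq isClosed_closure c d
  refine ⟨V₁ ∩ V₂, hV₁.inter hV₂, ⟨hx₁, hxy ▸ hx₂⟩, fun φ hφ h0 hs => ?_⟩
  rw [E₁ φ H₁ hφ hH1 hP1 (hs.trans inter_subset_left),
    E₂ φ H₂ hφ hH2 hP2 (hs.trans inter_subset_right), if_pos trivial, if_neg not_false, ← hxy]
  have := mul_le_mul_of_nonneg_left (ho x₀ y₀ hxy hD hcr) (h0 (Γ₁ (x₀, t)))
  linarith

lemma exists_locInt_le_of_notMem (hp1 : Γ₁.Positive)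
    (h1 : 0 ∈ Γ₁.inside t) (h2 : 0 ∈ Γ₂.inside t) (hH1 : ContDiff ℝ 1 H₁)
    (hP1 : Function.Periodic H₁ (2 * π)) (hD : Γ₁ (x₀, t) ∈ closure (core Γ₁ Γ₂ t))
    (hn : Γ₁ (x₀, t) ∉ Γ₂.curve t) :
    ∃ V, IsOpen V ∧ Γ₁ (x₀, t) ∈ V ∧ ∀ φ : ℂ → ℝ, ContDiff ℝ ∞ φ → (∀ z, 0 ≤ φ z) → tsupport φ ⊆ V →
      Γ₁.locInt (closure (core Γ₁ Γ₂ t)) t φ H₁ + Γ₂.locInt (closure (core Γ₁ Γ₂ t)) t φ H₂ ≤ 0 := by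
  have h := eventually_mem_closure_core_of_notMem hp1 h1 h2 hD hn
  obtain ⟨V, hV, hx, E⟩ := exists_locInt_eq isClosed_closure (h.filter_mono nhdsWithin_le_nhds)
    (h.filter_mono nhdsWithin_le_nhds)
  refine ⟨V ∩ (Γ₂.curve t)ᶜ, hV.inter (Γ₂.isClosed_curve t).isOpen_compl, ⟨hx, hn⟩,
    fun φ hφ h0 hs => ?_⟩
  rw [E φ H₁ hφ hH1 hP1 (hs.trans inter_subset_left), sub_self, zero_mul,
    locInt_eq_zero fun x => Or.inl fun h => (hs h).2 (Γ₂.mem_curve x t), add_zero]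

lemma exists_locInt_le (hp1 : Γ₁.Positive) (hp2 : Γ₂.Positive)
    (h1 : 0 ∈ Γ₁.inside t) (h2 : 0 ∈ Γ₂.inside t) (htr : Transversal Γ₁ Γ₂ t)
    (hH1 : ContDiff ℝ 1 H₁) (hH2 : ContDiff ℝ 1 H₂) (hP1 : Function.Periodic H₁ (2 * π))
    (hP2 : Function.Periodic H₂ (2 * π)) (ho : Ordered Γ₁ Γ₂ t H₁ H₂)
    (ho' : Ordered Γ₂ Γ₁ t H₂ H₁) (p : ℂ) :
    ∃ V, IsOpen V ∧ p ∈ V ∧ ∀ φ : ℂ → ℝ, ContDiff ℝ ∞ φ → (∀ z, 0 ≤ φ z) → tsupport φ ⊆ V →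
      Γ₁.locInt (closure (core Γ₁ Γ₂ t)) t φ H₁ + Γ₂.locInt (closure (core Γ₁ Γ₂ t)) t φ H₂ ≤ 0 := by
  by_cases hD : p ∈ closure (core Γ₁ Γ₂ t)
  swap
  · refine ⟨(closure (core Γ₁ Γ₂ t))ᶜ, isClosed_closure.isOpen_compl, hD, fun φ _ _ hs => ?_⟩
    have : ∀ z, z ∉ tsupport φ ∨ z ∉ closure (core Γ₁ Γ₂ t) := fun z => by
      by_contra! h
      exact hs h.1 h.2
    rw [locInt_eq_zero fun x => this _, locInt_eq_zero fun x => this _, add_zero]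
  by_cases hc1 : p ∈ Γ₁.curve t <;> by_cases hc2 : p ∈ Γ₂.curve t
  · obtain ⟨x, rfl⟩ := hc1
    obtain ⟨y, hy⟩ := hc2
    replace hy : Γ₂ (y, t) = Γ₁ (x, t) := hy
    rcases lt_or_gt_of_ne (htr.symm y x hy) with hcr | hcr
    · obtain ⟨V, hV, hxV, E⟩ := exists_locInt_le_of_corner hp2 hp1 h2 h1 hH2 hH1 hP2 hP1 ho' hy
        (by rw [core_comm, hy]; exact hD) (by rw [cr_comm]; linarith)
      refine ⟨V, hV, (show Γ₁ (x, t) ∈ V by rw [← hy]; exact hxV), fun φ a b c => ?_⟩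
      rw [add_comm, core_comm]
      exact E φ a b c
    · exact exists_locInt_le_of_corner hp1 hp2 h1 h2 hH1 hH2 hP1 hP2 ho hy.symm hD hcr
  · obtain ⟨x, rfl⟩ := hc1
    exact exists_locInt_le_of_notMem hp1 h1 h2 hH1 hP1 hD hc2
  · obtain ⟨y, rfl⟩ := hc2
    obtain ⟨V, hV, hxV, E⟩ := exists_locInt_le_of_notMem (H₂ := H₁) hp2 h2 h1 hH2 hP2
      (by rw [core_comm]; exact hD) hc1
    refine ⟨V, hV, hxV, fun φ a b c => ?_⟩
    rw [add_comm, core_comm]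
    exact E φ a b c
  · refine ⟨(Γ₁.curve t)ᶜ ∩ (Γ₂.curve t)ᶜ, (Γ₁.isClosed_curve t).isOpen_compl.inter
      (Γ₂.isClosed_curve t).isOpen_compl, ⟨hc1, hc2⟩, fun φ _ _ hs => ?_⟩
    rw [locInt_eq_zero fun x => Or.inl fun h => (hs h).1 (Γ₁.mem_curve x t),
      locInt_eq_zero fun x => Or.inl fun h => (hs h).2 (Γ₂.mem_curve x t), add_zero]

lemma locInt_add_locInt_le (hp1 : Γ₁.Positive) (hp2 : Γ₂.Positive)
    (h1 : 0 ∈ Γ₁.inside t) (h2 : 0 ∈ Γ₂.inside t) (htr : Transversal Γ₁ Γ₂ t)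
    (hH1 : ContDiff ℝ 1 H₁) (hH2 : ContDiff ℝ 1 H₂) (hP1 : Function.Periodic H₁ (2 * π))
    (hP2 : Function.Periodic H₂ (2 * π)) (ho : Ordered Γ₁ Γ₂ t H₁ H₂)
    (ho' : Ordered Γ₂ Γ₁ t H₂ H₁) :
    Γ₁.locInt (closure (core Γ₁ Γ₂ t)) t (fun _ => 1) H₁ +
      Γ₂.locInt (closure (core Γ₁ Γ₂ t)) t (fun _ => 1) H₂ ≤ 0 := by
  choose V hV hpV HV using exists_locInt_le hp1 hp2 h1 h2 htr hH1 hH2 hP1 hP2 ho ho'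
  have hK := (Γ₁.isCompact_curve t).union (Γ₂.isCompact_curve t)
  obtain ⟨s, hs⟩ := hK.elim_finite_subcover V hV fun p _ => mem_iUnion.2 ⟨p, hpV p⟩
  obtain ⟨f, hf⟩ := SmoothPartitionOfUnity.exists_isSubordinate (modelWithCornersSelf ℝ ℂ)
    hK.isClosed (fun p : s => V p) (fun p => hV p) (by simpa [iUnion_subtype] using hs)
  have hsm : ∀ p, ContDiff ℝ ∞ (f p) := fun p => (f p).contMDiff.contDiff
  have hone : ∀ z ∈ Γ₁.curve t ∪ Γ₂.curve t, ∑ p, f p z = 1 := fun z hz => by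
    rw [← finsum_eq_sum_of_fintype]; exact f.sum_eq_one hz
  rw [locInt_sum Finset.univ hsm hH1 fun x => hone _ (Or.inl (Γ₁.mem_curve x t)),
    locInt_sum Finset.univ hsm hH2 fun x => hone _ (Or.inr (Γ₂.mem_curve x t)),
    ← Finset.sum_add_distrib]
  exact Finset.sum_nonpos fun p _ => HV p (f p) (hsm p) (fun z => f.nonneg p z) (hf p)

end Fam

namespace Fam

variable {Γ Γ₁ Γ₂ : Fam} {t₀ t x₀ y₀ σ : ℝ} {P : ℂ}

lemma ordered_im (hp1 : Γ₁.Positive) (hp2 : Γ₂.Positive) (h1 : 0 ∈ Γ₁.inside t)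
    (h2 : 0 ∈ Γ₂.inside t) {B₁ B₂ : ℂ → ℝ → ℂ} {G₁ G₂ : ℝ → ℂ}
    (hB₁ : ContinuousOn (fun q : ℂ × ℝ => B₁ q.1 q.2) (Γ₁.inside t ×ˢ univ))
    (hB₂ : ContinuousOn (fun q : ℂ × ℝ => B₂ q.1 q.2) (Γ₂.inside t ×ˢ univ))
    (h0₁ : ∀ x, B₁ 0 x = 0) (h0₂ : ∀ x, B₂ 0 x = 0)
    (he₁ : ∀ b ∈ Γ₁.inside t, ∀ x, Complex.exp (B₁ b x) = (Γ₁ (x, t) - b) / Γ₁ (x, t))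
    (he₂ : ∀ b ∈ Γ₂.inside t, ∀ x, Complex.exp (B₂ b x) = (Γ₂ (x, t) - b) / Γ₂ (x, t))
    (hG₁ : ∀ x e, 0 < cr (Γ₁.vel (x, t)) e → ∀ᶠ s : ℝ in 𝓝[>] 0,
        Γ₁ (x, t) + s • e ∈ Γ₁.inside t ∧
        B₁ (Γ₁ (x, t) + s • e) x = G₁ x + Complex.log (s • e / Γ₁.vel (x, t)))
    (hG₂ : ∀ x e, 0 < cr (Γ₂.vel (x, t)) e → ∀ᶠ s : ℝ in 𝓝[>] 0,
        Γ₂ (x, t) + s • e ∈ Γ₂.inside t ∧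
        B₂ (Γ₂ (x, t) + s • e) x = G₂ x + Complex.log (s • e / Γ₂.vel (x, t))) :
    Ordered Γ₁ Γ₂ t (fun x => (G₁ x).im) (fun x => (G₂ x).im) := by
  intro x y hxy hD hcr
  obtain ⟨e, hu, hv, r, hr, H⟩ := exists_core_corner hp1 hp2 h1 h2 hxy hD hcr
  have hsub1 : core Γ₁ Γ₂ t ⊆ Γ₁.inside t := core_subset_inside h1 h2
  have hsub2 : core Γ₁ Γ₂ t ⊆ Γ₂.inside t := core_comm Γ₁ Γ₂ t ▸ core_subset_inside h2 h1
  have hc : Continuous fun s : ℝ => ‖Γ₁ (x, t) + s • e - Γ₁ (x, t)‖ := by fun_prop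
  obtain ⟨s, ⟨⟨⟨hs1, e1⟩, hs2, e2⟩, hs3⟩, hs0⟩ := ((((hG₁ x e hu).and (hG₂ y e hv)).and
    ((hc.continuousAt.eventually (gt_mem_nhds (show _ < r by simpa using hr))).filter_mono
      nhdsWithin_le_nhds)).and self_mem_nhdsWithin).exists
  replace hs0 : 0 < s := hs0
  rw [← hxy] at hs2 e2
  have hcore := H _ hs3 hs1 hs2
  have hcont : ∀ {Γ : Fam} {B : ℂ → ℝ → ℂ} (x : ℝ), ContinuousOn (fun q : ℂ × ℝ => B q.1 q.2)
      (Γ.inside t ×ˢ univ) → core Γ₁ Γ₂ t ⊆ Γ.inside t →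
      ContinuousOn (fun b => B b x) (core Γ₁ Γ₂ t) := fun x h hs =>
    h.comp (f := fun b : ℂ => (b, x)) (by fun_prop) fun b hb => ⟨hs hb, mem_univ _⟩
  have key := log_branch_sub_eq (S := core Γ₁ Γ₂ t) isPreconnected_connectedComponentIn
    (hcont x hB₁ hsub1) (hcont y hB₂ hsub2)
    (fun b hb => by rw [he₁ b (hsub1 hb), he₂ b (hsub2 hb), hxy]) (zero_mem_core h1 h2) hcore
  simp only [h0₁, h0₂, e1, e2, sub_self] at key
  have hd : ∀ u : ℂ, (s • e / u).arg = (e / u).arg := fun u => by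
    rw [smul_div_assoc, Complex.real_smul, Complex.arg_real_mul _ hs0]
  have hlt := arg_lt_arg_of_im_div_pos ((cr_pos_iff (Γ₁.vel_ne _)).1 hu)
    ((cr_pos_iff (Γ₂.vel_ne _)).1 hv) (by
      have he0 : e ≠ 0 := fun h => by simp [h, cr] at hu
      rw [div_div_div_cancel_left' _ _ he0]
      exact (cr_pos_iff (Γ₂.vel_ne _)).1 hcr)
  have him := congrArg Complex.im key
  simp only [Complex.sub_im, Complex.add_im, Complex.log_im, hd, Complex.zero_im] at him
  change (G₂ y).im ≤ (G₁ x).im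
  linarith

lemma contDiff_of_hasDerivAt {H H' : ℝ → ℝ} (h : ∀ x, HasDerivAt H (H' x) x) (hc : Continuous H') :
    ContDiff ℝ 1 H := by
  refine contDiff_one_iff_deriv.2 ⟨fun x => (h x).differentiableAt, ?_⟩
  rwa [show deriv H = H' from funext fun x => (h x).deriv]

lemma continuous_winding (h : 0 ∈ Γ.inside t) :
    Continuous fun x : ℝ => (Γ.vel (x, t) / Γ (x, t)).im := by
  have hc := Γ.continuous_vel
  have hc' := Γ.continuous
  exact Complex.continuous_im.comp (Continuous.div (by fun_prop) (by fun_prop)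
    fun x => by simpa using sub_ne h.1 x)

lemma locInt_one (h : 0 ∈ Γ.inside t) {S : Set ℂ} {H : ℝ → ℝ}
    (hH : ∀ x, HasDerivAt H (Γ.curv (x, t) - (Γ.vel (x, t) / Γ (x, t)).im) x) :
    Γ.locInt S t (fun _ => 1) H = (∫ x in Γ.bdry S t, Γ.curv (x, t)) -
      ∫ x in Γ.bdry S t, (Γ.vel (x, t) / Γ (x, t)).im := by
  have hk := Γ.continuous_curv
  rw [← integral_sub (Γ.integrableOn_bdry S t (by fun_prop))
    (Γ.integrableOn_bdry S t (continuous_winding h))]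
  simp only [locInt, one_mul, (hH _).deriv]

/-- The total curvature of the boundary of the core is at most `2π`. -/
lemma core_curv_le (hp1 : Γ₁.Positive) (hp2 : Γ₂.Positive) (h1 : 0 ∈ Γ₁.inside t)
    (h2 : 0 ∈ Γ₂.inside t) (htr : Transversal Γ₁ Γ₂ t) :
    (∫ x in Γ₁.bdry (closure (core Γ₁ Γ₂ t)) t, Γ₁.curv (x, t)) +
      ∫ x in Γ₂.bdry (closure (core Γ₁ Γ₂ t)) t, Γ₂.curv (x, t) ≤ 2 * π := by
  obtain ⟨B₁, hB₁, h0₁, hper₁, he₁⟩ := Γ₁.exists_branch h1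
  obtain ⟨B₂, hB₂, h0₂, hper₂, he₂⟩ := Γ₂.exists_branch h2
  obtain ⟨G₁, hGp₁, hGd₁, hG₁⟩ := Γ₁.exists_boundary_branch hp1 h1 hB₁ hper₁ he₁
  obtain ⟨G₂, hGp₂, hGd₂, hG₂⟩ := Γ₂.exists_boundary_branch hp2 h2 hB₂ hper₂ he₂
  have hd : ∀ {Γ : Fam} {G : ℝ → ℂ}, (∀ x, HasDerivAt G
      (dx Γ.vel (x, t) / Γ.vel (x, t) - Γ.vel (x, t) / Γ (x, t)) x) → ∀ x,
      HasDerivAt (fun x => (G x).im) (Γ.curv (x, t) - (Γ.vel (x, t) / Γ (x, t)).im) x :=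
    fun h x => (Complex.imCLM.hasFDerivAt.comp_hasDerivAt x (h x)).congr_deriv (by simp [curv])
  have hC : ∀ {Γ : Fam} {G : ℝ → ℂ}, 0 ∈ Γ.inside t → (∀ x, HasDerivAt G
      (dx Γ.vel (x, t) / Γ.vel (x, t) - Γ.vel (x, t) / Γ (x, t)) x) →
      ContDiff ℝ 1 fun x => (G x).im := fun {Γ G} h0 h => by
    have hk := Γ.continuous_curv
    exact contDiff_of_hasDerivAt (hd h) (Continuous.sub (by fun_prop) (continuous_winding h0))
  have hP : ∀ {G : ℝ → ℂ}, (∀ x, G (x + 2 * π) = G x) →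
      Function.Periodic (fun x => (G x).im) (2 * π) := fun h x => by simp only [h]
  have key := locInt_add_locInt_le hp1 hp2 h1 h2 htr (hC h1 hGd₁) (hC h2 hGd₂) (hP hGp₁) (hP hGp₂)
    (ordered_im hp1 hp2 h1 h2 hB₁ hB₂ h0₁ h0₂ he₁ he₂ hG₁ hG₂)
    (ordered_im hp2 hp1 h2 h1 hB₂ hB₁ h0₂ h0₁ he₂ he₁ hG₂ hG₁)
  rw [locInt_one h1 (hd hGd₁), locInt_one h2 (hd hGd₂)] at key
  have hw := core_winding_le hp1 hp2 h1 h2 (htr.avoids hp2) (by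
    rw [inter_comm]; exact htr.symm.avoids hp1)
  linarith

end Fam

namespace Fam

variable {Γ Γ₁ Γ₂ : Fam} {t₀ t : ℝ} {a : ℝ → ℝ}

lemma eventually_mem_inside {z : ℂ} (h : z ∈ Γ.inside t) : ∀ᶠ s in 𝓝 t, z ∈ Γ.inside s :=
  (by fun_prop : Continuous fun s : ℝ => (z, s)).continuousAt.eventually
    (Γ.isOpen_inside_track.mem_nhds h)

lemma losesSwept (h₁ : Γ₁.IsFlow a) (h₂ : Γ₂.IsFlow a) (ha : ∀ t, 0 < a t)
    (hac : Continuous a) (h1 : 0 ∈ Γ₁.inside t₀) (h2 : 0 ∈ Γ₂.inside t₀) :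
    LosesSwept Γ₁ Γ₂ t₀ := by
  obtain ⟨δ, hδ, H⟩ := Metric.eventually_nhds_iff.1
    ((eventually_mem_inside h1).and (eventually_mem_inside h2))
  have hs : ∀ t ∈ Icc t₀ (t₀ + δ / 2), ∀ s ∈ Icc t₀ t, dist s t₀ < δ := fun t ht s hs => by
    rw [Real.dist_eq, abs_lt]
    constructor <;> linarith [ht.2, hs.1, hs.2]
  exact ⟨δ / 2, by positivity, fun t ht => core_subset_union_swept h₁ h₂ ha hac ht.1
    (fun s h => (H (hs t ht s h)).1.1) (fun s h => (H (hs t ht s h)).2.1)⟩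

lemma flux_eq_neg_curv (hf : Γ.IsFlow a) {S : Set ℂ} (hS : IsClosed S) {ψ : ℂ → ℝ}
    (hψ : ∀ z ∈ S, ψ z = 1) :
    Γ.flux S t ψ = -(a t * ∫ x in Γ.bdry S t, Γ.curv (x, t)) := by
  rw [flux, ← integral_const_mul]
  congr 1
  refine setIntegral_congr_fun (Γ.measurableSet_bdry t hS) fun x hx => ?_
  simp only [hψ _ hx.2, one_mul, hf.cr_eq]

/-- The area of the core decreases at rate at most `2π`. -/
lemma eventually_core_ge (hp1 : Γ₁.Positive) (hp2 : Γ₂.Positive) (h₁ : Γ₁.IsFlow a)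
    (h₂ : Γ₂.IsFlow a) (ha : ∀ t, 0 < a t) (hac : Continuous a) (h1 : 0 ∈ Γ₁.inside t₀)
    (h2 : 0 ∈ Γ₂.inside t₀) (htr : Transversal Γ₁ Γ₂ t₀) {ε : ℝ} (hε : 0 < ε) :
    ∀ᶠ t in 𝓝[>] t₀, volume.real (core Γ₁ Γ₂ t₀) - (2 * π * a t₀ + ε) * (t - t₀) ≤
      volume.real (core Γ₁ Γ₂ t) := by
  obtain ⟨R, hR0, hR⟩ := Γ₁.exists_bound (t₀ - 1) (t₀ + 1)
  obtain ⟨ψ, hψ, hs, h0, hψ1, -⟩ := exists_bump hR0 (show R < R + 1 by linarith)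
  have hintg : ∀ t ∈ Icc (t₀ - 1) (t₀ + 1), 0 ∈ Γ₁.inside t → 0 ∈ Γ₂.inside t →
      ∫ z in core Γ₁ Γ₂ t, ψ z = volume.real (core Γ₁ Γ₂ t) := fun t ht k1 k2 => by
    rw [setIntegral_congr_fun (g := fun _ => (1 : ℝ)) (isOpen_core _ _ _).measurableSet]
    · simp
    · exact fun z hz => hψ1 z
        (mem_ball_zero_iff.1 (Γ₁.inside_subset_ball (hR t ht) (core_subset_inside k1 k2 hz))).le
  have hcl : ∀ z ∈ closure (core Γ₁ Γ₂ t₀), ψ z = 1 := fun z hz => hψ1 z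
    (mem_closedBall_zero_iff.1 (closure_minimal (((core_subset_inside h1 h2).trans
      (Γ₁.inside_subset_ball (hR t₀ ⟨by linarith, by linarith⟩))).trans ball_subset_closedBall)
      isClosed_closedBall hz))
  have hk := core_curv_le hp1 hp2 h1 h2 htr
  have hk' := mul_le_mul_of_nonneg_left hk (ha t₀).le
  filter_upwards [(losesSwept h₁ h₂ ha hac h1 h2).eventually_le hp1 hp2 h1 h2 (htr.avoids hp2)
    (by rw [inter_comm]; exact htr.symm.avoids hp1) hψ h0 hs hε, self_mem_nhdsWithin,
    nhdsWithin_le_nhds (eventually_mem_inside h1), nhdsWithin_le_nhds (eventually_mem_inside h2),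
    nhdsWithin_le_nhds (Icc_mem_nhds (by linarith : t₀ - 1 < t₀) (by linarith : t₀ < t₀ + 1))]
    with t ht htt k1 k2 hti
  replace htt : t₀ < t := htt
  rw [hintg t₀ ⟨by linarith, by linarith⟩ h1 h2, hintg t hti k1 k2, flux_eq_neg_curv h₁ isClosed_closure hcl,
    flux_eq_neg_curv h₂ isClosed_closure hcl] at ht
  refine le_trans ?_ ht
  nlinarith

end Fam

/-- A function with bounded rate of decrease and nonnegative lower right derivative almost
everywhere does not decrease. -/
lemma le_of_ae_dini {g : ℝ → ℝ} {A B C : ℝ} (hAB : A ≤ B)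
    (hC : ∀ s t, A ≤ s → s ≤ t → t ≤ B → g s - C * (t - s) ≤ g t)
    (hd : ∀ᵐ t, t ∈ Ioo A B → ∀ ε > 0, ∀ᶠ s in 𝓝[>] t, g t - ε * (s - t) ≤ g s) : g A ≤ g B := by
  obtain ⟨m, hm⟩ : ∃ m : ℝ → ℝ, m = fun t => g t + C * t := ⟨_, rfl⟩
  have hmono : MonotoneOn m (uIcc A B) := by
    rw [uIcc_of_le hAB, hm]
    intro s hs t ht hst
    have := hC s t hs.1 hst ht.2
    simp only
    linarith
  have hintg := hmono.intervalIntegrable_deriv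
  have hle := hmono.intervalIntegral_deriv_mem_uIcc
  have hmAB : m A ≤ m B := hmono left_mem_uIcc right_mem_uIcc hAB
  rw [uIcc_of_le (by linarith)] at hle
  have hge : ∫ _ in A..B, C ≤ ∫ x in A..B, deriv m x := by
    rw [intervalIntegral.integral_of_le hAB, intervalIntegral.integral_of_le hAB,
      integral_Ioc_eq_integral_Ioo, integral_Ioc_eq_integral_Ioo]
    refine setIntegral_mono_on_ae (by simp) (hintg.1.mono_set Ioo_subset_Ioc_self)
      measurableSet_Ioo ?_
    filter_upwards [hd, hmono.ae_differentiableWithinAt_of_mem] with t h1 h2 ht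
    have hd : DifferentiableAt ℝ m t := (h2 (by
      rw [uIcc_of_le hAB]; exact Ioo_subset_Icc_self ht)).differentiableAt (by
      rw [uIcc_of_le hAB]; exact Icc_mem_nhds ht.1 ht.2)
    refine le_of_forall_pos_sub_le fun ε hε => ?_
    have hs := (hasDerivAt_iff_tendsto_slope.1 hd.hasDerivAt).mono_left
      (nhdsWithin_mono t (show Ioi t ⊆ {t}ᶜ from fun s h => ne_of_gt h))
    refine ge_of_tendsto hs ?_
    filter_upwards [h1 ht ε hε, self_mem_nhdsWithin] with s k1 k2
    replace k2 : 0 < s - t := sub_pos.2 k2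
    rw [slope_def_field, le_div_iff₀ k2, hm]
    simp only
    linarith
  simp only [intervalIntegral.integral_const, smul_eq_mul] at hge
  rw [hm] at hle
  have := hle.2
  rw [hm] at hge
  simp only at this
  linarith

namespace Fam

variable {Γ₁ Γ₂ : Fam} {t₀ t A B : ℝ} {a φ : ℝ → ℝ}

/-- Translation of a family. -/
def translate (Γ : Fam) (w : ℂ) : Fam := Γ.move (τ := id) contDiff_id (v := fun _ => w) contDiff_const

lemma volume_tangential (Γ₁ Γ₂ : Fam) (t : ℝ) :
    volume {w : ℂ | ∃ x y, Γ₁ (x, t) = Γ₂ (y, t) + w ∧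
      cr (Γ₁.vel (x, t)) (Γ₂.vel (y, t)) = 0} = 0 := by
  let L : ℂ → ℂ →L[ℝ] ℂ := fun z =>
    Complex.reCLM.smulRight (Γ₁.vel (z.re, t)) - Complex.imCLM.smulRight (Γ₂.vel (z.im, t))
  have hf : ∀ z : ℂ, HasFDerivAt (fun z : ℂ => Γ₁ (z.re, t) - Γ₂ (z.im, t)) (L z) z := fun z =>
    ((Γ₁.hasDerivAt_x z.re t).hasFDerivAt.comp z Complex.reCLM.hasFDerivAt).sub
      ((Γ₂.hasDerivAt_x z.im t).hasFDerivAt.comp z Complex.imCLM.hasFDerivAt)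
  have hdet : ∀ z, (L z).det = -cr (Γ₁.vel (z.re, t)) (Γ₂.vel (z.im, t)) := fun z => by
    rw [ContinuousLinearMap.det, ← LinearMap.det_toMatrix Complex.basisOneI, Matrix.det_fin_two]
    simp [LinearMap.toMatrix_apply, L, cr]
    ring
  refine measure_mono_null ?_ (addHaar_image_eq_zero_of_det_fderivWithin_eq_zero volume
    (s := {z : ℂ | cr (Γ₁.vel (z.re, t)) (Γ₂.vel (z.im, t)) = 0})
    (fun z _ => (hf z).hasFDerivWithinAt) fun z hz => by rw [hdet, show cr _ _ = 0 from hz, neg_zero])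
  rintro w ⟨x, y, h, hc⟩
  exact ⟨⟨x, y⟩, hc, by simp [h]⟩

lemma exists_param_vel (Γ : Fam) (x t : ℝ) : ∃ y ∈ Icc 0 (2 * π), Γ (y, t) = Γ (x, t) ∧
    Γ.vel (y, t) = Γ.vel (x, t) := by
  obtain ⟨k, hk, -⟩ := existsUnique_add_zsmul_mem_Ico two_pi_pos x 0
  replace hk : x + k • (2 * π) ∈ Ico 0 (0 + 2 * π) := hk
  rw [zero_add, zsmul_eq_mul, mul_comm (k : ℝ)] at hk
  exact ⟨_, Ico_subset_Icc_self hk, Γ.per_int x t k, Γ.vel_per_int x t k⟩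

lemma ae_transversal (Γ₁ Γ₂ : Fam) :
    ∀ᵐ w : ℂ, ∀ᵐ t : ℝ, Transversal Γ₁ (Γ₂.translate w) t := by
  have key : ∀ᵐ t : ℝ, ∀ᵐ w : ℂ, ¬ ∃ x ∈ Icc 0 (2 * π), ∃ y ∈ Icc 0 (2 * π),
      Γ₁ (x, t) = Γ₂ (y, t) + w ∧ cr (Γ₁.vel (x, t)) (Γ₂.vel (y, t)) = 0 :=
    Eventually.of_forall fun t => by
      refine measure_mono_null (fun w hw => ?_) (volume_tangential Γ₁ Γ₂ t)
      obtain ⟨x, -, y, -, h⟩ := not_not.1 hw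
      exact ⟨x, y, h⟩
  rw [Measure.ae_ae_comm] at key
  · filter_upwards [key] with w hw
    filter_upwards [hw] with t ht x y hxy hc
    obtain ⟨x', hx', ex, evx⟩ := Γ₁.exists_param_vel x t
    obtain ⟨y', hy', ey, evy⟩ := Γ₂.exists_param_vel y t
    rw [translate, move_apply, ← ex, id, ← ey] at hxy
    rw [translate, move_vel, ← evx, id, ← evy] at hc
    exact ht ⟨x', hx', y', hy', hxy, hc⟩
  · have hv₁ := Γ₁.continuous_vel
    have hv₂ := Γ₂.continuous_vel
    have h₁ := Γ₁.continuous
    have h₂ := Γ₂.continuous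
    have hZ : IsClosed {q : ℝ × ℝ × ℝ | cr (Γ₁.vel (q.1, q.2.2)) (Γ₂.vel (q.2.1, q.2.2)) = 0} :=
      isClosed_eq (Continuous.cr (by fun_prop) (by fun_prop)) continuous_const
    have hK : ∀ n : ℕ, IsCompact ((fun q : ℝ × ℝ × ℝ =>
        (q.2.2, Γ₁ (q.1, q.2.2) - Γ₂ (q.2.1, q.2.2))) ''
        ((Icc 0 (2 * π) ×ˢ Icc 0 (2 * π) ×ˢ Icc (-n : ℝ) n) ∩
          {q : ℝ × ℝ × ℝ | cr (Γ₁.vel (q.1, q.2.2)) (Γ₂.vel (q.2.1, q.2.2)) = 0})) := fun n =>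
      (((isCompact_Icc.prod (isCompact_Icc.prod isCompact_Icc)).inter_right hZ)).image (by fun_prop)
    convert! (MeasurableSet.iUnion fun n => (hK n).isClosed.measurableSet).compl using 1
    ext ⟨t, w⟩
    simp only [mem_ofPred_eq, mem_compl_iff, mem_iUnion, not_iff_not]
    constructor
    · rintro ⟨x, hx, y, hy, h, hc⟩
      obtain ⟨n, hn⟩ := exists_nat_ge |t|
      exact ⟨n, (x, y, t), ⟨⟨hx, hy, abs_le.1 hn⟩, hc⟩, by simp [h]⟩
    · rintro ⟨n, ⟨x, y, s⟩, ⟨⟨hx, hy, -⟩, hc⟩, e⟩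
      obtain ⟨rfl, rfl⟩ := Prod.mk.inj e
      exact ⟨x, hx, y, hy, by simp, hc⟩

/-- The area of the core, corrected by `2πφ`, does not decrease. -/
lemma core_area_mono (hp1 : Γ₁.Positive) (hp2 : Γ₂.Positive) (h₁ : Γ₁.IsFlow a)
    (h₂ : Γ₂.IsFlow a) (ha : ∀ t, 0 < a t) (hac : Continuous a) (hφ : ∀ t, HasDerivAt φ (a t) t)
    (hAB : A ≤ B) (h01 : ∀ s ∈ Icc A B, 0 ∈ Γ₁.inside s) (h02 : ∀ s ∈ Icc A B, 0 ∈ Γ₂.inside s)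
    (htr : ∀ᵐ t, Transversal Γ₁ Γ₂ t) :
    volume.real (core Γ₁ Γ₂ A) + 2 * π * φ A ≤ volume.real (core Γ₁ Γ₂ B) + 2 * π * φ B := by
  obtain ⟨C, hC⟩ := exists_core_bound h₁ h₂ ha hac h01 h02
  have hφm : Monotone φ := monotone_of_deriv_nonneg (fun t => (hφ t).differentiableAt)
    fun t => by rw [(hφ t).deriv]; exact (ha t).le
  refine le_of_ae_dini (g := fun t => volume.real (core Γ₁ Γ₂ t) + 2 * π * φ t) (C := C) hAB
    (fun s t hs hst ht => ?_) ?_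
  · have := hC s t hs hst ht
    have := mul_le_mul_of_nonneg_left (hφm hst) two_pi_pos.le
    linarith
  · filter_upwards [htr] with t ht htI ε hε
    have hε' : 0 < ε / (1 + 2 * π) := by positivity
    have hd := (hasDerivAt_iff_tendsto_slope.1 (hφ t)).mono_left
      (nhdsWithin_mono t (show Ioi t ⊆ {t}ᶜ from fun s h => ne_of_gt h))
    filter_upwards [eventually_core_ge hp1 hp2 h₁ h₂ ha hac (h01 t (Ioo_subset_Icc_self htI))
      (h02 t (Ioo_subset_Icc_self htI)) ht hε',
      hd.eventually (lt_mem_nhds (sub_lt_self _ hε')), self_mem_nhdsWithin] with s k1 k2 k3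
    replace k3 : 0 < s - t := sub_pos.2 k3
    rw [slope_def_field, lt_div_iff₀ k3] at k2
    have := mul_le_mul_of_nonneg_left k2.le two_pi_pos.le
    have e : ε = ε / (1 + 2 * π) + 2 * π * (ε / (1 + 2 * π)) := by field_simp
    obtain ⟨η, hη⟩ : ∃ η, η = ε / (1 + 2 * π) := ⟨_, rfl⟩
    rw [← hη] at this k1 e
    rw [e]
    linarith

end Fam

namespace Fam

variable {Γ Γ₁ Γ₂ : Fam} {t₀ t A B : ℝ} {a φ : ℝ → ℝ}

lemma Positive.area_add (hp : Γ.Positive) (hf : Γ.IsFlow a) (hφ : ∀ t, HasDerivAt φ (a t) t)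
    (s t : ℝ) : volume.real (Γ.inside s) + 2 * π * φ s = volume.real (Γ.inside t) + 2 * π * φ t := by
  have h : ∀ s, HasDerivAt (fun s => volume.real (Γ.inside s) + 2 * π * φ s) 0 s := fun s =>
    ((IsFlow.hasDerivAt_area hf hp s).fun_add ((hφ s).const_mul (2 * π))).congr_deriv (by ring)
  exact is_const_of_deriv_eq_zero (fun s => (h s).differentiableAt) (fun s => (h s).deriv) s t

lemma volume_sdiff_inside_le (hp1 : Γ₁.Positive) (hp2 : Γ₂.Positive) (h₁ : Γ₁.IsFlow a)
    (h₂ : Γ₂.IsFlow a) (ha : ∀ t, 0 < a t) (hac : Continuous a) (hφ : ∀ t, HasDerivAt φ (a t) t)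
    (hAB : A ≤ B) (h01 : ∀ s ∈ Icc A B, 0 ∈ Γ₁.inside s) (h02 : ∀ s ∈ Icc A B, 0 ∈ Γ₂.inside s)
    (htr : ∀ᵐ t, Transversal Γ₁ Γ₂ t) :
    volume.real (Γ₁.inside B \ Γ₂.inside B) ≤
      volume.real (Γ₁.inside A) - volume.real (core Γ₁ Γ₂ A) := by
  have k1 := h01 B (right_mem_Icc.2 hAB)
  have k2 := h02 B (right_mem_Icc.2 hAB)
  have hs := core_subset_inside k1 k2
  have hs2 : core Γ₁ Γ₂ B ⊆ Γ₂.inside B := core_comm Γ₁ Γ₂ B ▸ core_subset_inside k2 k1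
  have h := core_area_mono hp1 hp2 h₁ h₂ ha hac hφ hAB h01 h02 htr
  have h' := hp1.area_add h₁ hφ A B
  have hle : volume.real (Γ₁.inside B \ Γ₂.inside B) ≤
      volume.real (Γ₁.inside B \ core Γ₁ Γ₂ B) :=
    measureReal_mono (sdiff_subset_sdiff_right hs2)
      (measure_ne_top_of_subset sdiff_subset (Γ₁.volume_inside_ne_top B))
  rw [measureReal_sdiff hs (isOpen_core _ _ _).measurableSet (Γ₁.volume_inside_ne_top B)] at hle
  linarith

lemma mem_translate_inside {w z : ℂ} : z ∈ (Γ.translate w).inside t ↔ z - w ∈ Γ.inside t :=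
  mem_move_inside Γ contDiff_id contDiff_const

lemma inside_subset_closure_of_translate (H : ∀ ε > 0, ∃ w : ℂ, ‖w‖ < ε ∧
      volume.real (Γ₁.inside t \ (Γ₂.translate w).inside t) ≤ ε) :
    Γ₁.inside t ⊆ closure (Γ₂.inside t) := by
  intro z hz
  by_contra hn
  obtain ⟨r, hr, hb⟩ := Metric.isOpen_iff.1 ((Γ₁.isOpen_inside t).inter
    isClosed_closure.isOpen_compl) z ⟨hz, hn⟩
  have hpos : 0 < volume.real (ball z (r / 2)) :=
    ENNReal.toReal_pos (measure_ball_pos _ _ (by positivity)).ne' measure_ball_lt_top.ne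
  obtain ⟨w, hw, hv⟩ := H (min (r / 2) (volume.real (ball z (r / 2)) / 2)) (by positivity)
  have hsub : ball z (r / 2) ⊆ Γ₁.inside t \ (Γ₂.translate w).inside t := fun u hu => by
    refine ⟨(hb (ball_subset_ball (by linarith) hu)).1, fun h => ?_⟩
    refine (hb (mem_ball.2 ?_)).2 (subset_closure (mem_translate_inside.1 h))
    have h1 := mem_ball.1 hu
    have h2 := hw.trans_le (min_le_left _ _)
    have := norm_sub_le (u - z) w
    rw [dist_eq_norm] at h1 ⊢
    rw [show u - w - z = u - z - w by ring]
    linarith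
  have := measureReal_mono hsub (measure_ne_top_of_subset sdiff_subset (Γ₁.volume_inside_ne_top t))
  have := min_le_right (r / 2) (volume.real (ball z (r / 2)) / 2)
  linarith

/-- If the first curve starts inside the second in the sense of areas, then it is strictly inside
at all times. -/
lemma mem_inside_of_approx (hp1 : Γ₁.Positive) (hp2 : Γ₂.Positive) (h₁ : Γ₁.IsFlow a)
    (h₂ : Γ₂.IsFlow a) (ha : ∀ t, 0 < a t) (hac : Continuous a) (hφ : ∀ t, HasDerivAt φ (a t) t)
    {τ δ₀ : ℝ} (hδ₀ : 0 < δ₀) (h01 : ∀ s ≤ τ, 0 ∈ Γ₁.inside s)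
    (h02 : ∀ s ≤ τ, ∀ w : ℂ, ‖w‖ < δ₀ → 0 ∈ (Γ₂.translate w).inside s)
    (H : ∀ ε > 0, ∃ δ > 0, ∃ A₀, ∀ A ≤ A₀, ∀ w : ℂ, ‖w‖ < δ →
      volume.real (Γ₁.inside A) - volume.real (core Γ₁ (Γ₂.translate w) A) ≤ ε)
    (harea : volume.real (Γ₁.inside τ) < volume.real (Γ₂.inside τ)) :
    ∀ t x, Γ₁ (x, t) ∈ Γ₂.inside t := by
  have hin : ∀ t ≤ τ, ∀ x, Γ₁ (x, t) ∈ Γ₂.inside t ∨ Γ₁ (x, t) ∈ Γ₂.curve t := fun t ht x => by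
    refine Γ₂.mem_inside_or_mem_curve_of_mem_closure (closure_minimal
      (inside_subset_closure_of_translate fun ε hε => ?_) isClosed_closure
      (hp1.mem_closure_inside x t))
    obtain ⟨δ, hδ, A₀, hA⟩ := H ε hε
    obtain ⟨w, hw, htr⟩ := (Measure.dense_of_ae (ae_transversal Γ₁ Γ₂)).inter_open_nonempty
      (ball 0 (min ε (min δ δ₀))) isOpen_ball ⟨0, mem_ball_self (by positivity)⟩
    rw [mem_ball_zero_iff, lt_min_iff, lt_min_iff] at hw
    exact ⟨w, hw.1, (volume_sdiff_inside_le hp1 (hp2.move _ _) h₁ (h₂.move_const w) ha hac hφ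
      (min_le_right A₀ t) (fun s hs => h01 s (hs.2.trans ht))
      (fun s hs => h02 s (hs.2.trans ht) w hw.2.2) htr).trans (hA _ (min_le_left _ _) w hw.2.1)⟩
  have hdis : ∀ t ≤ τ, Disjoint (Γ₁.curve t) (Γ₂.curve t) := fun t ht =>
    disjoint_of_area_lt h₁ h₂ ha hac hp1 hp2 one_pos (fun s hs => hin s (hs.2.trans ht)) (by
      have := hp1.area_add h₁ hφ t τ
      have := hp2.area_add h₂ hφ t τ
      linarith)
  have hle : ∀ t ≤ τ, ∀ x, Γ₁ (x, t) ∈ Γ₂.inside t := fun t ht x =>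
    (hin t ht x).resolve_right fun h => (hdis t ht).le_bot ⟨Γ₁.mem_curve x t, h⟩
  intro t x
  rcases le_total t τ with ht | ht
  · exact hle t ht x
  have hd : ∀ s ∈ Icc τ t, Γ₁ (x, s) ∉ Γ₂.curve s := fun s hs h =>
    (disjoint_forward h₁ h₂ ha hac hs.1 (hdis τ le_rfl)).le_bot ⟨Γ₁.mem_curve x s, h⟩
  refine ⟨hd t ⟨ht, le_rfl⟩, ?_⟩
  have hc := Γ₁.continuous
  rw [← (hle τ le_rfl x).2]
  exact Γ₂.wn_eq_of_isPreconnected (S := (fun s => (Γ₁ (x, s), s)) '' Icc τ t)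
    (isPreconnected_Icc.image _ (by fun_prop)) (by rintro _ ⟨s, hs, rfl⟩; exact hd s hs)
    ⟨t, ⟨ht, le_rfl⟩, rfl⟩ ⟨τ, ⟨le_rfl, ht⟩, rfl⟩

end Fam

section

/-- The points enclosed by a closed curve, in terms of logarithms. -/
def enclosed (γ : Set ℂ) : Set ℂ := {p | p ∉ γ ∧ ¬ HasLogOn γ fun z => z - p}

/-- Two Jordan curves with uniformly close parametrizations. -/
def CloseCurves (γ γ' : Set ℂ) (ε : ℝ) : Prop := ∃ φ ψ : Circle → ℂ,
  Continuous φ ∧ Function.Injective φ ∧ range φ = γ ∧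
  Continuous ψ ∧ Function.Injective ψ ∧ range ψ = γ' ∧ ∀ x, ‖φ x - ψ x‖ < ε

lemma hasLogOn_range_iff {φ : Circle → ℂ} (hφ : Continuous φ) (hi : Function.Injective φ)
    {f : ℂ → ℂ} : HasLogOn (range φ) f ↔ HasLogOn univ fun x => f (φ x) := by
  constructor
  · exact fun h => h.comp hφ.continuousOn fun x _ => mem_range_self x
  · rintro ⟨l, hl, he⟩
    exact HasLogOn.of_comp hφ (continuousOn_univ.1 hl) (fun x y h => by rw [hi h])
      fun x => he x (mem_univ x)

variable {γ γ' γ₁ γ₂ : Set ℂ} {ε : ℝ} {p r : ℂ}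

namespace CloseCurves

lemma isCompact_left (h : CloseCurves γ γ' ε) : IsCompact γ := by
  obtain ⟨φ, ψ, hφ, -, rfl, -⟩ := h
  exact isCompact_range hφ

lemma exists_near (h : CloseCurves γ γ' ε) {z : ℂ} (hz : z ∈ γ') : ∃ w ∈ γ, ‖w - z‖ < ε := by
  obtain ⟨φ, ψ, -, -, rfl, -, -, rfl, hd⟩ := h
  obtain ⟨x, rfl⟩ := hz
  exact ⟨_, mem_range_self x, hd x⟩

lemma notMem_right (h : CloseCurves γ γ' ε) (hp : ∀ z ∈ γ, ε ≤ ‖z - p‖) : p ∉ γ' := fun hz => by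
  obtain ⟨w, hw, hd⟩ := h.exists_near hz
  exact absurd hd (not_lt.2 (hp w hw))

lemma hasLogOn_ratio {φ ψ : Circle → ℂ} (hφ : Continuous φ) (hψ : Continuous ψ)
    (hd : ∀ x, ‖φ x - ψ x‖ < ε) (hp : ∀ x, ε ≤ ‖φ x - p‖) :
    HasLogOn univ fun x => (ψ x - p) / (φ x - p) := by
  have h0 : ∀ x, φ x - p ≠ 0 := fun x => norm_pos_iff.1
    (((norm_nonneg _).trans_lt (hd x)).trans_le (hp x))
  refine (hasLogOn_const one_ne_zero).of_close ?_ continuousOn_const fun x _ => ?_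
  · exact (Continuous.div (by fun_prop) (by fun_prop) h0).continuousOn
  · rw [div_sub_one (h0 x), norm_div, norm_one, div_lt_one (norm_pos_iff.2 (h0 x)),
      sub_sub_sub_cancel_right, norm_sub_rev]
    exact (hd x).trans_le (hp x)

lemma hasLogOn_iff (h : CloseCurves γ γ' ε) (hp : ∀ z ∈ γ, ε ≤ ‖z - p‖) :
    HasLogOn γ' (fun z => z - p) ↔ HasLogOn γ (fun z => z - p) := by
  have hp' := h.notMem_right hp
  obtain ⟨φ, ψ, hφ, iφ, rfl, hψ, iψ, rfl, hd⟩ := h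
  have hr := hasLogOn_ratio hφ hψ hd fun x => hp _ (mem_range_self x)
  have h0 : ∀ x, φ x - p ≠ 0 := fun x => norm_pos_iff.1
    (((norm_nonneg _).trans_lt (hd x)).trans_le (hp _ (mem_range_self x)))
  have h1 : ∀ x, ψ x - p ≠ 0 := fun x hx => hp' ⟨x, sub_eq_zero.1 hx⟩
  rw [hasLogOn_range_iff hφ iφ, hasLogOn_range_iff hψ iψ]
  exact ⟨fun h => (h.div hr).congr fun x _ => by field_simp [h0 x, h1 x],
    fun h => (hr.mul h).congr fun x _ => div_mul_cancel₀ _ (h0 x)⟩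

lemma hasLogOn_div (h : CloseCurves γ γ' ε) (hp : ∀ z ∈ γ, ε ≤ ‖z - p‖)
    (hr : ∀ z ∈ γ, ε ≤ ‖z - r‖) (hl : HasLogOn γ' fun z => (z - p) / (z - r)) :
    HasLogOn γ fun z => (z - p) / (z - r) := by
  have hp' := h.notMem_right hp
  have hr' := h.notMem_right hr
  obtain ⟨φ, ψ, hφ, iφ, rfl, hψ, iψ, rfl, hd⟩ := h
  have kp := hasLogOn_ratio hφ hψ hd fun x => hp _ (mem_range_self x)
  have kr := hasLogOn_ratio hφ hψ hd fun x => hr _ (mem_range_self x)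
  have h0 : ∀ x, φ x - p ≠ 0 := fun x => norm_pos_iff.1
    (((norm_nonneg _).trans_lt (hd x)).trans_le (hp _ (mem_range_self x)))
  have h2 : ∀ x, φ x - r ≠ 0 := fun x => norm_pos_iff.1
    (((norm_nonneg _).trans_lt (hd x)).trans_le (hr _ (mem_range_self x)))
  have h1 : ∀ x, ψ x - p ≠ 0 := fun x hx => hp' ⟨x, sub_eq_zero.1 hx⟩
  have h3 : ∀ x, ψ x - r ≠ 0 := fun x hx => hr' ⟨x, sub_eq_zero.1 hx⟩
  rw [hasLogOn_range_iff hψ iψ] at hl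
  rw [hasLogOn_range_iff hφ iφ]
  exact ((hl.div kp).mul kr).congr fun x _ => by
    have := h0 x; have := h1 x; have := h2 x; have := h3 x
    field_simp

end CloseCurves

lemma mem_enclosed_of_mem_component (hγ : IsCompact γ) (hp : p ∈ enclosed γ)
    (hr : r ∈ connectedComponentIn γᶜ p) : r ∈ enclosed γ := by
  have hrc := connectedComponentIn_subset _ _ hr
  refine ⟨hrc, fun h => hp.2 ?_⟩
  refine (h.mul (hasLogOn_div_of_mem_component hγ.isClosed hr)).congr fun z hz => ?_
  exact mul_div_cancel₀ _ (sub_ne_zero.2 fun e => hrc (e ▸ hz))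

lemma isOpen_enclosed (hγ : IsCompact γ) : IsOpen (enclosed γ) := by
  refine isOpen_iff_mem_nhds.2 fun p hp => mem_of_superset
    (hγ.isClosed.isOpen_compl.connectedComponentIn.mem_nhds (mem_connectedComponentIn hp.1))
    fun r hr => mem_enclosed_of_mem_component hγ hp hr

lemma isOpen_compl_enclosed (hγ : IsCompact γ) : IsOpen (γ ∪ enclosed γ)ᶜ := by
  refine isOpen_iff_mem_nhds.2 fun p hp => ?_
  rw [mem_compl_iff, mem_union, not_or] at hp
  refine mem_of_superset
    (hγ.isClosed.isOpen_compl.connectedComponentIn.mem_nhds (mem_connectedComponentIn hp.1))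
    fun r hr h => ?_
  refine h.elim (connectedComponentIn_subset _ _ hr) fun h => hp.2 ?_
  exact mem_enclosed_of_mem_component hγ h
    (connectedComponentIn_eq hr ▸ mem_connectedComponentIn hp.1)

lemma mem_enclosed_of_isBounded (hγ : IsCompact γ) (hp : p ∉ γ)
    (h : Bornology.IsBounded (connectedComponentIn γᶜ p)) : p ∈ enclosed γ :=
  ⟨hp, fun hl => not_isBounded_component_of_hasLogOn hγ hp hl h⟩

lemma isBounded_component (hγ : IsCompact γ) (hp : p ∈ enclosed γ) :
    Bornology.IsBounded (connectedComponentIn γᶜ p) := by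
  by_contra h
  exact hp.2 (hasLogOn_of_not_isBounded hγ h)

lemma volume_enclosed_ne_top (hγ : IsCompact γ) : volume (enclosed γ) ≠ ⊤ := by
  obtain ⟨R, -, hR⟩ := hγ.exists_norm_bound
  refine measure_ne_top_of_subset (fun p hp => ?_) (measure_ball_lt_top (x := (0 : ℂ)) (r := R)).ne
  by_contra h
  rw [mem_ball_zero_iff, not_lt] at h
  exact hp.2 (hasLogOn_sub_of_far hR h)

lemma enclosed_subset (h1 : IsCompact γ₁) (h2 : IsCompact γ₂) (h : γ₁ \ γ₂ ⊆ enclosed γ₂) :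
    enclosed γ₁ ⊆ enclosed γ₂ ∪ γ₂ := by
  intro p hp
  by_contra hn
  rw [mem_union, not_or] at hn
  have hU : connectedComponentIn γ₂ᶜ p ⊆ γ₁ᶜ := fun z hz hz1 => hn.1
    (mem_enclosed_of_mem_component h2 (h ⟨hz1, connectedComponentIn_subset _ _ hz⟩)
      (connectedComponentIn_eq hz ▸ mem_connectedComponentIn hn.2))
  have hb := (isBounded_component h1 hp).subset 
    (isPreconnected_connectedComponentIn.subset_connectedComponentIn
      (mem_connectedComponentIn hn.2) hU)
  exact hn.1 (mem_enclosed_of_isBounded h2 hn.2 hb)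

/-- Compact parts of a component survive small changes of the boundary. -/
lemma exists_subset_component {X₀ K : Set ℂ} (hX : IsClosed X₀) (hK : IsCompact K) {p₀ : ℂ}
    (h : K ⊆ connectedComponentIn X₀ᶜ p₀) :
    ∃ δ > 0, ∀ X ⊆ thickening δ X₀, K ⊆ connectedComponentIn Xᶜ p₀ := by
  refine hK.induction_on (p := fun S => ∃ δ > 0, ∀ X ⊆ thickening δ X₀,
    S ⊆ connectedComponentIn Xᶜ p₀) ⟨1, one_pos, fun _ _ => empty_subset _⟩ ?_ ?_ ?_
  · rintro s t hst ⟨δ, hδ, H⟩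
    exact ⟨δ, hδ, fun X hX => hst.trans (H X hX)⟩
  · rintro s t ⟨δ, hδ, H⟩ ⟨δ', hδ', H'⟩
    exact ⟨min δ δ', by positivity, fun X hX => union_subset
      (H X (hX.trans (thickening_mono (min_le_left _ _) _)))
      (H' X (hX.trans (thickening_mono (min_le_right _ _) _)))⟩
  · intro p hp
    have hpc := h hp
    have h0 : p₀ ∈ X₀ᶜ := by
      by_contra h0
      rw [connectedComponentIn_eq_empty h0] at hpc
      exact hpc
    have hop : IsOpen (connectedComponentIn X₀ᶜ p₀) := hX.isOpen_compl.connectedComponentIn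
    have hconn := hop.isConnected_iff_isPathConnected.1 (isConnected_connectedComponentIn_iff.2 h0)
    obtain ⟨P, hP⟩ := hconn.joinedIn p₀ (mem_connectedComponentIn h0) p hpc
    obtain ⟨ρ, hρ, hb⟩ := Metric.nhds_basis_closedBall.mem_iff.1 (hop.mem_nhds hpc)
    have hL : IsCompact (range P ∪ closedBall p ρ) :=
      (isCompact_range P.continuous).union (isCompact_closedBall p ρ)
    have hLc : IsPreconnected (range P ∪ closedBall p ρ) :=
      IsPreconnected.union p ⟨1, P.target⟩ (mem_closedBall_self hρ.le)
        (isPreconnected_range P.continuous) (convex_closedBall p ρ).isPreconnected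
    have hLs : range P ∪ closedBall p ρ ⊆ X₀ᶜ := (union_subset (range_subset_iff.2 hP) hb).trans
      (connectedComponentIn_subset _ _)
    obtain ⟨δ, hδ, hd⟩ := hL.exists_thickening_subset_open hX.isOpen_compl hLs
    refine ⟨closedBall p ρ, mem_nhdsWithin_of_mem_nhds (closedBall_mem_nhds p hρ), δ, hδ,
      fun X hXs z hz => hLc.subset_connectedComponentIn (Or.inl ⟨0, P.source⟩) ?_ (Or.inr hz)⟩
    intro u hu hux
    obtain ⟨v, hv, hd'⟩ := mem_thickening_iff.1 (hXs hux)
    exact hd (mem_thickening_iff.2 ⟨u, hu, by rwa [dist_comm]⟩) hv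

lemma hasLogOn_arc {f : ℝ → ℂ} {a b : ℝ} (hab : a ≤ b) (hf : ContinuousOn f (Icc a b))
    (hi : InjOn f (Icc a b)) {g : ℂ → ℂ} (hg : ContinuousOn g (f '' Icc a b))
    (h0 : ∀ z ∈ f '' Icc a b, g z ≠ 0) : HasLogOn (f '' Icc a b) g := by
  have hm : ∀ x : ℝ, f (projIcc a b hab x) ∈ f '' Icc a b := fun x =>
    mem_image_of_mem f (projIcc a b hab x).2
  have hc : Continuous fun x : ℝ => f (projIcc a b hab x) :=
    hf.comp_continuous (by fun_prop) fun x => (projIcc a b hab x).2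
  obtain ⟨l, hl, he⟩ := exists_log_of_simplyConnected
    (f := fun x : ℝ => g (f (projIcc a b hab x))) (hg.comp_continuous hc hm) fun x => h0 _ (hm x)
  rw [image_eq_range]
  refine HasLogOn.of_comp (l := fun x : Icc a b => l x) (continuousOn_iff_continuous_domRestrict.1 hf)
    (by fun_prop) (fun x y h => by rw [hi x.2 y.2 h]) fun x => ?_
  rw [he, projIcc_val]

lemma exists_exterior_near {ψ : Circle → ℂ} (hψ : Continuous ψ) (hi : Function.Injective ψ)
    {q : ℂ} (hq : q ∈ range ψ) {ρ : ℝ} (hρ : 0 < ρ) :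
    ∃ e ∈ ball q ρ, e ∉ range ψ ∧ e ∉ enclosed (range ψ) := by
  obtain ⟨θ, rfl⟩ := hq
  have hγ := isCompact_range hψ
  obtain ⟨h, hh⟩ : ∃ h : ℝ → ℂ, h = fun x => ψ (θ * Circle.exp x) := ⟨_, rfl⟩
  have hc : Continuous h := by rw [hh]; fun_prop
  have hper : ∀ x, h (x + 2 * π) = h x := fun x => by rw [hh]; simp [Circle.exp_add]
  have h0 : h 0 = ψ θ := by simp [hh]
  obtain ⟨η, hη, hη1, hb⟩ : ∃ η > 0, η ≤ 1 ∧ ∀ x : ℝ, |x| < η → h x ∈ ball (ψ θ) ρ := by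
    obtain ⟨η, hη, hb⟩ := Metric.continuousAt_iff.1 (hc.continuousAt (x := 0)) ρ hρ
    refine ⟨min η 1, by positivity, min_le_right _ _, fun x hx => ?_⟩
    rw [mem_ball, ← h0]
    exact hb (by rw [Real.dist_eq, sub_zero]; exact hx.trans_le (min_le_left _ _))
  have hπ := pi_gt_three
  have hinj : ∀ {x y : ℝ}, h x = h y → |x - y| < 2 * π → x = y := fun {x y} he hxy => by
    rw [hh] at he
    obtain ⟨m, hm⟩ := Circle.exp_eq_exp.1 (mul_left_cancel (hi he))
    rw [hm, add_sub_cancel_left, abs_mul, abs_of_pos two_pi_pos] at hxy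
    have h1 : |(m : ℝ)| < 1 := by
      by_contra! h1
      nlinarith [two_pi_pos]
    have h2 : m = 0 := Int.abs_lt_one_iff.1 (by exact_mod_cast h1)
    simpa [h2] using hm
  obtain ⟨X, hX⟩ : ∃ X, X = h '' Icc η (2 * π - η) := ⟨_, rfl⟩
  have hXc : IsCompact X := hX ▸ isCompact_Icc.image hc
  have hXγ : X ⊆ range ψ := by
    rw [hX, hh]
    rintro _ ⟨x, -, rfl⟩
    exact mem_range_self _
  have hqX : ψ θ ∉ X := by
    rw [hX, ← h0]
    rintro ⟨x, hx, he⟩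
    have := hinj he (by rw [sub_zero, abs_of_pos (hη.trans_le hx.1)]; linarith [hx.2])
    linarith [hx.1]
  have hout : ∀ z ∈ range ψ, z ∉ X → z ∈ ball (ψ θ) ρ := by
    rintro _ ⟨u, rfl⟩ hz
    have hu : h (Complex.arg ((θ⁻¹ * u : Circle) : ℂ)) = ψ u := by
      rw [hh]
      dsimp only
      rw [Circle.exp_arg, mul_inv_cancel_left]
    have hle := Complex.arg_le_pi ((θ⁻¹ * u : Circle) : ℂ)
    have hgt := Complex.neg_pi_lt_arg ((θ⁻¹ * u : Circle) : ℂ)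
    generalize Complex.arg ((θ⁻¹ * u : Circle) : ℂ) = x at hu hle hgt
    rw [← hu]
    refine hb x ?_
    by_contra! hx
    rcases le_abs.1 hx with hx | hx
    · exact hz (hX ▸ ⟨x, ⟨hx, by linarith⟩, hu⟩)
    · exact hz (hX ▸ ⟨x + 2 * π, ⟨by linarith, by linarith⟩, by rw [hper, hu]⟩)
  obtain ⟨R, hR0, hR⟩ := hγ.exists_norm_bound
  have hRn : R ≤ ‖(R : ℂ)‖ := by rw [Complex.norm_real]; exact le_abs_self R
  have hRγ : (R : ℂ) ∉ range ψ := fun hz => absurd (hR _ hz) (not_lt.2 hRn)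
  have hRe : (R : ℂ) ∉ enclosed (range ψ) := fun hz => hz.2 (hasLogOn_sub_of_far hR hRn)
  have hlog : HasLogOn X fun z => (z - R) / (z - ψ θ) := by
    have hs : ∀ z ∈ X, z - ψ θ ≠ 0 := fun z hz => sub_ne_zero.2 fun e => hqX (e ▸ hz)
    rw [hX] at hs ⊢
    refine hasLogOn_arc (by linarith) hc.continuousOn (fun x hx y hy he => hinj he ?_) ?_
      fun z hz => div_ne_zero (sub_ne_zero.2 fun e => hRγ (e ▸ hXγ (hX ▸ hz))) (hs z hz)
    · rw [abs_lt]
      constructor <;> linarith [hx.1, hx.2, hy.1, hy.2]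
    · exact ContinuousOn.div (by fun_prop) (by fun_prop) hs
  have hmem := mem_component_of_hasLogOn hXc (fun hz => hRγ (hXγ hz)) hqX hlog
  by_contra! hcon
  have hclosed : connectedComponentIn Xᶜ (R : ℂ) ⊆ (range ψ ∪ enclosed (range ψ))ᶜ := by
    refine isPreconnected_connectedComponentIn.subset_of_closure_inter_subset
      (isOpen_compl_enclosed hγ) ⟨R, mem_connectedComponentIn fun hz => hRγ (hXγ hz), ?_⟩ ?_
    · exact fun hz => hz.elim hRγ hRe
    · rintro p ⟨hp, hpV⟩ hz
      obtain ⟨O, hO, hpO, hOE⟩ : ∃ O, IsOpen O ∧ p ∈ O ∧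
          O ⊆ range ψ ∪ enclosed (range ψ) := by
        rcases hz with hz | hz
        · refine ⟨ball (ψ θ) ρ, isOpen_ball,
            hout p hz (connectedComponentIn_subset _ _ hpV), fun e he => ?_⟩
          by_contra hn
          rw [mem_union, not_or] at hn
          exact hn.2 (hcon e he hn.1)
        · exact ⟨_, isOpen_enclosed hγ, hz, subset_union_right⟩
      obtain ⟨e, he, hee⟩ := mem_closure_iff.1 hp O hO hpO
      exact hee (hOE he)
  exact hclosed hmem (Or.inl (mem_range_self θ))

end

lemma IsOpen.exists_isCompact_volume {U : Set ℂ} (hU : IsOpen U) (hv : volume U ≠ ⊤) {η : ℝ}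
    (hη : 0 < η) : ∃ K ⊆ U, IsCompact K ∧ volume.real U ≤ volume.real K + η := by
  obtain ⟨K, hKU, hK, hlt⟩ := hU.measurableSet.exists_isCompact_lt_add hv
    (ENNReal.ofReal_pos.2 hη).ne'
  refine ⟨K, hKU, hK, ?_⟩
  have h := ENNReal.toReal_mono (by simp [hK.measure_lt_top.ne]) hlt.le
  rwa [ENNReal.toReal_add hK.measure_lt_top.ne ENNReal.ofReal_ne_top,
    ENNReal.toReal_ofReal hη.le] at h

lemma IsCompact.exists_forall_le_norm_sub {K X : Set ℂ} (hK : IsCompact K) (hX : IsClosed X)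
    (h : Disjoint K X) : ∃ ε > 0, ∀ p ∈ K, ∀ z ∈ X, ε ≤ ‖z - p‖ := by
  obtain ⟨ε, hε, hd⟩ := hK.exists_thickening_subset_open hX.isOpen_compl
    (disjoint_left.1 h : K ⊆ Xᶜ)
  refine ⟨ε, hε, fun p hp z hz => ?_⟩
  by_contra! hlt
  exact hd (mem_thickening_iff.2 ⟨p, hp, by rwa [dist_eq_norm]⟩) hz

lemma exists_volume_thickening_le {X : Set ℂ} (hX : IsCompact X) (h0 : volume X = 0) {η : ℝ}
    (hη : 0 < η) : ∃ ε > 0, volume (thickening ε X) ≠ ⊤ ∧ volume.real (thickening ε X) ≤ η := by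
  have ht := tendsto_measure_cthickening_of_isClosed (μ := volume) (s := X)
    ⟨1, one_pos, hX.cthickening.measure_lt_top.ne⟩ hX.isClosed
  rw [h0] at ht
  obtain ⟨ε, hε, hb⟩ := (((ht.eventually_lt_const (ENNReal.ofReal_pos.2 hη)).filter_mono
    nhdsWithin_le_nhds).and (self_mem_nhdsWithin (s := Ioi (0 : ℝ)))).exists
  have hle := (measure_mono (thickening_subset_cthickening ε X)).trans hε.le
  exact ⟨ε, hb, ne_top_of_le_ne_top ENNReal.ofReal_ne_top hle,
    ENNReal.toReal_le_of_le_ofReal hη.le hle⟩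

namespace Fam

lemma Positive.mem_inside_iff {Γ : Fam} (hp : Γ.Positive) {γ : Set ℂ} {ε s : ℝ} {p : ℂ}
    (h : CloseCurves γ (Γ.curve s) ε) (hd : ∀ z ∈ γ, ε ≤ ‖z - p‖) :
    p ∈ Γ.inside s ↔ p ∈ enclosed γ := by
  have hpc := h.notMem_right hd
  have hpγ : p ∉ γ := fun hz => by
    obtain ⟨φ, ψ, -, -, -, -, -, -, hlt⟩ := h
    have h1 := (norm_nonneg _).trans_lt (hlt 1)
    have h2 := hd p hz
    rw [sub_self, norm_zero] at h2
    linarith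
  have h1 := h.hasLogOn_iff hd
  rw [Γ.hasLogOn_iff hpc] at h1
  simp only [inside, enclosed, mem_ofPred_eq, hpc, hpγ, not_false_eq_true, true_and, ← h1]
  rcases hp.wn_eq hpc with h | h <;> simp [h]

/-- The curve converges to `γ` at `-∞`. -/
def StartsAt (Γ : Fam) (γ : Set ℂ) : Prop :=
  ∀ ε > 0, ∀ᶠ s in atBot, CloseCurves γ (Γ.curve s) ε

variable {Γ Γ₁ Γ₂ : Fam} {γ γ₁ γ₂ : Set ℂ} {a φ : ℝ → ℝ}

lemma StartsAt.isCompact (h : Γ.StartsAt γ) : IsCompact γ :=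
  (h 1 one_pos).exists.choose_spec.isCompact_left

lemma StartsAt.eventually_subset_inside (h : Γ.StartsAt γ) (hp : Γ.Positive) {K : Set ℂ}
    (hK : IsCompact K) (hKs : K ⊆ enclosed γ) : ∀ᶠ s in atBot, K ⊆ Γ.inside s := by
  obtain ⟨ε, hε, hd⟩ := hK.exists_forall_le_norm_sub h.isCompact.isClosed
    (disjoint_left.2 fun p hp hz => (hKs hp).1 hz)
  filter_upwards [h ε hε] with s hs p hpK
  exact (hp.mem_inside_iff hs (hd p hpK)).2 (hKs hpK)

lemma StartsAt.area_le (h : Γ.StartsAt γ) (hp : Γ.Positive) (hf : Γ.IsFlow a)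
    (hφ : ∀ t, HasDerivAt φ (a t) t) (hφ0 : Tendsto φ atBot (𝓝 0)) (h0 : volume γ = 0) (t : ℝ) :
    volume.real (Γ.inside t) + 2 * π * φ t ≤ volume.real (enclosed γ) := by
  refine le_of_forall_pos_le_add fun η hη => ?_
  obtain ⟨ε, hε, htop, hv⟩ := exists_volume_thickening_le h.isCompact h0 (half_pos hη)
  have h2 : Tendsto (fun s => 2 * π * φ s) atBot (𝓝 0) := by simpa using hφ0.const_mul (2 * π)
  obtain ⟨s, hs, hs2⟩ := ((h ε hε).and (h2.eventually_lt_const (half_pos hη))).exists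
  rw [hp.area_add hf hφ t s]
  have hsub : Γ.inside s ⊆ enclosed γ ∪ thickening ε γ := fun p hpi => by
    by_contra hn
    rw [mem_union, not_or] at hn
    refine hn.1 ((hp.mem_inside_iff hs fun z hz => ?_).1 hpi)
    by_contra! hlt
    exact hn.2 (mem_thickening_iff.2 ⟨z, hz, by rwa [dist_comm, dist_eq_norm]⟩)
  have h3 := (measureReal_mono hsub (measure_union_ne_top
    (volume_enclosed_ne_top h.isCompact) htop)).trans (measureReal_union_le _ _)
  linarith

lemma StartsAt.le_area (h : Γ.StartsAt γ) (hp : Γ.Positive) (hf : Γ.IsFlow a)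
    (hφ : ∀ t, HasDerivAt φ (a t) t) (hφ0 : ∀ t, 0 < φ t) (t : ℝ) :
    volume.real (enclosed γ) ≤ volume.real (Γ.inside t) + 2 * π * φ t := by
  refine le_of_forall_pos_le_add fun η hη => ?_
  obtain ⟨K, hK, hKc, hle⟩ := (isOpen_enclosed h.isCompact).exists_isCompact_volume
    (volume_enclosed_ne_top h.isCompact) hη
  obtain ⟨s, hs⟩ := (h.eventually_subset_inside hp hKc hK).exists
  rw [hp.area_add hf hφ t s]
  have h1 := measureReal_mono hs (Γ.volume_inside_ne_top s)
  have h2 := mul_pos two_pi_pos (hφ0 s)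
  linarith

lemma StartsAt.hasLogOn_div (h : Γ.StartsAt γ) (hp : Γ.Positive) {p r : ℂ} (hpe : p ∈ enclosed γ)
    (hr : r ∈ enclosed γ) : HasLogOn γ fun z => (z - p) / (z - r) := by
  obtain ⟨ε, hε, hd⟩ := (isCompact_singleton.insert p).exists_forall_le_norm_sub (K := {p, r})
    h.isCompact.isClosed (disjoint_left.2 (by rintro _ (rfl | rfl) hz; exacts [hpe.1 hz, hr.1 hz]))
  obtain ⟨s, hs⟩ := (h ε hε).exists
  have h1 := (hp.mem_inside_iff hs (hd p (by simp))).2 hpe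
  have h2 := (hp.mem_inside_iff hs (hd r (by simp))).2 hr
  exact hs.hasLogOn_div (hd p (by simp)) (hd r (by simp))
    ((Γ.hasLogOn_div_iff h1.1 h2.1).2 (h1.2.trans h2.2.symm))

lemma StartsAt.isCompact_union (h1 : Γ₁.StartsAt γ₁) (h2 : Γ₂.StartsAt γ₂) :
    IsCompact (γ₁ ∪ γ₂) := h1.isCompact.union h2.isCompact

/-- A curve with interior cannot be contained in a curve meeting it in an arc. -/
lemma nonempty_sdiff_of_arc
    (harc : ∃ f : ℝ → ℂ, ContinuousOn f (Icc 0 1) ∧ InjOn f (Icc 0 1) ∧ f '' Icc 0 1 = γ₁ ∩ γ₂)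
    (hne : (enclosed γ₁).Nonempty) : (γ₁ \ γ₂).Nonempty := by
  by_contra hn
  rw [not_nonempty_iff_eq_empty, sdiff_eq_empty] at hn
  obtain ⟨f, hf, hi, he⟩ := harc
  rw [inter_eq_left.2 hn] at he
  obtain ⟨p, hp, hl⟩ := hne
  refine hl (he ▸ hasLogOn_arc zero_le_one hf hi (by fun_prop) fun z hz => ?_)
  exact sub_ne_zero.2 fun e => hp (e ▸ he ▸ hz)

lemma StartsAt.volume_enclosed_lt (h1 : Γ₁.StartsAt γ₁) (h2 : IsCompact γ₂)
    (hv₂ : volume γ₂ = 0) (hsub : γ₁ \ γ₂ ⊆ enclosed γ₂) (hne : (γ₁ \ γ₂).Nonempty) :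
    volume.real (enclosed γ₁) < volume.real (enclosed γ₂) := by
  obtain ⟨q, hq⟩ := hne
  obtain ⟨ρ, hρ, hb⟩ := Metric.isOpen_iff.1 (isOpen_enclosed h2) q (hsub hq)
  obtain ⟨e, heb, he1, he2⟩ : ∃ e ∈ ball q ρ, e ∉ γ₁ ∧ e ∉ enclosed γ₁ := by
    obtain ⟨s, φ, ψ, hφ, hi, rfl, -⟩ := (h1 1 one_pos).exists
    exact exists_exterior_near hφ hi hq.1 hρ
  obtain ⟨r, hr, hbr⟩ := Metric.isOpen_iff.1 ((isOpen_enclosed h2).inter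
    (isOpen_compl_enclosed h1.isCompact)) e ⟨hb heb, fun h => h.elim he1 he2⟩
  have hsub' : enclosed γ₁ \ γ₂ ⊆ enclosed γ₂ \ ball e r := fun p hp =>
    ⟨(enclosed_subset h1.isCompact h2 hsub hp.1).resolve_right hp.2,
      fun hpb => (hbr hpb).2 (Or.inr hp.1)⟩
  have h3 := measureReal_mono hsub'
    (measure_ne_top_of_subset sdiff_subset (volume_enclosed_ne_top h2))
  rw [measureReal_sdiff_null (by simp [measureReal_def, hv₂]) (by simp [hv₂]),
    measureReal_sdiff (fun z hz => (hbr hz).1) measurableSet_ball (volume_enclosed_ne_top h2)] at h3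
  have hpos : 0 < volume.real (ball e r) :=
    ENNReal.toReal_pos (measure_ball_pos _ _ hr).ne' measure_ball_lt_top.ne
  linarith

lemma subset_component_of_enclosed (h1 : Γ₁.StartsAt γ₁) (h2 : Γ₂.StartsAt γ₂) (hp1 : Γ₁.Positive)
    (hp2 : Γ₂.Positive) (hc : IsPreconnected (γ₁ ∩ γ₂)) (hsub : γ₁ \ γ₂ ⊆ enclosed γ₂) {p : ℂ}
    (hp : p ∈ enclosed γ₁ \ γ₂) : enclosed γ₁ \ γ₂ ⊆ connectedComponentIn (γ₁ ∪ γ₂)ᶜ p := by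
  intro r hr
  have hs : enclosed γ₁ \ γ₂ ⊆ enclosed γ₂ := fun z hz =>
    (enclosed_subset h1.isCompact h2.isCompact hsub hz.1).resolve_right hz.2
  exact mem_component_of_hasLogOn (h1.isCompact_union h2) (fun h => h.elim hp.1.1 hp.2)
    (fun h => h.elim hr.1.1 hr.2) ((h1.hasLogOn_div hp1 hp.1 hr.1).union h1.isCompact.isClosed
      h2.isCompact.isClosed (h2.hasLogOn_div hp2 (hs hp) (hs hr)) hc)

lemma CloseCurves.curve_subset {ε s : ℝ} (h : CloseCurves γ (Γ.curve s) ε) {z : ℂ}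
    (hz : z ∈ Γ.curve s) : ∃ w ∈ γ, dist z w < ε := by
  obtain ⟨w, hw, hd⟩ := h.exists_near hz
  exact ⟨w, hw, by rwa [dist_comm, dist_eq_norm]⟩

lemma subset_core_of_subset_component {p₀ w : ℂ} {s δ : ℝ} {K : Set ℂ}
    (hδ : ∀ X ⊆ thickening δ (γ₁ ∪ γ₂), K ⊆ connectedComponentIn Xᶜ p₀)
    (h1 : CloseCurves γ₁ (Γ₁.curve s) (δ / 2)) (h2 : CloseCurves γ₂ (Γ₂.curve s) (δ / 2))
    (hw : ‖w‖ < δ / 2) (hi1 : p₀ ∈ Γ₁.inside s) (hi2 : p₀ - w ∈ Γ₂.inside s) :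
    (fun z => z + p₀) ⁻¹' K ⊆
      core (Γ₁.translate (-p₀)) ((Γ₂.translate (-p₀)).translate w) s := by
  have hX : Γ₁.curve s ∪ (fun z => z - w) ⁻¹' Γ₂.curve s ⊆ thickening δ (γ₁ ∪ γ₂) := by
    rintro z (hz | hz)
    · obtain ⟨v, hv, hd⟩ := CloseCurves.curve_subset h1 hz
      exact mem_thickening_iff.2 ⟨v, Or.inl hv, by linarith [norm_nonneg w]⟩
    · obtain ⟨v, hv, hd⟩ := CloseCurves.curve_subset h2 hz
      refine mem_thickening_iff.2 ⟨v, Or.inr hv, ?_⟩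
      have := dist_triangle z (z - w) v
      rw [dist_self_sub_right] at this
      linarith
  intro z hz
  have hK := hδ _ hX hz
  have hp0 : p₀ ∈ connectedComponentIn (Γ₁.curve s ∪ (fun z => z - w) ⁻¹' Γ₂.curve s)ᶜ p₀ := by
    refine mem_connectedComponentIn ?_
    rintro (h | h)
    exacts [hi1.1 h, hi2.1 h]
  refine mem_core_of_isPreconnected (S := (fun z => z - p₀) ''
    connectedComponentIn (Γ₁.curve s ∪ (fun z => z - w) ⁻¹' Γ₂.curve s)ᶜ p₀)
    (isPreconnected_connectedComponentIn.image _ (by fun_prop)) ?_ ⟨p₀, hp0, sub_self _⟩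
    ⟨z + p₀, hK, add_sub_cancel_right _ _⟩ (zero_mem_core ?_ ?_)
  · rintro _ ⟨u, hu, rfl⟩
    have huc := connectedComponentIn_subset _ _ hu
    rintro (h | h)
    · exact huc (Or.inl (by simpa [translate, mem_move_curve] using h))
    · refine huc (Or.inr ?_)
      simp only [translate, mem_move_curve, id] at h
      rw [mem_preimage]
      convert! h using 1
      ring
  · rw [mem_translate_inside]; simpa using hi1
  · rw [mem_translate_inside, mem_translate_inside]
    convert! hi2 using 1
    ring

lemma volume_inside_translate (Γ : Fam) (w : ℂ) (t : ℝ) :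
    volume.real ((Γ.translate w).inside t) = volume.real (Γ.inside t) := by
  have : (Γ.translate w).inside t = (fun z => z + -w) ⁻¹' Γ.inside t := by
    ext z
    rw [mem_translate_inside, mem_preimage, sub_eq_add_neg]
  rw [this, measureReal_def, measure_preimage_add_right, measureReal_def]

/-- Curves starting at a common arc, one inside the other elsewhere, separate instantly. -/
theorem mem_inside_of_startsAt (hp1 : Γ₁.Positive) (hp2 : Γ₂.Positive) (hf1 : Γ₁.IsFlow a)
    (hf2 : Γ₂.IsFlow a) (ha : ∀ t, 0 < a t) (hac : Continuous a) (hφ : ∀ t, HasDerivAt φ (a t) t)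
    (hφ0 : ∀ t, 0 < φ t) (hφt : Tendsto φ atBot (𝓝 0)) (h1 : Γ₁.StartsAt γ₁)
    (h2 : Γ₂.StartsAt γ₂) (hv₁ : volume γ₁ = 0) (hv₂ : volume γ₂ = 0)
    (harc : ∃ f : ℝ → ℂ, ContinuousOn f (Icc 0 1) ∧ InjOn f (Icc 0 1) ∧ f '' Icc 0 1 = γ₁ ∩ γ₂)
    (hsub : γ₁ \ γ₂ ⊆ enclosed γ₂) (t x : ℝ) : Γ₁ (x, t) ∈ Γ₂.inside t := by
  have hle := h1.area_le hp1 hf1 hφ hφt hv₁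
  have hge := h2.le_area hp2 hf2 hφ hφ0
  have hU : IsOpen (enclosed γ₁ \ γ₂) := (isOpen_enclosed h1.isCompact).sdiff h2.isCompact.isClosed
  have hUv : volume.real (enclosed γ₁ \ γ₂) = volume.real (enclosed γ₁) :=
    measureReal_sdiff_null (by simp [measureReal_def, hv₂]) (by simp [hv₂])
  have hUt : volume (enclosed γ₁ \ γ₂) ≠ ⊤ :=
    measure_ne_top_of_subset sdiff_subset (volume_enclosed_ne_top h1.isCompact)
  obtain ⟨p₀, hp₀⟩ : (enclosed γ₁ \ γ₂).Nonempty := by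
    by_contra hn
    rw [not_nonempty_iff_eq_empty] at hn
    rw [hn, measureReal_empty] at hUv
    have h3 := hle 0
    have h4 := mul_pos two_pi_pos (hφ0 0)
    have h5 : 0 ≤ volume.real (Γ₁.inside 0) := measureReal_nonneg
    linarith
  have hlt := h1.volume_enclosed_lt h2.isCompact hv₂ hsub (nonempty_sdiff_of_arc harc ⟨p₀, hp₀.1⟩)
  have hc : IsPreconnected (γ₁ ∩ γ₂) := by
    obtain ⟨f, hf, -, he⟩ := harc
    exact he ▸ isPreconnected_Icc.image f hf
  have hcomp := subset_component_of_enclosed h1 h2 hp1 hp2 hc hsub hp₀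
  obtain ⟨δ₀, hδ₀, hball⟩ := Metric.nhds_basis_closedBall.mem_iff.1
    ((isOpen_enclosed h2.isCompact).mem_nhds
      ((enclosed_subset h1.isCompact h2.isCompact hsub hp₀.1).resolve_right hp₀.2))
  obtain ⟨τ, hτ⟩ := eventually_atBot.1
    ((h1.eventually_subset_inside hp1 isCompact_singleton (singleton_subset_iff.2 hp₀.1)).and
      (h2.eventually_subset_inside hp2 (isCompact_closedBall p₀ δ₀) hball))
  have hi1 : ∀ s ≤ τ, p₀ ∈ Γ₁.inside s := fun s hs => (hτ s hs).1 rfl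
  have hi2 : ∀ s ≤ τ, ∀ w : ℂ, ‖w‖ < δ₀ → p₀ - w ∈ Γ₂.inside s := fun s hs w hw =>
    (hτ s hs).2 (by rw [mem_closedBall, dist_self_sub_left]; exact hw.le)
  have key := mem_inside_of_approx (Γ₁ := Γ₁.translate (-p₀)) (Γ₂ := Γ₂.translate (-p₀))
    (hp1.move _ _) (hp2.move _ _) (hf1.move_const _) (hf2.move_const _) ha hac hφ (τ := τ) hδ₀
    (fun s hs => by rw [mem_translate_inside]; simpa using hi1 s hs)
    (fun s hs w hw => by
      rw [mem_translate_inside, mem_translate_inside]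
      convert! hi2 s hs w hw using 1
      ring) ?_ ?_ t x
  · have := mem_translate_inside.1 key
    simpa [translate, move_apply] using this
  · intro ε hε
    obtain ⟨K, hKU, hK, hKv⟩ := hU.exists_isCompact_volume hUt hε
    obtain ⟨δ, hδ, H⟩ := exists_subset_component (h1.isCompact_union h2).isClosed hK
      (hKU.trans hcomp)
    obtain ⟨A₀, hA₀⟩ := eventually_atBot.1 ((h1 (δ / 2) (half_pos hδ)).and
      (h2 (δ / 2) (half_pos hδ)))
    refine ⟨min (δ / 2) δ₀, by positivity, min A₀ τ, fun A hA w hw => ?_⟩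
    obtain ⟨hc1, hc2⟩ := hA₀ A (hA.trans (min_le_left _ _))
    have hAτ := hA.trans (min_le_right _ _)
    have hcore := subset_core_of_subset_component H hc1 hc2 (hw.trans_le (min_le_left _ _))
      (hi1 A hAτ) (hi2 A hAτ w (hw.trans_le (min_le_right _ _)))
    have hi1' : (0 : ℂ) ∈ (Γ₁.translate (-p₀)).inside A := by
      rw [mem_translate_inside]; simpa using hi1 A hAτ
    have hi2' : (0 : ℂ) ∈ ((Γ₂.translate (-p₀)).translate w).inside A := by
      rw [mem_translate_inside, mem_translate_inside]
      convert! hi2 A hAτ w (hw.trans_le (min_le_right _ _)) using 1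
      ring
    have hm := measureReal_mono hcore (measure_ne_top_of_subset (core_subset_inside hi1' hi2')
      (volume_inside_ne_top _ A))
    rw [measureReal_def, measure_preimage_add_right, ← measureReal_def] at hm
    rw [volume_inside_translate]
    have h3 := hle A
    have h4 := mul_pos two_pi_pos (hφ0 A)
    linarith
  · rw [volume_inside_translate, volume_inside_translate]
    have h3 := hle τ
    have h4 := hge τ
    linarith

end Fam

/-- The identification of the Euclidean plane with `ℂ`. -/
def toC : E2 ≃ₗᵢ[ℝ] ℂ := Complex.orthonormalBasisOneI.repr.symm

section transport
variable {γ : Set E2}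

lemma volume_toC_image (h : volume γ = 0) : volume (toC '' γ) = 0 := by
  have h1 : MeasurePreserving toC.symm volume volume :=
    Complex.orthonormalBasisOneI.repr.measurePreserving
  have h2 := h1.measure_preimage_equiv (f := toC.symm.toMeasurableEquiv) γ
  rw [h] at h2
  rw [toC.image_eq_preimage_symm]
  exact h2

lemma mem_interiorRegion_iff {p : E2} : p ∈ interiorRegion γ ↔
    toC p ∉ toC '' γ ∧ Bornology.IsBounded (connectedComponentIn (toC '' γ)ᶜ (toC p)) := by
  rw [interiorRegion, mem_ofPred_eq, toC.injective.mem_set_image]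
  refine and_congr_right fun hp => ?_
  have h := toC.toHomeomorph.image_connectedComponentIn (s := γᶜ) (x := p) hp
  rw [← image_compl_eq toC.bijective]
  change toC '' _ = connectedComponentIn (toC '' γᶜ) (toC p) at h
  rw [← h]
  refine ⟨fun hb => toC.lipschitz.isBounded_image hb, fun hb => ?_⟩
  have := toC.symm.lipschitz.isBounded_image hb
  rwa [image_image, funext toC.symm_apply_apply, image_id'] at this

lemma mem_interiorRegion_iff_enclosed (hγ : IsCompact γ) {p : E2} :
    p ∈ interiorRegion γ ↔ toC p ∈ enclosed (toC '' γ) := by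
  have hc := hγ.image toC.continuous
  rw [mem_interiorRegion_iff]
  exact ⟨fun h => mem_enclosed_of_isBounded hc h.1 h.2, fun h => ⟨h.1, isBounded_component hc h⟩⟩

end transport

lemma hasDerivAt_unit_tangent {v : ℝ → ℂ} {v' : ℂ} {x : ℝ} (hv : HasDerivAt v v' x)
    (h0 : v x ≠ 0) : HasDerivAt (fun y => ‖v y‖⁻¹ • v y)
      (((v' / v x).im / ‖v x‖) • (Complex.I * v x)) x := by
  have hn : ‖v x‖ ≠ 0 := norm_ne_zero_iff.2 h0
  have h1 : HasDerivAt (fun y => ‖v y‖) (inner ℝ (v x) v' / ‖v x‖) x := by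
    have := (hv.norm_sq).sqrt (by positivity)
    simp only [Real.sqrt_sq (norm_nonneg _)] at this
    exact this.congr_deriv (by field_simp)
  have h3 : HasDerivAt (fun y => ‖v y‖⁻¹) (-(inner ℝ (v x) v' / ‖v x‖) / ‖v x‖ ^ 2) x := h1.inv hn
  refine (h3.fun_smul hv).congr_deriv ?_
  obtain ⟨q, rfl⟩ : ∃ q, v' = q * v x := ⟨v' / v x, (div_mul_cancel₀ _ h0).symm⟩
  have h2 : inner ℝ (v x) (q * v x) = q.re * ‖v x‖ ^ 2 := by
    rw [Complex.inner, mul_assoc, Complex.mul_conj, Complex.re_mul_ofReal, Complex.normSq_eq_norm_sq]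
  rw [h2, mul_div_cancel_right₀ _ h0]
  have hnc : (‖v x‖ : ℂ) ≠ 0 := by exact_mod_cast hn
  simp only [Complex.real_smul]
  push_cast
  conv_lhs => rw [show q * v x = (q.re + q.im * Complex.I) * v x by rw [Complex.re_add_im]]
  field_simp
  ring

lemma HasDerivAt.toC_comp {f : ℝ → E2} {f' : E2} {x : ℝ} (h : HasDerivAt f f' x) :
    HasDerivAt (fun y => toC (f y)) (toC f') x :=
  (toC.toContinuousLinearEquiv : E2 →L[ℝ] ℂ).hasFDerivAt.comp_hasDerivAt x h

lemma toC_curvatureVector {c : ℝ → E2} {v : ℝ → ℂ} {v' : ℂ} {x : ℝ}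
    (hc : ∀ y, toC (deriv c y) = v y) (hv : HasDerivAt v v' x) (h0 : v x ≠ 0) :
    toC (curvatureVector c x) = ((v' / v x).im / ‖v x‖ ^ 2) • (Complex.I * v x) := by
  have hn : ∀ y, ‖deriv c y‖ = ‖v y‖ := fun y => by rw [← hc, toC.norm_map]
  have h1 := (toC.symm.toContinuousLinearEquiv : ℂ →L[ℝ] E2).hasFDerivAt.comp_hasDerivAt x
    (hasDerivAt_unit_tangent hv h0)
  have h2 : HasDerivAt (fun y => ‖deriv c y‖⁻¹ • deriv c y)
      (toC.symm (((v' / v x).im / ‖v x‖) • (Complex.I * v x))) x := by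
    refine h1.congr_of_eventuallyEq (Eventually.of_forall fun y => ?_)
    change _ = toC.symm (‖v y‖⁻¹ • v y)
    rw [map_smul, ← hc, toC.symm_apply_apply, toC.norm_map]
  rw [curvatureVector, h2.deriv, map_smul, toC.apply_symm_apply, hn, smul_smul]
  congr 1
  field_simp

namespace Fam

lemma hasDerivAt_vel {Γ : Fam} {x t : ℝ} : HasDerivAt (fun y => Γ.vel (y, t)) (dx Γ.vel (x, t)) x :=
  hasDerivAt_dx Γ.contDiff_vel x t

lemma IsFlow.rev {Γ : Fam} {a : ℝ → ℝ} (h : Γ.IsFlow a) : Γ.rev.IsFlow a := by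
  rintro ⟨x, t⟩
  have h1 : dt Γ.rev.F (x, t) = dt Γ.F (-x, t) :=
    (hasDerivAt_dt Γ.rev.smooth x t).unique (hasDerivAt_dt Γ.smooth (-x) t)
  have h2 : dx Γ.rev.vel (x, t) = dx Γ.vel (-x, t) := by
    refine (hasDerivAt_vel (Γ := Γ.rev)).unique ?_
    simp only [rev_vel]
    have h3 := ((hasDerivAt_vel (Γ := Γ) (x := -x) (t := t)).scomp x (hasDerivAt_neg x)).neg
    simpa [Function.comp_def] using! h3
  rw [h1, h (-x, t), curv, curv, h2, rev_vel, div_neg, Complex.neg_im, norm_neg]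
  simp only [mul_neg, smul_neg, neg_div, neg_smul, neg_neg]

end Fam

namespace CurvatureFlowSolution
variable {γ₀ : Set E2} {T : ℝ} (sol : CurvatureFlowSolution γ₀ T)

lemma hasDerivAt_space {t : ℝ} (ht : t ∈ Ioo 0 T) (x : ℝ) :
    HasDerivAt (fun y => sol.Γ y t) (deriv (fun y => sol.Γ y t) x) x :=
  (differentiableAt_of_deriv_ne_zero (sol.deriv_ne t ht x)).hasDerivAt

lemma continuous_space {t : ℝ} (ht : t ∈ Ioo 0 T) : Continuous fun y => sol.Γ y t :=
  continuous_iff_continuousAt.2 fun x => (sol.hasDerivAt_space ht x).continuousAt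

lemma exists_of_eq {t : ℝ} (ht : t ∈ Ioo 0 T) {x y : ℝ} (h : sol.Γ x t = sol.Γ y t) :
    ∃ k : ℤ, y = x + 2 * π * k := by
  have hper : Function.Periodic (fun x => sol.Γ x t) (2 * π) := sol.periodic t
  have hmod : ∀ z, sol.Γ (toIcoMod two_pi_pos 0 z) t = sol.Γ z t := fun z =>
    hper.sub_zsmul_eq _
  have h1 := sol.inj t ht _ (by simpa using toIcoMod_mem_Ico two_pi_pos 0 x) _
    (by simpa using toIcoMod_mem_Ico two_pi_pos 0 y) ((hmod x).trans (h.trans (hmod y).symm))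
  refine ⟨toIcoDiv two_pi_pos 0 y - toIcoDiv two_pi_pos 0 x, ?_⟩
  simp only [toIcoMod, zsmul_eq_mul] at h1
  push_cast
  linarith

lemma isJordanCurve_range {t : ℝ} (ht : t ∈ Ioo 0 T) :
    IsJordanCurve (range fun x => sol.Γ x t) := by
  have hper : Function.Periodic (fun x => sol.Γ x t) (2 * π) := sol.periodic t
  have hc : Continuous (hper.lift : AddCircle (2 * π) → E2) :=
    continuous_coinduced_dom.2 (sol.continuous_space ht)
  refine ⟨fun z => hper.lift (AddCircle.homeomorphCircle'.symm z),
    hc.comp AddCircle.homeomorphCircle'.symm.continuous,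
    Function.Injective.comp ?_ AddCircle.homeomorphCircle'.symm.injective, ?_⟩
  · intro x y
    induction x using QuotientAddGroup.induction_on with | _ x
    induction y using QuotientAddGroup.induction_on with | _ y
    intro h
    obtain ⟨k, hk⟩ := sol.exists_of_eq ht h
    refine QuotientAddGroup.eq.2 (AddSubgroup.mem_zmultiples_iff.2 ⟨k, ?_⟩)
    rw [hk, zsmul_eq_mul]
    ring
  · refine (AddCircle.homeomorphCircle'.symm.surjective.range_comp hper.lift).trans ?_
    exact (QuotientAddGroup.mk_surjective.range_comp hper.lift).symm

lemma eventually_closeCurves (hT : 0 < T) (h₀ : IsJordanCurve γ₀) {ε : ℝ} (hε : 0 < ε) :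
    ∀ᶠ t in 𝓝[>] 0, CloseCurves (toC '' γ₀) (toC '' range fun x => sol.Γ x t) ε := by
  have h1 : ∀ᶠ t in 𝓝[>] (0 : ℝ), t ∈ Ioo 0 T := Ioo_mem_nhdsGT hT
  filter_upwards [sol.init.eventually_lt_const hε, h1] with t ht htT
  obtain ⟨φ₀, hφ₀⟩ := h₀
  obtain ⟨ψ₀, hψ₀⟩ := sol.isJordanCurve_range htT
  obtain ⟨d, ⟨φ₁, φ₂, ⟨c1, i1, r1⟩, ⟨c2, i2, r2⟩, rfl⟩, hd⟩ :=
    exists_lt_of_csInf_lt (s := {d : ℝ | ∃ φ₁ φ₂ : Circle → E2,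
      IsParam (range fun x => sol.Γ x t) φ₁ ∧ IsParam γ₀ φ₂ ∧ d = ⨆ x : Circle, ‖φ₁ x - φ₂ x‖})
      ⟨_, ψ₀, φ₀, hψ₀, hφ₀, rfl⟩ ht
  refine ⟨toC ∘ φ₂, toC ∘ φ₁, toC.continuous.comp c2, toC.injective.comp i2, by rw [range_comp, r2],
    toC.continuous.comp c1, toC.injective.comp i1, by rw [range_comp, r1], fun x => ?_⟩
  rw [Function.comp_apply, Function.comp_apply, ← map_sub, toC.norm_map, norm_sub_rev]
  exact (le_ciSup (f := fun x => ‖φ₁ x - φ₂ x‖)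
    (isCompact_range (by fun_prop)).bddAbove x).trans_lt hd

lemma time_mem (hT : 0 < T) (s : ℝ) : T * sigmoid s ∈ Ioo 0 T :=
  ⟨mul_pos hT (sigmoid_pos s), by nlinarith [sigmoid_lt_one s]⟩

lemma contDiff_fam (hT : 0 < T) :
    ContDiff ℝ ∞ fun p : ℝ × ℝ => toC (sol.Γ p.1 (T * sigmoid p.2)) := by
  have h : ContDiff ℝ ∞ fun p : ℝ × ℝ => (p.1, T * sigmoid p.2) :=
    contDiff_fst.prodMk (contDiff_const.mul ((contDiff_sigmoid.of_le le_top).comp contDiff_snd))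
  exact toC.contDiff.comp (contDiffOn_univ.1 (sol.smooth.comp h.contDiffOn
    fun p _ => ⟨mem_univ _, time_mem hT p.2⟩))

lemma dx_fam (hT : 0 < T) (x s : ℝ) : dx (fun p => toC (sol.Γ p.1 (T * sigmoid p.2))) (x, s) =
    toC (deriv (fun y => sol.Γ y (T * sigmoid s)) x) :=
  (hasDerivAt_dx (sol.contDiff_fam hT) x s).unique
    (sol.hasDerivAt_space (time_mem hT s) x).toC_comp

/-- The flow in the complex plane, with time reparametrized by the whole line. -/
def fam (hT : 0 < T) : Fam where
  F p := toC (sol.Γ p.1 (T * sigmoid p.2))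
  smooth := sol.contDiff_fam hT
  per x t := congrArg toC (sol.periodic _ x)
  inj x y t h := sol.exists_of_eq (time_mem hT t) (toC.injective h)
  imm p := by
    rw [← Prod.mk.eta (p := p), sol.dx_fam hT]
    exact (map_ne_zero_iff _ toC.injective).2 (sol.deriv_ne _ (time_mem hT _) _)

lemma fam_curve (hT : 0 < T) (s : ℝ) : (sol.fam hT).curve s = toC '' sol.cf (T * sigmoid s) := by
  rw [cf, if_neg (time_mem hT s).1.ne', ← range_comp]
  rfl

lemma isFlow_fam (hT : 0 < T) : (sol.fam hT).IsFlow fun s => T * (sigmoid s * (1 - sigmoid s)) := by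
  rintro ⟨x, s⟩
  have ht := time_mem hT s
  have h1 : DifferentiableAt ℝ (fun t => sol.Γ x t) (T * sigmoid s) :=
    DifferentiableAt.comp (T * sigmoid s) (g := fun p : ℝ × ℝ => sol.Γ p.1 p.2)
      (f := fun t => (x, t)) ((sol.smooth.contDiffAt ((isOpen_univ.prod isOpen_Ioo).mem_nhds
        ⟨mem_univ _, ht⟩)).differentiableAt (by simp)) (by fun_prop)
  have h2 := (h1.hasDerivAt.toC_comp).scomp s ((hasDerivAt_sigmoid s).const_mul T)
  have h3 : dt (sol.fam hT).F (x, s) = (T * (sigmoid s * (1 - sigmoid s))) •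
      toC (deriv (fun t => sol.Γ x t) (T * sigmoid s)) :=
    (hasDerivAt_dt (sol.fam hT).smooth x s).unique h2
  rw [h3, sol.flow _ ht, toC_curvatureVector (v := fun y => (sol.fam hT).vel (y, s))
    (fun y => (sol.dx_fam hT y s).symm) Fam.hasDerivAt_vel ((sol.fam hT).vel_ne _), smul_smul, mul_div_assoc]
  rfl

lemma startsAt_fam (hT : 0 < T) (h₀ : IsJordanCurve γ₀) : (sol.fam hT).StartsAt (toC '' γ₀) := by
  intro ε hε
  have h1 : Tendsto (fun s => T * sigmoid s) atBot (𝓝[>] 0) :=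
    tendsto_nhdsWithin_iff.2 ⟨by simpa using tendsto_sigmoid_atBot.const_mul T,
      Eventually.of_forall fun s => (time_mem hT s).1⟩
  filter_upwards [h1.eventually (sol.eventually_closeCurves hT h₀ hε)] with s hs
  rwa [fam_curve, cf, if_neg (time_mem hT s).1.ne']

/-- A positively oriented version of the flow in the complex plane. -/
lemma exists_positive_fam (hT : 0 < T) (h₀ : IsJordanCurve γ₀) : ∃ Γ : Fam, Γ.Positive ∧
    (Γ.IsFlow fun s => T * (sigmoid s * (1 - sigmoid s))) ∧ Γ.StartsAt (toC '' γ₀) ∧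
    ∀ s, Γ.curve s = toC '' sol.cf (T * sigmoid s) := by
  rcases (sol.fam hT).positive_or_rev with h | h
  · exact ⟨_, h, sol.isFlow_fam hT, sol.startsAt_fam hT h₀, sol.fam_curve hT⟩
  · refine ⟨_, h, (sol.isFlow_fam hT).rev, fun ε hε => ?_, fun s => ?_⟩
    · simpa only [Fam.rev_curve] using sol.startsAt_fam hT h₀ ε hε
    · rw [Fam.rev_curve, fam_curve]

end CurvatureFlowSolution

end

/-- Lemma 3.1: if `γ₁ ≠ γ₂` share exactly a common arc `𝒜 = γ₁ ∩ γ₂`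
and `γ₁ \ 𝒜 ⊆ ℐ(γ₂)`, then for every `t ∈ (0,T)` the evolved curves are disjoint and
`cf(γ₁,t) ⊆ ℐ(cf(γ₂,t))`. -/
theorem commonArc_curves_separate
    (T : ℝ) (hT : 0 < T)
    (γ₁ γ₂ : Set E2) (h₁ : IsJordanCurve γ₁) (h₂ : IsJordanCurve γ₂)
    (hne : γ₁ ≠ γ₂)
    (hvol₁ : volume γ₁ = 0) (hvol₂ : volume γ₂ = 0)
    (A : Set E2) (hA : A = γ₁ ∩ γ₂)
    (harc : ∃ f : ℝ → E2, ContinuousOn f (Icc 0 1) ∧ Set.InjOn f (Icc 0 1) ∧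
      f '' Icc 0 1 = A)
    (hsub : γ₁ \ A ⊆ interiorRegion γ₂)
    (sol₁ : CurvatureFlowSolution γ₁ T) (sol₂ : CurvatureFlowSolution γ₂ T) :
    ∀ t ∈ Ioo (0 : ℝ) T,
      Disjoint (sol₁.cf t) (sol₂.cf t) ∧ sol₁.cf t ⊆ interiorRegion (sol₂.cf t) := by
  intro t ht
  suffices sol₁.cf t ⊆ interiorRegion (sol₂.cf t) from
    ⟨disjoint_left.2 fun p hp hp2 => (this hp).1 hp2, this⟩
  obtain ⟨Γ₁, hp1, hf1, hs1, hc1⟩ := sol₁.exists_positive_fam hT h₁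
  obtain ⟨Γ₂, hp2, hf2, hs2, hc2⟩ := sol₂.exists_positive_fam hT h₂
  obtain ⟨s, rfl⟩ : ∃ s, T * sigmoid s = t := by
    have h : t / T ∈ range sigmoid := by
      rw [range_sigmoid]
      exact ⟨div_pos ht.1 hT, (div_lt_one hT).2 ht.2⟩
    obtain ⟨s, hs⟩ := h
    exact ⟨s, by rw [hs, mul_div_cancel₀ _ hT.ne']⟩
  have hcomp₂ : IsCompact γ₂ := by
    obtain ⟨φ, hφ, -, rfl⟩ := h₂
    exact isCompact_range hφ
  have key := Fam.mem_inside_of_startsAt hp1 hp2 hf1 hf2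
    (fun s => mul_pos hT (mul_pos (sigmoid_pos s) (sub_pos.2 (sigmoid_lt_one s)))) (by fun_prop)
    (fun s => (hasDerivAt_sigmoid s).const_mul T) (fun s => mul_pos hT (sigmoid_pos s))
    (by simpa using tendsto_sigmoid_atBot.const_mul T) hs1 hs2 (volume_toC_image hvol₁)
    (volume_toC_image hvol₂) ?_ ?_ s
  · intro p hp
    have hcc : toC '' sol₂.cf (T * sigmoid s) = Γ₂.curve s := (hc2 s).symm
    obtain ⟨x, hx⟩ : toC p ∈ Γ₁.curve s := hc1 s ▸ mem_image_of_mem _ hp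
    replace hx : Γ₁ (x, s) = toC p := hx
    have h3 := key x
    rw [hx] at h3
    have h4 : toC p ∈ enclosed (Γ₂.curve s) :=
      ⟨h3.1, fun hl => zero_ne_one (((Γ₂.hasLogOn_iff h3.1).1 hl).symm.trans h3.2)⟩
    rw [mem_interiorRegion_iff, hcc]
    exact ⟨h3.1, isBounded_component (Γ₂.isCompact_curve s) h4⟩
  · obtain ⟨f, hf, hi, he⟩ := harc
    refine ⟨fun x => toC (f x), toC.continuous.comp_continuousOn hf, toC.injective.comp_injOn hi, ?_⟩
    rw [← image_inter toC.injective, ← hA, ← he, image_image]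
  · rw [← image_sdiff toC.injective]
    rintro _ ⟨p, hp, rfl⟩
    exact (mem_interiorRegion_iff_enclosed hcomp₂).1
      (hsub ⟨hp.1, fun h => hp.2 (hA ▸ h : p ∈ γ₁ ∩ γ₂).2⟩)

end
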